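/- Assume in addition ∫_ℝ (1+|x|²) J(x) dx < ∞. Let 1 < q < 2, let φ ∈ L¹(ℝ) be nonnegative, let 0 < μ ≤ 1 ≤ λ, and let u = u^μ_λ be the classical solution of the rescaled regularized problem. Then there exists a constant C = C(‖φ‖_{L¹(ℝ)}, q, J) > 0, independent of λ and μ, such that, setting ω(t,r) := 2∫_{|x|>r^{−1/2}} φ(x) dx + C·r^{1/2}·( t^{−2/q} + t^{−1/q} + t + t^{1/q} ) for t > 0 and r ∈ (0,1): (i) ∫_ℝ |u(t,x+h) − u(t,x)| dx ≤ ω(t,|h|) for every t > 0 and 0 < |h| < 1; (ii) ∫_ℝ |u(t+k,x) − u(t,x)| dx ≤ C·( (λ^{q−2} + μ)·k^{1/3} + k^{2/3}·t^{1/q−1} ) + 2·ω(t+k, k^{1/3}) + 2·ω(t, k^{1/3}) for every t > 0 and 0 < k < 1. -/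

import Mathlib

open MeasureTheory Filter ENNReal

/-- `u` is a classical solution of the rescaled regularized problem
`u_t + |u|^{q-1} u_x = λ^q (J_λ ∗ u - u) + μ u_xx` with initial datum
`φ_λ(x) = λ φ(λ x)`, where `J_λ(x) = λ J(λ x)`. -/
def IsRescaledSol (J : ℝ → ℝ) (q lam μ : ℝ) (φ : ℝ → ℝ) (u : ℝ → ℝ → ℝ) : Prop :=
  (∀ t : ℝ, 0 ≤ t → Integrable (u t)) ∧
  (∀ t₀ : ℝ, 0 ≤ t₀ →
    Tendsto (fun t => ∫ x, |u t x - u t₀ x|) (nhdsWithin t₀ (Set.Ici 0)) (nhds 0)) ∧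
  (∀ t : ℝ, 0 < t → ContDiff ℝ 2 (u t)) ∧
  (∀ x : ℝ, ContDiffOn ℝ 1 (fun s => u s x) (Set.Ioi 0)) ∧
  (∀ t : ℝ, 0 < t → ∀ x : ℝ,
    deriv (fun s => u s x) t + |u t x| ^ (q - 1) * deriv (u t) x
      = lam ^ q * ((∫ y, lam * J (lam * (x - y)) * u t y) - u t x)
        + μ * deriv (deriv (u t)) x) ∧
  (u 0 =ᵐ[volume] fun x => lam * φ (lam * x))

/-- The modulus
`ω(t,r) = 2 ∫_{|x| > r^{-1/2}} φ + C r^{1/2} (t^{-2/q} + t^{-1/q} + t + t^{1/q})`. -/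
noncomputable def omegaMod (φ : ℝ → ℝ) (q C t r : ℝ) : ℝ :=
  2 * (∫ x in {x : ℝ | r ^ (-(1 : ℝ) / 2) < |x|}, φ x)
    + C * r ^ ((1 : ℝ) / 2)
        * (t ^ (-(2 / q)) + t ^ (-(1 / q)) + t + t ^ (1 / q))

structure C2 (V V1 V2 : ℝ → ℝ) : Prop where
  d1 : ∀ x, HasDerivAt V (V1 x) x
  d2 : ∀ x, HasDerivAt V1 (V2 x) x
  c2 : Continuous V2

namespace C2
variable {V V1 V2 W W1 W2 : ℝ → ℝ}

theorem c0 (h : C2 V V1 V2) : Continuous V :=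
  continuous_iff_continuousAt.2 fun x => (h.d1 x).continuousAt

theorem c1 (h : C2 V V1 V2) : Continuous V1 :=
  continuous_iff_continuousAt.2 fun x => (h.d2 x).continuousAt

theorem sub (h : C2 V V1 V2) (k : C2 W W1 W2) :
    C2 (fun x => V x - W x) (fun x => V1 x - W1 x) (fun x => V2 x - W2 x) :=
  ⟨fun x => (h.d1 x).sub (k.d1 x), fun x => (h.d2 x).sub (k.d2 x), h.c2.sub k.c2⟩

theorem zero : C2 (fun _ => 0) (fun _ => 0) (fun _ => 0) :=
  ⟨fun x => hasDerivAt_const x 0, fun x => hasDerivAt_const x 0, continuous_const⟩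

theorem of_contDiff (h : ContDiff ℝ 2 V) : C2 V (deriv V) (deriv (deriv V)) := by
  have h1 : ContDiff ℝ 1 (deriv V) := by
    have : ContDiff ℝ (1 + 1) V := by simpa [one_add_one_eq_two] using h
    exact (contDiff_succ_iff_deriv.1 this).2.2
  have h0 : ContDiff ℝ 0 (deriv (deriv V)) := by
    have : ContDiff ℝ (0 + 1) (deriv V) := by simpa using h1
    exact (contDiff_succ_iff_deriv.1 this).2.2
  exact ⟨fun x => (h.differentiable (by norm_num) x).hasDerivAt,
    fun x => (h1.differentiable (by norm_num) x).hasDerivAt, h0.continuous⟩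

end C2

noncomputable def Fl (q v : ℝ) : ℝ := |v| ^ (q - 1) * v / q

theorem abs_Fl (q v : ℝ) (hq : 1 < q) : |Fl q v| = |v| ^ q / q := by
  unfold Fl
  rw [abs_div, abs_mul, abs_of_nonneg (Real.rpow_nonneg (abs_nonneg v) _),
    abs_of_pos (by linarith : (0:ℝ) < q)]
  congr 1
  rcases eq_or_ne v 0 with rfl | hv
  · rw [abs_zero, Real.zero_rpow (by linarith), Real.zero_rpow (by linarith)]; ring
  · have := Real.rpow_add (abs_pos.2 hv) (q - 1) 1
    rw [Real.rpow_one] at this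
    rw [← this]; congr 1; ring

theorem abs_Fl_le (q v : ℝ) (hq : 1 < q) : |Fl q v| ≤ |v| ^ q := by
  rw [abs_Fl q v hq]
  apply div_le_self (Real.rpow_nonneg (abs_nonneg v) _) hq.le

theorem Fl_zero (q : ℝ) : Fl q 0 = 0 := by simp [Fl]

theorem hasDerivAt_Fl (q v : ℝ) (hq : 1 < q) : HasDerivAt (Fl q) (|v| ^ (q - 1)) v := by
  rcases lt_trichotomy v 0 with hv | rfl | hv
  · have h1 : HasDerivAt (fun x : ℝ => (-x) ^ q) (-1 * q * (-v) ^ (q - 1)) v :=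
      (hasDerivAt_neg v).rpow_const (p := q) (Or.inl (by linarith))
    have h2 := (h1.neg).div_const q
    have h3 : HasDerivAt (Fl q) (-(-1 * q * (-v) ^ (q - 1)) / q) v := by
      refine h2.congr_of_eventuallyEq ?_
      filter_upwards [Iio_mem_nhds hv] with x hx
      have hx : x < 0 := hx
      unfold Fl
      rw [abs_of_neg hx]
      have := Real.rpow_add (neg_pos.2 hx) (q - 1) 1
      rw [Real.rpow_one] at this
      have e : q - 1 + 1 = q := by ring
      rw [e] at this
      simp only [Pi.neg_apply]
      rw [this]; ring
    convert h3 using 1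
    rw [abs_of_neg hv]; field_simp
  · rw [abs_zero, Real.zero_rpow (by linarith)]
    rw [hasDerivAt_iff_isLittleO_nhds_zero]
    simp only [Fl_zero, zero_add, sub_zero, smul_zero]
    have h : Tendsto (fun h : ℝ => |h| ^ (q - 1) / q) (nhds 0) (nhds 0) := by
      have hc : ContinuousAt (fun h : ℝ => |h| ^ (q - 1) / q) 0 := by
        refine ContinuousAt.div_const ?_ q
        exact (continuous_abs.continuousAt).rpow_const (Or.inr (by linarith))
      have := hc.tendsto
      simpa [Real.zero_rpow (by linarith : q - 1 ≠ 0)] using this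
    have := (Asymptotics.isLittleO_one_iff ℝ).2 h
    have h2 := this.mul_isBigO (Asymptotics.isBigO_refl (fun h : ℝ => h) (nhds 0))
    refine (h2.congr_left ?_).congr_right ?_
    · intro x; unfold Fl; ring
    · intro x; ring
  · have h1 : HasDerivAt (fun x : ℝ => x ^ q) (q * v ^ (q - 1)) v :=
      Real.hasDerivAt_rpow_const (Or.inl hv.ne')
    have h2 := h1.div_const q
    have h3 : HasDerivAt (Fl q) (q * v ^ (q - 1) / q) v := by
      refine h2.congr_of_eventuallyEq ?_
      filter_upwards [Ioi_mem_nhds hv] with x hx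
      have hx : 0 < x := hx
      unfold Fl
      rw [abs_of_pos hx]
      have := Real.rpow_add hx (q - 1) 1
      rw [Real.rpow_one] at this
      have e : q - 1 + 1 = q := by ring
      rw [e] at this
      rw [this]
    convert h3 using 1
    rw [abs_of_pos hv]; field_simp

theorem continuous_Fl (q : ℝ) (hq : 1 < q) : Continuous (Fl q) :=
  continuous_iff_continuousAt.2 fun x => (hasDerivAt_Fl q x hq).continuousAt

theorem continuous_absrpow (q : ℝ) (hq : 0 ≤ q) : Continuous (fun v : ℝ => |v| ^ q) :=
  continuous_abs.rpow_const (fun _ => Or.inr hq)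

theorem int_of_supp {f : ℝ → ℝ} {r : ℝ} (hc : Continuous f) (h : ∀ x, r < |x| → f x = 0) :
    Integrable f := by
  apply hc.integrable_of_hasCompactSupport
  apply HasCompactSupport.intro (isCompact_Icc (a := -r) (b := r))
  intro x hx
  apply h
  by_contra hh
  exact hx (abs_le.1 (not_lt.1 hh))

theorem deriv_supp {f f' : ℝ → ℝ} {r : ℝ} (hd : ∀ x, HasDerivAt f (f' x) x)
    (h : ∀ x, r < |x| → f x = 0) : ∀ x, r < |x| → f' x = 0 := by
  intro x hx
  have : HasDerivAt f 0 x := by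
    refine (hasDerivAt_const x (0:ℝ)).congr_of_eventuallyEq ?_
    filter_upwards [(isOpen_lt continuous_const continuous_abs).mem_nhds hx] with y hy
    exact h y hy
  exact (hd x).unique this

theorem ibp0 {f f' : ℝ → ℝ} {r : ℝ} (hd : ∀ x, HasDerivAt f (f' x) x) (hc : Continuous f')
    (h : ∀ x, r < |x| → f x = 0) : ∫ x, f' x = 0 :=
  integral_eq_zero_of_hasDerivAt_of_integrable hd (int_of_supp hc (deriv_supp hd h))
    (int_of_supp (continuous_iff_continuousAt.2 fun x => (hd x).continuousAt) h)

theorem lin2 {α : Type*} [MeasurableSpace α] {ν : Measure α} {f g : α → ℝ} (hf : Integrable f ν)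
    (hg : Integrable g ν) (a b : ℝ) : Integrable (fun x => a * f x + b * g x) ν ∧
    ∫ x, (a * f x + b * g x) ∂ν = a * ∫ x, f x ∂ν + b * ∫ x, g x ∂ν := by
  refine ⟨(hf.const_mul a).add (hg.const_mul b), ?_⟩
  rw [integral_add (hf.const_mul a) (hg.const_mul b), integral_const_mul, integral_const_mul]

theorem lin3 {α : Type*} [MeasurableSpace α] {ν : Measure α} {f g h : α → ℝ} (hf : Integrable f ν)
    (hg : Integrable g ν) (hh : Integrable h ν) (a b c : ℝ) :
    Integrable (fun x => a * f x + b * g x + c * h x) ν ∧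
    ∫ x, (a * f x + b * g x + c * h x) ∂ν
      = a * ∫ x, f x ∂ν + b * ∫ x, g x ∂ν + c * ∫ x, h x ∂ν := by
  obtain ⟨i, e⟩ := lin2 hf hg a b
  refine ⟨i.add (hh.const_mul c), ?_⟩
  rw [integral_add i (hh.const_mul c), e, integral_const_mul]

theorem lin4 {α : Type*} [MeasurableSpace α] {ν : Measure α} {f g h k : α → ℝ}
    (hf : Integrable f ν) (hg : Integrable g ν) (hh : Integrable h ν) (hk : Integrable k ν)
    (a b c d : ℝ) :
    Integrable (fun x => a * f x + b * g x + c * h x + d * k x) ν ∧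
    ∫ x, (a * f x + b * g x + c * h x + d * k x) ∂ν
      = a * ∫ x, f x ∂ν + b * ∫ x, g x ∂ν + c * ∫ x, h x ∂ν + d * ∫ x, k x ∂ν := by
  obtain ⟨i, e⟩ := lin3 hf hg hh a b c
  refine ⟨i.add (hk.const_mul d), ?_⟩
  rw [integral_add i (hk.const_mul d), e, integral_const_mul]

theorem lin5 {α : Type*} [MeasurableSpace α] {ν : Measure α} {f g h k l : α → ℝ}
    (hf : Integrable f ν) (hg : Integrable g ν) (hh : Integrable h ν) (hk : Integrable k ν)
    (hl : Integrable l ν) (a b c d p : ℝ) :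
    Integrable (fun x => a * f x + b * g x + c * h x + d * k x + p * l x) ν ∧
    ∫ x, (a * f x + b * g x + c * h x + d * k x + p * l x) ∂ν
      = a * ∫ x, f x ∂ν + b * ∫ x, g x ∂ν + c * ∫ x, h x ∂ν + d * ∫ x, k x ∂ν
        + p * ∫ x, l x ∂ν := by
  obtain ⟨i, e⟩ := lin4 hf hg hh hk a b c d
  refine ⟨i.add (hl.const_mul p), ?_⟩
  rw [integral_add i (hl.const_mul p), e, integral_const_mul]

structure Beta (β β1 β2 : ℝ → ℝ) (C : ℝ) : Prop where
  d1 : ∀ x, HasDerivAt β (β1 x) x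
  d2 : ∀ x, HasDerivAt β1 (β2 x) x
  c2 : Continuous β2
  b1 : ∀ v, |β1 v| ≤ C
  b2 : ∀ v, (1 + v ^ 2) * |β2 v| ≤ C

namespace Beta
variable {β β1 β2 : ℝ → ℝ} {C : ℝ}
theorem c0 (h : Beta β β1 β2 C) : Continuous β :=
  continuous_iff_continuousAt.2 fun x => (h.d1 x).continuousAt
theorem c1 (h : Beta β β1 β2 C) : Continuous β1 :=
  continuous_iff_continuousAt.2 fun x => (h.d2 x).continuousAt
theorem Cnn (h : Beta β β1 β2 C) : 0 ≤ C := (abs_nonneg _).trans (h.b1 0)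
theorem lip (h : Beta β β1 β2 C) (a b : ℝ) : |β a - β b| ≤ C * |a - b| := by
  have := (convex_univ (𝕜 := ℝ) (E := ℝ)).norm_image_sub_le_of_norm_hasDerivWithin_le
    (f := β) (f' := β1) (C := C) (x := b) (y := a)
    (fun x _ => (h.d1 x).hasDerivWithinAt) (fun x _ => h.b1 x) trivial trivial
  simpa using this
end Beta

noncomputable def kdens (q μ : ℝ) (β1 β2 w w1 ψ ψ1 V V1 N : ℝ → ℝ) (x : ℝ) : ℝ :=
  (β2 (V x - w x) * (V1 x - w1 x) * ψ x + β1 (V x - w x) * ψ1 x) * (Fl q (V x) - μ * V1 x)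
    + β1 (V x - w x) * ψ x * N x

noncomputable def Rr (q μ : ℝ) (V V1 V2 N : ℝ → ℝ) (x : ℝ) : ℝ :=
  - (|V x| ^ (q - 1) * V1 x) + N x + μ * V2 x

noncomputable def edens (V V1 : ℝ → ℝ) (x : ℝ) : ℝ := 1 + V x ^ 2 + V1 x ^ 2 / (1 + V x ^ 2)

section
variable {q μ C r : ℝ} {β β1 β2 w w1 w2 ψ ψ1 ψ2 V V1 V2 N : ℝ → ℝ}

theorem edens_cont (hV : C2 V V1 V2) : Continuous (edens V V1) := by
  have := hV.c0; have := hV.c1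
  unfold edens
  refine ((continuous_const.add (by fun_prop)).add ?_)
  exact Continuous.div (by fun_prop) (by fun_prop) (fun x => by positivity)

theorem betaint (hN : Integrable N) (hβ : Beta β β1 β2 C) (hw : C2 w w1 w2) (hψ : C2 ψ ψ1 ψ2)
    (hs : ∀ x, r < |x| → ψ x = 0) (hV : Continuous V) :
    Integrable (fun x => β1 (V x - w x) * ψ x * N x) := by
  have c : Continuous (fun x => β1 (V x - w x) * ψ x) :=
    (hβ.c1.comp (hV.sub hw.c0)).mul hψ.c0
  have hb : ∃ B, ∀ x, ‖β1 (V x - w x) * ψ x‖ ≤ B := by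
    have := (HasCompactSupport.intro (f := fun x => β1 (V x - w x) * ψ x) (isCompact_Icc (a := -r) (b := r)) (by
      intro x hx
      have : ψ x = 0 := by
        apply hs
        by_contra hh
        exact hx (abs_le.1 (not_lt.1 hh))
      simp [this]))
    exact c.bounded_above_of_compact_support this
  obtain ⟨B, hB⟩ := hb
  exact hN.bdd_mul c.aestronglyMeasurable (Eventually.of_forall hB)

theorem weak_fixed (hq : 1 < q) (hN : Integrable N) (hβ : Beta β β1 β2 C) (hw : C2 w w1 w2)
    (hψ : C2 ψ ψ1 ψ2) (hs : ∀ x, r < |x| → ψ x = 0) (hV : C2 V V1 V2) :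
    Integrable (fun x => β1 (V x - w x) * ψ x * Rr q μ V V1 V2 N x) ∧
    Integrable (kdens q μ β1 β2 w w1 ψ ψ1 V V1 N) ∧
    ∫ x, β1 (V x - w x) * ψ x * Rr q μ V V1 V2 N x
      = ∫ x, kdens q μ β1 β2 w w1 ψ ψ1 V V1 N x := by
  have i0 := betaint hN hβ hw hψ hs hV.c0
  have hv := hV.sub hw
  have a0 := hV.c0; have a1 := hV.c1; have a2 := hV.c2
  have p0 := hψ.c0; have p1 := hψ.c1
  have b1 := hβ.c1; have b2 := hβ.c2
  have v0 := hv.c0; have v1 := hv.c1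
  have f0 := continuous_Fl q hq
  have f1 := continuous_absrpow (q - 1) (by linarith)
  have hs1 := deriv_supp hψ.d1 hs
  have i1 : Integrable (fun x => β1 (V x - w x) * ψ x * (- (|V x| ^ (q - 1) * V1 x) + μ * V2 x)) := by
    apply int_of_supp (r := r)
    · have : Continuous fun x => |V x| ^ (q - 1) := f1.comp a0
      have : Continuous fun x => β1 (V x - w x) := b1.comp v0
      fun_prop
    · intro x hx; simp [hs x hx]
  let D : ℝ → ℝ := fun x => (β2 (V x - w x) * (V1 x - w1 x) * ψ x + β1 (V x - w x) * ψ1 x) * (Fl q (V x) - μ * V1 x) + β1 (V x - w x) * ψ x * (|V x| ^ (q - 1) * V1 x - μ * V2 x)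
  have dD : ∀ x, HasDerivAt (fun x => β1 (V x - w x) * ψ x * (Fl q (V x) - μ * V1 x)) (D x) x := by
    intro x
    have h1 : HasDerivAt (fun x => β1 (V x - w x)) (β2 (V x - w x) * (V1 x - w1 x)) x :=
      (hβ.d2 (V x - w x)).comp x (hv.d1 x)
    have h2 : HasDerivAt (fun x => Fl q (V x)) (|V x| ^ (q-1) * V1 x) x :=
      (hasDerivAt_Fl q (V x) hq).comp x (hV.d1 x)
    exact (h1.mul (hψ.d1 x)).mul (h2.sub ((hV.d2 x).const_mul μ))
  have cD : Continuous D := by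
    have : Continuous fun x => |V x| ^ (q - 1) := f1.comp a0
    have : Continuous fun x => β1 (V x - w x) := b1.comp v0
    have : Continuous fun x => β2 (V x - w x) := b2.comp v0
    have : Continuous fun x => Fl q (V x) := f0.comp a0
    fun_prop
  have sD : ∀ x, r < |x| → β1 (V x - w x) * ψ x * (Fl q (V x) - μ * V1 x) = 0 := by
    intro x hx; simp [hs x hx]
  have iD := int_of_supp cD (deriv_supp dD sD)
  have zD := ibp0 dD cD sD
  have iR : Integrable (fun x => β1 (V x - w x) * ψ x * Rr q μ V V1 V2 N x) := by
    refine (i1.add i0).congr (Eventually.of_forall fun x => ?_)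
    simp only [Rr, Pi.add_apply]; ring
  have ek : kdens q μ β1 β2 w w1 ψ ψ1 V V1 N = fun x => β1 (V x - w x) * ψ x * Rr q μ V V1 V2 N x + D x := by
    funext x; simp only [kdens, Rr, D]; ring
  refine ⟨iR, ?_, ?_⟩
  · rw [ek]; exact iR.add iD
  · rw [ek, integral_add iR iD, zD, add_zero]

theorem rpow_le_one_add_sq {q : ℝ} (hq0 : 0 ≤ q) (hq2 : q ≤ 2) (v : ℝ) : |v| ^ q ≤ 1 + v ^ 2 := by
  rcases le_total |v| 1 with h | h
  · have := Real.rpow_le_one (abs_nonneg v) h hq0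
    nlinarith [sq_nonneg v]
  · have := Real.rpow_le_rpow_of_exponent_le h hq2
    rw [Real.rpow_two, sq_abs] at this
    linarith

theorem edens_nonneg (V V1 : ℝ → ℝ) (x : ℝ) : 0 ≤ edens V V1 x := by unfold edens; positivity

theorem edens_lb (V V1 : ℝ → ℝ) (x : ℝ) : 1 ≤ edens V V1 x ∧ |V1 x| ≤ edens V V1 x
    ∧ V1 x ^ 2 ≤ (1 + V x ^ 2) * edens V V1 x ∧ 1 + V x ^ 2 ≤ edens V V1 x := by
  have h0 : 0 < 1 + V x ^ 2 := by positivity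
  have h1 : 0 ≤ V1 x ^ 2 / (1 + V x ^ 2) := by positivity
  have h2 : V1 x ^ 2 = (1 + V x ^ 2) * (V1 x ^ 2 / (1 + V x ^ 2)) := by field_simp
  have h3 : 0 ≤ V x ^ 2 := sq_nonneg _
  unfold edens
  refine ⟨by linarith, ?_, by nlinarith, by linarith⟩
  rw [abs_le]
  constructor <;> nlinarith [sq_nonneg (1 + V x ^ 2 - V1 x ^ 2 / (1 + V x ^ 2))]

theorem kdens_bound (hq : 1 < q) (hq2 : q < 2) (hμ : 0 ≤ μ) (hβ : Beta β β1 β2 C) {n Ψ : ℝ}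
    (hs : ∀ x, r < |x| → ψ x = 0) (hψ1 : ∀ x, HasDerivAt ψ (ψ1 x) x)
    (hw : ∀ x, |x| ≤ r → |w x| ≤ n ∧ |w1 x| ≤ n)
    (hΨ : ∀ x, |ψ x| ≤ Ψ ∧ |ψ1 x| ≤ Ψ) (x : ℝ) :
    |kdens q μ β1 β2 w w1 ψ ψ1 V V1 N x| ≤
      (2 * C * (1 + n ^ 2) * (1 + n) + C) * Ψ * (1 + μ) * (Set.Icc (-r) r).indicator (edens V V1) x
        + C * Ψ * |N x| := by
  have hC := hβ.Cnn
  have hΨ0 : 0 ≤ Ψ := (abs_nonneg _).trans (hΨ 0).1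
  by_cases hx : |x| ≤ r
  · rw [Set.indicator_of_mem (show x ∈ Set.Icc (-r) r from abs_le.1 hx)]
    obtain ⟨hw0, hw1⟩ := hw x hx
    have hn : 0 ≤ n := (abs_nonneg _).trans hw0
    obtain ⟨e1, e2, e3, e4⟩ := edens_lb V V1 x
    set e := edens V V1 x
    obtain ⟨g0, g1⟩ := hΨ x
    have hb1 := hβ.b1 (V x - w x)
    have hb2 := hβ.b2 (V x - w x)
    have hF : |Fl q (V x)| ≤ 1 + V x ^ 2 :=
      (abs_Fl_le q _ hq).trans (rpow_le_one_add_sq (by linarith) hq2.le _)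
    have hP : 0 < 1 + V x ^ 2 := by positivity
    have hb2' : (1 + V x ^ 2) * |β2 (V x - w x)| ≤ 2 * C * (1 + n ^ 2) := by
      have : 1 + V x ^ 2 ≤ 2 * (1 + n ^ 2) * (1 + (V x - w x) ^ 2) := by
        have : w x ^ 2 ≤ n ^ 2 := sq_le_sq' (by linarith [(abs_le.1 hw0).1]) (abs_le.1 hw0).2
        have h4 : V x ^ 2 ≤ 2 * (V x - w x) ^ 2 + 2 * w x ^ 2 := by
          nlinarith [sq_nonneg (V x - 2 * w x)]
        nlinarith [sq_nonneg (n * (V x - w x)), sq_nonneg (V x - w x)]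
      calc _ ≤ 2 * (1 + n ^ 2) * (1 + (V x - w x) ^ 2) * |β2 (V x - w x)| :=
            mul_le_mul_of_nonneg_right this (abs_nonneg _)
        _ = 2 * (1 + n ^ 2) * ((1 + (V x - w x) ^ 2) * |β2 (V x - w x)|) := by ring
        _ ≤ 2 * (1 + n ^ 2) * C := by gcongr
        _ = _ := by ring
    set b2 := |β2 (V x - w x)|
    have hb20 : 0 ≤ b2 := abs_nonneg _
    set D := 2 * C * (1 + n ^ 2)
    have hD : 0 ≤ D := by positivity
    have hA : |Fl q (V x) - μ * V1 x| ≤ (1 + V x ^ 2) + μ * |V1 x| := by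
      calc _ ≤ |Fl q (V x)| + |μ * V1 x| := abs_sub _ _
        _ ≤ _ := by rw [abs_mul, abs_of_nonneg hμ]; gcongr
    have hV1w : |V1 x - w1 x| ≤ |V1 x| + n := (abs_sub _ _).trans (by gcongr)
    have t1 : b2 * (|V1 x| + n) * ((1 + V x ^ 2) + μ * |V1 x|) ≤ D * (1 + n) * (1 + μ) * e := by
      have u1 : b2 * (1 + V x ^ 2) * (|V1 x| + n) ≤ D * ((1 + n) * e) := by
        apply mul_le_mul (by linarith) _ (by positivity) hD
        nlinarith
      have u2 : b2 * (|V1 x| + n) * |V1 x| ≤ D * ((1 + n) * e) := by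
        have : (|V1 x| + n) * |V1 x| ≤ (1 + V x ^ 2) * ((1 + n) * e) := by
          have h1 : |V1 x| * |V1 x| = V1 x ^ 2 := by rw [← sq, sq_abs]
          have h2 : n * |V1 x| ≤ n * e := by gcongr
          have h3 : n * e ≤ (1 + V x ^ 2) * (n * e) := by
            apply le_mul_of_one_le_left (by positivity); nlinarith [sq_nonneg (V x)]
          nlinarith
        calc b2 * (|V1 x| + n) * |V1 x| = b2 * ((|V1 x| + n) * |V1 x|) := by ring
          _ ≤ b2 * ((1 + V x ^ 2) * ((1 + n) * e)) := by gcongr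
          _ = ((1 + V x ^ 2) * b2) * ((1 + n) * e) := by ring
          _ ≤ D * ((1 + n) * e) := by gcongr
      have u3 : μ * (b2 * (|V1 x| + n) * |V1 x|) ≤ μ * (D * ((1 + n) * e)) := by gcongr
      calc _ = b2 * (1 + V x ^ 2) * (|V1 x| + n) + μ * (b2 * (|V1 x| + n) * |V1 x|) := by ring
        _ ≤ D * ((1 + n) * e) + μ * (D * ((1 + n) * e)) := add_le_add u1 u3
        _ = _ := by ring
    have t2 : (1 + V x ^ 2) + μ * |V1 x| ≤ (1 + μ) * e := by
      have : μ * |V1 x| ≤ μ * e := by gcongr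
      linarith
    unfold kdens
    calc _ ≤ |(β2 (V x - w x) * (V1 x - w1 x) * ψ x + β1 (V x - w x) * ψ1 x) * (Fl q (V x) - μ * V1 x)| + |β1 (V x - w x) * ψ x * N x| := abs_add_le _ _
      _ ≤ (b2 * (|V1 x| + n) * Ψ + C * Ψ) * ((1 + V x ^ 2) + μ * |V1 x|) + C * Ψ * |N x| := by
          rw [abs_mul, abs_mul (β1 (V x - w x) * ψ x), abs_mul (β1 (V x - w x))]
          gcongr
          refine (abs_add_le _ _).trans ?_
          rw [abs_mul, abs_mul, abs_mul (β1 (V x - w x))]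
          gcongr
      _ = Ψ * (b2 * (|V1 x| + n) * ((1 + V x ^ 2) + μ * |V1 x|)) + C * Ψ * ((1 + V x ^ 2) + μ * |V1 x|) + C * Ψ * |N x| := by ring
      _ ≤ Ψ * (D * (1 + n) * (1 + μ) * e) + C * Ψ * ((1 + μ) * e) + C * Ψ * |N x| := by gcongr
      _ = _ := by ring
  · have h0 := hs x (not_le.1 hx)
    have h1 := deriv_supp hψ1 hs x (not_le.1 hx)
    rw [Set.indicator_of_notMem (show x ∉ Set.Icc (-r) r from fun h => hx (abs_le.2 h))]
    simp [kdens, h0, h1]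
    positivity
end

theorem young_q {q η : ℝ} (hq : 1 < q) (hq2 : q < 2) (hη : 0 < η) {m : ℕ} (hm2 : 2 ≤ m)
    (hm : 1 ≤ m * (2 - q)) : ∃ C, 0 ≤ C ∧ ∀ s χ : ℝ, 0 ≤ s → 0 ≤ χ → χ ≤ 1 →
      s ^ q * χ ^ (m - 1) ≤ η * (s ^ 2 * χ ^ m) + C * s := by
  set a := q - 1 with ha
  set b := 2 - q with hb
  have ha0 : 0 < a := by linarith
  have hb0 : 0 < b := by linarith
  refine ⟨η ^ (-(a / b)), by positivity, fun s χ hs hχ hχ1 => ?_⟩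
  rcases hs.eq_or_lt with rfl | hs
  · rw [Real.zero_rpow (by linarith)]; simp
  rcases hχ.eq_or_lt with rfl | hχ
  · rw [zero_pow (by omega)]; 
    have : 0 ≤ η ^ (-(a / b)) * s := by positivity
    have h2 : 0 ≤ η * (s ^ 2 * 0 ^ m) := by positivity
    linarith
  have key := Real.geom_mean_le_arith_mean2_weighted (w₁ := a) (w₂ := b) (p₁ := η * (s ^ 2 * χ ^ m))
    (p₂ := η ^ (-(a / b)) * s) ha0.le hb0.le (by positivity) (by positivity) (by ring)
  have e1 : (η * (s ^ 2 * χ ^ m)) ^ a * (η ^ (-(a / b)) * s) ^ b = s ^ q * (χ ^ m) ^ a := by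
    rw [Real.mul_rpow hη.le (by positivity), Real.mul_rpow (by positivity) (by positivity),
      Real.mul_rpow (by positivity) hs.le, ← Real.rpow_mul hη.le]
    have e2 : -(a / b) * b = -a := by field_simp
    rw [e2, Real.rpow_neg hη.le]
    have e3 : (s ^ 2) ^ a = s ^ (2 * a) := by
      rw [← Real.rpow_natCast, ← Real.rpow_mul hs.le]; norm_num
    rw [e3]
    have e4 : s ^ (2 * a) * s ^ b = s ^ q := by
      rw [← Real.rpow_add hs]; congr 1; rw [ha, hb]; ring
    have : η ^ a ≠ 0 := by positivity
    rw [← e4]; field_simp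
  have e5 : χ ^ (m - 1) ≤ (χ ^ m) ^ a := by
    rw [← Real.rpow_natCast, ← Real.rpow_natCast, ← Real.rpow_mul hχ.le]
    apply Real.rpow_le_rpow_of_exponent_ge hχ hχ1
    rw [Nat.cast_sub (by omega)]
    push_cast
    have : (m : ℝ) * a = m - m * b := by rw [ha, hb]; ring
    rw [this]; linarith
  have p1 : 0 ≤ η * (s ^ 2 * χ ^ m) := by positivity
  have p2 : 0 ≤ η ^ (-(a / b)) * s := by positivity
  calc s ^ q * χ ^ (m - 1) ≤ s ^ q * (χ ^ m) ^ a := by gcongr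
    _ ≤ a * (η * (s ^ 2 * χ ^ m)) + b * (η ^ (-(a / b)) * s) := by rw [← e1]; exact key
    _ ≤ _ := by
      have h1 : a ≤ 1 := by linarith
      have h2 : b ≤ 1 := by linarith
      nlinarith

theorem young_2q {q η : ℝ} (hq : 1 < q) (hq2 : q < 2) (hη : 0 < η) :
    ∃ C, 0 ≤ C ∧ ∀ s : ℝ, 0 ≤ s → (s ^ q) ^ 2 / (1 + s ^ 2) ≤ η * s ^ 2 + C * s := by
  obtain ⟨m, hm⟩ := exists_nat_ge (1 / (2 - q))
  have hm' : 1 ≤ ((m + 2 : ℕ) : ℝ) * (2 - q) := by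
    have h0 : 0 < 2 - q := by linarith
    rw [div_le_iff₀ h0] at hm
    push_cast; nlinarith
  set η' := Real.sqrt (η / 2) with hη'
  have h1 : η' ^ 2 = η / 2 := Real.sq_sqrt (by positivity)
  obtain ⟨C, hC, h⟩ := young_q hq hq2 (η := η') (by positivity) (m := m + 2) (by omega) hm'
  refine ⟨2 * C ^ 2, by positivity, fun s hs => ?_⟩
  have h2 := h s 1 hs zero_le_one le_rfl
  simp only [one_pow, mul_one] at h2
  have h3 : (s ^ q) ^ 2 ≤ η * s ^ 4 + 2 * C ^ 2 * s ^ 2 := by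
    have : (s ^ q) ^ 2 ≤ (η' * s ^ 2 + C * s) ^ 2 := by gcongr
    calc _ ≤ _ := this
      _ ≤ 2 * η' ^ 2 * s ^ 4 + 2 * C ^ 2 * s ^ 2 := by nlinarith [sq_nonneg (η' * s ^ 2 - C * s)]
      _ = _ := by rw [h1]; ring
  rw [div_le_iff₀ (by positivity)]
  have h4 : s ^ 2 ≤ s * (1 + s ^ 2) := by nlinarith [sq_nonneg (s - 1), mul_nonneg hs (sq_nonneg (s-1))]
  have h5 : 2 * C ^ 2 * s ^ 2 ≤ 2 * C ^ 2 * (s * (1 + s ^ 2)) := by gcongr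
  nlinarith [sq_nonneg s]

theorem sup_le_int {f f' : ℝ → ℝ} {r : ℝ} (hd : ∀ x, HasDerivAt f (f' x) x) (hc : Continuous f')
    (h : ∀ x, r < |x| → f x = 0) (x : ℝ) : |f x| ≤ ∫ y, |f' y| := by
  have hi := (int_of_supp hc (deriv_supp hd h)).abs
  set a := min x (-(|r| + 1))
  have ha : f a = 0 := by
    apply h
    have h1 : a ≤ -(|r| + 1) := min_le_right _ _
    have := abs_nonneg r
    rw [abs_of_nonpos (by linarith)]
    linarith [le_abs_self r]
  have e := intervalIntegral.integral_eq_sub_of_hasDerivAt (a := a) (b := x) (f := f) (f' := f')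
    (fun y _ => hd y) (hc.intervalIntegrable _ _)
  rw [ha, sub_zero] at e
  rw [← e]
  calc _ ≤ ∫ y in Set.uIoc a x, ‖f' y‖ := intervalIntegral.norm_integral_le_integral_norm_uIoc
    _ ≤ ∫ y, |f' y| := setIntegral_le_integral hi (Eventually.of_forall fun y => abs_nonneg _)

structure Cutf (q c1 : ℝ) (Y : ℝ → ℝ) (ψ ψ1 ψ2 : ℝ → ℝ) (r : ℝ) : Prop where
  c2 : C2 ψ ψ1 ψ2
  nn : ∀ x, 0 ≤ ψ x
  le1 : ∀ x, ψ x ≤ 1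
  b1 : ∀ x, |ψ1 x| ≤ c1
  b2 : ∀ x, |ψ2 x| ≤ c1
  supp : ∀ x, r < |x| → ψ x = 0
  young : ∀ η, 0 < η → 0 ≤ Y η ∧ ∀ s x, 0 ≤ s → s ^ q * |ψ1 x| ≤ η * (s ^ 2 * ψ x) + Y η * s

theorem arctan_abs_le (v : ℝ) : |Real.arctan v| ≤ 2 := by
  have h1 := Real.arctan_lt_pi_div_two v
  have h2 := Real.neg_pi_div_two_lt_arctan v
  have := Real.pi_lt_four
  rw [abs_le]; constructor <;> linarith

noncomputable def bArc (v : ℝ) : ℝ := v * Real.arctan v - Real.log (1 + v ^ 2) / 2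

theorem beta_arctan : Beta bArc Real.arctan (fun v => 1 / (1 + v ^ 2)) 2 where
  d1 := by
    intro v
    have h1 := (hasDerivAt_id v).mul (Real.hasDerivAt_arctan v)
    have h2 : HasDerivAt (fun v : ℝ => 1 + v ^ 2) (2 * v) v := by
      simpa using ((hasDerivAt_pow 2 v).const_add 1)
    have h3 := (h2.log (by positivity)).div_const 2
    refine (h1.sub h3).congr_deriv ?_
    simp only [id]
    field_simp; ring
  d2 := fun v => Real.hasDerivAt_arctan v
  c2 := Continuous.div continuous_const (by fun_prop) (fun x => by positivity)
  b1 := arctan_abs_le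
  b2 := by
    intro v
    rw [abs_of_pos (by positivity)]
    have : (1 + v ^ 2) * (1 / (1 + v ^ 2)) = 1 := by field_simp
    rw [this]; norm_num

theorem bArc_zero : bArc 0 = 0 := by simp [bArc]

theorem bArc_le (v : ℝ) : |bArc v| ≤ 2 * |v| := by
  have := beta_arctan.lip v 0
  simpa [bArc_zero] using this

section
variable {q μ c1 r M : ℝ} {Y : ℝ → ℝ} {ψ ψ1 ψ2 v v1 v2 : ℝ → ℝ}

theorem gcont (hv : C2 v v1 v2) : Continuous (fun x => v1 x ^ 2 / (1 + v x ^ 2)) := by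
  have := hv.c0; have := hv.c1
  exact Continuous.div (by fun_prop) (by fun_prop) (fun x => by positivity)

theorem supX (hψ : Cutf q c1 Y ψ ψ1 ψ2 r) (hv : C2 v v1 v2)
    (hM : ∫ x in Set.Icc (-r) r, |v x| ≤ M) :
    ∫ x, v x ^ 2 * ψ x ≤ M * (M + 1) * (∫ x, v1 x ^ 2 / (1 + v x ^ 2) * ψ x) + 2 * M * (c1 * M + 1) := by
  have v0 := hv.c0; have v1c := hv.c1; have p0 := hψ.c2.c0; have p1 := hψ.c2.c1
  have gc := gcont hv
  have hM0 : 0 ≤ M := le_trans (setIntegral_nonneg measurableSet_Icc fun x _ => abs_nonneg _) hM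
  have hc1 : 0 ≤ c1 := (abs_nonneg _).trans (hψ.b1 0)
  have s0 := hψ.supp
  have s1 := deriv_supp hψ.c2.d1 s0
  set X := ∫ x, v x ^ 2 * ψ x
  set G := ∫ x, v1 x ^ 2 / (1 + v x ^ 2) * ψ x
  have iX : Integrable fun x => v x ^ 2 * ψ x := int_of_supp (r := r) (by fun_prop) (fun x hx => by simp [s0 x hx])
  have iG : Integrable fun x => v1 x ^ 2 / (1 + v x ^ 2) * ψ x := int_of_supp (r := r) (gc.mul p0) (fun x hx => by simp [s0 x hx])
  have iv : IntegrableOn (fun x => |v x|) (Set.Icc (-r) r) := (v0.abs.continuousOn).integrableOn_Icc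
  have ivI := iv.integrable_indicator measurableSet_Icc
  have evI : ∫ x, (Set.Icc (-r) r).indicator (fun x => |v x|) x ≤ M := by
    rw [integral_indicator measurableSet_Icc]; exact hM
  set h : ℝ → ℝ := fun x => Real.sqrt (1 + v x ^ 2) - 1
  have hsq : ∀ x, 0 < Real.sqrt (1 + v x ^ 2) := fun x => Real.sqrt_pos.2 (by positivity)
  have hsq2 : ∀ x, Real.sqrt (1 + v x ^ 2) ^ 2 = 1 + v x ^ 2 := fun x => Real.sq_sqrt (by positivity)
  have hh0 : ∀ x, 0 ≤ h x := fun x => by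
    have : 1 ≤ Real.sqrt (1 + v x ^ 2) := Real.one_le_sqrt.2 (by nlinarith [sq_nonneg (v x)])
    simp only [h]; linarith
  have hh1 : ∀ x, h x ≤ |v x| := fun x => by
    have : Real.sqrt (1 + v x ^ 2) ≤ 1 + |v x| := by
      rw [Real.sqrt_le_left (by positivity)]
      nlinarith [abs_nonneg (v x), sq_abs (v x)]
    simp only [h]; linarith
  have hh2 : ∀ x, |v x| ≤ h x + 1 := fun x => by
    simp only [h, sub_add_cancel]
    exact Real.abs_le_sqrt (by linarith)
  have dh : ∀ x, HasDerivAt h (v x * v1 x / Real.sqrt (1 + v x ^ 2)) x := by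
    intro x
    have h2 : HasDerivAt (fun x : ℝ => 1 + v x ^ 2) (2 * v x * v1 x) x := by
      simpa using (((hv.d1 x).pow 2).const_add 1)
    refine ((h2.sqrt (by positivity)).sub_const 1).congr_deriv ?_
    have := hsq x
    field_simp
  have chs : Continuous fun x => Real.sqrt (1 + v x ^ 2) := by fun_prop
  have ch : Continuous h := by fun_prop
  have cf' : Continuous fun x => v x * v1 x / Real.sqrt (1 + v x ^ 2) * ψ x + h x * ψ1 x :=
    ((Continuous.div (by fun_prop) chs (fun x => (hsq x).ne')).mul p0).add (ch.mul p1)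
  have key := sup_le_int (r := r) (f := fun x => h x * ψ x)
    (fun x => (dh x).mul (hψ.c2.d1 x)) cf' (fun x hx => by simp [s0 x hx])
  set S := ∫ x, |v x * v1 x / Real.sqrt (1 + v x ^ 2) * ψ x + h x * ψ1 x|
  set δ := 1 / (2 * (M + 1))
  have hδ : 0 < δ := by positivity
  have hS : S ≤ δ * X + (M + 1) / 2 * G + c1 * M := by
    have : S ≤ ∫ x, (δ * (v x ^ 2 * ψ x) + (M + 1) / 2 * (v1 x ^ 2 / (1 + v x ^ 2) * ψ x))
        + c1 * (Set.Icc (-r) r).indicator (fun x => |v x|) x := by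
      apply integral_mono
      · exact (int_of_supp (r := r) cf' (fun x hx => by simp [s0 x hx, s1 x hx])).abs
      · exact ((iX.const_mul _).add (iG.const_mul _)).add (ivI.const_mul _)
      · intro x
        by_cases hx : r < |x|
        · simp only [s0 x hx, s1 x hx]
          simp only [mul_zero, add_zero, abs_zero, zero_add]
          exact mul_nonneg hc1 (Set.indicator_nonneg (fun x _ => abs_nonneg _) x)
        · simp only []
          rw [Set.indicator_of_mem (show x ∈ Set.Icc (-r) r from abs_le.1 (not_lt.1 hx))]
          refine (abs_add_le _ _).trans (add_le_add ?_ ?_)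
          · rw [abs_mul, abs_of_nonneg (hψ.nn x), abs_div, abs_mul, abs_of_pos (hsq x), mul_div_assoc]
            have e1 : (|v1 x| / Real.sqrt (1 + v x ^ 2)) ^ 2 = v1 x ^ 2 / (1 + v x ^ 2) := by
              rw [div_pow, hsq2, sq_abs]
            rw [← e1]
            set z := |v1 x| / Real.sqrt (1 + v x ^ 2)
            have e2 : |v x| * z ≤ δ * v x ^ 2 + (M + 1) / 2 * z ^ 2 := by
              rw [← sq_abs (v x)]
              have : δ * (2 * (M + 1)) = 1 := by simp only [δ]; field_simp
              nlinarith [mul_nonneg hδ.le (sq_nonneg (|v x| - (M + 1) * z))]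
            nlinarith [mul_le_mul_of_nonneg_right e2 (hψ.nn x)]
          · rw [abs_mul, abs_of_nonneg (hh0 x), mul_comm]
            exact mul_le_mul (hψ.b1 x) (hh1 x) (hh0 x) hc1
    refine this.trans ?_
    rw [(lin3 iX iG ivI _ _ _).2]
    gcongr
  have hS0 : 0 ≤ S := integral_nonneg fun x => abs_nonneg _
  have hX : X ≤ (S + 1) * M := by
    have : X ≤ ∫ x, (S + 1) * (Set.Icc (-r) r).indicator (fun x => |v x|) x := by
      apply integral_mono iX (ivI.const_mul _)
      intro x
      by_cases hx : r < |x|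
      · simp only [s0 x hx, mul_zero]
        exact mul_nonneg (by linarith) (Set.indicator_nonneg (fun x _ => abs_nonneg _) x)
      · simp only []
        rw [Set.indicator_of_mem (show x ∈ Set.Icc (-r) r from abs_le.1 (not_lt.1 hx))]
        have k1 := (le_abs_self _).trans (key x)
        rw [← sq_abs]
        have k2 : |v x| * ψ x ≤ h x * ψ x + 1 := by
          have := mul_le_mul_of_nonneg_right (hh2 x) (hψ.nn x)
          nlinarith [hψ.le1 x]
        nlinarith [abs_nonneg (v x)]
    rw [integral_const_mul] at this
    exact this.trans (by gcongr)
  have hX0 : 0 ≤ X := integral_nonneg fun x => mul_nonneg (sq_nonneg _) (hψ.nn x)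
  have hd : δ * M ≤ 1 / 2 := by
    simp only [δ]; rw [div_mul_eq_mul_div, div_le_iff₀ (by positivity)]; linarith
  have h9 : X ≤ (δ * X + (M + 1) / 2 * G + c1 * M + 1) * M := hX.trans (by gcongr)
  nlinarith
end

theorem rpow_split {q : ℝ} (hq : 1 < q) (hq2 : q < 2) {V w n : ℝ} (hw : |w| ≤ n) :
    |V| ^ q ≤ 2 * (|V - w| ^ q + n ^ q) := by
  have hn : 0 ≤ n := (abs_nonneg _).trans hw
  have h1 : |V| ≤ |V - w| + n := by
    calc |V| = |(V - w) + w| := by ring_nf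
      _ ≤ _ := (abs_add_le _ _).trans (by gcongr)
  have h2 : |V| ^ q ≤ (|V - w| + n) ^ q := by gcongr
  have h3 : (|V - w| + n) ^ q ≤ 2 ^ (q - 1) * (|V - w| ^ q + n ^ q) := by
    have := NNReal.rpow_add_le_mul_rpow_add_rpow ⟨|V - w|, abs_nonneg _⟩ ⟨n, hn⟩ hq.le
    have h := NNReal.coe_le_coe.2 this
    push_cast at h
    exact h
  have h4 : (2:ℝ) ^ (q - 1) ≤ 2 := by
    calc (2:ℝ) ^ (q - 1) ≤ 2 ^ (1:ℝ) := Real.rpow_le_rpow_of_exponent_le (by norm_num) (by linarith)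
      _ = 2 := by simp
  have h5 : 0 ≤ |V - w| ^ q + n ^ q := by positivity
  nlinarith

theorem kdens_pt {q μ c1 r n η1 η2 C1 : ℝ} {Y ψ ψ1 ψ2 V V1 w w1 N : ℝ → ℝ} (hq : 1 < q) (hq2 : q < 2)
    (hμ : 0 < μ) (hψ : Cutf q c1 Y ψ ψ1 ψ2 r) (hn : 0 ≤ n)
    (hw : ∀ x, |x| ≤ r → |w x| ≤ n ∧ |w1 x| ≤ n)
    (h1 : ∀ s : ℝ, 0 ≤ s → (s ^ q) ^ 2 / (1 + s ^ 2) ≤ η1 * s ^ 2 + C1 * s) (hη2 : 0 < η2)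
    (hC1 : 0 ≤ C1) (x : ℝ) :
    kdens q μ Real.arctan (fun v => 1 / (1 + v ^ 2)) w w1 ψ ψ1 V V1 N x ≤
      -(μ / 2) * ((V1 x - w1 x) ^ 2 / (1 + (V x - w x) ^ 2) * ψ x)
      + (8 * η1 / μ + 4 * η2) * ((V x - w x) ^ 2 * ψ x)
      + 1 * (Set.Icc (-r) r).indicator (fun x => (8 * C1 / μ + 4 * Y η2) * |V x - w x| +
        (8 / μ + 4 * c1 + μ + 2 * μ * c1) * ((n ^ q) ^ 2 + n ^ q + n ^ 2 + n)) x
      + 2 * |N x| + (-μ) * (Real.arctan (V x - w x) * (V1 x - w1 x) * ψ1 x) := by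
  have hc1 : 0 ≤ c1 := (abs_nonneg _).trans (hψ.b1 0)
  by_cases hx : r < |x|
  · have e0 := hψ.supp x hx
    have e1 := deriv_supp hψ.c2.d1 hψ.supp x hx
    rw [Set.indicator_of_notMem (show x ∉ Set.Icc (-r) r from fun h => not_le.2 hx (abs_le.2 h))]
    simp [kdens, e0, e1]
  · rw [Set.indicator_of_mem (show x ∈ Set.Icc (-r) r from abs_le.1 (not_lt.1 hx))]
    obtain ⟨w0, w1'⟩ := hw x (not_lt.1 hx)
    have hF := (abs_Fl_le q (V x) hq).trans (rpow_split hq hq2 (V := V x) w0)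
    have y := (hψ.young η2 hη2).2 |V x - w x| x (abs_nonneg _)
    have y1 := h1 |V x - w x| (abs_nonneg _)
    have ha := arctan_abs_le (V x - w x)
    have p0 := hψ.nn x
    have p1 := hψ.le1 x
    have q1 := hψ.b1 x
    rw [sq_abs] at y y1
    unfold kdens
    set v := V x - w x
    set z := V1 x - w1 x
    set S := |v| ^ q
    set A := n ^ q
    set F := Fl q (V x)
    have hS : 0 ≤ S := by positivity
    have hA : 0 ≤ A := by positivity
    set D := 1 + v ^ 2
    have hD : 1 ≤ D := by simp only [D]; nlinarith [sq_nonneg v]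
    have hV1 : V1 x = z + w1 x := by simp only [z]; ring
    rw [hV1]
    -- the term with F squared
    have f1 : F ^ 2 ≤ 8 * S ^ 2 + 8 * A ^ 2 := by
      have : F ^ 2 ≤ (2 * (S + A)) ^ 2 := by rw [← sq_abs]; gcongr
      nlinarith [sq_nonneg (S - A)]
    have f2 : F ^ 2 / D ≤ 8 * (η1 * v ^ 2 + C1 * |v|) + 8 * A ^ 2 := by
      have : F ^ 2 / D ≤ (8 * S ^ 2 + 8 * A ^ 2) / D := by gcongr
      have e : (8 * S ^ 2 + 8 * A ^ 2) / D = 8 * (S ^ 2 / D) + 8 * A ^ 2 / D := by ring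
      have e2 : 8 * A ^ 2 / D ≤ 8 * A ^ 2 := div_le_self (by positivity) hD
      linarith
    have t1 : 1 / D * z * ψ x * (F - μ * (z + w1 x)) ≤ -(μ / 2) * (z ^ 2 / D * ψ x) +
        (1 / μ * (F ^ 2 / D) + μ * n ^ 2) * ψ x := by
      have k1 : 1 / D * z * F ≤ μ / 4 * (z ^ 2 / D) + 1 / μ * (F ^ 2 / D) := by
        have : 0 ≤ 1 / (μ * D) * (μ * z / 2 - F) ^ 2 := by positivity
        have e : 1 / (μ * D) * (μ * z / 2 - F) ^ 2 = μ / 4 * (z ^ 2 / D) + 1 / μ * (F ^ 2 / D) - 1 / D * z * F := by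
          field_simp; ring
        linarith
      have k2 : - (1 / D * z * (μ * w1 x)) ≤ μ / 4 * (z ^ 2 / D) + μ * n ^ 2 := by
        have e0 : 0 ≤ μ / D * (z / 2 + w1 x) ^ 2 := by positivity
        have e : μ / D * (z / 2 + w1 x) ^ 2 = μ / 4 * (z ^ 2 / D) + μ * (w1 x ^ 2 / D) + (1 / D * z * (μ * w1 x)) := by
          field_simp; ring
        have e2 : w1 x ^ 2 / D ≤ w1 x ^ 2 := div_le_self (by positivity) hD
        have e3 : w1 x ^ 2 ≤ n ^ 2 := by rw [← sq_abs]; gcongr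
        have e4 : μ * (w1 x ^ 2 / D) ≤ μ * n ^ 2 := by gcongr; linarith
        linarith
      have k3 : 1 / D * z * (F - μ * (z + w1 x)) ≤ -(μ / 2) * (z ^ 2 / D) + (1 / μ * (F ^ 2 / D) + μ * n ^ 2) := by
        have : 1 / D * z * (F - μ * (z + w1 x)) = 1 / D * z * F - μ * (z ^ 2 / D) - 1 / D * z * (μ * w1 x) := by ring
        linarith
      nlinarith [mul_le_mul_of_nonneg_right k3 p0]
    have t2 : (1 / μ * (F ^ 2 / D) + μ * n ^ 2) * ψ x ≤ 8 * η1 / μ * (v ^ 2 * ψ x) + 8 * C1 / μ * |v| + 8 / μ * A ^ 2 + μ * n ^ 2 := by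
      have e : 1 / μ * (F ^ 2 / D) ≤ 1 / μ * (8 * (η1 * v ^ 2 + C1 * |v|) + 8 * A ^ 2) := by gcongr
      have e1 : (1 / μ * (F ^ 2 / D) + μ * n ^ 2) * ψ x ≤ (1 / μ * (8 * (η1 * v ^ 2 + C1 * |v|) + 8 * A ^ 2) + μ * n ^ 2) * ψ x := by gcongr
      have e2 : (8 * C1 / μ * |v| + 8 / μ * A ^ 2 + μ * n ^ 2) * ψ x ≤ 8 * C1 / μ * |v| + 8 / μ * A ^ 2 + μ * n ^ 2 :=
        mul_le_of_le_one_right (by positivity) p1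
      calc _ ≤ _ := e1
        _ = 8 * η1 / μ * (v ^ 2 * ψ x) + (8 * C1 / μ * |v| + 8 / μ * A ^ 2 + μ * n ^ 2) * ψ x := by ring
        _ ≤ _ := by linarith
    have t3 : Real.arctan v * ψ1 x * (F - μ * w1 x) ≤ 4 * η2 * (v ^ 2 * ψ x) + 4 * Y η2 * |v| + 4 * c1 * A + 2 * μ * c1 * n := by
      calc _ ≤ |Real.arctan v * ψ1 x * (F - μ * w1 x)| := le_abs_self _
        _ = |Real.arctan v| * |ψ1 x| * |F - μ * w1 x| := by rw [abs_mul, abs_mul]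
        _ ≤ 2 * |ψ1 x| * (2 * (S + A) + μ * n) := by
            gcongr
            refine (abs_sub _ _).trans ?_
            rw [abs_mul, abs_of_pos hμ]; gcongr
        _ = 4 * (S * |ψ1 x|) + 4 * |ψ1 x| * A + 2 * μ * |ψ1 x| * n := by ring
        _ ≤ 4 * (η2 * (v ^ 2 * ψ x) + Y η2 * |v|) + 4 * c1 * A + 2 * μ * c1 * n := by gcongr
        _ = _ := by ring
    have t4 : Real.arctan v * ψ x * N x ≤ 2 * |N x| := by
      calc _ ≤ |Real.arctan v * ψ x * N x| := le_abs_self _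
        _ = |Real.arctan v| * ψ x * |N x| := by rw [abs_mul, abs_mul, abs_of_nonneg p0]
        _ ≤ 2 * 1 * |N x| := by gcongr
        _ = _ := by ring
    have t5 : 8 / μ * A ^ 2 + 4 * c1 * A + μ * n ^ 2 + 2 * μ * c1 * n ≤ (8 / μ + 4 * c1 + μ + 2 * μ * c1) * (A ^ 2 + A + n ^ 2 + n) := by
      have a1 : 0 ≤ 8 / μ := by positivity
      have a2 : 0 ≤ μ * c1 := by positivity
      have a3 : 0 ≤ A ^ 2 := sq_nonneg _
      have a4 : 0 ≤ n ^ 2 := sq_nonneg _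
      have : (8 / μ + 4 * c1 + μ + 2 * μ * c1) * (A ^ 2 + A + n ^ 2 + n) = 8 / μ * A ^ 2 + 4 * c1 * A + μ * n ^ 2 + 2 * (μ * c1) * n + (8 / μ * (A + n ^ 2 + n) + 4 * c1 * (A ^ 2 + n ^ 2 + n) + μ * (A ^ 2 + A + n) + 2 * (μ * c1) * (A ^ 2 + A + n ^ 2)) := by ring
      rw [this]
      have : 0 ≤ (8 / μ * (A + n ^ 2 + n) + 4 * c1 * (A ^ 2 + n ^ 2 + n) + μ * (A ^ 2 + A + n) + 2 * (μ * c1) * (A ^ 2 + A + n ^ 2)) := by positivity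
      linarith
    have e0 : (1 / D * z * ψ x + Real.arctan v * ψ1 x) * (F - μ * (z + w1 x)) + Real.arctan v * ψ x * N x
      = 1 / D * z * ψ x * (F - μ * (z + w1 x)) + Real.arctan v * ψ1 x * (F - μ * w1 x)
        + Real.arctan v * ψ x * N x + (-μ) * (Real.arctan v * z * ψ1 x) := by ring
    rw [e0]
    linarith

theorem E1fix {q μ : ℝ} (hq : 1 < q) (hq2 : q < 2) (hμ : 0 < μ) (c1 M κ : ℝ) (Y : ℝ → ℝ)
    (hc1 : 0 ≤ c1) (hM0 : 0 ≤ M) :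
    ∃ c C : ℝ, 0 < c ∧ 0 ≤ C ∧ ∀ (r n : ℝ) (V V1 V2 w w1 w2 ψ ψ1 ψ2 N : ℝ → ℝ), Cutf q c1 Y ψ ψ1 ψ2 r →
      C2 V V1 V2 → C2 w w1 w2 → Integrable N → ∫ x, |N x| ≤ M → 0 ≤ n → 0 ≤ r →
      (∀ x, |x| ≤ r → |w x| ≤ n ∧ |w1 x| ≤ n) →
      r * ((n ^ q) ^ 2 + n ^ q + n ^ 2 + n) ≤ κ →
      ∫ x in Set.Icc (-r) r, |V x - w x| ≤ M →
      ∫ x, kdens q μ Real.arctan (fun v => 1 / (1 + v ^ 2)) w w1 ψ ψ1 V V1 N x ≤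
        C - c * ∫ x, ((V x - w x) ^ 2 + (V1 x - w1 x) ^ 2 / (1 + (V x - w x) ^ 2)) * ψ x := by
  set a := M * (M + 1)
  set b := 2 * M * (c1 * M + 1)
  have ha : 0 ≤ a := by positivity
  have hb : 0 ≤ b := by positivity
  set η := μ / (8 * (a + 1)) with hη
  have hη0 : 0 < η := by positivity
  have hηa : 2 * η * a ≤ μ / 4 := by
    rw [hη]; rw [show 2 * (μ / (8 * (a + 1))) * a = (2 * μ * a) / (8 * (a + 1)) by ring, div_le_iff₀ (by positivity)]
    nlinarith
  obtain ⟨C1, hC1, h1⟩ := young_2q hq hq2 (η := η * μ / 16) (by positivity)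
  set η2 := η / 8
  have hη2 : 0 < η2 := by positivity
  set B1 := 8 * C1 / μ + 4 * Y η2
  set B2 := 8 / μ + 4 * c1 + μ + 2 * μ * c1
  have hB2 : 0 ≤ B2 := by positivity
  set C := |B1| * M + B2 * (2 * |κ|) + 2 * M + μ * (2 * c1 * M) + 2 * η * b
  refine ⟨min (μ / 4) η, C, by positivity, by positivity, ?_⟩
  intro r n V V1 V2 w w1 w2 ψ ψ1 ψ2 N hψ hV hw hN hNM hn hr hwn hκ hvM
  have hv := hV.sub hw
  have hB1 : 0 ≤ B1 := by have := (hψ.young η2 hη2).1; positivity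
  have hX := supX hψ hv hvM
  have v0 := hv.c0; have v1c := hv.c1; have p0 := hψ.c2.c0; have p1 := hψ.c2.c1
  have gc := gcont hv
  have s0 := hψ.supp
  have s1 := deriv_supp hψ.c2.d1 s0
  have s2 := deriv_supp hψ.c2.d2 s1
  have iX : Integrable fun x => (V x - w x) ^ 2 * ψ x := int_of_supp (r := r) (by fun_prop) (fun x hx => by simp [s0 x hx])
  have iG : Integrable fun x => (V1 x - w1 x) ^ 2 / (1 + (V x - w x) ^ 2) * ψ x := int_of_supp (r := r) (gc.mul p0) (fun x hx => by simp [s0 x hx])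
  have iv : IntegrableOn (fun x => |V x - w x|) (Set.Icc (-r) r) := (v0.abs.continuousOn).integrableOn_Icc
  set Wn := (n ^ q) ^ 2 + n ^ q + n ^ 2 + n
  have hWn : 0 ≤ Wn := by positivity
  have iI0 : IntegrableOn (fun x => B1 * |V x - w x| + B2 * Wn) (Set.Icc (-r) r) :=
    Continuous.integrableOn_Icc (by fun_prop)
  have iI := iI0.integrable_indicator measurableSet_Icc
  have eI : ∫ x, (Set.Icc (-r) r).indicator (fun x => B1 * |V x - w x| + B2 * Wn) x ≤ B1 * M + B2 * (2 * κ) := by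
    rw [integral_indicator measurableSet_Icc, integral_add (iv.const_mul _) (integrable_const _), integral_const_mul,
      setIntegral_const]
    have : (volume.real (Set.Icc (-r) r)) = 2 * r := by
      rw [Real.volume_real_Icc_of_le (by linarith)]; ring
    rw [this]
    simp only [smul_eq_mul]
    have : 2 * r * (B2 * Wn) = B2 * (2 * (r * Wn)) := by ring
    rw [this]
    gcongr
  have ca : Continuous fun x => Real.arctan (V x - w x) := Real.continuous_arctan.comp v0
  have iA : Integrable fun x => Real.arctan (V x - w x) * (V1 x - w1 x) * ψ1 x :=
    int_of_supp (r := r) (by fun_prop) (fun x hx => by simp [s1 x hx])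
  have hk := (weak_fixed (μ := μ) hq hN beta_arctan hw hψ.c2 s0 hV).2.1
  have L := lin5 iG iX iI hN.abs iA (-(μ/2)) (8 * (η * μ / 16) / μ + 4 * η2) 1 2 (-μ)
  have main := integral_mono hk L.1 (fun x => kdens_pt hq hq2 hμ hψ hn hwn h1 hη2 hC1 x)
  rw [L.2] at main
  have eη : 8 * (η * μ / 16) / μ + 4 * η2 = η := by simp only [η2]; field_simp; ring
  rw [eη] at main
  -- integrate by parts
  have cb : Continuous fun x => bArc (V x - w x) := beta_arctan.c0.comp v0
  have dB : ∀ x, HasDerivAt (fun x => bArc (V x - w x) * ψ1 x)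
      (Real.arctan (V x - w x) * (V1 x - w1 x) * ψ1 x + bArc (V x - w x) * ψ2 x) x := fun x => by
    have hc : HasDerivAt (fun x => bArc (V x - w x)) (Real.arctan (V x - w x) * (V1 x - w1 x)) x :=
      HasDerivAt.comp (h₂ := bArc) x (beta_arctan.d1 (V x - w x)) (hv.d1 x)
    exact hc.mul (hψ.c2.d2 x)
  have p2 := hψ.c2.c2
  have iB : Integrable fun x => bArc (V x - w x) * ψ2 x :=
    int_of_supp (r := r) (by fun_prop) (fun x hx => by simp [s2 x hx])
  have zB := ibp0 (r := r) dB (by fun_prop) (fun x hx => by simp [s1 x hx])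
  rw [integral_add iA iB] at zB
  have eB : |∫ x, bArc (V x - w x) * ψ2 x| ≤ 2 * c1 * M := by
    calc _ ≤ ∫ x, |bArc (V x - w x) * ψ2 x| := abs_integral_le_integral_abs
      _ ≤ ∫ x, (Set.Icc (-r) r).indicator (fun x => 2 * c1 * |V x - w x|) x := by
          have iv2 : IntegrableOn (fun x => 2 * c1 * |V x - w x|) (Set.Icc (-r) r) := iv.const_mul _
          apply integral_mono iB.abs (iv2.integrable_indicator measurableSet_Icc)
          intro x
          by_cases hx : r < |x|
          · simp only [s2 x hx, mul_zero, abs_zero]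
            exact Set.indicator_nonneg (fun x _ => by positivity) x
          · simp only []
            rw [Set.indicator_of_mem (show x ∈ Set.Icc (-r) r from abs_le.1 (not_lt.1 hx)), abs_mul]
            have := mul_le_mul (bArc_le (V x - w x)) (hψ.b2 x) (abs_nonneg _) (by positivity)
            linarith
      _ = 2 * c1 * ∫ x in Set.Icc (-r) r, |V x - w x| := by
          rw [integral_indicator measurableSet_Icc, integral_const_mul]
      _ ≤ _ := by gcongr
  have eXG := (lin2 iX iG 1 1).2
  simp only [one_mul] at eXG
  have e9 : ∫ x, ((V x - w x) ^ 2 + (V1 x - w1 x) ^ 2 / (1 + (V x - w x) ^ 2)) * ψ x =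
     (∫ x, (V x - w x) ^ 2 * ψ x) + ∫ x, (V1 x - w1 x) ^ 2 / (1 + (V x - w x) ^ 2) * ψ x := by
    rw [← eXG]; congr 1; funext x; ring
  rw [e9]
  set X := ∫ x, (V x - w x) ^ 2 * ψ x
  set G := ∫ x, (V1 x - w1 x) ^ 2 / (1 + (V x - w x) ^ 2) * ψ x
  have hX0 : 0 ≤ X := integral_nonneg fun x => mul_nonneg (sq_nonneg _) (hψ.nn x)
  have hG0 : 0 ≤ G := integral_nonneg fun x => mul_nonneg (by positivity) (hψ.nn x)
  have m1 : min (μ / 4) η * X ≤ η * X := by gcongr; exact min_le_right _ _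
  have m2 : min (μ / 4) η * G ≤ μ / 4 * G := by gcongr; exact min_le_left _ _
  have m3 : 2 * η * X ≤ 2 * η * (a * G + b) := by gcongr
  have m4 : 2 * η * a * G ≤ μ / 4 * G := by gcongr
  have m5 : B2 * (2 * κ) ≤ B2 * (2 * |κ|) := by gcongr; exact le_abs_self _
  have m6 : μ * |∫ x, bArc (V x - w x) * ψ2 x| ≤ μ * (2 * c1 * M) := by gcongr
  have m7 : μ * ∫ x, bArc (V x - w x) * ψ2 x ≤ μ * |∫ x, bArc (V x - w x) * ψ2 x| := by gcongr; exact le_abs_self _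
  have m8 : -μ * (∫ x, Real.arctan (V x - w x) * (V1 x - w1 x) * ψ1 x) = μ * ∫ x, bArc (V x - w x) * ψ2 x := by
    rw [eq_neg_of_add_eq_zero_left zB]; ring
  have m9 : B1 * M = |B1| * M := by rw [abs_of_nonneg hB1]
  rw [m8] at main
  simp only [C]
  linarith

noncomputable def bA (ε v : ℝ) : ℝ := Real.sqrt (ε ^ 2 + v ^ 2) - ε
noncomputable def bA1 (ε v : ℝ) : ℝ := v / Real.sqrt (ε ^ 2 + v ^ 2)
noncomputable def bA2 (ε v : ℝ) : ℝ := ε ^ 2 / Real.sqrt (ε ^ 2 + v ^ 2) ^ 3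

section
variable {ε : ℝ}

theorem bA_s (hε : 0 < ε) (v : ℝ) : ε ≤ Real.sqrt (ε ^ 2 + v ^ 2) ∧ |v| ≤ Real.sqrt (ε ^ 2 + v ^ 2)
    ∧ Real.sqrt (ε ^ 2 + v ^ 2) ^ 2 = ε ^ 2 + v ^ 2 ∧ Real.sqrt (ε ^ 2 + v ^ 2) ≤ ε + |v| := by
  refine ⟨Real.le_sqrt_of_sq_le (by nlinarith [sq_nonneg v]), Real.abs_le_sqrt (by nlinarith [sq_nonneg ε]),
    Real.sq_sqrt (by positivity), ?_⟩
  rw [Real.sqrt_le_left (by positivity)]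
  nlinarith [abs_nonneg v, sq_abs v, mul_nonneg hε.le (abs_nonneg v)]

theorem bA_lb (v : ℝ) : |v| - ε ≤ bA ε v := by
  unfold bA
  have : |v| ≤ Real.sqrt (ε ^ 2 + v ^ 2) := Real.abs_le_sqrt (by nlinarith [sq_nonneg ε])
  linarith

theorem bA_nn (hε : 0 < ε) (v : ℝ) : 0 ≤ bA ε v ∧ bA ε v ≤ |v| := by
  obtain ⟨h1, h2, h3, h4⟩ := bA_s hε v
  unfold bA
  constructor <;> linarith

theorem bA_d1 (hε : 0 < ε) (v : ℝ) : HasDerivAt (bA ε) (bA1 ε v) v := by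
  have h2 : HasDerivAt (fun v : ℝ => ε ^ 2 + v ^ 2) (2 * v) v := by
    simpa using ((hasDerivAt_pow 2 v).const_add (ε ^ 2))
  refine ((h2.sqrt (by positivity)).sub_const ε).congr_deriv ?_
  unfold bA1
  have : 0 < Real.sqrt (ε ^ 2 + v ^ 2) := Real.sqrt_pos.2 (by positivity)
  field_simp

theorem bA_d2 (hε : 0 < ε) (v : ℝ) : HasDerivAt (bA1 ε) (bA2 ε v) v := by
  have h2 : HasDerivAt (fun v : ℝ => ε ^ 2 + v ^ 2) (2 * v) v := by
    simpa using ((hasDerivAt_pow 2 v).const_add (ε ^ 2))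
  have h3 := h2.sqrt (by positivity)
  have hs : 0 < Real.sqrt (ε ^ 2 + v ^ 2) := Real.sqrt_pos.2 (by positivity)
  refine ((hasDerivAt_id v).div h3 hs.ne').congr_deriv ?_
  unfold bA2
  have e := (bA_s hε v).2.2.1
  simp only [id]
  set s := Real.sqrt (ε ^ 2 + v ^ 2)
  have e2 : ε ^ 2 = s ^ 2 - v ^ 2 := by linarith
  rw [e2]
  field_simp

theorem bA2_nn (hε : 0 < ε) (v : ℝ) : 0 ≤ bA2 ε v := by unfold bA2; positivity

theorem bA2_sq (hε : 0 < ε) (v : ℝ) : bA2 ε v * v ^ 2 ≤ ε := by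
  obtain ⟨h1, h2, h3, h4⟩ := bA_s hε v
  unfold bA2
  set s := Real.sqrt (ε ^ 2 + v ^ 2)
  have hs : 0 < s := lt_of_lt_of_le hε h1
  rw [div_mul_eq_mul_div, div_le_iff₀ (by positivity)]
  have : v ^ 2 ≤ s ^ 2 := by nlinarith [sq_nonneg ε]
  calc ε ^ 2 * v ^ 2 = ε * (ε * v ^ 2) := by ring
    _ ≤ ε * (s * s ^ 2) := by gcongr
    _ = _ := by ring

theorem beta_bA (hε : 0 < ε) (hε1 : ε ≤ 1) : Beta (bA ε) (bA1 ε) (bA2 ε) ((1 + ε ^ 2) / ε) where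
  d1 := bA_d1 hε
  d2 := bA_d2 hε
  c2 := by
    unfold bA2
    exact Continuous.div continuous_const (by fun_prop) (fun v => by
      have : 0 < Real.sqrt (ε ^ 2 + v ^ 2) := Real.sqrt_pos.2 (by positivity)
      positivity)
  b1 := by
    intro v
    obtain ⟨h1, h2, h3, h4⟩ := bA_s hε v
    unfold bA1
    have hs : 0 < Real.sqrt (ε ^ 2 + v ^ 2) := lt_of_lt_of_le hε h1
    rw [abs_div, abs_of_pos hs]
    have e1 : |v| / Real.sqrt (ε ^ 2 + v ^ 2) ≤ 1 := (div_le_one hs).2 h2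
    have e2 : 1 ≤ (1 + ε ^ 2) / ε := by
      rw [le_div_iff₀ hε]; nlinarith [sq_nonneg ε]
    linarith
  b2 := by
    intro v
    rw [abs_of_nonneg (bA2_nn hε v)]
    obtain ⟨h1, h2, h3, h4⟩ := bA_s hε v
    unfold bA2
    set s := Real.sqrt (ε ^ 2 + v ^ 2)
    have hs : 0 < s := lt_of_lt_of_le hε h1
    rw [mul_div_assoc', div_le_div_iff₀ (by positivity) hε]
    have e1 : ε ^ 2 * (1 + v ^ 2) ≤ (1 + ε ^ 2) * s ^ 2 := by rw [h3]; nlinarith [sq_nonneg v, sq_nonneg ε, sq_nonneg (ε^2)]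
    calc (1 + v ^ 2) * ε ^ 2 * ε ≤ ((1 + ε ^ 2) * s ^ 2) * s := by
          apply mul_le_mul (by linarith) h1 hε.le (by positivity)
      _ = _ := by ring

theorem bA1_le (hε : 0 < ε) (v : ℝ) : |bA1 ε v| ≤ 1 := by
  obtain ⟨h1, h2, h3, h4⟩ := bA_s hε v
  unfold bA1
  have hs : 0 < Real.sqrt (ε ^ 2 + v ^ 2) := lt_of_lt_of_le hε h1
  rw [abs_div, abs_of_pos hs]
  exact (div_le_one hs).2 h2
end

theorem Fl_diff {q : ℝ} (hq : 1 < q) {V w n : ℝ} (hw : |w| ≤ n) :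
    |Fl q V - Fl q w| ≤ |V - w| * (|V| + n) ^ (q - 1) := by
  have hn : 0 ≤ n := (abs_nonneg _).trans hw
  have := (convex_Icc (-(|V| + n)) (|V| + n)).norm_image_sub_le_of_norm_hasDerivWithin_le
    (f := Fl q) (f' := fun v => |v| ^ (q - 1)) (C := (|V| + n) ^ (q - 1)) (x := w) (y := V)
    (fun x _ => (hasDerivAt_Fl q x hq).hasDerivWithinAt)
    (fun x hx => by
      rw [Real.norm_eq_abs, abs_of_nonneg (by positivity)]
      have : |x| ≤ |V| + n := abs_le.2 hx
      gcongr)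
    (abs_le.1 (by linarith [abs_nonneg V])) (abs_le.1 (by linarith))
  rw [Real.norm_eq_abs, Real.norm_eq_abs] at this
  linarith

set_option maxHeartbeats 1000000 in
theorem E2fix {q μ : ℝ} (hq : 1 < q) (hq2 : q < 2) (hμ : 0 < μ) {c1 n r : ℝ} {Y : ℝ → ℝ}
    (hn : 0 ≤ n) (hr : 0 ≤ r) (hc1 : 0 ≤ c1) :
    ∃ A B : ℝ, 0 ≤ A ∧ 0 ≤ B ∧ ∀ (ε : ℝ) (V V1 V2 w w1 w2 ψ ψ1 ψ2 N : ℝ → ℝ), 0 < ε → ε ≤ 1 →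
      Cutf q c1 Y ψ ψ1 ψ2 r →
      C2 V V1 V2 → C2 w w1 w2 → Integrable N →
      (∀ x, |x| ≤ r → |w x| ≤ n ∧ |w1 x| ≤ n ∧ |w2 x| ≤ n) →
      ∫ x, kdens q μ (bA1 ε) (bA2 ε) w w1 ψ ψ1 V V1 N x ≤
        (∫ x in Set.Icc (-r) r, (A + B * V x ^ 2)) + ∫ x, |N x| := by
  set A := (1 + 2 * n ^ 2) / (4 * μ) + c1 * (2 + n ^ 2) + n ^ (q - 1) * n + μ * n + μ * c1 * (1 + n)
  set B := 1 / (2 * μ) + c1 + μ * c1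
  refine ⟨A, B, by positivity, by positivity, ?_⟩
  intro ε V V1 V2 w w1 w2 ψ ψ1 ψ2 N hε hε1 hψ hV hw hN hwn
  have hβ := beta_bA hε hε1
  have hv := hV.sub hw
  have hk := (weak_fixed (μ := μ) hq hN hβ hw hψ.c2 hψ.supp hV).2.1
  have v0 := hv.c0; have v1c := hv.c1; have p0 := hψ.c2.c0; have p1 := hψ.c2.c1; have p2 := hψ.c2.c2
  have w0 := hw.c0; have w1c := hw.c1; have w2c := hw.c2
  have V0 := hV.c0
  have s0 := hψ.supp
  have s1 := deriv_supp hψ.c2.d1 s0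
  have s2 := deriv_supp hψ.c2.d2 s1
  have cb0 : Continuous fun x => bA ε (V x - w x) := hβ.c0.comp v0
  have cb1 : Continuous fun x => bA1 ε (V x - w x) := hβ.c1.comp v0
  have cb2 : Continuous fun x => bA2 ε (V x - w x) := hβ.c2.comp v0
  have cF : Continuous fun x => Fl q (w x) := (continuous_Fl q hq).comp w0
  have cF1 : Continuous fun x => |w x| ^ (q - 1) := (continuous_absrpow (q-1) (by linarith)).comp w0
  -- exact derivative 1
  let E1 : ℝ → ℝ := fun x => bA1 ε (V x - w x) * (V1 x - w1 x) * ψ1 x + bA ε (V x - w x) * ψ2 x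
  have d1 : ∀ x, HasDerivAt (fun x => bA ε (V x - w x) * ψ1 x) (E1 x) x := fun x => by
    have hc : HasDerivAt (fun x => bA ε (V x - w x)) (bA1 ε (V x - w x) * (V1 x - w1 x)) x :=
      HasDerivAt.comp (h₂ := bA ε) x (hβ.d1 (V x - w x)) (hv.d1 x)
    exact hc.mul (hψ.c2.d2 x)
  have c1E : Continuous E1 := by fun_prop
  have z1 := ibp0 (r := r) d1 c1E (fun x hx => by simp [s1 x hx])
  have i1 : Integrable E1 := int_of_supp (r := r) c1E (fun x hx => by simp [E1, s1 x hx, s2 x hx])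
  let E2 : ℝ → ℝ := fun x => (bA2 ε (V x - w x) * (V1 x - w1 x) * ψ x + bA1 ε (V x - w x) * ψ1 x) * (Fl q (w x) - μ * w1 x) + bA1 ε (V x - w x) * ψ x * (|w x| ^ (q - 1) * w1 x - μ * w2 x)
  have d2 : ∀ x, HasDerivAt (fun x => bA1 ε (V x - w x) * ψ x * (Fl q (w x) - μ * w1 x)) (E2 x) x := fun x => by
    have hc : HasDerivAt (fun x => bA1 ε (V x - w x)) (bA2 ε (V x - w x) * (V1 x - w1 x)) x :=
      HasDerivAt.comp (h₂ := bA1 ε) x (hβ.d2 (V x - w x)) (hv.d1 x)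
    have hf : HasDerivAt (fun x => Fl q (w x)) (|w x| ^ (q - 1) * w1 x) x :=
      HasDerivAt.comp (h₂ := Fl q) x (hasDerivAt_Fl q _ hq) (hw.d1 x)
    exact (hc.mul (hψ.c2.d1 x)).mul (hf.sub ((hw.d2 x).const_mul μ))
  have c2E : Continuous E2 := by fun_prop
  have z2 := ibp0 (r := r) d2 c2E (fun x hx => by simp [s0 x hx])
  have i2 : Integrable E2 := int_of_supp (r := r) c2E (fun x hx => by simp [E2, s0 x hx, s1 x hx])
  have iI0 : IntegrableOn (fun x => A + B * V x ^ 2) (Set.Icc (-r) r) :=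
    Continuous.integrableOn_Icc (by fun_prop)
  have iI := iI0.integrable_indicator measurableSet_Icc
  have L := lin4 iI hN.abs i1 i2 1 1 (-μ) 1
  have main := integral_mono hk L.1 (fun x => ?_)
  · rw [L.2, z1, z2, integral_indicator measurableSet_Icc] at main
    linarith
  by_cases hx : r < |x|
  · have e0 := s0 x hx
    have e1 := s1 x hx
    have e2 := s2 x hx
    rw [Set.indicator_of_notMem (show x ∉ Set.Icc (-r) r from fun h => not_le.2 hx (abs_le.2 h))]
    simp [kdens, e0, e1, e2, E1, E2]
  · rw [Set.indicator_of_mem (show x ∈ Set.Icc (-r) r from abs_le.1 (not_lt.1 hx))]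
    obtain ⟨hw0, hw1, hw2⟩ := hwn x (not_lt.1 hx)
    have hF := Fl_diff hq (V := V x) hw0
    have hFV := (abs_Fl_le q (V x) hq).trans (rpow_le_one_add_sq (by linarith) hq2.le _)
    have hFw := (abs_Fl_le q (w x) hq).trans (rpow_le_one_add_sq (by linarith) hq2.le _)
    have g0 := hψ.nn x; have g1 := hψ.le1 x; have g2 := hψ.b1 x; have g3 := hψ.b2 x
    have k0 := bA_nn hε (V x - w x)
    have k1 := bA1_le hε (V x - w x)
    have k2 := bA2_nn hε (V x - w x)
    have k3 := bA2_sq hε (V x - w x)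
    have hv' : |V x - w x| ≤ 1 + V x ^ 2 + n := by
      refine (abs_sub _ _).trans ?_
      have : |V x| ≤ 1 + V x ^ 2 := by nlinarith [sq_nonneg (|V x| - 1), sq_abs (V x), abs_nonneg (V x)]
      linarith
    have hw2' : w x ^ 2 ≤ n ^ 2 := by rw [← sq_abs]; gcongr
    have hpw : ((|V x| + n) ^ (q - 1)) ^ 2 ≤ 1 + 2 * V x ^ 2 + 2 * n ^ 2 := by
      rw [← Real.rpow_natCast, ← Real.rpow_mul (by positivity)]
      have := rpow_le_one_add_sq (q := (q - 1) * (2:ℕ)) (by push_cast; nlinarith) (by push_cast; linarith) (|V x| + n)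
      rw [abs_of_nonneg (by positivity : 0 ≤ |V x| + n)] at this
      nlinarith [sq_nonneg (|V x| - n), sq_abs (V x)]
    simp only [kdens, E1, E2]
    set v := V x - w x
    set b1 := bA1 ε v
    set b2 := bA2 ε v
    set z := V1 x - w1 x
    have hV1 : V1 x = z + w1 x := by simp only [z]; ring
    rw [hV1]
    set Δ := Fl q (V x) - Fl q (w x)
    have hFV' : Fl q (V x) = Δ + Fl q (w x) := by simp only [Δ]; ring
    have t1 : b2 * z * ψ x * (Δ - μ * z) ≤ (1 + 2 * V x ^ 2 + 2 * n ^ 2) / (4 * μ) := by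
      have e1 : z * (Δ - μ * z) ≤ Δ ^ 2 / (4 * μ) := by
        rw [le_div_iff₀ (by positivity)]
        nlinarith [sq_nonneg (2 * μ * z - Δ)]
      have e2 : Δ ^ 2 ≤ v ^ 2 * (1 + 2 * V x ^ 2 + 2 * n ^ 2) := by
        calc Δ ^ 2 = |Δ| ^ 2 := (sq_abs _).symm
          _ ≤ (|v| * (|V x| + n) ^ (q - 1)) ^ 2 := by gcongr
          _ = v ^ 2 * ((|V x| + n) ^ (q - 1)) ^ 2 := by rw [mul_pow, sq_abs]
          _ ≤ _ := by gcongr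
      have hP : 0 ≤ 1 + 2 * V x ^ 2 + 2 * n ^ 2 := by positivity
      calc b2 * z * ψ x * (Δ - μ * z) = (b2 * ψ x) * (z * (Δ - μ * z)) := by ring
        _ ≤ (b2 * ψ x) * (v ^ 2 * (1 + 2 * V x ^ 2 + 2 * n ^ 2) / (4 * μ)) := by
            gcongr
            exact e1.trans (by gcongr)
        _ = ((b2 * v ^ 2) * ψ x) * ((1 + 2 * V x ^ 2 + 2 * n ^ 2) / (4 * μ)) := by ring
        _ ≤ 1 * ((1 + 2 * V x ^ 2 + 2 * n ^ 2) / (4 * μ)) := by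
            gcongr
            have : 0 ≤ b2 * v ^ 2 := by positivity
            nlinarith
        _ = _ := by ring
    have t2 : b1 * ψ1 x * Δ ≤ c1 * (2 + V x ^ 2 + n ^ 2) := by
      calc _ ≤ |b1 * ψ1 x * Δ| := le_abs_self _
        _ = |b1| * |ψ1 x| * |Δ| := by rw [abs_mul, abs_mul]
        _ ≤ 1 * c1 * ((1 + V x ^ 2) + (1 + w x ^ 2)) := by
            gcongr
            exact (abs_sub _ _).trans (by gcongr)
        _ ≤ _ := by rw [one_mul]; exact mul_le_mul_of_nonneg_left (by linarith) hc1
    have t3 : b1 * ψ x * N x ≤ |N x| := by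
      calc _ ≤ |b1 * ψ x * N x| := le_abs_self _
        _ = |b1| * ψ x * |N x| := by rw [abs_mul, abs_mul, abs_of_nonneg g0]
        _ ≤ 1 * 1 * |N x| := by gcongr
        _ = _ := by ring
    have t4 : -(b1 * ψ x * (|w x| ^ (q - 1) * w1 x - μ * w2 x)) ≤ n ^ (q - 1) * n + μ * n := by
      calc _ ≤ |b1 * ψ x * (|w x| ^ (q - 1) * w1 x - μ * w2 x)| := neg_le_abs _
        _ = |b1| * ψ x * |(|w x| ^ (q - 1) * w1 x - μ * w2 x)| := by rw [abs_mul, abs_mul, abs_of_nonneg g0]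
        _ ≤ 1 * 1 * (n ^ (q - 1) * n + μ * n) := by
            gcongr
            refine (abs_sub _ _).trans ?_
            rw [abs_mul, abs_mul, abs_of_pos hμ, abs_of_nonneg (by positivity : 0 ≤ |w x| ^ (q - 1))]
            have : 0 ≤ q - 1 := by linarith
            gcongr
        _ = _ := by ring
    have t5 : μ * (bA ε v * ψ2 x) ≤ μ * c1 * (1 + V x ^ 2 + n) := by
      calc μ * (bA ε v * ψ2 x) ≤ μ * |bA ε v * ψ2 x| := by gcongr; exact le_abs_self _
        _ = μ * (bA ε v * |ψ2 x|) := by rw [abs_mul, abs_of_nonneg k0.1]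
        _ ≤ μ * ((1 + V x ^ 2 + n) * c1) := by gcongr; linarith
        _ = _ := by ring
    have e0 : (b2 * z * ψ x + b1 * ψ1 x) * (Fl q (V x) - μ * (z + w1 x)) + b1 * ψ x * N x =
      b2 * z * ψ x * (Δ - μ * z) + b1 * ψ1 x * Δ + b1 * ψ x * N x + (-(b1 * ψ x * (|w x| ^ (q - 1) * w1 x - μ * w2 x))) + μ * (bA ε v * ψ2 x) + (-μ) * (b1 * z * ψ1 x + bA ε v * ψ2 x) + 1 * ((b2 * z * ψ x + b1 * ψ1 x) * (Fl q (w x) - μ * w1 x) + b1 * ψ x * (|w x| ^ (q - 1) * w1 x - μ * w2 x)) := by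
      rw [hFV']; ring
    rw [e0]
    have e9 : A + B * V x ^ 2 = (1 + 2 * V x ^ 2 + 2 * n ^ 2) / (4 * μ) + c1 * (2 + V x ^ 2 + n ^ 2) + (n ^ (q - 1) * n + μ * n) + μ * c1 * (1 + V x ^ 2 + n) := by
      simp only [A, B]; field_simp; ring
    rw [e9]
    linarith

theorem bdd_of_supp {f : ℝ → ℝ} {r : ℝ} (hc : Continuous f) (h : ∀ x, r < |x| → f x = 0) :
    ∃ B, 0 ≤ B ∧ ∀ x, |f x| ≤ B := by
  obtain ⟨B, hB⟩ := hc.bounded_above_of_compact_support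
    (HasCompactSupport.intro (isCompact_Icc (a := -r) (b := r)) (fun x hx => h x (by
      by_contra hh
      exact hx (abs_le.1 (not_lt.1 hh)))))
  exact ⟨B, (norm_nonneg _).trans (hB 0), hB⟩

theorem exists_cutf {q : ℝ} (hq : 1 < q) (hq2 : q < 2) {r1 r2 : ℝ} (h1 : 0 < r1) (h2 : r1 < r2) :
    ∃ (c1 : ℝ) (Y ψ ψ1 ψ2 : ℝ → ℝ), 0 ≤ c1 ∧ Cutf q c1 Y ψ ψ1 ψ2 r2 ∧ ∀ x, |x| ≤ r1 → ψ x = 1 := by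
  let χ : ContDiffBump (0:ℝ) := ⟨r1, r2, h1, h2⟩
  have hχ : ContDiff ℝ 2 (χ : ℝ → ℝ) := χ.contDiff
  have c := C2.of_contDiff hχ
  have s0 : ∀ x, r2 < |x| → (χ : ℝ → ℝ) x = 0 := fun x hx =>
    χ.zero_of_le_dist (by simpa [Real.dist_eq] using hx.le)
  have s1 := deriv_supp c.d1 s0
  have s2 := deriv_supp c.d2 s1
  obtain ⟨B1, hB1, b1⟩ := bdd_of_supp c.c1 s1
  obtain ⟨B2, hB2, b2⟩ := bdd_of_supp c.c2 s2
  obtain ⟨m0, hm0⟩ := exists_nat_ge (1 / (2 - q))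
  obtain ⟨m, hm⟩ : ∃ m, m = m0 + 2 := ⟨_, rfl⟩
  have hm2 : 2 ≤ m := by omega
  have hm' : 1 ≤ (m : ℝ) * (2 - q) := by
    have h0 : 0 < 2 - q := by linarith
    rw [div_le_iff₀ h0] at hm0
    rw [hm]; push_cast; nlinarith
  set f : ℝ → ℝ := ⇑χ
  set f1 := deriv f
  set f2 := deriv f1
  have hf0 : ∀ x, 0 ≤ f x := fun x => χ.nonneg
  have hf1 : ∀ x, f x ≤ 1 := fun x => χ.le_one
  set mm : ℝ := (m:ℝ)
  have hmm : 0 < mm := by simp only [mm]; exact_mod_cast (by omega : 0 < m)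
  have hYex := fun η : ℝ => fun hη : 0 < η => young_q hq hq2 (η := η / (mm * (B1 + 1))) (by positivity) hm2 hm'
  choose! Y hY using hYex
  set c1 := mm * (mm * B1 ^ 2 + B2) + mm * B1
  refine ⟨c1, fun η => mm * (B1 + 1) * Y η, fun x => f x ^ m, fun x => mm * f x ^ (m - 1) * f1 x,
    fun x => mm * (((m - 1 : ℕ) : ℝ) * f x ^ (m - 1 - 1) * f1 x) * f1 x + mm * f x ^ (m - 1) * f2 x,
    by positivity, ?_, ?_⟩
  · refine ⟨⟨fun x => (c.d1 x).pow m, fun x => (((c.d1 x).pow (m-1)).const_mul mm).mul (c.d2 x), ?_⟩, fun x => pow_nonneg (hf0 x) _,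
      fun x => pow_le_one₀ (hf0 x) (hf1 x), ?_, ?_, ?_, ?_⟩
    · have := c.c0; have := c.c1; have := c.c2
      fun_prop
    · intro x
      rw [abs_mul, abs_mul, abs_of_pos hmm, abs_of_nonneg (pow_nonneg (hf0 x) _)]
      have a := b1 x
      have : f x ^ (m-1) ≤ 1 := pow_le_one₀ (hf0 x) (hf1 x)
      have p := pow_nonneg (hf0 x) (m-1)
      calc mm * f x ^ (m-1) * |f1 x| ≤ mm * 1 * B1 := by gcongr
        _ ≤ c1 := by
          have : 0 ≤ mm * (mm * B1 ^ 2 + B2) := by positivity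
          simp only [c1]; linarith
    · intro x
      have a := b1 x
      have b := b2 x
      have p1 : f x ^ (m-1) ≤ 1 := pow_le_one₀ (hf0 x) (hf1 x)
      have p2 : f x ^ (m-1-1) ≤ 1 := pow_le_one₀ (hf0 x) (hf1 x)
      have p3 := pow_nonneg (hf0 x) (m-1)
      have p4 := pow_nonneg (hf0 x) (m-1-1)
      have p5 : ((m - 1 : ℕ) : ℝ) ≤ mm := by simp only [mm]; exact_mod_cast Nat.sub_le _ _
      calc _ ≤ |mm * (((m - 1 : ℕ) : ℝ) * f x ^ (m - 1 - 1) * f1 x) * f1 x| + |mm * f x ^ (m - 1) * f2 x| := abs_add_le _ _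
        _ = mm * (((m - 1 : ℕ) : ℝ) * f x ^ (m - 1 - 1) * |f1 x|) * |f1 x| + mm * f x ^ (m - 1) * |f2 x| := by
          simp only [abs_mul, abs_of_pos hmm, abs_of_nonneg p3, abs_of_nonneg p4, Nat.abs_cast]
        _ ≤ mm * (mm * 1 * B1) * B1 + mm * 1 * B2 := by gcongr
        _ ≤ c1 := by
          have : 0 ≤ mm * B1 := by positivity
          simp only [c1]; nlinarith
    · intro x hx
      simp only [s0 x hx]
      exact zero_pow (by omega)
    · intro η hη
      obtain ⟨y0, y1⟩ := hY η hη
      refine ⟨by positivity, fun s x hs => ?_⟩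
      have k := y1 s (f x) hs (hf0 x) (hf1 x)
      rw [abs_mul, abs_mul, abs_of_pos hmm, abs_of_nonneg (pow_nonneg (hf0 x) _)]
      have a : |f1 x| ≤ B1 + 1 := (b1 x).trans (by linarith)
      have hs' : 0 ≤ s ^ q := by positivity
      have p3 := pow_nonneg (hf0 x) (m-1)
      calc s ^ q * (mm * f x ^ (m - 1) * |f1 x|) ≤ s ^ q * (mm * f x ^ (m - 1) * (B1 + 1)) := by gcongr
        _ = (mm * (B1 + 1)) * (s ^ q * f x ^ (m-1)) := by ring
        _ ≤ (mm * (B1 + 1)) * (η / (mm * (B1 + 1)) * (s ^ 2 * f x ^ m) + Y η * s) := by gcongr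
        _ = _ := by field_simp
  · intro x hx
    have : f x = 1 := χ.one_of_mem_closedBall (by simpa [Real.dist_eq] using hx)
    simp [this]

theorem Cutf.scale {q c1 r ρ : ℝ} {Y ψ ψ1 ψ2 : ℝ → ℝ} (h : Cutf q c1 Y ψ ψ1 ψ2 r) (hρ : 1 ≤ ρ) :
    Cutf q c1 Y (fun x => ψ (x / ρ)) (fun x => ψ1 (x / ρ) / ρ) (fun x => ψ2 (x / ρ) / ρ / ρ) (ρ * r) := by
  have hρ0 : 0 < ρ := by linarith
  have d : ∀ x, HasDerivAt (fun x : ℝ => x / ρ) (1 / ρ) x := fun x => by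
    simpa using (hasDerivAt_id x).div_const ρ
  have hc1 : 0 ≤ c1 := (abs_nonneg _).trans (h.b1 0)
  refine ⟨⟨fun x => ?_, fun x => ?_, ?_⟩, fun x => h.nn _, fun x => h.le1 _, fun x => ?_, fun x => ?_, fun x hx => ?_, fun η hη => ⟨(h.young η hη).1, fun s x hs => ?_⟩⟩
  · have := HasDerivAt.comp (h₂ := ψ) x (h.c2.d1 (x / ρ)) (d x)
    refine this.congr_deriv (by ring)
  · have := (HasDerivAt.comp (h₂ := ψ1) x (h.c2.d2 (x / ρ)) (d x)).div_const ρ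
    refine this.congr_deriv (by ring)
  · have := h.c2.c2
    fun_prop
  · rw [abs_div, abs_of_pos hρ0]
    exact (div_le_self (abs_nonneg _) hρ).trans (h.b1 _)
  · rw [abs_div, abs_div, abs_of_pos hρ0]
    exact (div_le_self (by positivity) hρ).trans ((div_le_self (abs_nonneg _) hρ).trans (h.b2 _))
  · apply h.supp
    rw [abs_div, abs_of_pos hρ0, lt_div_iff₀ hρ0]; linarith
  · have k := (h.young η hη).2 s (x / ρ) hs
    refine le_trans ?_ k
    rw [abs_div, abs_of_pos hρ0]
    have : |ψ1 (x / ρ)| / ρ ≤ |ψ1 (x / ρ)| := div_le_self (abs_nonneg _) hρ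
    have hs' : 0 ≤ s ^ q := by positivity
    gcongr

structure PS (q μ M s0 T0 : ℝ) (U U1 U2 N : ℝ → ℝ → ℝ) : Prop where
  hq : 1 < q
  hq2 : q < 2
  hμ : 0 < μ
  int : ∀ t, Integrable (U t)
  bd : ∀ t, ∫ x, |U t x| ≤ M
  c2 : ∀ t, C2 (U t) (U1 t) (U2 t)
  l1c : ∀ t0, Tendsto (fun t => ∫ x, |U t x - U t0 x|) (nhds t0) (nhds 0)
  tc : ∀ x, Continuous fun t => U t x
  Nm : Measurable (Function.uncurry N)
  Ni : ∀ t, Integrable (N t)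
  Nb : ∀ t, ∫ x, |N t x| ≤ M
  Rc : ∀ x, Continuous fun t => Rr q μ (U t) (U1 t) (U2 t) (N t) x
  hd : ∀ x, ∀ t ∈ Set.Ioo s0 T0, HasDerivAt (fun t => U t x) (Rr q μ (U t) (U1 t) (U2 t) (N t) x) t

theorem meas_deriv {U U1 : ℝ → ℝ → ℝ} (hm : Measurable (Function.uncurry U))
    (hd : ∀ t x, HasDerivAt (U t) (U1 t x) x) : Measurable (Function.uncurry U1) := by
  refine measurable_of_tendsto_metrizable (f := fun (n : ℕ) (p : ℝ × ℝ) =>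
    (1 / ((n:ℝ) + 1))⁻¹ * (U p.1 (p.2 + 1 / ((n:ℝ) + 1)) - U p.1 p.2)) ?_ ?_
  · intro n
    have h1 : Measurable fun p : ℝ × ℝ => U p.1 (p.2 + 1 / ((n:ℝ) + 1)) :=
      hm.comp (measurable_fst.prodMk (measurable_snd.add_const _))
    have h2 : Measurable fun p : ℝ × ℝ => U p.1 p.2 := hm
    exact (h1.sub h2).const_mul _
  · rw [tendsto_pi_nhds]
    rintro ⟨t, x⟩
    have h := (hd t x).tendsto_slope_zero
    have k : Tendsto (fun n : ℕ => 1 / ((n:ℝ) + 1)) atTop (nhdsWithin 0 {0}ᶜ) := by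
      rw [tendsto_nhdsWithin_iff]
      refine ⟨tendsto_one_div_add_atTop_nhds_zero_nat, Eventually.of_forall fun n => ?_⟩
      have : (0:ℝ) < 1 / ((n:ℝ) + 1) := by positivity
      exact this.ne'
    exact h.comp k

namespace PS
variable {q μ M s0 T0 : ℝ} {U U1 U2 N : ℝ → ℝ → ℝ}

theorem mU (h : PS q μ M s0 T0 U U1 U2 N) : Measurable (Function.uncurry U) := by
  exact measurable_uncurry_of_continuous_of_measurable (fun x => h.tc x)
     (fun t => ((h.c2 t).c0).measurable)

theorem mU1 (h : PS q μ M s0 T0 U U1 U2 N) : Measurable (Function.uncurry U1) :=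
  meas_deriv h.mU fun t => (h.c2 t).d1
theorem mU2 (h : PS q μ M s0 T0 U U1 U2 N) : Measurable (Function.uncurry U2) :=
  meas_deriv h.mU1 fun t => (h.c2 t).d2

theorem M0 (h : PS q μ M s0 T0 U U1 U2 N) : 0 ≤ M :=
  (integral_nonneg fun _ => abs_nonneg _).trans (h.bd 0)

theorem m_edens (h : PS q μ M s0 T0 U U1 U2 N) :
    Measurable fun p : ℝ × ℝ => edens (U p.1) (U1 p.1) p.2 := by
  have h0 : Measurable fun p : ℝ × ℝ => U p.1 p.2 := h.mU
  have h1 : Measurable fun p : ℝ × ℝ => U1 p.1 p.2 := h.mU1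
  unfold edens
  fun_prop

theorem m_Rr (h : PS q μ M s0 T0 U U1 U2 N) :
    Measurable fun p : ℝ × ℝ => Rr q μ (U p.1) (U1 p.1) (U2 p.1) (N p.1) p.2 := by
  have h0 : Measurable fun p : ℝ × ℝ => U p.1 p.2 := h.mU
  have h1 : Measurable fun p : ℝ × ℝ => U1 p.1 p.2 := h.mU1
  have h2 : Measurable fun p : ℝ × ℝ => U2 p.1 p.2 := h.mU2
  have h3 : Measurable fun p : ℝ × ℝ => N p.1 p.2 := h.Nm
  unfold Rr
  fun_prop

theorem m_kdens (h : PS q μ M s0 T0 U U1 U2 N) {β1 β2 w w1 ψ ψ1 : ℝ → ℝ} (hb1 : Continuous β1)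
    (hb2 : Continuous β2) (hw : Continuous w) (hw1 : Continuous w1) (hp : Continuous ψ)
    (hp1 : Continuous ψ1) :
    Measurable fun p : ℝ × ℝ => kdens q μ β1 β2 w w1 ψ ψ1 (U p.1) (U1 p.1) (N p.1) p.2 := by
  have h0 : Measurable fun p : ℝ × ℝ => U p.1 p.2 := h.mU
  have h1 : Measurable fun p : ℝ × ℝ => U1 p.1 p.2 := h.mU1
  have h3 : Measurable fun p : ℝ × ℝ => N p.1 p.2 := h.Nm
  have hF := (continuous_Fl q h.hq).measurable
  have := hb1.measurable; have := hb2.measurable; have := hw.measurable; have := hw1.measurable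
  have := hp.measurable; have := hp1.measurable
  unfold kdens
  fun_prop

end PS

/-- the local energy -/
noncomputable def Eg (U U1 : ℝ → ℝ → ℝ) (r τ : ℝ) : ℝ :=
  ∫ x in Set.Icc (-r) r, edens (U τ) (U1 τ) x

theorem Eg_nonneg (U U1 : ℝ → ℝ → ℝ) (r τ : ℝ) : 0 ≤ Eg U U1 r τ :=
  integral_nonneg fun x => edens_nonneg _ _ x

structure Cls (r C : ℝ) (β β1 β2 w w1 w2 ψ ψ1 ψ2 : ℝ → ℝ) : Prop where
  hβ : Beta β β1 β2 C
  hw : C2 w w1 w2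
  hψ : C2 ψ ψ1 ψ2
  hs : ∀ x, r < |x| → ψ x = 0

noncomputable def Ph (β w ψ : ℝ → ℝ) (U : ℝ → ℝ → ℝ) (t : ℝ) : ℝ := ∫ x, β (U t x - w x) * ψ x

noncomputable def kk (q μ : ℝ) (β1 β2 w w1 ψ ψ1 : ℝ → ℝ) (U U1 N : ℝ → ℝ → ℝ) (τ : ℝ) : ℝ :=
  ∫ x, kdens q μ β1 β2 w w1 ψ ψ1 (U τ) (U1 τ) (N τ) x

theorem bdd_Icc {f : ℝ → ℝ} (hf : Continuous f) (r : ℝ) : ∃ n, 0 ≤ n ∧ ∀ x, |x| ≤ r → |f x| ≤ n := by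
  obtain ⟨n, hn⟩ := (isCompact_Icc (a := -r) (b := r)).exists_bound_of_continuousOn hf.continuousOn
  exact ⟨max n 0, le_max_right _ _, fun x hx => (hn x (abs_le.1 hx)).trans (le_max_left _ _)⟩

section
variable {q μ M s0 T0 : ℝ} {U U1 U2 N : ℝ → ℝ → ℝ}
variable {r C : ℝ} {β β1 β2 w w1 w2 ψ ψ1 ψ2 : ℝ → ℝ}

theorem Eg_meas (h : PS q μ M s0 T0 U U1 U2 N) (r : ℝ) : StronglyMeasurable (Eg U U1 r) :=
  h.m_edens.stronglyMeasurable.integral_prod_right' (ν := volume.restrict (Set.Icc (-r) r))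

theorem Cls.bd (c : Cls r C β β1 β2 w w1 w2 ψ ψ1 ψ2) : ∃ B, 0 ≤ B ∧ ∀ x, |ψ x| ≤ B ∧ |ψ1 x| ≤ B := by
  obtain ⟨a, ha, ha'⟩ := bdd_of_supp c.hψ.c0 c.hs
  obtain ⟨b, hb, hb'⟩ := bdd_of_supp c.hψ.c1 (deriv_supp c.hψ.d1 c.hs)
  exact ⟨max a b, le_max_of_le_left ha, fun x => ⟨(ha' x).trans (le_max_left _ _), (hb' x).trans (le_max_right _ _)⟩⟩

theorem kk_meas (h : PS q μ M s0 T0 U U1 U2 N) (c : Cls r C β β1 β2 w w1 w2 ψ ψ1 ψ2) :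
    StronglyMeasurable (kk q μ β1 β2 w w1 ψ ψ1 U U1 N) :=
  (h.m_kdens c.hβ.c1 c.hβ.c2 c.hw.c0 c.hw.c1 c.hψ.c0 c.hψ.c1).stronglyMeasurable.integral_prod_right'

theorem kk_bound (h : PS q μ M s0 T0 U U1 U2 N) (c : Cls r C β β1 β2 w w1 w2 ψ ψ1 ψ2) :
    ∃ A B : ℝ, 0 ≤ A ∧ 0 ≤ B ∧ ∀ τ, |kk q μ β1 β2 w w1 ψ ψ1 U U1 N τ| ≤ A * Eg U U1 r τ + B := by
  obtain ⟨n0, hn0, hw0⟩ := bdd_Icc c.hw.c0 r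
  obtain ⟨n1, hn1, hw1⟩ := bdd_Icc c.hw.c1 r
  obtain ⟨Ψ, hΨ, hψ⟩ := c.bd
  have hC := c.hβ.Cnn
  have hμ := h.hμ
  set n := max n0 n1
  have hn : 0 ≤ n := le_max_of_le_left hn0
  refine ⟨(2 * C * (1 + n ^ 2) * (1 + n) + C) * Ψ * (1 + μ), C * Ψ * M, by positivity,
    mul_nonneg (by positivity) h.M0, fun τ => ?_⟩
  have b := kdens_bound (N := N τ) (V := U τ) (V1 := U1 τ) h.hq h.hq2 h.hμ.le c.hβ c.hs c.hψ.d1 (n := n)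
    (fun x hx => ⟨(hw0 x hx).trans (le_max_left _ _), (hw1 x hx).trans (le_max_right _ _)⟩) hψ
  have ik := (weak_fixed (μ := μ) h.hq (h.Ni τ) c.hβ c.hw c.hψ c.hs (h.c2 τ)).2.1
  have ie : Integrable ((Set.Icc (-r) r).indicator (edens (U τ) (U1 τ))) :=
    (integrable_indicator_iff measurableSet_Icc).2
      ((edens_cont (h.c2 τ)).continuousOn.integrableOn_compact isCompact_Icc)
  obtain ⟨i2, e2⟩ := lin2 ie (h.Ni τ).abs ((2 * C * (1 + n ^ 2) * (1 + n) + C) * Ψ * (1 + μ)) (C * Ψ)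
  calc _ ≤ ∫ x, |kdens q μ β1 β2 w w1 ψ ψ1 (U τ) (U1 τ) (N τ) x| := abs_integral_le_integral_abs
    _ ≤ _ := integral_mono ik.abs i2 b
    _ = _ := e2
    _ ≤ _ := by
      rw [integral_indicator measurableSet_Icc]
      have := mul_le_mul_of_nonneg_left (h.Nb τ) (by positivity : 0 ≤ C * Ψ)
      unfold Eg
      linarith

theorem kk_int (h : PS q μ M s0 T0 U U1 U2 N) (c : Cls r C β β1 β2 w w1 w2 ψ ψ1 ψ2) {S : Set ℝ}
    (hS : volume S ≠ ⊤) (hE : IntegrableOn (Eg U U1 r) S) :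
    IntegrableOn (kk q μ β1 β2 w w1 ψ ψ1 U U1 N) S := by
  obtain ⟨A, B, hA, hB, hk⟩ := kk_bound h c
  refine Integrable.mono' (g := fun τ => A * Eg U U1 r τ + B) ?_ (kk_meas h c).aestronglyMeasurable
    (Eventually.of_forall hk)
  exact (hE.const_mul A).add (integrableOn_const hS)

theorem ph_int (h : PS q μ M s0 T0 U U1 U2 N) (c : Cls r C β β1 β2 w w1 w2 ψ ψ1 ψ2) (t : ℝ) :
    Integrable fun x => β (U t x - w x) * ψ x :=
  int_of_supp (r := r) ((c.hβ.c0.comp ((h.c2 t).c0.sub c.hw.c0)).mul c.hψ.c0)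
    (fun x hx => by simp [c.hs x hx])

theorem int_sub_abs (h : PS q μ M s0 T0 U U1 U2 N) (t s : ℝ) :
    Integrable fun x => |U t x - U s x| := ((h.int t).sub (h.int s)).abs

theorem int_sub_le (h : PS q μ M s0 T0 U U1 U2 N) (t s : ℝ) :
    ∫ x, |U t x - U s x| ≤ 2 * M := by
  calc _ ≤ ∫ x, (|U t x| + |U s x|) :=
        integral_mono (int_sub_abs h t s) ((h.int t).abs.add (h.int s).abs) fun x => abs_sub _ _
    _ = _ := integral_add (h.int t).abs (h.int s).abs
    _ ≤ _ := by linarith [h.bd t, h.bd s]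

theorem ph_cont (h : PS q μ M s0 T0 U U1 U2 N) (c : Cls r C β β1 β2 w w1 w2 ψ ψ1 ψ2) :
    Continuous (Ph β w ψ U) := by
  obtain ⟨Ψ, hΨ, hψ⟩ := c.bd
  have hC := c.hβ.Cnn
  rw [continuous_iff_continuousAt]
  intro t0
  rw [ContinuousAt, tendsto_iff_norm_sub_tendsto_zero]
  refine squeeze_zero (fun _ => norm_nonneg _) (g := fun t => C * Ψ * ∫ x, |U t x - U t0 x|) ?_ ?_
  · intro t
    unfold Ph
    rw [← integral_sub (ph_int h c t) (ph_int h c t0), ← integral_const_mul]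
    refine (norm_integral_le_integral_norm _).trans (integral_mono ((ph_int h c t).sub (ph_int h c t0)).norm
      ((int_sub_abs h t t0).const_mul _) fun x => ?_)
    simp only [Real.norm_eq_abs]
    rw [← sub_mul, abs_mul]
    have := c.hβ.lip (U t x - w x) (U t0 x - w x)
    rw [sub_sub_sub_cancel_right] at this
    calc _ ≤ (C * |U t x - U t0 x|) * Ψ := by gcongr; exact (hψ x).1
      _ = _ := by ring
  · simpa using (h.l1c t0).const_mul (C * Ψ)

end

/-- passing to the closed interval -/
theorem anti_close {D : ℝ → ℝ} {a b : ℝ} (hab : a < b) (hD : ContinuousOn D (Set.Icc a b))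
    (h : ∀ c d, a < c → c ≤ d → d < b → D d ≤ D c) : D b ≤ D a := by
  have h1 : ∀ c, a < c → c < b → D b ≤ D c := by
    intro c hc hcb
    have t : Tendsto D (nhdsWithin b (Set.Ioo c b)) (nhds (D b)) :=
      (hD b ⟨hab.le, le_rfl⟩).mono (fun x hx => ⟨hc.le.trans hx.1.le, hx.2.le⟩)
    have : (nhdsWithin b (Set.Ioo c b)).NeBot := right_nhdsWithin_Ioo_neBot hcb
    exact le_of_tendsto t (eventually_mem_nhdsWithin.mono fun d hd => h c d hc hd.1.le hd.2)
  have t : Tendsto D (nhdsWithin a (Set.Ioo a b)) (nhds (D a)) :=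
    (hD a ⟨le_rfl, hab.le⟩).mono Set.Ioo_subset_Icc_self
  have : (nhdsWithin a (Set.Ioo a b)).NeBot := left_nhdsWithin_Ioo_neBot hab
  exact ge_of_tendsto t (eventually_mem_nhdsWithin.mono fun d hd => h1 d hd.1 hd.2)

theorem bArc_nonneg (v : ℝ) : 0 ≤ bArc v := by
  have key : ∀ v : ℝ, 0 < v → 0 ≤ bArc v := by
    intro v hv
    obtain ⟨c, hc, e⟩ := exists_hasDerivAt_eq_slope bArc Real.arctan hv
      beta_arctan.c0.continuousOn (fun x _ => beta_arctan.d1 x)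
    rw [bArc_zero, sub_zero, sub_zero] at e
    have : 0 < Real.arctan c := by
      rw [← Real.arctan_zero]; exact Real.arctan_strictMono hc.1
    have e' : bArc v = Real.arctan c * v := by rw [e]; field_simp
    rw [e']; positivity
  rcases lt_trichotomy v 0 with h | h | h
  · have := key (-v) (by linarith)
    simpa [bArc, Real.arctan_neg] using this
  · rw [h, bArc_zero]
  · exact key v h

theorem gap_close {P g : ℝ → ℝ} {a b : ℝ} (hab : a < b) (hP : Continuous P)
    (hg : IntegrableOn g (Set.Icc a b))
    (h : ∀ c d, a < c → c ≤ d → d < b → P d - P c ≤ ∫ τ in c..d, g τ) :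
    P b - P a ≤ ∫ τ in a..b, g τ := by
  have ii : ∀ c d, a ≤ c → c ≤ d → d ≤ b → IntervalIntegrable g volume c d := fun c d h1 h2 h3 => by
    rw [intervalIntegrable_iff_integrableOn_Icc_of_le h2]
    exact hg.mono_set (Set.Icc_subset_Icc h1 h3)
  have hc : ContinuousOn (fun x => ∫ τ in a..x, g τ) (Set.Icc a b) := by
    have := intervalIntegral.continuousOn_primitive_interval (f := g) (μ := volume) (a := a) (b := b)
      (by rwa [Set.uIcc_of_le hab.le])
    rwa [Set.uIcc_of_le hab.le] at this
  have := anti_close (D := fun x => P x - ∫ τ in a..x, g τ) hab (hP.continuousOn.sub hc)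
    (fun c d h1 h2 h3 => by
      have e := intervalIntegral.integral_add_adjacent_intervals (ii a c le_rfl h1.le (by linarith)) (ii c d h1.le h2 h3.le)
      have := h c d h1 h2 h3
      linarith)
  simp only [intervalIntegral.integral_same] at this
  linarith

def Good (q μ : ℝ) (U U1 N : ℝ → ℝ → ℝ) (R s t : ℝ) : Prop :=
  (∀ r, r < R → IntegrableOn (Eg U U1 r) (Set.Icc s t)) ∧
  ∀ s' t', s ≤ s' → s' ≤ t' → t' ≤ t → ∀ r, r < R → ∀ (C : ℝ) (β β1 β2 w w1 w2 ψ ψ1 ψ2 : ℝ → ℝ),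
    Cls r C β β1 β2 w w1 w2 ψ ψ1 ψ2 →
    Ph β w ψ U t' - Ph β w ψ U s' = ∫ τ in s'..t', kk q μ β1 β2 w w1 ψ ψ1 U U1 N τ

theorem edens_shift {V V1 w w1 n : ℝ} (hw : |w| ≤ n) (hw1 : |w1| ≤ n) :
    1 + V ^ 2 + V1 ^ 2 / (1 + V ^ 2) ≤ (1 + 4 * n ^ 2) + (4 + 4 * n ^ 2) * ((V - w) ^ 2 + (V1 - w1) ^ 2 / (1 + (V - w) ^ 2)) := by
  have a : w ^ 2 ≤ n ^ 2 := sq_le_sq' (by linarith [neg_abs_le w]) (by linarith [le_abs_self w])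
  have b : w1 ^ 2 ≤ n ^ 2 := sq_le_sq' (by linarith [neg_abs_le w1]) (by linarith [le_abs_self w1])
  have h1 : V ^ 2 ≤ 2 * (V - w) ^ 2 + 2 * n ^ 2 := by nlinarith [sq_nonneg (V - 2 * w)]
  have h2 : V1 ^ 2 ≤ 2 * (V1 - w1) ^ 2 + 2 * n ^ 2 := by nlinarith [sq_nonneg (V1 - 2 * w1)]
  have h3 : 1 + (V - w) ^ 2 ≤ (2 + 2 * n ^ 2) * (1 + V ^ 2) := by
    nlinarith [sq_nonneg (V + w), sq_nonneg (n * V)]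
  have h4 : V1 ^ 2 / (1 + V ^ 2) ≤ (4 + 4 * n ^ 2) * ((V1 - w1) ^ 2 / (1 + (V - w) ^ 2)) + 2 * n ^ 2 := by
    have k1 : V1 ^ 2 / (1 + V ^ 2) ≤ (2 * (V1 - w1) ^ 2 + 2 * n ^ 2) / (1 + V ^ 2) := by gcongr
    have k2 : 2 * n ^ 2 / (1 + V ^ 2) ≤ 2 * n ^ 2 := div_le_self (by positivity) (by nlinarith [sq_nonneg V])
    have k3 : 2 * (V1 - w1) ^ 2 / (1 + V ^ 2) ≤ (4 + 4 * n ^ 2) * ((V1 - w1) ^ 2 / (1 + (V - w) ^ 2)) := by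
      rw [← mul_div_assoc, div_le_div_iff₀ (by positivity) (by positivity)]
      nlinarith [mul_le_mul_of_nonneg_left h3 (by positivity : 0 ≤ 2 * (V1 - w1) ^ 2)]
    rw [add_div] at k1
    linarith
  nlinarith [sq_nonneg (V - w), sq_nonneg (n * (V - w))]

section
variable {q μ M s0 T0 : ℝ} {U U1 U2 N : ℝ → ℝ → ℝ}

theorem arc_diff (h : PS q μ M s0 T0 U U1 U2 N) {n r R : ℝ} (hn : 0 ≤ n) (hr : 0 < r) (hR : r < R) :
    ∃ (r' C c : ℝ) (ψ ψ1 ψ2 : ℝ → ℝ), r' < R ∧ 0 ≤ C ∧ 0 < c ∧ (∀ x, 0 ≤ ψ x ∧ ψ x ≤ 1) ∧ C2 ψ ψ1 ψ2 ∧ (∀ x, r' < |x| → ψ x = 0) ∧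
      ∀ w w1 w2, C2 w w1 w2 → Integrable w → ∫ x, |w x| ≤ M → (∀ x, |x| < R → |w x| ≤ n ∧ |w1 x| ≤ n) →
      ∀ τ, kk q μ Real.arctan (fun v => 1 / (1 + v ^ 2)) w w1 ψ ψ1 U U1 N τ ≤ C - c * Eg U U1 r τ := by
  obtain ⟨r', hr1, hr2⟩ := exists_between hR
  obtain ⟨c1, Y, ψ, ψ1, ψ2, hc1, hψ, h1⟩ := exists_cutf h.hq h.hq2 hr hr1
  have hM := h.M0
  obtain ⟨c, C, hc, hC, H⟩ := E1fix h.hq h.hq2 h.hμ c1 (2 * M) (r' * ((n ^ q) ^ 2 + n ^ q + n ^ 2 + n)) Y hc1 (by linarith)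
  have hr' : 0 < r' := hr.trans hr1
  have hB : 0 < 4 + 4 * n ^ 2 := by positivity
  refine ⟨r', C + c * ((1 + 4 * n ^ 2) * (2 * r)) / (4 + 4 * n ^ 2), c / (4 + 4 * n ^ 2), ψ, ψ1, ψ2, hr2,
    by positivity, by positivity, fun x => ⟨hψ.nn x, hψ.le1 x⟩, hψ.c2, hψ.supp, ?_⟩
  intro w w1 w2 hw hwi hwM hwn τ
  have iw : Integrable fun x => |U τ x - w x| := ((h.int τ).sub hwi).abs
  have i2 : ∫ x, |U τ x - w x| ≤ 2 * M := by
    calc _ ≤ ∫ x, (|U τ x| + |w x|) :=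
          integral_mono iw ((h.int τ).abs.add hwi.abs) fun x => abs_sub _ _
      _ = _ := integral_add (h.int τ).abs hwi.abs
      _ ≤ _ := by linarith [h.bd τ]
  have K := H r' n (U τ) (U1 τ) (U2 τ) w w1 w2 ψ ψ1 ψ2 (N τ) hψ (h.c2 τ) hw (h.Ni τ) ((h.Nb τ).trans (by linarith)) hn hr'.le
    (fun x hx => hwn x (hx.trans_lt hr2)) le_rfl
    ((setIntegral_le_integral iw (Eventually.of_forall fun x => abs_nonneg _)).trans i2)
  set g : ℝ → ℝ := fun x => (U τ x - w x) ^ 2 + (U1 τ x - w1 x) ^ 2 / (1 + (U τ x - w x) ^ 2)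
  have gc : Continuous g := by
    have := (h.c2 τ).c0; have := (h.c2 τ).c1; have := hw.c0; have := hw.c1
    have hne : ∀ x, 1 + (U τ x - w x) ^ 2 ≠ 0 := fun x => by positivity
    simp only [g]
    fun_prop (disch := exact hne _)
  have gn : ∀ x, 0 ≤ g x := fun x => by simp only [g]; positivity
  have gi : Integrable fun x => g x * ψ x := int_of_supp (r := r') (gc.mul hψ.c2.c0) fun x hx => by simp [hψ.supp x hx]
  have e1 : ∫ x in Set.Icc (-r) r, g x ≤ ∫ x, g x * ψ x := by
    calc _ = ∫ x in Set.Icc (-r) r, g x * ψ x :=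
          setIntegral_congr_fun measurableSet_Icc fun x hx => by simp [h1 x (abs_le.2 hx)]
      _ ≤ _ := setIntegral_le_integral gi (Eventually.of_forall fun x => mul_nonneg (gn x) (hψ.nn x))
  have e2 : Eg U U1 r τ ≤ (1 + 4 * n ^ 2) * (2 * r) + (4 + 4 * n ^ 2) * ∫ x in Set.Icc (-r) r, g x := by
    have i1 : IntegrableOn g (Set.Icc (-r) r) := gc.continuousOn.integrableOn_compact isCompact_Icc
    have ic : IntegrableOn (fun _ : ℝ => (1:ℝ)) (Set.Icc (-r) r) := integrableOn_const (by simp)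
    obtain ⟨j1, j2⟩ := lin2 ic i1 (1 + 4 * n ^ 2) (4 + 4 * n ^ 2)
    calc Eg U U1 r τ ≤ ∫ x in Set.Icc (-r) r, ((1 + 4 * n ^ 2) * 1 + (4 + 4 * n ^ 2) * g x) := by
          refine setIntegral_mono_on ((edens_cont (h.c2 τ)).continuousOn.integrableOn_compact isCompact_Icc) j1 measurableSet_Icc fun x hx => ?_
          have hx' := hwn x ((abs_le.2 hx).trans_lt hR)
          have := edens_shift (V := U τ x) (V1 := U1 τ x) hx'.1 hx'.2
          rw [mul_one]; exact this
      _ = _ := by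
        rw [j2]
        simp [hr.le]
        left; ring
  have e3 : Eg U U1 r τ ≤ (1 + 4 * n ^ 2) * (2 * r) + (4 + 4 * n ^ 2) * ∫ x, g x * ψ x :=
    e2.trans (by gcongr)
  refine le_trans K ?_
  have : c * (Eg U U1 r τ) ≤ c * ((1 + 4 * n ^ 2) * (2 * r) + (4 + 4 * n ^ 2) * ∫ x, g x * ψ x) := by gcongr
  rw [← sub_nonneg]
  have : 0 ≤ (c * ((1 + 4 * n ^ 2) * (2 * r) + (4 + 4 * n ^ 2) * ∫ x, g x * ψ x) - c * Eg U U1 r τ) / (4 + 4 * n ^ 2) :=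
    div_nonneg (by linarith) hB.le
  refine this.trans_eq ?_
  have hB' := hB.ne'
  generalize (∫ x, g x * ψ x) = G1
  generalize Eg U U1 r τ = E1
  generalize 4 + 4 * n ^ 2 = B1 at hB'
  field_simp
  ring

theorem gap1 (h : PS q μ M s0 T0 U U1 U2 N) {n r R : ℝ} (hn : 0 ≤ n) (hr : 0 < r) (hR : r < R) :
    ∃ D, 0 ≤ D ∧ ∀ a b, a < b → (∀ x, |x| < R → |U a x| ≤ n ∧ |U1 a x| ≤ n) →
      (∀ c d, a < c → c ≤ d → d < b → Good q μ U U1 N R c d) →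
      IntegrableOn (Eg U U1 r) (Set.Icc a b) ∧ ∫ τ in a..b, Eg U U1 r τ ≤ D * (b - a) := by
  obtain ⟨r', C, c, ψ, ψ1, ψ2, hr', hC, hc, hψ, hψ2, hs, H⟩ := arc_diff h hn hr hR
  refine ⟨C / c, by positivity, ?_⟩
  intro a b hab ha hG
  have K := H (U a) (U1 a) (U2 a) (h.c2 a) (h.int a) (h.bd a) ha
  have cls : Cls r' 2 bArc Real.arctan (fun v => 1 / (1 + v ^ 2)) (U a) (U1 a) (U2 a) ψ ψ1 ψ2 :=
    ⟨beta_arctan, h.c2 a, hψ2, hs⟩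
  set P := Ph bArc (U a) ψ U
  have hPc : Continuous P := ph_cont h cls
  have hP0 : ∀ t, 0 ≤ P t := fun t => integral_nonneg fun x => mul_nonneg (bArc_nonneg _) (hψ x).1
  have hPa : P a = 0 := by simp [P, Ph, bArc_zero]
  have hPb : ∀ t, P t ≤ 4 * M := by
    intro t
    calc P t ≤ ∫ x, 2 * |U t x - U a x| := by
          refine integral_mono (ph_int h cls t) ((int_sub_abs h t a).const_mul 2) fun x => ?_
          have := (le_abs_self _).trans (bArc_le (U t x - U a x))
          have := bArc_nonneg (U t x - U a x)
          simp only
          nlinarith [hψ x]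
      _ ≤ _ := by rw [integral_const_mul]; linarith [int_sub_le h t a]
  have key : ∀ c' d, a < c' → c' ≤ d → d < b → IntegrableOn (Eg U U1 r) (Set.Icc c' d) ∧ P d - P c' ≤ ∫ τ in c'..d, (C - c * Eg U U1 r τ) := by
    intro c' d h1 h2 h3
    have g := hG c' d h1 h2 h3
    refine ⟨g.1 r hR, ?_⟩
    rw [g.2 c' d le_rfl h2 le_rfl r' hr' _ _ _ _ _ _ _ _ _ _ cls]
    have iE := g.1 r hR
    refine intervalIntegral.integral_mono_on h2 ?_ ?_ fun τ _ => K τ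
    · rw [intervalIntegrable_iff_integrableOn_Icc_of_le h2]
      exact kk_int h cls (by simp) (g.1 r' hr')
    · rw [intervalIntegrable_iff_integrableOn_Icc_of_le h2]
      exact (integrableOn_const (by simp)).sub (iE.const_mul c)
  have comp : ∀ c' d, c' ≤ d → IntegrableOn (Eg U U1 r) (Set.Icc c' d) → ∫ τ in c'..d, (C - c * Eg U U1 r τ) = C * (d - c') - c * ∫ τ in c'..d, Eg U U1 r τ := by
    intro c' d h2 hi
    rw [intervalIntegral.integral_sub intervalIntegrable_const, intervalIntegral.integral_const, intervalIntegral.integral_const_mul, smul_eq_mul, mul_comm]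
    rw [intervalIntegrable_iff_integrableOn_Icc_of_le h2]
    exact hi.const_mul c
  have hI : IntegrableOn (Eg U U1 r) (Set.Icc a b) := by
    rw [integrableOn_Icc_iff_integrableOn_Ioc]
    have t0 := tendsto_one_div_add_atTop_nhds_zero_nat (𝕜 := ℝ)
    have p : ∀ i : ℕ, 0 < 1 / ((i:ℝ) + 1) ∧ 1 / ((i:ℝ) + 1) ≤ 1 := fun i => ⟨by positivity, by
      rw [div_le_one (by positivity)]; linarith [(Nat.cast_nonneg i : (0:ℝ) ≤ i)]⟩
    refine integrableOn_Ioc_of_intervalIntegral_norm_bounded (l := atTop)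
      (a := fun i : ℕ => a + (b - a) / 2 * (1 / ((i:ℝ) + 1))) (b := fun i : ℕ => b - (b - a) / 2 * (1 / ((i:ℝ) + 1)))
      (I := (C * (b - a) + 4 * M) / c) ?_ ?_ ?_ (Eventually.of_forall ?_)
    · intro i
      obtain ⟨p1, p2⟩ := p i
      exact (key _ _ (by nlinarith) (by nlinarith) (by nlinarith)).1.mono_set Set.Ioc_subset_Icc_self
    · simpa using (t0.const_mul ((b - a) / 2)).const_add a
    · simpa using (t0.const_mul ((b - a) / 2)).const_sub b
    · intro i
      obtain ⟨p1, p2⟩ := p i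
      have le : a + (b - a) / 2 * (1 / ((i:ℝ) + 1)) ≤ b - (b - a) / 2 * (1 / ((i:ℝ) + 1)) := by nlinarith
      obtain ⟨k1, k2⟩ := key _ _ (by nlinarith) le (by nlinarith)
      rw [comp _ _ le k1] at k2
      simp only [Real.norm_eq_abs, abs_of_nonneg (Eg_nonneg U U1 r _)]
      rw [← intervalIntegral.integral_of_le le, le_div_iff₀ hc]
      have := hPb (a + (b - a) / 2 * (1 / ((i:ℝ) + 1)))
      have := hP0 (b - (b - a) / 2 * (1 / ((i:ℝ) + 1)))
      have : C * (b - (b - a) / 2 * (1 / ((i:ℝ) + 1)) - (a + (b - a) / 2 * (1 / ((i:ℝ) + 1)))) ≤ C * (b - a) := by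
        refine mul_le_mul_of_nonneg_left ?_ hC
        nlinarith
      linarith
  refine ⟨hI, ?_⟩
  have fin := gap_close hab hPc (g := fun τ => C - c * Eg U U1 r τ) ((integrableOn_const (by simp)).sub (hI.const_mul c))
    (fun c' d h1 h2 h3 => (key c' d h1 h2 h3).2)
  rw [comp a b hab.le hI, hPa] at fin
  have := hP0 b
  rw [div_mul_eq_mul_div, le_div_iff₀ hc]
  linarith

theorem gap2 (h : PS q μ M s0 T0 U U1 U2 N) {R a b : ℝ} (hab : a < b)
    (hE : ∀ r, r < R → IntegrableOn (Eg U U1 r) (Set.Icc a b))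
    (hG : ∀ c d, a < c → c ≤ d → d < b → Good q μ U U1 N R c d) {r C : ℝ} (hr : r < R)
    {β β1 β2 w w1 w2 ψ ψ1 ψ2 : ℝ → ℝ} (cls : Cls r C β β1 β2 w w1 w2 ψ ψ1 ψ2) :
    Ph β w ψ U b - Ph β w ψ U a = ∫ τ in a..b, kk q μ β1 β2 w w1 ψ ψ1 U U1 N τ := by
  have hk := kk_int h cls (by simp) (hE r hr)
  apply le_antisymm
  · exact gap_close hab (ph_cont h cls) hk fun c d h1 h2 h3 =>
      ((hG c d h1 h2 h3).2 c d le_rfl h2 le_rfl r hr _ _ _ _ _ _ _ _ _ _ cls).le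
  · have := gap_close (P := fun t => - Ph β w ψ U t) hab (ph_cont h cls).neg hk.neg fun c d h1 h2 h3 => by
      have := (hG c d h1 h2 h3).2 c d le_rfl h2 le_rfl r hr _ _ _ _ _ _ _ _ _ _ cls
      simp only [Pi.neg_apply, intervalIntegral.integral_neg]
      linarith
    simp only [Pi.neg_apply, intervalIntegral.integral_neg] at this
    linarith
end

section
variable {q μ M s0 T0 : ℝ} {U U1 U2 N : ℝ → ℝ → ℝ}

theorem Eg_mono (h : PS q μ M s0 T0 U U1 U2 N) {r r' : ℝ} (hr : r ≤ r') (τ : ℝ) :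
    Eg U U1 r τ ≤ Eg U U1 r' τ :=
  setIntegral_mono_set ((edens_cont (h.c2 τ)).continuousOn.integrableOn_compact isCompact_Icc)
    (Eventually.of_forall fun x => edens_nonneg _ _ x)
    (Set.Icc_subset_Icc (by linarith) hr).eventuallyLE

theorem Eg_int_mono (h : PS q μ M s0 T0 U U1 U2 N) {r r' : ℝ} (hr : r ≤ r') {S : Set ℝ}
    (hE : IntegrableOn (Eg U U1 r') S) : IntegrableOn (Eg U U1 r) S :=
  Integrable.mono' hE (Eg_meas h r).aestronglyMeasurable (Eventually.of_forall fun τ => by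
    rw [Real.norm_eq_abs, abs_of_nonneg (Eg_nonneg _ _ _ _)]; exact Eg_mono h hr τ)

theorem gap1' (h : PS q μ M s0 T0 U U1 U2 N) {n R a b : ℝ} (hn : 0 ≤ n) (hR : 0 < R) (hab : a < b)
    (ha : ∀ x, |x| < R → |U a x| ≤ n ∧ |U1 a x| ≤ n)
    (hG : ∀ c d, a < c → c ≤ d → d < b → Good q μ U U1 N R c d) (r : ℝ) (hr : r < R) :
    IntegrableOn (Eg U U1 r) (Set.Icc a b) := by
  obtain ⟨D, _, H⟩ := gap1 h hn (r := max r (R / 2)) (R := R) (lt_max_of_lt_right (by linarith)) (max_lt hr (by linarith))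
  exact Eg_int_mono h (le_max_left _ _) (H a b hab ha hG).1

theorem gap3 (h : PS q μ M s0 T0 U U1 U2 N) {n r R : ℝ} (hn : 0 ≤ n) (hr : 0 < r) (hR : r < R) :
    ∃ D, 0 ≤ D ∧ ∀ a b, a < b → (∀ x, |x| < R → |U a x| ≤ n ∧ |U1 a x| ≤ n ∧ |U2 a x| ≤ n) →
      (∀ c d, a < c → c ≤ d → d < b → Good q μ U U1 N R c d) →
      ∫ x in Set.Icc (-r) r, |U b x - U a x| ≤ D * (b - a) := by
  obtain ⟨r', hr1, hr2⟩ := exists_between hR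
  have hr' : 0 < r' := hr.trans hr1
  obtain ⟨c1, Y, ψ, ψ1, ψ2, hc1, hψ, h1⟩ := exists_cutf h.hq h.hq2 hr hr1
  obtain ⟨A, B, hA, hB, H⟩ := E2fix (Y := Y) h.hq h.hq2 h.hμ hn hr'.le hc1
  obtain ⟨D, hD, H1⟩ := gap1 h hn hr' hr2
  have hM := h.M0
  refine ⟨(A + B) * D + M, by positivity, ?_⟩
  intro a b hab ha hG
  have ha2 : ∀ x, |x| < R → |U a x| ≤ n ∧ |U1 a x| ≤ n := fun x hx => ⟨(ha x hx).1, (ha x hx).2.1⟩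
  obtain ⟨iE, bE⟩ := H1 a b hab ha2 hG
  have hiE := gap1' h hn (hr.trans hR) hab ha2 hG
  have key : ∀ ε : ℝ, 0 < ε → ε ≤ 1 → ∫ x in Set.Icc (-r) r, |U b x - U a x| ≤ ((A + B) * D + M) * (b - a) + ε * (2 * r) := by
    intro ε hε hε1
    have cls : Cls r' _ (bA ε) (bA1 ε) (bA2 ε) (U a) (U1 a) (U2 a) ψ ψ1 ψ2 :=
      ⟨beta_bA hε hε1, h.c2 a, hψ.c2, hψ.supp⟩
    have e := gap2 h hab hiE hG hr2 cls
    have z : Ph (bA ε) (U a) ψ U a = 0 := by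
      have : bA ε 0 = 0 := by simp [bA, Real.sqrt_sq hε.le]
      simp [Ph, this]
    have kb : ∀ τ, kk q μ (bA1 ε) (bA2 ε) (U a) (U1 a) ψ ψ1 U U1 N τ ≤ (A + B) * Eg U U1 r' τ + M := by
      intro τ
      have k := H ε (U τ) (U1 τ) (U2 τ) (U a) (U1 a) (U2 a) ψ ψ1 ψ2 (N τ) hε hε1 hψ (h.c2 τ) (h.c2 a) (h.Ni τ)
        (fun x hx => ha x (hx.trans_lt hr2))
      refine k.trans (add_le_add ?_ (h.Nb τ))
      unfold Eg
      rw [← integral_const_mul]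
      have cV := (h.c2 τ).c0
      refine setIntegral_mono_on (Continuous.integrableOn_Icc (by fun_prop))
        (Continuous.integrableOn_Icc ((edens_cont (h.c2 τ)).const_mul _)) measurableSet_Icc fun x hx => ?_
      obtain ⟨e1, e2, e3, e4⟩ := edens_lb (U τ) (U1 τ) x
      nlinarith [sq_nonneg (U τ x)]
    have le : Ph (bA ε) (U a) ψ U b ≤ ((A + B) * D + M) * (b - a) := by
      rw [z, sub_zero] at e
      rw [e]
      have i1 : IntervalIntegrable (fun τ => (A + B) * Eg U U1 r' τ) volume a b := by
        rw [intervalIntegrable_iff_integrableOn_Icc_of_le hab.le]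
        exact iE.const_mul _
      calc _ ≤ ∫ τ in a..b, ((A + B) * Eg U U1 r' τ + M) := by
            refine intervalIntegral.integral_mono_on hab.le ?_ (i1.add intervalIntegrable_const) fun τ _ => kb τ
            rw [intervalIntegrable_iff_integrableOn_Icc_of_le hab.le]
            exact kk_int h cls (by simp) iE
        _ = (A + B) * (∫ τ in a..b, Eg U U1 r' τ) + M * (b - a) := by
            rw [intervalIntegral.integral_add i1 intervalIntegrable_const, intervalIntegral.integral_const_mul,
              intervalIntegral.integral_const, smul_eq_mul, mul_comm (b - a)]
        _ ≤ (A + B) * (D * (b - a)) + M * (b - a) := by gcongr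
        _ = _ := by ring
    have ip := ph_int h cls b
    have ic : IntegrableOn (fun _ : ℝ => ε) (Set.Icc (-r) r) := integrableOn_const (by simp)
    calc ∫ x in Set.Icc (-r) r, |U b x - U a x| ≤ ∫ x in Set.Icc (-r) r, (bA ε (U b x - U a x) * ψ x + ε) := by
          refine setIntegral_mono_on (int_sub_abs h b a).integrableOn (ip.integrableOn.add ic) measurableSet_Icc fun x hx => ?_
          rw [h1 x (abs_le.2 hx), mul_one]
          linarith [bA_lb (ε := ε) (U b x - U a x)]
      _ = (∫ x in Set.Icc (-r) r, bA ε (U b x - U a x) * ψ x) + ε * (2 * r) := by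
          rw [integral_add ip.integrableOn ic]
          simp [hr.le]
          ring
      _ ≤ Ph (bA ε) (U a) ψ U b + ε * (2 * r) := by
          gcongr
          exact setIntegral_le_integral ip (Eventually.of_forall fun x => mul_nonneg (bA_nn hε _).1 (hψ.nn x))
      _ ≤ _ := by gcongr
  have t : Tendsto (fun ε : ℝ => ((A + B) * D + M) * (b - a) + ε * (2 * r)) (nhdsWithin 0 (Set.Ioo 0 1)) (nhds (((A + B) * D + M) * (b - a) + 0 * (2 * r))) := by
    apply Tendsto.mono_left _ nhdsWithin_le_nhds
    exact Continuous.tendsto (by fun_prop) 0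
  have : (nhdsWithin (0:ℝ) (Set.Ioo 0 1)).NeBot := left_nhdsWithin_Ioo_neBot one_pos
  have := ge_of_tendsto t (eventually_mem_nhdsWithin.mono fun ε hε => key ε hε.1 hε.2.le)
  simpa using this

end

/-- gaps of a closed set -/
def gapset (A : Set ℝ) : Set (ℝ × ℝ) := {p | p.1 ∈ A ∧ p.2 ∈ A ∧ p.1 < p.2 ∧ ∀ x ∈ A, ¬ (p.1 < x ∧ x < p.2)}

theorem gap_eq {A : Set ℝ} {p p' : ℝ × ℝ} (hp : p ∈ gapset A) (hp' : p' ∈ gapset A) {x : ℝ}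
    (hx : x ∈ Set.Ioo p.1 p.2) (hx' : x ∈ Set.Ioo p'.1 p'.2) : p = p' := by
  obtain ⟨a1, a2, a3, a4⟩ := hp
  obtain ⟨b1, b2, b3, b4⟩ := hp'
  have e1 : p.1 = p'.1 := by
    apply le_antisymm
    · by_contra hh; exact b4 _ a1 ⟨not_le.1 hh, hx.1.trans hx'.2⟩
    · by_contra hh; exact a4 _ b1 ⟨not_le.1 hh, hx'.1.trans hx.2⟩
  have e2 : p.2 = p'.2 := by
    apply le_antisymm
    · by_contra hh; exact a4 _ b2 ⟨hx.1.trans hx'.2, not_le.1 hh⟩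
    · by_contra hh; exact b4 _ a2 ⟨hx'.1.trans hx.2, not_le.1 hh⟩
  exact Prod.ext e1 e2

theorem gap_disj (A : Set ℝ) : (gapset A).PairwiseDisjoint fun p => Set.Ioo p.1 p.2 := by
  intro p hp p' hp' hne
  rw [Function.onFun, Set.disjoint_left]
  intro x hx hx'
  exact hne (gap_eq hp hp' hx hx')

theorem gap_count (A : Set ℝ) : (gapset A).Countable :=
  (gap_disj A).countable_of_isOpen (fun _ _ => isOpen_Ioo) fun p hp => Set.nonempty_Ioo.2 hp.2.2.1

theorem gap_cover {A : Set ℝ} (hA : IsClosed A) {s t x : ℝ} (hs : s ∈ A) (ht : t ∈ A) (hx : x ∈ Set.Icc s t)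
    (hxA : x ∉ A) : ∃ p ∈ gapset A, x ∈ Set.Ioo p.1 p.2 := by
  have c1 : IsClosed (A ∩ Set.Iic x) := hA.inter isClosed_Iic
  have c2 : IsClosed (A ∩ Set.Ici x) := hA.inter isClosed_Ici
  have m1 := c1.csSup_mem ⟨s, hs, hx.1⟩ ⟨x, fun y hy => hy.2⟩
  have m2 := c2.csInf_mem ⟨t, ht, hx.2⟩ ⟨x, fun y hy => hy.2⟩
  have l1 : sSup (A ∩ Set.Iic x) < x := lt_of_le_of_ne m1.2 fun e => hxA (e ▸ m1.1)
  have l2 : x < sInf (A ∩ Set.Ici x) := lt_of_le_of_ne m2.2 fun e => hxA (e ▸ m2.1)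
  refine ⟨(_, _), ⟨m1.1, m2.1, l1.trans l2, fun y hy => ?_⟩, l1, l2⟩
  rintro ⟨y1, y2⟩
  rcases le_total y x with h | h
  · exact absurd (le_csSup ⟨x, fun y hy => hy.2⟩ (show y ∈ A ∩ Set.Iic x from ⟨hy, h⟩)) (not_le.2 y1)
  · exact absurd (csInf_le ⟨x, fun y hy => hy.2⟩ (show y ∈ A ∩ Set.Ici x from ⟨hy, h⟩)) (not_le.2 y2)

theorem gap_union {A : Set ℝ} (hA : IsClosed A) {s t : ℝ} (hs : s ∈ A) (ht : t ∈ A) (hsub : A ⊆ Set.Icc s t) :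
    Set.Icc s t = A ∪ ⋃ p : gapset A, Set.Ioo p.1.1 p.1.2 := by
  apply Set.Subset.antisymm
  · intro x hx
    by_cases hxA : x ∈ A
    · exact Or.inl hxA
    · obtain ⟨p, hp, hx'⟩ := gap_cover hA hs ht hx hxA
      exact Or.inr (Set.mem_iUnion.2 ⟨⟨p, hp⟩, hx'⟩)
  · rintro x (hx | hx)
    · exact hsub hx
    · obtain ⟨⟨p, hp⟩, hx'⟩ := Set.mem_iUnion.1 hx
      exact ⟨(hsub hp.1).1.trans hx'.1.le, hx'.2.le.trans (hsub hp.2.1).2⟩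

theorem gap_disjA {A : Set ℝ} : Disjoint A (⋃ p : gapset A, Set.Ioo p.1.1 p.1.2) := by
  rw [Set.disjoint_left]
  intro x hx hx'
  obtain ⟨⟨p, hp⟩, h⟩ := Set.mem_iUnion.1 hx'
  exact hp.2.2.2 x hx h

theorem gap_summable {A : Set ℝ} {s t : ℝ} (hsub : A ⊆ Set.Icc s t) :
    Summable fun p : gapset A => p.1.2 - p.1.1 := by
  have := (gap_count A).to_subtype
  have hm : volume (⋃ p : gapset A, Set.Ioo p.1.1 p.1.2) ≠ ⊤ := by
    refine ne_top_of_le_ne_top (b := volume (Set.Icc s t)) (by simp) (measure_mono ?_)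
    intro x hx
    obtain ⟨⟨p, hp⟩, hx'⟩ := Set.mem_iUnion.1 hx
    exact ⟨(hsub hp.1).1.trans hx'.1.le, hx'.2.le.trans (hsub hp.2.1).2⟩
  rw [measure_iUnion (f := fun p : gapset A => Set.Ioo p.1.1 p.1.2) (fun p p' hne => gap_disj A p.2 p'.2 (fun e => hne (Subtype.ext e))) (fun _ => measurableSet_Ioo)] at hm
  have := ENNReal.summable_toReal hm
  refine this.congr fun p => ?_
  rw [Real.volume_Ioo, ENNReal.toReal_ofReal (by linarith [p.2.2.2.1])]

/-- splitting of an integral -/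
theorem gap_split {A : Set ℝ} (hA : IsClosed A) {s t : ℝ} (hs : s ∈ A) (ht : t ∈ A) (hsub : A ⊆ Set.Icc s t)
    {g : ℝ → ℝ} (hg : IntegrableOn g (Set.Icc s t)) :
    Summable (fun p : gapset A => ∫ τ in Set.Ioo p.1.1 p.1.2, g τ) ∧
    ∫ τ in Set.Icc s t, g τ = (∫ τ in A, g τ) + ∑' p : gapset A, ∫ τ in Set.Ioo p.1.1 p.1.2, g τ := by
  have := (gap_count A).to_subtype
  have e := gap_union hA hs ht hsub
  rw [e] at hg
  have hs := hasSum_integral_iUnion (f := g) (μ := volume) (s := fun p : gapset A => Set.Ioo p.1.1 p.1.2) (fun _ => measurableSet_Ioo)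
    (fun p p' hne => gap_disj A p.2 p'.2 (fun e => hne (Subtype.ext e))) hg.right_of_union
  refine ⟨hs.summable, ?_⟩
  rw [e, setIntegral_union gap_disjA (MeasurableSet.iUnion fun _ => measurableSet_Ioo) hg.left_of_union hg.right_of_union, hs.tsum_eq]

section
variable {q μ M s0 T0 : ℝ} {U U1 U2 N : ℝ → ℝ → ℝ}

theorem gap_mem_props {A : Set ℝ} {s t : ℝ} (hsub : A ⊆ Set.Icc s t) {G : ℝ → ℝ → Prop}
    (hG : ∀ c d, s ≤ c → c ≤ d → d ≤ t → (∀ x ∈ A, ¬ (c ≤ x ∧ x ≤ d)) → G c d) (p : gapset A) :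
    ∀ c d, p.1.1 < c → c ≤ d → d < p.1.2 → G c d := by
  intro c d h1 h2 h3
  refine hG c d ((hsub p.2.1).1.trans h1.le) h2 (h3.le.trans (hsub p.2.2.1).2) fun x hx hh => ?_
  exact p.2.2.2.2 x hx ⟨h1.trans_le hh.1, hh.2.trans_lt h3⟩

theorem step_core1 (h : PS q μ M s0 T0 U U1 U2 N) {R n s t : ℝ} {A : Set ℝ} (hR : 0 < R) (hn : 0 ≤ n)
    (hA : IsClosed A) (hs : s ∈ A) (ht : t ∈ A) (hsub : A ⊆ Set.Icc s t)
    (hb : ∀ τ ∈ A, ∀ x, |x| < R → |U τ x| ≤ n ∧ |U1 τ x| ≤ n ∧ |U2 τ x| ≤ n)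
    (hG : ∀ c d, s ≤ c → c ≤ d → d ≤ t → (∀ x ∈ A, ¬ (c ≤ x ∧ x ≤ d)) → Good q μ U U1 N R c d)
    (r : ℝ) (hr : r < R) : IntegrableOn (Eg U U1 r) (Set.Icc s t) := by
  have hcount := (gap_count A).to_subtype
  obtain ⟨r1, hr1⟩ : ∃ r1, r1 = max r (R / 2) := ⟨_, rfl⟩
  have hr1p : 0 < r1 := hr1 ▸ lt_max_of_lt_right (by linarith)
  have hr1R : r1 < R := hr1 ▸ max_lt hr (by linarith)
  apply Eg_int_mono h (r' := r1) (hr1 ▸ le_max_left _ _)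
  obtain ⟨D, hD, H⟩ := gap1 h hn hr1p hr1R
  have hAf : volume A ≠ ⊤ := ne_top_of_le_ne_top (b := volume (Set.Icc s t)) (by simp) (measure_mono hsub)
  rw [gap_union hA hs ht hsub]
  apply IntegrableOn.union
  · refine Integrable.mono' (g := fun _ => (1 + n ^ 2 + n ^ 2) * (2 * r1)) (integrableOn_const hAf) (Eg_meas h r1).aestronglyMeasurable ?_
    refine (ae_restrict_iff' hA.measurableSet).2 (Eventually.of_forall fun τ hτ => ?_)
    rw [Real.norm_eq_abs, abs_of_nonneg (Eg_nonneg _ _ _ _)]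
    calc Eg U U1 r1 τ ≤ ∫ x in Set.Icc (-r1) r1, (1 + n ^ 2 + n ^ 2) := by
          refine setIntegral_mono_on (edens_cont (h.c2 τ)).integrableOn_Icc (integrableOn_const (by simp)) measurableSet_Icc fun x hx => ?_
          obtain ⟨b0, b1, _⟩ := hb τ hτ x ((abs_le.2 hx).trans_lt hr1R)
          have a : U τ x ^ 2 ≤ n ^ 2 := sq_le_sq' (by linarith [neg_abs_le (U τ x)]) (by linarith [le_abs_self (U τ x)])
          have b : U1 τ x ^ 2 ≤ n ^ 2 := sq_le_sq' (by linarith [neg_abs_le (U1 τ x)]) (by linarith [le_abs_self (U1 τ x)])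
          have : U1 τ x ^ 2 / (1 + U τ x ^ 2) ≤ U1 τ x ^ 2 := div_le_self (sq_nonneg _) (by nlinarith [sq_nonneg (U τ x)])
          unfold edens
          linarith
      _ = _ := by
          simp [hr1p.le]; ring
  · have P := fun p : gapset A => H p.1.1 p.1.2 p.2.2.2.1 (fun x hx => ⟨(hb _ p.2.1 x hx).1, (hb _ p.2.1 x hx).2.1⟩)
      (gap_mem_props hsub hG p)
    refine integrableOn_iUnion_of_summable_integral_norm (fun p => (P p).1.mono_set Set.Ioo_subset_Icc_self) ?_
    refine Summable.of_nonneg_of_le (fun p => integral_nonneg fun _ => norm_nonneg _) (fun p => ?_) ((gap_summable hsub).mul_left D)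
    simp only [Real.norm_eq_abs, abs_of_nonneg (Eg_nonneg U U1 r1 _)]
    rw [← integral_Ioc_eq_integral_Ioo, ← intervalIntegral.integral_of_le p.2.2.2.1.le]
    exact (P p).2

theorem step_core2 (h : PS q μ M s0 T0 U U1 U2 N) {R n s t : ℝ} {A : Set ℝ} (hR : 0 < R) (hn : 0 ≤ n)
    (hs0 : s0 ≤ s) (hT0 : t ≤ T0)
    (hA : IsClosed A) (hs : s ∈ A) (ht : t ∈ A) (hsub : A ⊆ Set.Icc s t)
    (hb : ∀ τ ∈ A, ∀ x, |x| < R → |U τ x| ≤ n ∧ |U1 τ x| ≤ n ∧ |U2 τ x| ≤ n)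
    (hG : ∀ c d, s ≤ c → c ≤ d → d ≤ t → (∀ x ∈ A, ¬ (c ≤ x ∧ x ≤ d)) → Good q μ U U1 N R c d)
    {r C : ℝ} (hr : r < R) {β β1 β2 w w1 w2 ψ ψ1 ψ2 : ℝ → ℝ} (cls : Cls r C β β1 β2 w w1 w2 ψ ψ1 ψ2) :
    Ph β w ψ U t - Ph β w ψ U s = ∫ τ in s..t, kk q μ β1 β2 w w1 ψ ψ1 U U1 N τ := by
  have hcount := (gap_count A).to_subtype
  have hst : s ≤ t := (hsub hs).2
  obtain ⟨r1, hr1⟩ : ∃ r1, r1 = max r (R / 2) := ⟨_, rfl⟩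
  have hr1p : 0 < r1 := hr1 ▸ lt_max_of_lt_right (by linarith)
  have hr1R : r1 < R := hr1 ▸ max_lt hr (by linarith)
  have hrr1 : r ≤ r1 := hr1 ▸ le_max_left _ _
  obtain ⟨D, hD, H3⟩ := gap3 h hn hr1p hr1R
  have hAf : volume A ≠ ⊤ := ne_top_of_le_ne_top (b := volume (Set.Icc s t)) (by simp) (measure_mono hsub)
  obtain ⟨Ψ, hΨ, hψ⟩ := cls.bd
  have hC := cls.hβ.Cnn
  have hE := step_core1 h hR hn hA hs ht hsub hb hG
  -- time integration for fixed x
  let fd : ℝ → ℝ → ℝ := fun τ x => β1 (U τ x - w x) * ψ x * Rr q μ (U τ) (U1 τ) (U2 τ) (N τ) x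
  have fdc : ∀ x, Continuous fun τ => fd τ x := fun x =>
    ((cls.hβ.c1.comp ((h.tc x).sub continuous_const)).mul continuous_const).mul (h.Rc x)
  have ftc : ∀ x a b, s ≤ a → a ≤ b → b ≤ t → ∫ τ in a..b, fd τ x = β (U b x - w x) * ψ x - β (U a x - w x) * ψ x := by
    intro x a b ha hab hb'
    refine intervalIntegral.integral_eq_sub_of_hasDerivAt_of_le hab
      (((cls.hβ.c0.comp ((h.tc x).sub continuous_const)).mul continuous_const).continuousOn) (fun τ hτ => ?_)
      ((fdc x).intervalIntegrable _ _)
    have d1 := h.hd x τ ⟨hs0.trans_lt (ha.trans_lt hτ.1), hτ.2.trans_le (hb'.trans hT0)⟩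
    have d2 := ((cls.hβ.d1 (U τ x - w x)).comp τ (d1.sub_const (w x))).mul_const (ψ x)
    refine d2.congr_deriv ?_
    simp only [fd]; ring
  let Gp : gapset A → ℝ → ℝ := fun p x => β (U p.1.2 x - w x) * ψ x - β (U p.1.1 x - w x) * ψ x
  have gp : ∀ p : gapset A, s ≤ p.1.1 ∧ p.1.1 < p.1.2 ∧ p.1.2 ≤ t := fun p => ⟨(hsub p.2.1).1, p.2.2.2.1, (hsub p.2.2.1).2⟩
  have split : ∀ x, β (U t x - w x) * ψ x - β (U s x - w x) * ψ x = (∫ τ in A, fd τ x) + ∑' p : gapset A, Gp p x := by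
    intro x
    have k := (gap_split hA hs ht hsub (g := fun τ => fd τ x) (fdc x).integrableOn_Icc).2
    rw [← ftc x s t le_rfl hst le_rfl, intervalIntegral.integral_of_le hst, ← integral_Icc_eq_integral_Ioc, k]
    congr 1
    refine tsum_congr fun p => ?_
    simp only [Gp]
    rw [← ftc x p.1.1 p.1.2 (gp p).1 (gp p).2.1.le (gp p).2.2, intervalIntegral.integral_of_le (gp p).2.1.le, integral_Ioc_eq_integral_Ioo]
  have Gpi : ∀ p, Integrable (Gp p) := fun p => (ph_int h cls _).sub (ph_int h cls _)
  have Gpn : ∀ p, ∫ x, ‖Gp p x‖ ≤ C * Ψ * D * (p.1.2 - p.1.1) := by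
    intro p
    have k := H3 p.1.1 p.1.2 (gp p).2.1 (hb _ p.2.1) (gap_mem_props hsub hG p)
    have e : ∀ x, ‖Gp p x‖ ≤ C * Ψ * (Set.Icc (-r1) r1).indicator (fun x => |U p.1.2 x - U p.1.1 x|) x := by
      intro x
      by_cases hx : x ∈ Set.Icc (-r1) r1
      · rw [Set.indicator_of_mem hx]
        simp only [Gp, Real.norm_eq_abs]
        rw [← sub_mul, abs_mul]
        have := cls.hβ.lip (U p.1.2 x - w x) (U p.1.1 x - w x)
        rw [sub_sub_sub_cancel_right] at this
        calc _ ≤ (C * |U p.1.2 x - U p.1.1 x|) * Ψ := by gcongr; exact (hψ x).1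
          _ = _ := by ring
      · rw [Set.indicator_of_notMem hx]
        have : ψ x = 0 := cls.hs x (by
          by_contra hh
          exact hx (abs_le.1 ((not_lt.1 hh).trans hrr1)))
        simp [Gp, this]
    calc _ ≤ ∫ x, C * Ψ * (Set.Icc (-r1) r1).indicator (fun x => |U p.1.2 x - U p.1.1 x|) x :=
          integral_mono (Gpi p).norm (((int_sub_abs h _ _).indicator measurableSet_Icc).const_mul _) e
      _ = C * Ψ * ∫ x in Set.Icc (-r1) r1, |U p.1.2 x - U p.1.1 x| := by
          rw [integral_const_mul, integral_indicator measurableSet_Icc]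
      _ ≤ C * Ψ * (D * (p.1.2 - p.1.1)) := by gcongr
      _ = _ := by ring
  have Gps : Summable fun p => ∫ x, ‖Gp p x‖ :=
    Summable.of_nonneg_of_le (fun p => integral_nonneg fun _ => norm_nonneg _) Gpn ((gap_summable hsub).mul_left _)
  have Gsum := integral_tsum_of_summable_integral_norm Gpi Gps
  have Gk : ∀ p, ∫ x, Gp p x = ∫ τ in Set.Ioo p.1.1 p.1.2, kk q μ β1 β2 w w1 ψ ψ1 U U1 N τ := by
    intro p
    have k := gap2 h (gp p).2.1 (fun r hr => (hE r hr).mono_set (Set.Icc_subset_Icc (gp p).1 (gp p).2.2)) (gap_mem_props hsub hG p) hr cls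
    rw [intervalIntegral.integral_of_le (gp p).2.1.le, integral_Ioc_eq_integral_Ioo] at k
    rw [← k]
    exact integral_sub (ph_int h cls _) (ph_int h cls _)
  -- the part over A
  have fdi : ∀ τ, Integrable (fd τ) := fun τ => (weak_fixed (μ := μ) h.hq (h.Ni τ) cls.hβ cls.hw cls.hψ cls.hs (h.c2 τ)).1
  have fdm : Measurable (Function.uncurry fd) := by
    have h0 : Measurable fun p : ℝ × ℝ => U p.1 p.2 := h.mU
    have h1 := h.m_Rr
    have := cls.hβ.c1.measurable; have := cls.hw.c0.measurable; have := cls.hψ.c0.measurable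
    simp only [Function.uncurry_def, fd]
    fun_prop
  have hμ := h.hμ
  have fdb : ∀ τ ∈ A, ∫ x, ‖fd τ x‖ ≤ C * Ψ * (n ^ (q - 1) * n + μ * n) * (2 * r1) + C * Ψ * M := by
    intro τ hτ
    have ie : Integrable ((Set.Icc (-r1) r1).indicator (fun _ : ℝ => (1:ℝ))) :=
      (integrable_indicator_iff measurableSet_Icc).2 (integrableOn_const (by simp))
    obtain ⟨j1, j2⟩ := lin2 ie (h.Ni τ).abs (C * Ψ * (n ^ (q - 1) * n + μ * n)) (C * Ψ)
    calc _ ≤ ∫ x, (C * Ψ * (n ^ (q - 1) * n + μ * n) * (Set.Icc (-r1) r1).indicator (fun _ : ℝ => (1:ℝ)) x + C * Ψ * |N τ x|) := by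
          refine integral_mono (fdi τ).norm j1 fun x => ?_
          by_cases hx : x ∈ Set.Icc (-r1) r1
          · rw [Set.indicator_of_mem hx]
            obtain ⟨b0, b1, b2⟩ := hb τ hτ x ((abs_le.2 hx).trans_lt hr1R)
            simp only [fd, Real.norm_eq_abs, abs_mul]
            have hRr : |Rr q μ (U τ) (U1 τ) (U2 τ) (N τ) x| ≤ n ^ (q - 1) * n + |N τ x| + μ * n := by
              unfold Rr
              refine (abs_add_le _ _).trans (add_le_add ((abs_add_le _ _).trans (add_le_add ?_ le_rfl)) ?_)
              · rw [abs_neg, abs_mul, abs_of_nonneg (by positivity : 0 ≤ |U τ x| ^ (q - 1))]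
                have : |U τ x| ^ (q - 1) ≤ n ^ (q - 1) := Real.rpow_le_rpow (abs_nonneg _) b0 (by linarith [h.hq])
                gcongr
              · rw [abs_mul, abs_of_pos hμ]; gcongr
            have k1 := cls.hβ.b1 (U τ x - w x)
            have k2 := (hψ x).1
            calc _ ≤ C * Ψ * (n ^ (q - 1) * n + |N τ x| + μ * n) := by gcongr
              _ = _ := by ring
          · rw [Set.indicator_of_notMem hx]
            have : ψ x = 0 := cls.hs x (by
              by_contra hh
              exact hx (abs_le.1 ((not_lt.1 hh).trans hrr1)))
            simp only [fd, this, mul_zero, zero_mul, norm_zero, zero_add]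
            positivity
      _ ≤ _ := by
          rw [j2, integral_indicator measurableSet_Icc]
          have := mul_le_mul_of_nonneg_left (h.Nb τ) (by positivity : 0 ≤ C * Ψ)
          have e : ∫ x in Set.Icc (-r1) r1, (1:ℝ) = 2 * r1 := by simp [hr1p.le]; ring
          rw [e]
          linarith
  have fdI : Integrable (Function.uncurry fd) ((volume.restrict A).prod volume) := by
    rw [integrable_prod_iff fdm.aestronglyMeasurable]
    refine ⟨Eventually.of_forall fdi, ?_⟩
    refine Integrable.mono' (g := fun _ => C * Ψ * (n ^ (q - 1) * n + μ * n) * (2 * r1) + C * Ψ * M) (integrableOn_const hAf)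
      (fdm.norm.stronglyMeasurable.integral_prod_right' (ν := volume)).aestronglyMeasurable ?_
    refine (ae_restrict_iff' hA.measurableSet).2 (Eventually.of_forall fun τ hτ => ?_)
    rw [Real.norm_eq_abs, abs_of_nonneg (integral_nonneg fun _ => norm_nonneg _)]
    exact fdb τ hτ
  have swap : ∫ x, ∫ τ in A, fd τ x = ∫ τ in A, kk q μ β1 β2 w w1 ψ ψ1 U U1 N τ := by
    rw [← integral_integral_swap fdI]
    refine integral_congr_ae (Eventually.of_forall fun τ => ?_)
    exact (weak_fixed (μ := μ) h.hq (h.Ni τ) cls.hβ cls.hw cls.hψ cls.hs (h.c2 τ)).2.2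
  have iA : Integrable fun x => ∫ τ in A, fd τ x := fdI.integral_prod_right
  have iT : Integrable fun x => ∑' p, Gp p x := by
    have : (fun x => ∑' p, Gp p x) = fun x => (β (U t x - w x) * ψ x - β (U s x - w x) * ψ x) - ∫ τ in A, fd τ x := by
      funext x; rw [split x]; ring
    rw [this]
    exact ((ph_int h cls _).sub (ph_int h cls _)).sub iA
  have kS := (gap_split hA hs ht hsub (kk_int h cls (by simp) (hE r hr))).2
  rw [intervalIntegral.integral_of_le hst, ← integral_Icc_eq_integral_Ioc, kS]
  unfold Ph
  rw [← integral_sub (ph_int h cls _) (ph_int h cls _)]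
  simp_rw [split]
  rw [integral_add iA iT, swap, ← Gsum]
  simp_rw [Gk]
end

def Tn (U : ℝ → ℝ → ℝ) (R n : ℝ) : Set ℝ := {t | ∀ x h k, |x| ≤ R → |h| ≤ R → |k| ≤ R →
  |U t x| ≤ n ∧ |U t (x + h) - U t x| ≤ n * |h| ∧
  |U t (x + h + k) - U t (x + k) - (U t (x + h) - U t x)| ≤ n * |k| * |h|}

section
variable {q μ M s0 T0 : ℝ} {U U1 U2 N : ℝ → ℝ → ℝ}

theorem Tn_closed (h : PS q μ M s0 T0 U U1 U2 N) (R n : ℝ) : IsClosed (Tn U R n) := by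
  have e : Tn U R n = ⋂ (x : ℝ) (y : ℝ) (k : ℝ) (_ : |x| ≤ R) (_ : |y| ≤ R) (_ : |k| ≤ R),
    {t | |U t x| ≤ n ∧ |U t (x + y) - U t x| ≤ n * |y| ∧
      |U t (x + y + k) - U t (x + k) - (U t (x + y) - U t x)| ≤ n * |k| * |y|} := by
    ext t; simp only [Tn, Set.mem_iInter, Set.mem_setOf_eq]
  rw [e]
  refine isClosed_iInter fun x => isClosed_iInter fun y => isClosed_iInter fun k => isClosed_iInter fun _ =>
    isClosed_iInter fun _ => isClosed_iInter fun _ => ?_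
  have c1 := h.tc x; have c2 := h.tc (x + y); have c3 := h.tc (x + k); have c4 := h.tc (x + y + k)
  refine (isClosed_le c1.abs continuous_const).and ((isClosed_le (c2.sub c1).abs continuous_const).and
    (isClosed_le ((c4.sub c3).sub (c2.sub c1)).abs continuous_const))

theorem Tn_mono {R n m : ℝ} (hnm : n ≤ m) : Tn U R n ⊆ Tn U R m := by
  intro t ht x y k hx hy hk
  obtain ⟨a, b, c⟩ := ht x y k hx hy hk
  refine ⟨a.trans hnm, b.trans (by gcongr), c.trans (by gcongr)⟩

theorem Tn_bound (h : PS q μ M s0 T0 U U1 U2 N) {R n : ℝ} (hR : 0 < R) (hn : 0 ≤ n) {t : ℝ} (ht : t ∈ Tn U R n)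
    (x : ℝ) (hx : |x| < R) : |U t x| ≤ n ∧ |U1 t x| ≤ n ∧ |U2 t x| ≤ n := by
  have key : ∀ {f f' : ℝ → ℝ} {C : ℝ}, 0 ≤ C → (∀ x, HasDerivAt f (f' x) x) → ∀ x,
      (∀ y, |y| ≤ R → |f (x + y) - f x| ≤ C * |y|) → |f' x| ≤ C := by
    intro f f' C hC hf x hh
    refine (hf x).le_of_lip' hC ?_
    filter_upwards [Metric.ball_mem_nhds x hR] with z hz
    have := hh (z - x) (by rw [Metric.mem_ball, Real.dist_eq] at hz; exact hz.le)
    simpa using this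
  refine ⟨(ht x 0 0 hx.le (by simpa using hR.le) (by simpa using hR.le)).1, ?_, ?_⟩
  · exact key hn (h.c2 t).d1 x fun y hy => (ht x y 0 hx.le hy (by simpa using hR.le)).2.1
  · refine key hn (h.c2 t).d2 x fun k hk => ?_
    refine key (f := fun z => U t (z + k) - U t z) (f' := fun z => U1 t (z + k) - U1 t z) (by positivity) (fun z => ?_) x fun y hy => ?_
    · exact ((h.c2 t).d1 (z + k)).comp_add_const z k |>.sub ((h.c2 t).d1 z)
    · have := (ht x y k hx.le hy hk).2.2
      rwa [sub_sub_sub_comm] at this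

theorem mvt_abs {f f' : ℝ → ℝ} {C r : ℝ} (hf : ∀ x, HasDerivAt f (f' x) x) (hC : ∀ x, |x| ≤ r → |f' x| ≤ C) {x y : ℝ}
    (hx : |x| ≤ r) (hy : |y| ≤ r) : |f y - f x| ≤ C * |y - x| :=
  (convex_Icc (-r) r).norm_image_sub_le_of_norm_hasDerivWithin_le (fun z _ => (hf z).hasDerivWithinAt)
    (fun z hz => hC z (abs_le.2 hz)) (abs_le.1 hx) (abs_le.1 hy)

theorem Tn_cover (h : PS q μ M s0 T0 U U1 U2 N) (R t : ℝ) : ∃ n : ℕ, t ∈ Tn U R n := by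
  obtain ⟨a, ha, ha'⟩ := bdd_Icc (h.c2 t).c0 (3 * R)
  obtain ⟨b, hb, hb'⟩ := bdd_Icc (h.c2 t).c1 (3 * R)
  obtain ⟨c, hc, hc'⟩ := bdd_Icc (h.c2 t).c2 (3 * R)
  obtain ⟨n, hn⟩ := exists_nat_ge (a + b + c)
  refine ⟨n, fun x y k hx hy hk => ?_⟩
  have hR : 0 ≤ R := (abs_nonneg x).trans hx
  have l1 : |x + y| ≤ 2 * R := (abs_add_le _ _).trans (by linarith)
  have l2 : |x + y + k| ≤ 3 * R := (abs_add_le _ _).trans (by linarith)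
  have l3 : |x + k| ≤ 3 * R := (abs_add_le _ _).trans (by linarith)
  have p1 := abs_nonneg y
  have p2 := abs_nonneg k
  refine ⟨(ha' x (by linarith)).trans (by linarith), ?_, ?_⟩
  · have := mvt_abs (h.c2 t).d1 hb' (x := x) (y := x + y) (by linarith) (by linarith)
    rw [add_sub_cancel_left] at this
    exact this.trans (by gcongr; linarith)
  · have d : ∀ z, HasDerivAt (fun z => U t (z + k) - U t z) (U1 t (z + k) - U1 t z) z := fun z =>
      ((h.c2 t).d1 (z + k)).comp_add_const z k |>.sub ((h.c2 t).d1 z)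
    have := mvt_abs (r := 2 * R) (C := c * |k|) d (fun z hz => by
      have := mvt_abs (h.c2 t).d2 hc' (x := z) (y := z + k) (by linarith) ((abs_add_le _ _).trans (by linarith))
      rwa [add_sub_cancel_left] at this) (x := x) (y := x + y) (by linarith) l1
    rw [add_sub_cancel_left, sub_sub_sub_comm] at this
    exact this.trans (by gcongr; linarith)

theorem Good.mono {R s t s' t' : ℝ} (g : Good q μ U U1 N R s t) (hs : s ≤ s') (ht : t' ≤ t) : Good q μ U U1 N R s' t' :=
  ⟨fun r hr => (g.1 r hr).mono_set (Set.Icc_subset_Icc hs ht), fun a b h1 h2 h3 => g.2 a b (hs.trans h1) h2 (h3.trans ht)⟩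

theorem Good.trans (h : PS q μ M s0 T0 U U1 U2 N) {R a b c : ℝ} (hab : a ≤ b) (hbc : b ≤ c) (g : Good q μ U U1 N R a b) (g' : Good q μ U U1 N R b c) :
    Good q μ U U1 N R a c := by
  have hE : ∀ r, r < R → IntegrableOn (Eg U U1 r) (Set.Icc a c) := fun r hr => by
    rw [← Set.Icc_union_Icc_eq_Icc hab hbc]
    exact (g.1 r hr).union (g'.1 r hr)
  refine ⟨hE, fun s t h1 h2 h3 r hr C β β1 β2 w w1 w2 ψ ψ1 ψ2 cls => ?_⟩
  rcases le_total t b with h4 | h4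
  · exact g.2 s t h1 h2 h4 r hr _ _ _ _ _ _ _ _ _ _ cls
  rcases le_total b s with h5 | h5
  · exact g'.2 s t h5 h2 h3 r hr _ _ _ _ _ _ _ _ _ _ cls
  have e1 := g.2 s b h1 h5 le_rfl r hr _ _ _ _ _ _ _ _ _ _ cls
  have e2 := g'.2 b t le_rfl h4 h3 r hr _ _ _ _ _ _ _ _ _ _ cls
  have ki := kk_int h cls (by simp) (hE r hr)
  rw [← intervalIntegral.integral_add_adjacent_intervals (b := b), ← e1, ← e2]
  · ring
  · rw [intervalIntegrable_iff_integrableOn_Icc_of_le h5]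
    exact ki.mono_set (Set.Icc_subset_Icc h1 hbc)
  · rw [intervalIntegrable_iff_integrableOn_Icc_of_le h4]
    exact ki.mono_set (Set.Icc_subset_Icc hab h3)

theorem Good.point (h : PS q μ M s0 T0 U U1 U2 N) (R a : ℝ) : Good q μ U U1 N R a a := by
  refine ⟨fun r hr => by simp, fun s t h1 h2 h3 r hr C β β1 β2 w w1 w2 ψ ψ1 ψ2 cls => ?_⟩
  have : s = t := le_antisymm h2 (h3.trans h1)
  subst this
  simp

theorem step (h : PS q μ M s0 T0 U U1 U2 N) {R n s t : ℝ} (hR : 0 < R) (hs0 : s0 ≤ s) (hT0 : t ≤ T0) (hst : s ≤ t)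
    (hG : ∀ c d, s ≤ c → c ≤ d → d ≤ t → (∀ x ∈ Tn U R n, ¬ (c ≤ x ∧ x ≤ d)) → Good q μ U U1 N R c d) :
    Good q μ U U1 N R s t := by
  have core : ∀ s' t', s ≤ s' → s' ≤ t' → t' ≤ t → ∃ (A : Set ℝ) (m : ℝ), 0 ≤ m ∧ IsClosed A ∧ s' ∈ A ∧ t' ∈ A ∧ A ⊆ Set.Icc s' t' ∧
      (∀ τ ∈ A, ∀ x, |x| < R → |U τ x| ≤ m ∧ |U1 τ x| ≤ m ∧ |U2 τ x| ≤ m) ∧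
      (∀ c d, s' ≤ c → c ≤ d → d ≤ t' → (∀ x ∈ A, ¬ (c ≤ x ∧ x ≤ d)) → Good q μ U U1 N R c d) := by
    intro s' t' h1 h2 h3
    obtain ⟨m1, hm1⟩ := Tn_cover h R s'
    obtain ⟨m2, hm2⟩ := Tn_cover h R t'
    obtain ⟨m, hm⟩ : ∃ m, m = max (max (m1:ℝ) m2) n := ⟨_, rfl⟩
    have k1 : (m1:ℝ) ≤ m := hm ▸ (le_max_left _ _).trans (le_max_left _ _)
    have k2 : (m2:ℝ) ≤ m := hm ▸ (le_max_right _ _).trans (le_max_left _ _)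
    have k3 : n ≤ m := hm ▸ le_max_right _ _
    have k0 : 0 ≤ m := (Nat.cast_nonneg m1).trans k1
    refine ⟨Tn U R m ∩ Set.Icc s' t', m, k0, (Tn_closed h R m).inter isClosed_Icc, ⟨Tn_mono k1 hm1, le_rfl, h2⟩, ⟨Tn_mono k2 hm2, h2, le_rfl⟩,
      Set.inter_subset_right, fun τ hτ x hx => Tn_bound h hR k0 hτ.1 x hx, fun c d c1 c2 c3 c4 => ?_⟩
    exact hG c d (h1.trans c1) c2 (c3.trans h3) fun x hx hh => c4 x ⟨Tn_mono k3 hx, c1.trans hh.1, hh.2.trans c3⟩ hh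
  constructor
  · obtain ⟨A, m, m0, a1, a2, a3, a4, a5, a6⟩ := core s t le_rfl hst le_rfl
    exact step_core1 h hR m0 a1 a2 a3 a4 a5 a6
  · intro s' t' h1 h2 h3 r hr C β β1 β2 w w1 w2 ψ ψ1 ψ2 cls
    obtain ⟨A, m, m0, a1, a2, a3, a4, a5, a6⟩ := core s' t' h1 h2 h3
    exact step_core2 h hR m0 (hs0.trans h1) (h3.trans hT0) a1 a2 a3 a4 a5 a6 hr cls

theorem glue (h : PS q μ M s0 T0 U U1 U2 N) {R c d : ℝ} (hc : s0 ≤ c) (hd : d ≤ T0) (hcd : c ≤ d)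
    (hl : ∀ x ∈ Set.Icc c d, ∃ δ > 0, Good q μ U U1 N R (max s0 (x - δ)) (min T0 (x + δ))) : Good q μ U U1 N R c d := by
  choose! δ hδ hg using hl
  obtain ⟨t, t0, tm, ⟨m, tm2⟩, tc⟩ := exists_monotone_Icc_subset_open_cover_Icc hcd
    (c := fun i : Set.Icc c d => {y : Set.Icc c d | |y.1 - i.1| < δ i.1}) (fun i => by
      refine isOpen_lt ?_ continuous_const
      fun_prop) (fun y _ => by
        refine Set.mem_iUnion.2 ⟨y, ?_⟩
        simpa using hδ y.1 y.2)
  have ind : ∀ n : ℕ, Good q μ U U1 N R c (t n) := by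
    intro n
    induction n with
    | zero => rw [t0]; exact Good.point h R c
    | succ n ih =>
      refine Good.trans h (t n).2.1 (tm (Nat.le_succ n)) ih ?_
      obtain ⟨i, hi⟩ := tc n
      have e1 : |(t n).1 - i.1| < δ i.1 := hi ⟨le_rfl, tm (Nat.le_succ n)⟩
      have e2 : |(t (n + 1)).1 - i.1| < δ i.1 := hi ⟨tm (Nat.le_succ n), le_rfl⟩
      rw [abs_lt] at e1 e2
      exact (hg i.1 i.2).mono (max_le (hc.trans (t n).2.1) (by linarith)) (le_min ((t (n+1)).2.2.trans hd) (by linarith))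
  have := ind m
  rwa [tm2 m le_rfl] at this

theorem good_all (h : PS q μ M s0 T0 U U1 U2 N) {R : ℝ} (hR : 0 < R) (hst : s0 ≤ T0) : Good q μ U U1 N R s0 T0 := by
  refine glue h le_rfl le_rfl hst ?_
  by_contra hne
  push Not at hne
  let E : Set ℝ := {x | x ∈ Set.Icc s0 T0 ∧ ∀ δ > 0, ¬ Good q μ U U1 N R (max s0 (x - δ)) (min T0 (x + δ))}
  have hEne : E.Nonempty := hne
  have hEc : IsClosed E := by
    rw [← isOpen_compl_iff, Metric.isOpen_iff]
    intro x hx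
    by_cases hxI : x ∈ Set.Icc s0 T0
    · have : ∃ δ > 0, Good q μ U U1 N R (max s0 (x - δ)) (min T0 (x + δ)) := by
        by_contra hh
        push Not at hh
        exact hx ⟨hxI, hh⟩
      obtain ⟨δ, hδ, g⟩ := this
      refine ⟨δ / 2, by positivity, fun y hy hyE => ?_⟩
      rw [Metric.mem_ball, Real.dist_eq, abs_lt] at hy
      exact hyE.2 (δ / 2) (by positivity) (g.mono (max_le_max le_rfl (by linarith)) (min_le_min le_rfl (by linarith)))
    · obtain ⟨δ, hδ, hb⟩ := Metric.isOpen_iff.1 (isClosed_Icc (a := s0) (b := T0)).isOpen_compl x hxI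
      exact ⟨δ, hδ, fun y hy hyE => hb hy hyE.1⟩
  have : Nonempty E := hEne.to_subtype
  have : CompleteSpace E := hEc.completeSpace_coe
  obtain ⟨n, hn⟩ := nonempty_interior_of_iUnion_of_closed (X := E) (f := fun n : ℕ => Subtype.val ⁻¹' (Tn U R n))
    (fun n => (Tn_closed h R n).preimage continuous_subtype_val) (by
      rw [Set.eq_univ_iff_forall]
      intro x
      obtain ⟨n, hn⟩ := Tn_cover h R x.1
      exact Set.mem_iUnion.2 ⟨n, hn⟩)
  obtain ⟨x, hx⟩ := hn
  rw [mem_interior_iff_mem_nhds, Metric.mem_nhds_iff] at hx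
  obtain ⟨δ, hδ, hb⟩ := hx
  refine x.2.2 (δ / 2) (by positivity) ?_
  have hxI := x.2.1
  refine step (n := n) h hR (le_max_left _ _) (min_le_left _ _) (max_le (le_min hst (by linarith [hxI.1])) (le_min (by linarith [hxI.2]) (by linarith))) ?_
  intro c d h1 h2 h3 h4
  refine glue h ((le_max_left _ _).trans h1) (h3.trans (min_le_left _ _)) h2 fun y hy => ?_
  by_contra hh
  push Not at hh
  have c1 := (le_max_right _ _).trans h1
  have c2 := h3.trans (min_le_right _ _)
  have c3 := (le_max_left _ _).trans h1
  have c4 := h3.trans (min_le_left _ _)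
  have yE : y ∈ E := ⟨⟨c3.trans hy.1, hy.2.trans c4⟩, hh⟩
  have : (⟨y, yE⟩ : E) ∈ Metric.ball x δ := by
    rw [Metric.mem_ball, Subtype.dist_eq, Real.dist_eq, abs_lt]
    constructor <;> linarith [hy.1, hy.2]
  exact h4 y (hb this) hy

end

theorem fatou_int {α : Type*} [MeasurableSpace α] {ν : Measure α} {G : ℕ → α → ℝ} {f : α → ℝ} {B : ℝ}
    (hGf : ∀ x, Tendsto (fun n => G n x) atTop (nhds (f x))) (hi : ∀ n, Integrable (G n) ν)
    (hn : ∀ n x, 0 ≤ G n x) (hB : ∀ n, ∫ x, G n x ∂ν ≤ B) : Integrable f ν := by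
  refine ⟨aestronglyMeasurable_of_tendsto_ae _ (fun n => (hi n).aestronglyMeasurable) (Eventually.of_forall hGf), ?_⟩
  have e : ∀ n, ∫⁻ x, ‖G n x‖ₑ ∂ν ≤ ENNReal.ofReal B := fun n => by
    rw [← ofReal_integral_norm_eq_lintegral_enorm (hi n)]
    apply ENNReal.ofReal_le_ofReal
    refine le_trans (le_of_eq ?_) (hB n)
    congr 1; ext x; simp [abs_of_nonneg (hn n x)]
  have k : ∫⁻ x, ‖f x‖ₑ ∂ν ≤ liminf (fun n => ∫⁻ x, ‖G n x‖ₑ ∂ν) atTop :=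
    (lintegral_mono fun x => (by rw [((hGf x).enorm).liminf_eq])).trans
      (lintegral_liminf_le' fun n => (hi n).aestronglyMeasurable.enorm)
  have k2 : liminf (fun n => ∫⁻ x, ‖G n x‖ₑ ∂ν) atTop ≤ ENNReal.ofReal B :=
    liminf_le_of_le (by isBoundedDefault) fun b hb => by
      obtain ⟨n, hn⟩ := hb.exists
      exact hn.trans (e n)
  exact (k.trans k2).trans_lt ENNReal.ofReal_lt_top

/-- the global energy density -/
noncomputable def ge (V V1 : ℝ → ℝ) (x : ℝ) : ℝ := V x ^ 2 + V1 x ^ 2 / (1 + V x ^ 2)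

theorem ge_nn (V V1 : ℝ → ℝ) (x : ℝ) : 0 ≤ ge V V1 x := by unfold ge; positivity

theorem ge_cont {V V1 V2 : ℝ → ℝ} (h : C2 V V1 V2) : Continuous (ge V V1) := by
  have := edens_cont h
  have e : ge V V1 = fun x => edens V V1 x - 1 := by ext x; unfold ge edens; ring
  rw [e]; fun_prop

theorem cut_tend {χ : ℝ → ℝ} (h1 : ∀ x, |x| ≤ 1 → χ x = 1) (x : ℝ) :
    ∀ᶠ n : ℕ in atTop, χ (x / ((n:ℝ) + 1)) = 1 := by
  obtain ⟨m, hm⟩ := exists_nat_ge |x|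
  filter_upwards [eventually_ge_atTop m] with n hn
  apply h1
  have hp : (0:ℝ) < (n:ℝ) + 1 := by positivity
  rw [abs_div, abs_of_pos hp, div_le_one hp]
  have : (m:ℝ) ≤ n := by exact_mod_cast hn
  linarith

section
variable {q μ M s0 T0 : ℝ} {U U1 U2 N : ℝ → ℝ → ℝ}

theorem PS.m_ge (h : PS q μ M s0 T0 U U1 U2 N) : Measurable fun p : ℝ × ℝ => ge (U p.1) (U1 p.1) p.2 := by
  have h0 : Measurable fun p : ℝ × ℝ => U p.1 p.2 := h.mU
  have h1 : Measurable fun p : ℝ × ℝ => U1 p.1 p.2 := h.mU1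
  unfold ge
  fun_prop

theorem ge_int (h : PS q μ M s0 T0 U U1 U2 N) (hst : s0 ≤ T0) :
    Integrable (fun p : ℝ × ℝ => ge (U p.1) (U1 p.1) p.2) ((volume.restrict (Set.Icc s0 T0)).prod volume) := by
  obtain ⟨c1, Y, χ, χ1, χ2, hc1, hχ, h1⟩ := exists_cutf h.hq h.hq2 one_pos one_lt_two
  obtain ⟨c, C, hc, hC, H⟩ := E1fix h.hq h.hq2 h.hμ c1 M 0 Y hc1 h.M0
  have hs : ∀ n : ℕ, _ := fun n => hχ.scale (ρ := (n:ℝ) + 1) (by linarith [n.cast_nonneg (α := ℝ)])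
  have ig : ∀ (n : ℕ) τ, Integrable fun x => ge (U τ) (U1 τ) x * χ (x / ((n:ℝ) + 1)) := fun n τ =>
    int_of_supp ((ge_cont (h.c2 τ)).mul (hs n).c2.c0) fun x hx => by rw [(hs n).supp x hx, mul_zero]
  have nn : ∀ (n : ℕ) τ x, 0 ≤ ge (U τ) (U1 τ) x * χ (x / ((n:ℝ) + 1)) := fun n τ x => mul_nonneg (ge_nn _ _ _) (hχ.nn _)
  have cls : ∀ n : ℕ, _ := fun n => (⟨beta_arctan, C2.zero, (hs n).c2, (hs n).supp⟩ : Cls _ _ _ _ _ _ _ _ _ _ _)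
  have K : ∀ (n : ℕ) τ, kk q μ Real.arctan (fun v => 1 / (1 + v ^ 2)) (fun _ => 0) (fun _ => 0) (fun x => χ (x / ((n:ℝ) + 1)))
      (fun x => χ1 (x / ((n:ℝ) + 1)) / ((n:ℝ) + 1)) U U1 N τ ≤ C - c * ∫ x, ge (U τ) (U1 τ) x * χ (x / ((n:ℝ) + 1)) := by
    intro n τ
    have := H (((n:ℝ) + 1) * 2) 0 (U τ) (U1 τ) (U2 τ) _ _ _ _ _ _ (N τ) (hs n) (h.c2 τ) C2.zero (h.Ni τ) (h.Nb τ) le_rfl (by positivity)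
      (by simp) (by rw [Real.zero_rpow (by linarith [h.hq])]; simp) (by
        simp only [sub_zero]
        exact (setIntegral_le_integral (h.int τ).abs (Eventually.of_forall fun x => abs_nonneg _)).trans (h.bd τ))
    simpa [kk, ge] using this
  have kint : ∀ n : ℕ, IntegrableOn (kk q μ Real.arctan (fun v => 1 / (1 + v ^ 2)) (fun _ => 0) (fun _ => 0) (fun x => χ (x / ((n:ℝ) + 1)))
      (fun x => χ1 (x / ((n:ℝ) + 1)) / ((n:ℝ) + 1)) U U1 N) (Set.Icc s0 T0) := fun n => by
    have g := good_all h (R := ((n:ℝ) + 1) * 2 + 1) (by positivity) hst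
    exact kk_int h (cls n) (by simp) (g.1 _ (by linarith))
  have mG : ∀ n : ℕ, Measurable fun p : ℝ × ℝ => ge (U p.1) (U1 p.1) p.2 * χ (p.2 / ((n:ℝ) + 1)) := fun n => by
    have := h.m_ge
    have := (hs n).c2.c0.measurable
    exact h.m_ge.mul (this.comp measurable_snd)
  have Gi : ∀ n : ℕ, IntegrableOn (fun τ => ∫ x, ge (U τ) (U1 τ) x * χ (x / ((n:ℝ) + 1))) (Set.Icc s0 T0) := fun n => by
    refine Integrable.mono' (g := fun τ => (C - kk q μ Real.arctan (fun v => 1 / (1 + v ^ 2)) (fun _ => 0) (fun _ => 0) (fun x => χ (x / ((n:ℝ) + 1)))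
      (fun x => χ1 (x / ((n:ℝ) + 1)) / ((n:ℝ) + 1)) U U1 N τ) / c) ?_ ?_ ?_
    · exact ((integrableOn_const (by simp)).sub (kint n)).div_const _
    · exact (mG n).stronglyMeasurable.integral_prod_right'.aestronglyMeasurable
    · refine Eventually.of_forall fun τ => ?_
      rw [Real.norm_eq_abs, abs_of_nonneg (integral_nonneg fun x => nn n τ x), le_div_iff₀ hc]
      linarith [K n τ]
  have pi : ∀ n : ℕ, Integrable (fun p : ℝ × ℝ => ge (U p.1) (U1 p.1) p.2 * χ (p.2 / ((n:ℝ) + 1)))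
      ((volume.restrict (Set.Icc s0 T0)).prod volume) := fun n => by
    rw [integrable_prod_iff (mG n).aestronglyMeasurable]
    refine ⟨Eventually.of_forall fun τ => ig n τ, ?_⟩
    refine (Gi n).congr (Eventually.of_forall fun τ => ?_)
    simp only [Real.norm_eq_abs]
    congr 1; ext x; rw [abs_of_nonneg (nn n τ x)]
  refine fatou_int (G := fun (n : ℕ) (p : ℝ × ℝ) => ge (U p.1) (U1 p.1) p.2 * χ (p.2 / ((n:ℝ) + 1)))
    (B := (C * (T0 - s0) + 2 * M) / c) (fun p => ?_) pi (fun n p => nn n _ _) fun n => ?_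
  · refine tendsto_const_nhds.congr' ?_
    filter_upwards [cut_tend h1 p.2] with n hn
    rw [hn, mul_one]
  · rw [integral_prod _ (pi n), le_div_iff₀ hc]
    have g := (good_all h (R := ((n:ℝ) + 1) * 2 + 1) (by positivity) hst).2 s0 T0 le_rfl hst le_rfl _ (by linarith) _ _ _ _ _ _ _ _ _ _ (cls n)
    rw [intervalIntegral.integral_of_le hst, ← integral_Icc_eq_integral_Ioc] at g
    have e1 : 0 ≤ Ph bArc (fun _ => 0) (fun x => χ (x / ((n:ℝ) + 1))) U T0 :=
      integral_nonneg fun x => mul_nonneg (bArc_nonneg _) (hχ.nn _)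
    have e2 : Ph bArc (fun _ => 0) (fun x => χ (x / ((n:ℝ) + 1))) U s0 ≤ 2 * M := by
      calc _ ≤ ∫ x, 2 * |U s0 x| := integral_mono (ph_int h (cls n) s0) ((h.int s0).abs.const_mul 2) fun x => by
            have := bArc_le (U s0 x - 0)
            have b := bArc_nonneg (U s0 x - 0)
            rw [abs_of_nonneg b] at this
            simp only [sub_zero] at this b ⊢
            calc _ ≤ bArc (U s0 x) * 1 := by gcongr; exact hχ.le1 _
              _ ≤ _ := by linarith
        _ ≤ _ := by rw [integral_const_mul]; linarith [h.bd s0]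
    have ic : IntegrableOn (fun _ : ℝ => C) (Set.Icc s0 T0) := integrableOn_const (by simp)
    have e3 : _ ≤ ∫ τ in Set.Icc s0 T0, (C - c * ∫ x, ge (U τ) (U1 τ) x * χ (x / ((n:ℝ) + 1))) :=
      setIntegral_mono (kint n) (ic.sub ((Gi n).const_mul c)) (K n)
    rw [integral_sub ic ((Gi n).const_mul c), integral_const_mul] at e3
    simp only [integral_const, measureReal_restrict_apply_univ, Real.volume_real_Icc_of_le hst, smul_eq_mul] at e3
    linarith

end

/-- space-time measure on a time slab -/
noncomputable def nu (s t : ℝ) : Measure (ℝ × ℝ) := (volume.restrict (Set.Icc s t)).prod volume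

theorem nu_mono {s t s' t' : ℝ} (hs : s' ≤ s) (ht : t ≤ t') {f : ℝ × ℝ → ℝ} (h : Integrable f (nu s' t')) :
    Integrable f (nu s t) := by
  unfold nu at *
  refine h.mono_measure ?_
  exact Measure.prod_mono (Measure.restrict_mono (Set.Icc_subset_Icc hs ht) le_rfl) le_rfl

theorem nu_integral {s t : ℝ} (hst : s ≤ t) {f : ℝ × ℝ → ℝ} (h : Integrable f (nu s t)) :
    ∫ p, f p ∂(nu s t) = ∫ τ in s..t, ∫ x, f (τ, x) := by
  unfold nu at *
  rw [integral_prod _ h, integral_Icc_eq_integral_Ioc, intervalIntegral.integral_of_le hst]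

theorem nu_int_of_bd {s t M : ℝ} {f : ℝ × ℝ → ℝ} (hm : Measurable f) (hi : ∀ τ, Integrable fun x => f (τ, x))
    (hb : ∀ τ, ∫ x, |f (τ, x)| ≤ M) : Integrable f (nu s t) := by
  unfold nu
  rw [integrable_prod_iff hm.aestronglyMeasurable]
  refine ⟨Eventually.of_forall hi, ?_⟩
  refine Integrable.mono' (g := fun _ => M) (integrableOn_const (by simp)) (hm.norm.stronglyMeasurable.integral_prod_right'.aestronglyMeasurable) ?_
  refine Eventually.of_forall fun τ => ?_
  rw [Real.norm_eq_abs, abs_of_nonneg (integral_nonneg fun x => norm_nonneg _)]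
  exact hb τ

noncomputable def kdg (q μ : ℝ) (β β1 β2 ψ ψ1 ψ2 V V1 N : ℝ → ℝ) (x : ℝ) : ℝ :=
  (β2 (V x) * V1 x * (Fl q (V x) - μ * V1 x) + β1 (V x) * N x) * ψ x + β1 (V x) * Fl q (V x) * ψ1 x
    + μ * β (V x) * ψ2 x

theorem kdg_eq {q μ C r : ℝ} {β β1 β2 ψ ψ1 ψ2 V V1 V2 N : ℝ → ℝ} (hq : 1 < q) (hN : Integrable N) (hβ : Beta β β1 β2 C)
    (hψ : C2 ψ ψ1 ψ2) (hs : ∀ x, r < |x| → ψ x = 0) (hV : C2 V V1 V2) :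
    ∫ x, kdens q μ β1 β2 (fun _ => 0) (fun _ => 0) ψ ψ1 V V1 N x = ∫ x, kdg q μ β β1 β2 ψ ψ1 ψ2 V V1 N x := by
  have i1 := (weak_fixed (μ := μ) hq hN hβ C2.zero hψ hs hV).2.1
  have d : ∀ x, HasDerivAt (fun x => -μ * (β (V x) * ψ1 x)) (-μ * (β1 (V x) * V1 x * ψ1 x + β (V x) * ψ2 x)) x :=
    fun x => (((hβ.d1 (V x)).comp x (hV.d1 x)).mul (hψ.d2 x)).const_mul _
  have s1 := deriv_supp hψ.d1 hs
  have c : Continuous fun x => -μ * (β1 (V x) * V1 x * ψ1 x + β (V x) * ψ2 x) := by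
    have := hβ.c0; have := hβ.c1; have := hV.c0; have := hV.c1; have := hψ.c1; have := hψ.c2
    fun_prop
  have ss : ∀ x, r < |x| → -μ * (β (V x) * ψ1 x) = 0 := fun x hx => by rw [s1 x hx]; ring
  have z := ibp0 d c ss
  have i2 := int_of_supp c (deriv_supp d ss)
  have e : kdg q μ β β1 β2 ψ ψ1 ψ2 V V1 N = fun x => kdens q μ β1 β2 (fun _ => 0) (fun _ => 0) ψ ψ1 V V1 N x
      - (-μ * (β1 (V x) * V1 x * ψ1 x + β (V x) * ψ2 x)) := by
    ext x; simp only [kdg, kdens, sub_zero]; ring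
  rw [e, integral_sub i1 i2, z, sub_zero]

theorem rpow_bd1 {q : ℝ} (hq : 1 < q) (hq2 : q < 2) (v : ℝ) : |v| ^ q ≤ |v| + v ^ 2 := by
  have h : |v| ^ q = |v| * |v| ^ (q - 1) := by
    rcases eq_or_ne v 0 with rfl | hv
    · simp [Real.zero_rpow (by linarith : q ≠ 0)]
    · rw [← Real.rpow_one_add' (abs_nonneg v) (by linarith)]; congr 1; ring
  have h2 : |v| ^ (q - 1) ≤ 1 + |v| := by
    rcases le_total |v| 1 with h | h
    · exact (Real.rpow_le_one (abs_nonneg _) h (by linarith)).trans (by linarith [abs_nonneg v])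
    · calc _ ≤ |v| ^ (1:ℝ) := Real.rpow_le_rpow_of_exponent_le h (by linarith)
        _ ≤ _ := by rw [Real.rpow_one]; linarith
  rw [h]
  calc _ ≤ |v| * (1 + |v|) := by gcongr
    _ = _ := by rw [← sq_abs v]; ring

theorem rpow_bd2 {q : ℝ} (hq : 1 < q) (hq2 : q < 2) (v w : ℝ) :
    |w| * |v| ^ q ≤ (1 + v ^ 2) * (v ^ 2 + w ^ 2 / (1 + v ^ 2)) := by
  have h : |v| ^ q = |v| * |v| ^ (q - 1) := by
    rcases eq_or_ne v 0 with rfl | hv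
    · simp [Real.zero_rpow (by linarith : q ≠ 0)]
    · rw [← Real.rpow_one_add' (abs_nonneg v) (by linarith)]; congr 1; ring
  have h2 : (|v| ^ (q - 1)) ^ 2 ≤ 1 + v ^ 2 := by
    rw [← Real.rpow_mul_natCast (abs_nonneg v)]
    exact rpow_le_one_add_sq (by push_cast; linarith) (by push_cast; linarith) v
  have h0 : 0 ≤ |v| ^ (q - 1) := Real.rpow_nonneg (abs_nonneg v) _
  have e : (1 + v ^ 2) * (v ^ 2 + w ^ 2 / (1 + v ^ 2)) = (1 + v ^ 2) * v ^ 2 + w ^ 2 := by field_simp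
  rw [e, h]
  generalize |v| ^ (q - 1) = z at *
  have : |w| ^ 2 = w ^ 2 := sq_abs w
  have h3 : z ^ 2 * v ^ 2 ≤ (1 + v ^ 2) * v ^ 2 := by gcongr
  have : |v| ^ 2 = v ^ 2 := sq_abs v
  have : 0 ≤ |v| := abs_nonneg v
  nlinarith [sq_nonneg (|w| - |v| * z), abs_nonneg w, abs_nonneg v, sq_nonneg (|v| * z)]

theorem kdg_bd {q μ C B : ℝ} {β β1 β2 ψ ψ1 ψ2 V V1 N : ℝ → ℝ} (hq : 1 < q) (hq2 : q < 2) (hμ : 0 < μ)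
    (hβ : Beta β β1 β2 C) (hβ0 : β 0 = 0) (x : ℝ) (h0 : |ψ x| ≤ B) (h1 : |ψ1 x| ≤ B) (h2 : |ψ2 x| ≤ B) :
    |kdg q μ β β1 β2 ψ ψ1 ψ2 V V1 N x| ≤ (C * B * (2 + μ)) * (ge V V1 x + |V x| + |N x|) := by
  have hC := hβ.Cnn
  have hB : 0 ≤ B := (abs_nonneg _).trans h0
  have b1 := hβ.b1 (V x)
  have b2 := hβ.b2 (V x)
  have b0 := hβ.lip (V x) 0
  rw [hβ0, sub_zero, sub_zero] at b0
  have f := abs_Fl_le q (V x) hq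
  have g := ge_nn V V1 x
  have r1 := rpow_bd1 hq hq2 (V x)
  have r2 := rpow_bd2 hq hq2 (V x) (V1 x)
  have p : 0 < 1 + V x ^ 2 := by positivity
  have gv : V x ^ 2 ≤ ge V V1 x := by unfold ge; have : 0 ≤ V1 x ^ 2 / (1 + V x ^ 2) := by positivity
                                      linarith
  have gw : V1 x ^ 2 ≤ (1 + V x ^ 2) * ge V V1 x := by
    unfold ge; rw [mul_add, mul_div_cancel₀ _ p.ne']; nlinarith [sq_nonneg (V x), mul_nonneg (sq_nonneg (V x)) (sq_nonneg (V x))]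
  have t1 : |β2 (V x) * V1 x * (Fl q (V x) - μ * V1 x)| ≤ C * (1 + μ) * ge V V1 x := by
    have : |β2 (V x)| * (|V1 x| * |Fl q (V x) - μ * V1 x|) ≤ |β2 (V x)| * ((1 + V x ^ 2) * ((1 + μ) * ge V V1 x)) := by
      apply mul_le_mul_of_nonneg_left _ (abs_nonneg _)
      calc _ ≤ |V1 x| * (|V x| ^ q + μ * |V1 x|) := by
            gcongr
            refine (abs_sub _ _).trans ?_
            rw [abs_mul, abs_of_pos hμ]; gcongr
        _ = |V1 x| * |V x| ^ q + μ * V1 x ^ 2 := by rw [← sq_abs (V1 x)]; ring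
        _ ≤ (1 + V x ^ 2) * ge V V1 x + μ * ((1 + V x ^ 2) * ge V V1 x) := add_le_add r2 (by gcongr)
        _ = _ := by ring
    rw [mul_assoc, abs_mul, abs_mul]
    refine this.trans ?_
    calc _ = ((1 + V x ^ 2) * |β2 (V x)|) * ((1 + μ) * ge V V1 x) := by ring
      _ ≤ C * ((1 + μ) * ge V V1 x) := by gcongr
      _ = _ := by ring
  have a0 := abs_nonneg (V x)
  have aN := abs_nonneg (N x)
  have t2 : |β1 (V x) * N x| ≤ C * |N x| := by rw [abs_mul]; gcongr
  have t3 : |β1 (V x) * Fl q (V x)| ≤ C * (|V x| + ge V V1 x) := by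
    rw [abs_mul]
    have : |Fl q (V x)| ≤ |V x| + ge V V1 x := by linarith
    gcongr
  have t4 : |μ * β (V x)| ≤ μ * (C * |V x|) := by rw [abs_mul, abs_of_pos hμ]; gcongr
  unfold kdg
  refine (abs_add_three _ _ _).trans ?_
  rw [abs_mul, abs_mul (β1 (V x) * Fl q (V x)), abs_mul (μ * β (V x))]
  have u1 : |β2 (V x) * V1 x * (Fl q (V x) - μ * V1 x) + β1 (V x) * N x| ≤ C * (1 + μ) * ge V V1 x + C * |N x| :=
    (abs_add_le _ _).trans (by linarith)
  calc _ ≤ (C * (1 + μ) * ge V V1 x + C * |N x|) * B + (C * (|V x| + ge V V1 x)) * B + (μ * (C * |V x|)) * B := by gcongr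
    _ ≤ _ := by
      rw [← sub_nonneg]
      ring_nf
      have : 0 ≤ C * B := by positivity
      positivity

section
variable {q μ M s0 T0 C B : ℝ} {U U1 U2 N : ℝ → ℝ → ℝ} {β β1 β2 ψ ψ1 ψ2 : ℝ → ℝ}

theorem PS.m_kdg (h : PS q μ M s0 T0 U U1 U2 N) (hβ : Beta β β1 β2 C) (hψ : C2 ψ ψ1 ψ2) :
    Measurable fun p : ℝ × ℝ => kdg q μ β β1 β2 ψ ψ1 ψ2 (U p.1) (U1 p.1) (N p.1) p.2 := by
  have h0 : Measurable fun p : ℝ × ℝ => U p.1 p.2 := h.mU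
  have h1 : Measurable fun p : ℝ × ℝ => U1 p.1 p.2 := h.mU1
  have h2 : Measurable fun p : ℝ × ℝ => N p.1 p.2 := h.Nm
  have := hβ.c0.measurable; have := hβ.c1.measurable; have := hβ.c2.measurable
  have := hψ.c0.measurable; have := hψ.c1.measurable; have := hψ.c2.measurable
  have := (continuous_Fl q h.hq).measurable
  unfold kdg
  fun_prop

theorem bd_int (h : PS q μ M s0 T0 U U1 U2 N) (hst : s0 ≤ T0) (A : ℝ) :
    Integrable (fun p : ℝ × ℝ => A * (ge (U p.1) (U1 p.1) p.2 + |U p.1 p.2| + |N p.1 p.2|)) (nu s0 T0) := by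
  have h0 : Measurable fun p : ℝ × ℝ => |U p.1 p.2| := h.mU.abs
  have h2 : Measurable fun p : ℝ × ℝ => |N p.1 p.2| := h.Nm.abs
  refine (((ge_int h hst).add (nu_int_of_bd (M := M) h0 (fun τ => (h.int τ).abs) ?_)).add (nu_int_of_bd (M := M) h2 (fun τ => (h.Ni τ).abs) ?_)).const_mul A
  · intro τ; simpa using h.bd τ
  · intro τ; simpa using h.Nb τ

theorem kdg_int (h : PS q μ M s0 T0 U U1 U2 N) (hst : s0 ≤ T0) (hβ : Beta β β1 β2 C) (hβ0 : β 0 = 0) (hψ : C2 ψ ψ1 ψ2)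
    (hB : ∀ x, |ψ x| ≤ B ∧ |ψ1 x| ≤ B ∧ |ψ2 x| ≤ B) :
    Integrable (fun p : ℝ × ℝ => kdg q μ β β1 β2 ψ ψ1 ψ2 (U p.1) (U1 p.1) (N p.1) p.2) (nu s0 T0) :=
  Integrable.mono' (bd_int h hst _) (h.m_kdg hβ hψ).aestronglyMeasurable (Eventually.of_forall fun p =>
    kdg_bd h.hq h.hq2 h.hμ hβ hβ0 p.2 (hB _).1 (hB _).2.1 (hB _).2.2)

theorem beta_int (h : PS q μ M s0 T0 U U1 U2 N) (hβ : Beta β β1 β2 C) (hβ0 : β 0 = 0) (t : ℝ) :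
    Integrable fun x => β (U t x) := by
  refine Integrable.mono' ((h.int t).abs.const_mul C) (hβ.c0.comp (h.c2 t).c0).aestronglyMeasurable (Eventually.of_forall fun x => ?_)
  simpa [hβ0] using hβ.lip (U t x) 0

theorem gw (h : PS q μ M s0 T0 U U1 U2 N) (hβ : Beta β β1 β2 C) (hβ0 : β 0 = 0) (hψ : C2 ψ ψ1 ψ2)
    (hB : ∀ x, |ψ x| ≤ B ∧ |ψ1 x| ≤ B ∧ |ψ2 x| ≤ B) {s t : ℝ} (hs : s0 ≤ s) (hst : s ≤ t) (ht : t ≤ T0) :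
    (∫ x, β (U t x) * ψ x) - ∫ x, β (U s x) * ψ x
      = ∫ p, kdg q μ β β1 β2 ψ ψ1 ψ2 (U p.1) (U1 p.1) (N p.1) p.2 ∂(nu s t) := by
  have h00 : s0 ≤ T0 := by linarith
  obtain ⟨c1, Y, χ, χ1, χ2, hc1, hχ, h1⟩ := exists_cutf h.hq h.hq2 one_pos one_lt_two
  have hsc : ∀ n : ℕ, _ := fun n => hχ.scale (ρ := (n:ℝ) + 1) (by linarith [n.cast_nonneg (α := ℝ)])
  have hBn : 0 ≤ B := (abs_nonneg _).trans (hB 0).1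
  have hC := hβ.Cnn
  let f0 : ℕ → ℝ → ℝ := fun n x => ψ x * χ (x / ((n:ℝ) + 1))
  let f1 : ℕ → ℝ → ℝ := fun n x => ψ1 x * χ (x / ((n:ℝ) + 1)) + ψ x * (χ1 (x / ((n:ℝ) + 1)) / ((n:ℝ) + 1))
  let f2 : ℕ → ℝ → ℝ := fun n x => (ψ2 x * χ (x / ((n:ℝ) + 1)) + ψ1 x * (χ1 (x / ((n:ℝ) + 1)) / ((n:ℝ) + 1)))
    + (ψ1 x * (χ1 (x / ((n:ℝ) + 1)) / ((n:ℝ) + 1)) + ψ x * (χ2 (x / ((n:ℝ) + 1)) / ((n:ℝ) + 1) / ((n:ℝ) + 1)))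
  have fc : ∀ n, C2 (f0 n) (f1 n) (f2 n) := fun n => ⟨fun x => (hψ.d1 x).mul ((hsc n).c2.d1 x),
    fun x => ((hψ.d2 x).mul ((hsc n).c2.d1 x)).add ((hψ.d1 x).mul ((hsc n).c2.d2 x)), by
      have := hψ.c0; have := hψ.c1; have := hψ.c2; have := (hsc n).c2.c0; have := (hsc n).c2.c1; have := (hsc n).c2.c2
      have := hχ.c2.c0; have := hχ.c2.c1; have := hχ.c2.c2
      simp only [f2]
      fun_prop⟩
  have fs : ∀ (n : ℕ) x, ((n:ℝ) + 1) * 2 < |x| → f0 n x = 0 := fun n x hx => by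
    simp only [f0]; rw [(hsc n).supp x hx, mul_zero]
  have ac : ∀ n x, |χ (x / ((n:ℝ) + 1))| ≤ 1 := fun n x => by rw [abs_of_nonneg (hχ.nn _)]; exact hχ.le1 _
  have fb : ∀ n x, |f0 n x| ≤ B * (1 + 3 * c1) ∧ |f1 n x| ≤ B * (1 + 3 * c1) ∧ |f2 n x| ≤ B * (1 + 3 * c1) := by
    intro n x
    obtain ⟨b0, b1, b2⟩ := hB x
    have a0 := ac n x
    have a1 := (hsc n).b1 x
    have a2 := (hsc n).b2 x
    have m : ∀ a b A' B' : ℝ, |a| ≤ A' → |b| ≤ B' → |a * b| ≤ A' * B' := fun a b A' B' ha hb => by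
      rw [abs_mul]; exact mul_le_mul ha hb (abs_nonneg _) ((abs_nonneg _).trans ha)
    have := m _ _ _ _ b0 a0; have := m _ _ _ _ b1 a0; have := m _ _ _ _ b2 a0
    have := m _ _ _ _ b0 a1; have := m _ _ _ _ b1 a1; have := m _ _ _ _ b0 a2
    have bc : 0 ≤ B * c1 := by positivity
    refine ⟨by simp only [f0]; linarith, ?_, ?_⟩
    · simp only [f1]; refine (abs_add_le _ _).trans (by linarith)
    · simp only [f2]; refine (abs_add_le _ _).trans ((add_le_add (abs_add_le _ _) (abs_add_le _ _)).trans (by linarith))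
  have cz : ∀ (g : ℝ → ℝ) x, (∀ y, |g y| ≤ c1) → Tendsto (fun n : ℕ => g (x / ((n:ℝ) + 1)) / ((n:ℝ) + 1)) atTop (nhds 0) := by
    intro g x hg
    refine squeeze_zero_norm (a := fun n : ℕ => c1 * (1 / ((n:ℝ) + 1))) (fun n => ?_) ?_
    · have hp : (0:ℝ) < (n:ℝ) + 1 := by positivity
      rw [Real.norm_eq_abs, abs_div, abs_of_pos hp, mul_one_div]
      gcongr; exact hg _
    · simpa using (tendsto_one_div_add_atTop_nhds_zero_nat (𝕜 := ℝ)).const_mul c1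
  have c0t : ∀ x, Tendsto (fun n : ℕ => χ (x / ((n:ℝ) + 1))) atTop (nhds 1) := fun x =>
    tendsto_const_nhds.congr' (by filter_upwards [cut_tend h1 x] with n hn; rw [hn])
  have t0 : ∀ x, Tendsto (fun n => f0 n x) atTop (nhds (ψ x)) := fun x => by
    simpa using (c0t x).const_mul (ψ x)
  have t1 : ∀ x, Tendsto (fun n => f1 n x) atTop (nhds (ψ1 x)) := fun x => by
    simpa using ((c0t x).const_mul (ψ1 x)).add ((cz χ1 x hχ.b1).const_mul (ψ x))
  have t2 : ∀ x, Tendsto (fun n => f2 n x) atTop (nhds (ψ2 x)) := fun x => by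
    have := (cz χ2 x hχ.b2).mul (tendsto_one_div_add_atTop_nhds_zero_nat (𝕜 := ℝ))
    simp only [mul_one_div] at this
    simpa using (((c0t x).const_mul (ψ2 x)).add ((cz χ1 x hχ.b1).const_mul (ψ1 x))).add (((cz χ1 x hχ.b1).const_mul (ψ1 x)).add (this.const_mul (ψ x)))
  have cls : ∀ n : ℕ, Cls (((n:ℝ) + 1) * 2) C β β1 β2 (fun _ => 0) (fun _ => 0) (fun _ => 0) (f0 n) (f1 n) (f2 n) :=
    fun n => ⟨hβ, C2.zero, fc n, fs n⟩
  have L : ∀ τ, Tendsto (fun n => ∫ x, β (U τ x) * f0 n x) atTop (nhds (∫ x, β (U τ x) * ψ x)) := fun τ => by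
    refine tendsto_integral_of_dominated_convergence (fun x => |β (U τ x)| * (B * (1 + 3 * c1))) (fun n => ?_) ((beta_int h hβ hβ0 τ).abs.mul_const _)
      (fun n => Eventually.of_forall fun x => ?_) (Eventually.of_forall fun x => (t0 x).const_mul _)
    · exact ((hβ.c0.comp (h.c2 τ).c0).mul (fc n).c0).aestronglyMeasurable
    · rw [norm_mul]; simp only [Real.norm_eq_abs]; gcongr; exact (fb n x).1
  have R : Tendsto (fun n => ∫ p, kdg q μ β β1 β2 (f0 n) (f1 n) (f2 n) (U p.1) (U1 p.1) (N p.1) p.2 ∂(nu s t)) atTop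
      (nhds (∫ p, kdg q μ β β1 β2 ψ ψ1 ψ2 (U p.1) (U1 p.1) (N p.1) p.2 ∂(nu s t))) := by
    refine tendsto_integral_of_dominated_convergence (fun p => (C * (B * (1 + 3 * c1)) * (2 + μ)) * (ge (U p.1) (U1 p.1) p.2 + |U p.1 p.2| + |N p.1 p.2|))
      (fun n => (h.m_kdg hβ (fc n)).aestronglyMeasurable) (nu_mono hs ht (bd_int h h00 _)) (fun n => Eventually.of_forall fun p =>
    kdg_bd h.hq h.hq2 h.hμ hβ hβ0 p.2 (fb n _).1 (fb n _).2.1 (fb n _).2.2) (Eventually.of_forall fun p => ?_)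
    unfold kdg
    exact (((t0 p.2).const_mul _).add ((t1 p.2).const_mul _)).add ((t2 p.2).const_mul _)
  refine tendsto_nhds_unique ((L t).sub (L s)) (R.congr fun n => ?_)
  have g := (good_all h (R := ((n:ℝ) + 1) * 2 + 1) (by positivity) h00).2 s t hs hst ht _ (by linarith) _ _ _ _ _ _ _ _ _ _ (cls n)
  simp only [Ph, sub_zero] at g
  rw [g, nu_integral hst (nu_mono hs ht (kdg_int h h00 hβ hβ0 (fc n) (fb n)))]
  unfold kk
  congr 1; ext τ
  exact (kdg_eq h.hq (h.Ni τ) hβ (fc n) (fs n) (h.c2 τ)).symm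

end

noncomputable def cv (j V : ℝ → ℝ) (x : ℝ) : ℝ := ∫ y, j (x - y) * V y

section
variable {j V ψ : ℝ → ℝ} {B : ℝ}

theorem cv_prod (hj : Integrable j) (hV : Integrable V) :
    Integrable (fun p : ℝ × ℝ => j (p.1 - p.2) * V p.2) (volume.prod volume) := by
  have := hV.convolution_integrand (ContinuousLinearMap.mul ℝ ℝ) hj
  refine this.congr (Eventually.of_forall fun p => ?_)
  simp [mul_comm]

theorem cv_ae (hj : Integrable j) (hV : Integrable V) : ∀ᵐ x, Integrable fun y => j (x - y) * V y :=
  (cv_prod hj hV).prod_right_ae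

theorem cv_int (hj : Integrable j) (hV : Integrable V) : Integrable (cv j V) :=
  (cv_prod hj hV).integral_prod_left

theorem cv_shift (hj : Integrable j) (y : ℝ) : Integrable (fun x => j (x - y)) ∧ ∫ x, j (x - y) = ∫ x, j x :=
  ⟨hj.comp_sub_right y, integral_sub_right_eq_self j y⟩

theorem cv_dual (hj : Integrable j) (hV : Integrable V) (hm : AEStronglyMeasurable ψ) (hB : ∀ x, |ψ x| ≤ B) :
    ∫ x, cv j V x * ψ x = ∫ y, V y * ∫ x, j (x - y) * ψ x := by
  have i : Integrable (fun p : ℝ × ℝ => (j (p.1 - p.2) * V p.2) * ψ p.1) (volume.prod volume) :=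
    (cv_prod hj hV).mul_bdd (c := B) (hm.comp_fst) (Eventually.of_forall fun p => hB _)
  have := integral_integral_swap (f := fun x y => (j (x - y) * V y) * ψ x) i
  calc _ = ∫ x, ∫ y, (j (x - y) * V y) * ψ x := by
        congr 1; ext x; rw [cv, ← integral_mul_const]
    _ = _ := this
    _ = _ := by
        congr 1; ext y; rw [← integral_const_mul]; congr 1; ext x; ring

theorem cv_total (hj : Integrable j) (hV : Integrable V) : ∫ x, cv j V x = (∫ x, j x) * ∫ x, V x := by
  have := cv_dual hj hV (ψ := fun _ => 1) (B := 1) aestronglyMeasurable_const (by simp)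
  simp only [mul_one] at this
  rw [this, ← integral_const_mul]
  congr 1; ext y; rw [(cv_shift hj y).2, mul_comm]

theorem cv_norm (hj : Integrable j) (hV : Integrable V) : ∫ x, |cv j V x| ≤ (∫ x, |j x|) * ∫ x, |V x| := by
  rw [← cv_total hj.abs hV.abs]
  refine integral_mono (cv_int hj hV).abs (cv_int hj.abs hV.abs) fun x => ?_
  refine (abs_integral_le_integral_abs).trans (le_of_eq ?_)
  simp [cv, abs_mul]

end

structure Kern (j : ℝ → ℝ) : Prop where
  m : Measurable j
  nn : ∀ x, 0 ≤ j x
  even : ∀ x, j (-x) = j x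
  int : Integrable j
  mass : ∫ x, j x = 1

noncomputable def nl (j : ℝ → ℝ) (Λ : ℝ) (V : ℝ → ℝ) (x : ℝ) : ℝ := Λ * (cv j V x - V x)

section
variable {j V : ℝ → ℝ} {Λ : ℝ}

theorem Kern.abs (hj : Kern j) : ∫ x, |j x| = 1 := by
  rw [← hj.mass]; congr 1; ext x; exact abs_of_nonneg (hj.nn x)

theorem Kern.sh (hj : Kern j) (x : ℝ) : Integrable (fun y => j (x - y)) ∧ ∫ y, j (x - y) = 1 := by
  have e : (fun y => j (x - y)) = fun y => j (y - x) := by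
    ext y; rw [← hj.even, neg_sub]
  rw [e]
  exact ⟨hj.int.comp_sub_right x, (integral_sub_right_eq_self j x).trans hj.mass⟩

theorem nl_int (hj : Kern j) (hV : Integrable V) : Integrable (nl j Λ V) :=
  ((cv_int hj.int hV).sub hV).const_mul Λ

theorem nl_norm (hj : Kern j) (hΛ : 0 ≤ Λ) (hV : Integrable V) : ∫ x, |nl j Λ V x| ≤ 2 * Λ * ∫ x, |V x| := by
  have h := cv_norm hj.int hV
  rw [hj.abs, one_mul] at h
  calc _ ≤ ∫ x, (Λ * |cv j V x| + Λ * |V x|) := by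
        refine integral_mono (nl_int hj hV).abs (lin2 (cv_int hj.int hV).abs hV.abs Λ Λ).1 fun x => ?_
        simp only [nl, abs_mul, abs_of_nonneg hΛ]
        rw [← mul_add]; gcongr; exact abs_sub _ _
    _ = Λ * (∫ x, |cv j V x|) + Λ * ∫ x, |V x| := (lin2 (cv_int hj.int hV).abs hV.abs Λ Λ).2
    _ ≤ _ := by nlinarith

theorem nl_entropy (hj : Kern j) (hΛ : 0 ≤ Λ) (hV : Integrable V) {S S1 S2 : ℝ → ℝ} {C : ℝ} (hS : Beta S S1 S2 C)
    (hc : ∀ a b, S1 a * (b - a) ≤ S b - S a) (hSi : Integrable fun x => S (V x)) (hm : Continuous V) :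
    ∫ x, S1 (V x) * nl j Λ V x ≤ 0 := by
  have i1 : Integrable fun x => S1 (V x) * nl j Λ V x :=
    (nl_int hj hV).bdd_mul (hS.c1.comp hm).aestronglyMeasurable (Eventually.of_forall fun x => hS.b1 _)
  have i2 : Integrable fun x => Λ * (cv j (fun x => S (V x)) x - S (V x)) :=
    ((cv_int hj.int hSi).sub hSi).const_mul Λ
  calc _ ≤ ∫ x, Λ * (cv j (fun x => S (V x)) x - S (V x)) := by
        refine integral_mono_ae i1 i2 ?_
        filter_upwards [cv_ae hj.int hV, cv_ae hj.int hSi] with x h1 h2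
        obtain ⟨k1, k2⟩ := hj.sh x
        have e1 : cv j V x - V x = ∫ y, j (x - y) * (V y - V x) := by
          simp only [mul_sub]
          rw [integral_sub h1 (k1.mul_const _), integral_mul_const, k2, one_mul]; rfl
        have e2 : cv j (fun x => S (V x)) x - S (V x) = ∫ y, j (x - y) * (S (V y) - S (V x)) := by
          simp only [mul_sub]
          rw [integral_sub h2 (k1.mul_const _), integral_mul_const, k2, one_mul]; rfl
        have e3 : S1 (V x) * (cv j V x - V x) ≤ cv j (fun x => S (V x)) x - S (V x) := by
          rw [e1, e2, ← integral_const_mul]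
          refine integral_mono ?_ ?_ fun y => ?_
          · refine Integrable.const_mul ?_ _
            simp only [mul_sub]; exact h1.sub (k1.mul_const _)
          · simp only [mul_sub]; exact h2.sub (k1.mul_const _)
          · have := mul_le_mul_of_nonneg_left (hc (V x) (V y)) (hj.nn (x - y))
            simp only; linarith
        have := mul_le_mul_of_nonneg_left e3 hΛ
        simp only [nl]; linarith
    _ = 0 := by
        rw [integral_const_mul, integral_sub (cv_int hj.int hSi) hSi, cv_total hj.int hSi, hj.mass]; ring

end

section
variable {q μ M s0 T0 C Λ : ℝ} {U U1 U2 N : ℝ → ℝ → ℝ} {S S1 S2 j : ℝ → ℝ}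

theorem entropy (h : PS q μ M s0 T0 U U1 U2 N) (hj : Kern j) (hΛ : 0 ≤ Λ) (hN : ∀ t, N t = nl j Λ (U t))
    (hS : Beta S S1 S2 C) (hS0 : S 0 = 0) (h2 : ∀ v, 0 ≤ S2 v)
    (hc : ∀ a b, S1 a * (b - a) ≤ S b - S a) {s t : ℝ} (hs : s0 ≤ s) (hst : s ≤ t) (ht : t ≤ T0) :
    ∫ x, S (U t x) ≤ ∫ x, S (U s x) := by
  have h00 : s0 ≤ T0 := by linarith
  have c1 : C2 (fun _ : ℝ => (1:ℝ)) (fun _ => 0) (fun _ => 0) :=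
    ⟨fun x => hasDerivAt_const x 1, fun x => hasDerivAt_const x 0, continuous_const⟩
  have g := gw h hS hS0 c1 (B := 1) (by simp) hs hst ht
  have gi := nu_mono hs ht (kdg_int h h00 hS hS0 c1 (B := 1) (by simp))
  have gei := nu_mono hs ht (ge_int h h00)
  simp only [mul_one] at g
  suffices ∫ p, kdg q μ S S1 S2 (fun _ => 1) (fun _ => 0) (fun _ => 0) (U p.1) (U1 p.1) (N p.1) p.2 ∂(nu s t) ≤ 0 by linarith
  unfold nu at *
  rw [integral_prod _ gi]
  refine integral_nonpos_of_ae ?_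
  filter_upwards [gi.prod_right_ae, gei.prod_right_ae] with τ a1 a2
  simp only [Pi.zero_apply]
  have hF := continuous_Fl q h.hq
  have hSF : Continuous fun v => S2 v * Fl q v := hS.c2.mul hF
  set H : ℝ → ℝ := fun v => ∫ w in (0:ℝ)..v, S2 w * Fl q w
  have hH : ∀ v, HasDerivAt H (S2 v * Fl q v) v := fun v =>
    intervalIntegral.integral_hasDerivAt_right (hSF.intervalIntegrable _ _) (hSF.stronglyMeasurableAtFilter _ _) hSF.continuousAt
  have hb : ∀ v, |S2 v * Fl q v| ≤ C := fun v => by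
    rw [abs_mul]
    have f := (abs_Fl_le q v h.hq).trans (rpow_le_one_add_sq (by linarith [h.hq]) h.hq2.le v)
    calc _ ≤ |S2 v| * (1 + v ^ 2) := by gcongr
      _ = (1 + v ^ 2) * |S2 v| := by ring
      _ ≤ C := hS.b2 v
  have Hb : ∀ v, |H v| ≤ C * |v| := fun v => by
    have := intervalIntegral.norm_integral_le_of_norm_le_const (a := 0) (b := v) (f := fun w => S2 w * Fl q w) (C := C) (fun w _ => by rw [Real.norm_eq_abs]; exact hb w)
    simpa using this
  have hHc : Continuous H := continuous_iff_continuousAt.2 fun v => (hH v).continuousAt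
  have cU := (h.c2 τ).c0
  have cU1 := (h.c2 τ).c1
  have d : ∀ x, HasDerivAt (fun x => H (U τ x)) (S2 (U τ x) * Fl q (U τ x) * U1 τ x) x := fun x =>
    (hH (U τ x)).comp x ((h.c2 τ).d1 x)
  have iH : Integrable fun x => H (U τ x) :=
    Integrable.mono' ((h.int τ).abs.const_mul C) (hHc.comp cU).aestronglyMeasurable (Eventually.of_forall fun x => Hb _)
  have c2' := hS.c2
  have iH' : Integrable fun x => S2 (U τ x) * Fl q (U τ x) * U1 τ x := by
    refine Integrable.mono' (a2.const_mul C) ?_ (Eventually.of_forall fun x => ?_)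
    · have : Continuous fun x => S2 (U τ x) * Fl q (U τ x) * U1 τ x := by fun_prop
      exact this.aestronglyMeasurable
    · rw [Real.norm_eq_abs, abs_mul, abs_mul]
      have f := abs_Fl_le q (U τ x) h.hq
      have r := rpow_bd2 h.hq h.hq2 (U τ x) (U1 τ x)
      calc _ ≤ |S2 (U τ x)| * |U τ x| ^ q * |U1 τ x| := by gcongr
        _ = |S2 (U τ x)| * (|U1 τ x| * |U τ x| ^ q) := by ring
        _ ≤ |S2 (U τ x)| * ((1 + U τ x ^ 2) * ge (U τ) (U1 τ) x) := mul_le_mul_of_nonneg_left r (abs_nonneg _)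
        _ = ((1 + U τ x ^ 2) * |S2 (U τ x)|) * ge (U τ) (U1 τ) x := by ring
        _ ≤ _ := by gcongr; exact ge_nn _ _ _
                    exact hS.b2 _
  have z := integral_eq_zero_of_hasDerivAt_of_integrable d iH' iH
  have iN : Integrable fun x => S1 (U τ x) * N τ x :=
    (h.Ni τ).bdd_mul (hS.c1.comp cU).aestronglyMeasurable (Eventually.of_forall fun x => hS.b1 _)
  have z2 : ∫ x, S1 (U τ x) * N τ x ≤ 0 := by
    rw [hN τ]; exact nl_entropy hj hΛ (h.int τ) hS hc (beta_int h hS hS0 τ) cU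
  calc _ ≤ ∫ x, (S2 (U τ x) * Fl q (U τ x) * U1 τ x + S1 (U τ x) * N τ x) := by
        refine integral_mono a1 (iH'.add iN) fun x => ?_
        simp only [kdg]
        have : 0 ≤ S2 (U τ x) * (μ * U1 τ x ^ 2) := mul_nonneg (h2 _) (mul_nonneg h.hμ.le (sq_nonneg _))
        nlinarith
    _ ≤ 0 := by rw [integral_add iH' iN, z]; linarith

end

noncomputable def Th1 (r : ℝ) : ℝ := (max r 0) ^ 2 / (1 + (max r 0) ^ 2)
noncomputable def Th2 (r : ℝ) : ℝ := 2 * max r 0 / (1 + (max r 0) ^ 2) ^ 2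
noncomputable def Th (r : ℝ) : ℝ := ∫ s in (0:ℝ)..r, Th1 s

theorem Th1_cont : Continuous Th1 := by
  unfold Th1
  refine Continuous.div (by fun_prop) (by fun_prop) fun x => by positivity

theorem Th2_cont : Continuous Th2 := by
  unfold Th2
  refine Continuous.div (by fun_prop) (by fun_prop) fun x => by positivity

theorem Th_d1 (r : ℝ) : HasDerivAt Th (Th1 r) r :=
  intervalIntegral.integral_hasDerivAt_right (Th1_cont.intervalIntegrable _ _)
    (Th1_cont.stronglyMeasurableAtFilter _ _) Th1_cont.continuousAt

theorem max_sq (r : ℝ) : (max r 0) ^ 2 = Fl 2 r + r ^ 2 / 2 := by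
  unfold Fl
  rw [show (2:ℝ) - 1 = 1 by norm_num, Real.rpow_one]
  rcases le_total r 0 with h | h
  · rw [max_eq_right h, abs_of_nonpos h]; ring
  · rw [max_eq_left h, abs_of_nonneg h]; ring

theorem hasDerivAt_max_sq (r : ℝ) : HasDerivAt (fun r : ℝ => (max r 0) ^ 2) (2 * max r 0) r := by
  have e : (fun r : ℝ => (max r 0) ^ 2) = fun r => Fl 2 r + r ^ 2 / 2 := funext max_sq
  rw [e]
  have := (hasDerivAt_Fl 2 r one_lt_two).add ((hasDerivAt_pow 2 r).div_const 2)
  refine this.congr_deriv ?_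
  rw [show (2:ℝ) - 1 = 1 by norm_num, Real.rpow_one]
  rcases le_total r 0 with h | h
  · rw [max_eq_right h, abs_of_nonpos h]; norm_num
  · rw [max_eq_left h, abs_of_nonneg h]; norm_num; ring

theorem Th_d2 (r : ℝ) : HasDerivAt Th1 (Th2 r) r := by
  have a := hasDerivAt_max_sq r
  have b := a.div (a.const_add 1) (by positivity)
  refine b.congr_deriv ?_
  unfold Th2; congr 1; ring

theorem Th1_nn (r : ℝ) : 0 ≤ Th1 r := by unfold Th1; positivity
theorem Th2_nn (r : ℝ) : 0 ≤ Th2 r := by unfold Th2; positivity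
theorem Th1_le (r : ℝ) : Th1 r ≤ 1 := by
  unfold Th1; rw [div_le_one (by positivity)]; linarith

theorem Th_zero {r : ℝ} (h : r ≤ 0) : Th r = 0 := by
  unfold Th
  rw [intervalIntegral.integral_congr (g := fun _ => 0)]
  · simp
  · intro s hs
    rw [Set.uIcc_of_ge h] at hs
    simp [Th1, max_eq_right hs.2]

theorem Th_mono : Monotone Th := monotone_of_hasDerivAt_nonneg Th_d1 Th1_nn

theorem Th_nn (r : ℝ) : 0 ≤ Th r := by
  rcases le_total r 0 with h | h
  · rw [Th_zero h]
  · rw [← Th_zero le_rfl]; exact Th_mono h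

theorem Th1_mono : Monotone Th1 := monotone_of_hasDerivAt_nonneg Th_d2 Th2_nn

theorem tangent {S S1 : ℝ → ℝ} (hd : ∀ v, HasDerivAt S (S1 v) v) (hm : Monotone S1) (a b : ℝ) :
    S1 a * (b - a) ≤ S b - S a := by
  rcases lt_trichotomy a b with h | rfl | h
  · obtain ⟨c, hc, e⟩ := exists_hasDerivAt_eq_slope S S1 h (fun x _ => (hd x).continuousAt.continuousWithinAt) fun x _ => hd x
    have p : 0 < b - a := by linarith
    rw [eq_div_iff p.ne'] at e
    rw [← e]; gcongr; exact hm hc.1.le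
  · simp
  · obtain ⟨c, hc, e⟩ := exists_hasDerivAt_eq_slope S S1 h (fun x _ => (hd x).continuousAt.continuousWithinAt) fun x _ => hd x
    have p : 0 < a - b := by linarith
    rw [eq_div_iff p.ne'] at e
    have := hm hc.2.le
    nlinarith

theorem Th_le (r : ℝ) (h : 0 ≤ r) : Th r ≤ r := by
  have h1 := intervalIntegral.integral_mono_on (f := Th1) (g := fun _ => 1) h (Th1_cont.intervalIntegrable (μ := volume) _ _)
    (by simp) (fun x _ => Th1_le x)
  simpa [Th] using h1

theorem Th_pos {r : ℝ} (h : 0 < r) : 0 < Th r := by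
  have := tangent Th_d1 Th1_mono (r / 2) r
  have a := Th_nn (r / 2)
  have b : 0 < Th1 (r / 2) := by
    unfold Th1; rw [max_eq_left (by positivity)]; positivity
  nlinarith

theorem Th_bd2 {σ k v : ℝ} (hσ : σ ^ 2 = 1) (hk : 0 ≤ k) : (1 + v ^ 2) * |Th2 (σ * v - k)| ≤ 2 + 2 * k ^ 2 := by
  rw [abs_of_nonneg (Th2_nn _)]
  unfold Th2
  rcases le_total (σ * v - k) 0 with h | h
  · rw [max_eq_right h]; norm_num; positivity
  · rw [max_eq_left h]
    set p := σ * v - k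
    have e : v ^ 2 = (p + k) ^ 2 := by
      simp only [p]; ring_nf; rw [hσ]; ring
    have e1 : 1 + v ^ 2 ≤ (2 + 2 * k ^ 2) * (1 + p ^ 2) := by
      rw [e]; nlinarith [sq_nonneg (p - k), sq_nonneg (p * k)]
    rw [← mul_div_assoc, div_le_iff₀ (by positivity)]
    calc _ ≤ ((2 + 2 * k ^ 2) * (1 + p ^ 2)) * (1 + p ^ 2) := by
          gcongr; nlinarith [sq_nonneg (p - 1)]
      _ = _ := by ring

theorem Th_beta {σ k : ℝ} (hσ : σ ^ 2 = 1) (hk : 0 ≤ k) :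
    Beta (fun v => Th (σ * v - k)) (fun v => σ * Th1 (σ * v - k)) (fun v => Th2 (σ * v - k)) (2 + 2 * k ^ 2) where
  d1 v := by
    have l : HasDerivAt (fun v => σ * v - k) σ v := by
      simpa using ((hasDerivAt_id v).const_mul σ).sub_const k
    exact ((Th_d1 (σ * v - k)).comp v l).congr_deriv (mul_comm _ _)
  d2 v := by
    have l : HasDerivAt (fun v => σ * v - k) σ v := by
      simpa using ((hasDerivAt_id v).const_mul σ).sub_const k
    refine (((Th_d2 (σ * v - k)).comp v l).const_mul σ).congr_deriv ?_
    rw [show σ * (Th2 (σ * v - k) * σ) = σ ^ 2 * Th2 (σ * v - k) by ring, hσ, one_mul]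
  c2 := by have := Th2_cont; fun_prop
  b1 v := by
    have : |σ| = 1 := by rw [← sq_eq_sq₀ (abs_nonneg _) zero_le_one]; simpa using hσ
    rw [abs_mul, this, one_mul, abs_of_nonneg (Th1_nn _)]
    nlinarith [Th1_le (σ * v - k), sq_nonneg k]
  b2 v := Th_bd2 hσ hk

section
variable {q μ M s0 T0 C Λ : ℝ} {U U1 U2 N : ℝ → ℝ → ℝ} {j : ℝ → ℝ}

theorem Th_ent (h : PS q μ M s0 T0 U U1 U2 N) (hj : Kern j) (hΛ : 0 ≤ Λ) (hN : ∀ t, N t = nl j Λ (U t))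
    {σ k : ℝ} (hσ : σ ^ 2 = 1) (hk : 0 ≤ k) {s t : ℝ} (hs : s0 ≤ s) (hst : s ≤ t) (ht : t ≤ T0) :
    ∫ x, Th (σ * U t x - k) ≤ ∫ x, Th (σ * U s x - k) := by
  have hb := Th_beta hσ hk
  refine entropy h hj hΛ hN hb (by simp [Th_zero (neg_nonpos.2 hk)]) (fun v => Th2_nn _) ?_ hs hst ht
  exact tangent hb.d1 (monotone_of_hasDerivAt_nonneg hb.d2 fun v => Th2_nn _)

theorem Th_concl (h : PS q μ M s0 T0 U U1 U2 N) {σ k : ℝ} (hσ : σ ^ 2 = 1) (hk : 0 ≤ k) {t : ℝ}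
    (h0 : ∫ x, Th (σ * U t x - k) ≤ 0) (x : ℝ) : σ * U t x ≤ k := by
  have hb := Th_beta hσ hk
  have i := beta_int h hb (by simp [Th_zero (neg_nonpos.2 hk)]) t
  have c : Continuous fun x => Th (σ * U t x - k) := hb.c0.comp (h.c2 t).c0
  have e : ∫ x, Th (σ * U t x - k) = 0 := le_antisymm h0 (integral_nonneg fun x => Th_nn _)
  have z := (integral_eq_zero_iff_of_nonneg (fun x => Th_nn _) i).1 e
  have z' : (fun x => Th (σ * U t x - k)) = fun _ => 0 := Continuous.ae_eq_iff_eq (μ := volume) c continuous_const |>.1 z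
  by_contra hx
  push Not at hx
  have := Th_pos (sub_pos.2 hx)
  have z2 := congrFun z' x
  linarith

theorem sup_prop (h : PS q μ M s0 T0 U U1 U2 N) (hj : Kern j) (hΛ : 0 ≤ Λ) (hN : ∀ t, N t = nl j Λ (U t))
    {k : ℝ} {s t : ℝ} (hs : s0 ≤ s) (hst : s ≤ t) (ht : t ≤ T0) (hb : ∀ x, |U s x| ≤ k) (x : ℝ) : |U t x| ≤ k := by
  have hk : 0 ≤ k := (abs_nonneg _).trans (hb 0)
  have key : ∀ σ : ℝ, σ ^ 2 = 1 → (∀ x, σ * U s x ≤ k) → σ * U t x ≤ k := by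
    intro σ hσ h1
    refine Th_concl h hσ hk ((Th_ent h hj hΛ hN hσ hk hs hst ht).trans (le_of_eq ?_)) x
    rw [← integral_zero ℝ ℝ]
    congr 1; ext x; exact Th_zero (by linarith [h1 x])
  have a := key 1 (by norm_num) fun x => by linarith [le_abs_self (U s x), hb x]
  have b := key (-1) (by norm_num) fun x => by linarith [neg_le_abs (U s x), hb x]
  rw [abs_le]; constructor <;> linarith

theorem nonneg_prop (h : PS q μ M s0 T0 U U1 U2 N) (hj : Kern j) (hΛ : 0 ≤ Λ) (hN : ∀ t, N t = nl j Λ (U t))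
    {t : ℝ} (hs : s0 ≤ t) (ht : t ≤ T0) : ∫ x, Th (-U t x) ≤ ∫ x, Th (- U s0 x) := by
  have := Th_ent h hj hΛ hN (σ := -1) (k := 0) (by norm_num) le_rfl le_rfl hs ht
  simpa using this

theorem nonneg_concl (h : PS q μ M s0 T0 U U1 U2 N) {t : ℝ} (h0 : ∫ x, Th (-U t x) ≤ 0) (x : ℝ) : 0 ≤ U t x := by
  have := Th_concl h (σ := -1) (k := 0) (t := t) (by norm_num) le_rfl (by simpa using h0) x
  linarith

/-- boundedness at almost every time -/
theorem bdd_of_ge {V V1 : ℝ → ℝ} (hV : Integrable V) (hd : ∀ x, HasDerivAt V (V1 x) x) (hc : Continuous V1)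
    (hg : Integrable (ge V V1)) (x : ℝ) : |V x| ≤ 1 + ∫ x, ge V V1 x := by
  set f : ℝ → ℝ := fun x => Real.sqrt (1 + V x ^ 2) - 1
  set f1 : ℝ → ℝ := fun x => V x * V1 x / Real.sqrt (1 + V x ^ 2)
  have cV : Continuous V := continuous_iff_continuousAt.2 fun x => (hd x).continuousAt
  have sp : ∀ x, 0 < Real.sqrt (1 + V x ^ 2) := fun x => Real.sqrt_pos.2 (by positivity)
  have d : ∀ x, HasDerivAt f (f1 x) x := fun x => by
    have a : HasDerivAt (fun x => 1 + V x ^ 2) (2 * V x * V1 x) x := by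
      have := ((hd x).pow 2).const_add 1
      refine this.congr_deriv (by norm_num)
    refine ((a.sqrt (by positivity)).sub_const 1).congr_deriv ?_
    simp only [f1]; field_simp
  have fb : ∀ x, |f x| ≤ |V x| := fun x => by
    have h1 : 1 ≤ Real.sqrt (1 + V x ^ 2) := Real.one_le_sqrt.2 (by nlinarith [sq_nonneg (V x)])
    simp only [f]
    rw [abs_of_nonneg (by linarith)]
    have : Real.sqrt (1 + V x ^ 2) ≤ 1 + |V x| := by
      rw [Real.sqrt_le_left (by positivity)]; nlinarith [abs_nonneg (V x), sq_abs (V x)]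
    linarith
  have cf : Continuous f := continuous_iff_continuousAt.2 fun x => (d x).continuousAt
  have cf1 : Continuous f1 := Continuous.div (by fun_prop) (by fun_prop) fun x => (sp x).ne'
  have f1b : ∀ x, |f1 x| ≤ ge V V1 x := fun x => by
    simp only [f1, ge]
    rw [abs_div, abs_of_pos (sp x), abs_mul, div_le_iff₀ (sp x)]
    have e : V1 x ^ 2 / (1 + V x ^ 2) = (|V1 x| / Real.sqrt (1 + V x ^ 2)) ^ 2 := by
      rw [div_pow, sq_abs, Real.sq_sqrt (by positivity)]
    rw [e]
    set s := Real.sqrt (1 + V x ^ 2)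
    have hs := sp x
    have e2 : |V1 x| = (|V1 x| / s) * s := (div_mul_cancel₀ _ (ne_of_gt hs)).symm
    set w := |V1 x| / s
    rw [e2, ← sq_abs (V x)]
    have : |V x| * w ≤ |V x| ^ 2 + w ^ 2 := by nlinarith [sq_nonneg (|V x| - w), sq_nonneg (|V x|), sq_nonneg w]
    nlinarith
  have fi : Integrable f := Integrable.mono' hV.abs cf.aestronglyMeasurable (Eventually.of_forall fb)
  have f1i : Integrable f1 := Integrable.mono' hg cf1.aestronglyMeasurable (Eventually.of_forall f1b)
  have lim : Tendsto f atBot (nhds 0) :=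
    tendsto_zero_of_hasDerivAt_of_integrableOn_Iic (a := 0) (fun x _ => d x) f1i.integrableOn fi.integrableOn
  have e := integral_Iic_of_hasDerivAt_of_tendsto' (a := x) (fun y _ => d y) f1i.integrableOn lim
  have b : f x ≤ ∫ x, ge V V1 x := by
    rw [sub_zero] at e; rw [← e]
    calc _ ≤ ∫ y in Set.Iic x, ge V V1 y :=
          integral_mono f1i.integrableOn hg.integrableOn fun y => (le_abs_self _).trans (f1b y)
      _ ≤ _ := setIntegral_le_integral hg (Eventually.of_forall fun y => ge_nn _ _ _)
  have : |V x| ≤ Real.sqrt (1 + V x ^ 2) := Real.abs_le_sqrt (by linarith)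
  simp only [f] at b; linarith

theorem exists_good_time (h : PS q μ M s0 T0 U U1 U2 N) (h0 : s0 < T0) {s1 : ℝ} (hs : s0 < s1) (hs1 : s1 ≤ T0) :
    ∃ τ ∈ Set.Icc s0 s1, Integrable (ge (U τ) (U1 τ)) := by
  have i := nu_mono le_rfl hs1 (ge_int h h0.le)
  have a := i.prod_right_ae
  have : (volume.restrict (Set.Icc s0 s1)) ≠ 0 := by
    rw [Ne, Measure.restrict_eq_zero, Real.volume_Icc]; simpa using hs
  have a2 := a.and (ae_restrict_mem measurableSet_Icc)
  have : NeZero (volume.restrict (Set.Icc s0 s1)) := ⟨this⟩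
  obtain ⟨τ, h1, h2⟩ := a2.exists
  exact ⟨τ, h2, h1⟩
end

section
variable {k k1 V W : ℝ → ℝ} {A r : ℝ}

theorem cvi (hk : Continuous k) (hA : ∀ x, |k x| ≤ A) (hV : Integrable V) (x : ℝ) : Integrable fun y => k (x - y) * V y :=
  hV.bdd_mul (c := A) (by fun_prop : Continuous fun y => k (x - y)).aestronglyMeasurable (Eventually.of_forall fun y => hA _)

theorem cv_bd (hk : Continuous k) (hA : ∀ x, |k x| ≤ A) (hV : Integrable V) (x : ℝ) : |cv k V x| ≤ A * ∫ y, |V y| := by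
  rw [← integral_const_mul]
  refine abs_integral_le_integral_abs.trans (integral_mono (cvi hk hA hV x).abs (hV.abs.const_mul A) fun y => ?_)
  simp only [abs_mul]; gcongr; exact hA _

theorem cv_sub (hk : Continuous k) (hA : ∀ x, |k x| ≤ A) (hV : Integrable V) (hW : Integrable W) (x : ℝ) :
    |cv k V x - cv k W x| ≤ A * ∫ y, |V y - W y| := by
  have e : cv k V x - cv k W x = cv k (fun y => V y - W y) x := by
    unfold cv; rw [← integral_sub (cvi hk hA hV x) (cvi hk hA hW x)]; congr 1; ext y; ring
  rw [e]; exact cv_bd hk hA (hV.sub hW) x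

theorem cv_tc {Ut : ℝ → ℝ → ℝ} (hk : Continuous k) (hA : ∀ x, |k x| ≤ A) (hV : ∀ t, Integrable (Ut t))
    (hc : ∀ t0, Tendsto (fun t => ∫ x, |Ut t x - Ut t0 x|) (nhds t0) (nhds 0)) (x : ℝ) : Continuous fun t => cv k (Ut t) x := by
  refine continuous_iff_continuousAt.2 fun t0 => ?_
  rw [ContinuousAt, tendsto_iff_dist_tendsto_zero]
  refine squeeze_zero (fun _ => dist_nonneg) (fun t => ?_) (by simpa using (hc t0).const_mul A)
  exact cv_sub hk hA (hV t) (hV t0) x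

theorem cv_cont (hk : Continuous k) (hA : ∀ x, |k x| ≤ A) (hV : Integrable V) : Continuous (cv k V) := by
  unfold cv
  refine MeasureTheory.continuous_of_dominated (bound := fun y => A * |V y|) (fun x => (cvi hk hA hV x).aestronglyMeasurable)
    (fun x => Eventually.of_forall fun y => ?_) (hV.abs.const_mul A) (Eventually.of_forall fun y => by fun_prop)
  rw [Real.norm_eq_abs, abs_mul]; gcongr; exact hA _

theorem cv_deriv (hd : ∀ x, HasDerivAt k (k1 x) x) (hk1 : Continuous k1) (hA0 : ∀ x, |k x| ≤ A) (hA : ∀ x, |k1 x| ≤ A) (hV : Integrable V) (x : ℝ) :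
    HasDerivAt (cv k V) (cv k1 V x) x := by
  have hk : Continuous k := continuous_iff_continuousAt.2 fun x => (hd x).continuousAt
  refine (hasDerivAt_integral_of_dominated_loc_of_deriv_le (F := fun x y => k (x - y) * V y)
    (F' := fun x y => k1 (x - y) * V y) (bound := fun y => A * |V y|) univ_mem
    (Eventually.of_forall fun x => (cvi hk hA0 hV x).aestronglyMeasurable) (cvi hk hA0 hV x)
    (cvi hk1 hA hV x).aestronglyMeasurable (Eventually.of_forall fun y x _ => ?_) (hV.abs.const_mul A)
    (Eventually.of_forall fun y x _ => ?_)).2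
  · rw [Real.norm_eq_abs, abs_mul]; gcongr; exact hA _
  · exact ((hd (x - y)).comp_sub_const x y).mul_const _

/-- Jensen -/
theorem cv_jensen (hk : Kern k) (hVm : AEStronglyMeasurable V) (hV : Integrable fun x => V x ^ 2) :
    (Integrable fun x => cv k V x ^ 2) ∧ ∫ x, cv k V x ^ 2 ≤ ∫ x, V x ^ 2 := by
  have p : ∀ᵐ x, cv k V x ^ 2 ≤ cv k (fun y => V y ^ 2) x := by
    filter_upwards [cv_ae hk.int hV] with x hx
    obtain ⟨a, b⟩ := hk.sh x
    have hVi : Integrable fun y => k (x - y) * V y := by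
      refine Integrable.mono' (a.add hx) (a.aestronglyMeasurable.mul hVm) (Eventually.of_forall fun y => ?_)
      rw [Real.norm_eq_abs, abs_mul, abs_of_nonneg (hk.nn _)]
      have := hk.nn (x - y)
      have : |V y| ≤ 1 + V y ^ 2 := by nlinarith [sq_nonneg (|V y| - 1), sq_abs (V y), abs_nonneg (V y)]
      simp only [Pi.add_apply]
      nlinarith
    set c := cv k V x
    have e := (lin3 hx hVi a 1 (-2 * c) (c ^ 2)).2
    have nn : 0 ≤ ∫ y, (1 * (k (x - y) * V y ^ 2) + -2 * c * (k (x - y) * V y) + c ^ 2 * k (x - y)) :=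
      integral_nonneg fun y => by
        have : 0 ≤ k (x - y) * (V y - c) ^ 2 := mul_nonneg (hk.nn _) (sq_nonneg _)
        simp only [Pi.zero_apply]; nlinarith
    rw [e, b] at nn
    have c1 : ∫ y, k (x - y) * V y = c := rfl
    have c2 : ∫ y, k (x - y) * V y ^ 2 = cv k (fun y => V y ^ 2) x := rfl
    rw [c1, c2] at nn
    nlinarith
  have m : AEStronglyMeasurable (cv k V) := by
    have : AEStronglyMeasurable (fun p : ℝ × ℝ => k (p.1 - p.2) * V p.2) (volume.prod volume) :=
      (hk.m.comp (measurable_fst.sub measurable_snd)).aestronglyMeasurable.mul hVm.comp_snd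
    exact this.integral_prod_right'
  have i : Integrable fun x => cv k V x ^ 2 :=
    Integrable.mono' (cv_int hk.int hV) (m.pow 2) (p.mono fun x hx => by
      rw [Real.norm_eq_abs, abs_of_nonneg (sq_nonneg _)]; exact hx)
  refine ⟨i, (integral_mono_ae i (cv_int hk.int hV) p).trans (le_of_eq ?_)⟩
  rw [cv_total hk.int hV, hk.mass, one_mul]

end

structure Mol (ρ ρ1 ρ2 ρ3 : ℝ → ℝ) (r A : ℝ) : Prop where
  k : Kern ρ
  d1 : ∀ x, HasDerivAt ρ (ρ1 x) x
  d2 : ∀ x, HasDerivAt ρ1 (ρ2 x) x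
  d3 : ∀ x, HasDerivAt ρ2 (ρ3 x) x
  c3 : Continuous ρ3
  b0 : ∀ x, |ρ x| ≤ A
  b1 : ∀ x, |ρ1 x| ≤ A
  b2 : ∀ x, |ρ2 x| ≤ A
  b3 : ∀ x, |ρ3 x| ≤ A
  s0 : ∀ x, r < |x| → ρ x = 0

namespace Mol
variable {ρ ρ1 ρ2 ρ3 : ℝ → ℝ} {r A : ℝ}
theorem c0 (h : Mol ρ ρ1 ρ2 ρ3 r A) : Continuous ρ := continuous_iff_continuousAt.2 fun x => (h.d1 x).continuousAt
theorem c1 (h : Mol ρ ρ1 ρ2 ρ3 r A) : Continuous ρ1 := continuous_iff_continuousAt.2 fun x => (h.d2 x).continuousAt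
theorem c2 (h : Mol ρ ρ1 ρ2 ρ3 r A) : Continuous ρ2 := continuous_iff_continuousAt.2 fun x => (h.d3 x).continuousAt
theorem s1 (h : Mol ρ ρ1 ρ2 ρ3 r A) : ∀ x, r < |x| → ρ1 x = 0 := deriv_supp h.d1 h.s0
theorem s2 (h : Mol ρ ρ1 ρ2 ρ3 r A) : ∀ x, r < |x| → ρ2 x = 0 := deriv_supp h.d2 h.s1
theorem s3 (h : Mol ρ ρ1 ρ2 ρ3 r A) : ∀ x, r < |x| → ρ3 x = 0 := deriv_supp h.d3 h.s2
theorem i1 (h : Mol ρ ρ1 ρ2 ρ3 r A) : Integrable ρ1 := int_of_supp h.c1 h.s1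
theorem i2 (h : Mol ρ ρ1 ρ2 ρ3 r A) : Integrable ρ2 := int_of_supp h.c2 h.s2
theorem i3 (h : Mol ρ ρ1 ρ2 ρ3 r A) : Integrable ρ3 := int_of_supp h.c3 h.s3

theorem scale (h : Mol ρ ρ1 ρ2 ρ3 r A) {δ : ℝ} (hδ : 0 < δ) :
    ∃ A', Mol (fun x => ρ (x / δ) / δ) (fun x => ρ1 (x / δ) / δ / δ) (fun x => ρ2 (x / δ) / δ / δ / δ)
      (fun x => ρ3 (x / δ) / δ / δ / δ / δ) (r * δ) A' := by
  have A0 : 0 ≤ A := (abs_nonneg _).trans (h.b0 0)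
  have sd : ∀ {f f1 : ℝ → ℝ}, (∀ x, HasDerivAt f (f1 x) x) → ∀ x, HasDerivAt (fun x => f (x / δ)) (f1 (x / δ) / δ) x := by
    intro f f1 hf x
    have := (hf (x / δ)).comp x ((hasDerivAt_id x).div_const δ)
    refine this.congr_deriv (by ring)
  have e : (fun x => ρ (x / δ) / δ) = fun x => δ⁻¹ * ρ (δ⁻¹ * x) := by
    ext x; rw [div_eq_inv_mul, div_eq_inv_mul]
  refine ⟨A * (1 / δ + 1 / δ / δ + 1 / δ / δ / δ + 1 / δ / δ / δ / δ), ⟨?_, ?_, ?_, ?_, ?_⟩, fun x => (sd h.d1 x).div_const δ,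
    fun x => ((sd h.d2 x).div_const δ).div_const δ, fun x => (((sd h.d3 x).div_const δ).div_const δ).div_const δ, ?_, ?_, ?_, ?_, ?_, ?_⟩
  · have := h.k.m; fun_prop
  · intro x; exact div_nonneg (h.k.nn _) hδ.le
  · intro x; rw [neg_div, h.k.even]
  · exact (h.k.int.comp_div hδ.ne').div_const δ
  · rw [e, integral_const_mul, Measure.integral_comp_mul_left, h.k.mass]
    rw [abs_of_pos (by positivity)]; simp [hδ.ne']
  · have := h.c3; fun_prop
  · intro x
    rw [abs_div, abs_of_pos hδ]
    calc _ ≤ A / δ := by gcongr; exact h.b0 _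
      _ = A * (1 / δ) := by ring
      _ ≤ _ := by gcongr; have : 0 ≤ 1 / δ / δ + 1 / δ / δ / δ + 1 / δ / δ / δ / δ := by positivity
                  linarith
  · intro x
    rw [abs_div, abs_div, abs_of_pos hδ]
    calc _ ≤ A / δ / δ := by gcongr; exact h.b1 _
      _ = A * (1 / δ / δ) := by ring
      _ ≤ _ := by gcongr; have : 0 ≤ 1 / δ + 1 / δ / δ / δ + 1 / δ / δ / δ / δ := by positivity
                  linarith
  · intro x
    rw [abs_div, abs_div, abs_div, abs_of_pos hδ]
    calc _ ≤ A / δ / δ / δ := by gcongr; exact h.b2 _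
      _ = A * (1 / δ / δ / δ) := by ring
      _ ≤ _ := by gcongr; have : 0 ≤ 1 / δ + 1 / δ / δ + 1 / δ / δ / δ / δ := by positivity
                  linarith
  · intro x
    rw [abs_div, abs_div, abs_div, abs_div, abs_of_pos hδ]
    calc _ ≤ A / δ / δ / δ / δ := by gcongr; exact h.b3 _
      _ = A * (1 / δ / δ / δ / δ) := by ring
      _ ≤ _ := by gcongr; have : 0 ≤ 1 / δ + 1 / δ / δ + 1 / δ / δ / δ := by positivity
                  linarith
  · intro x hx
    rw [h.s0 (x / δ), zero_div]
    rw [abs_div, abs_of_pos hδ, lt_div_iff₀ hδ]; exact hx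

end Mol

theorem exists_mol : ∃ ρ ρ1 ρ2 ρ3 A, Mol ρ ρ1 ρ2 ρ3 1 A := by
  let f : ContDiffBump (0:ℝ) := ⟨1 / 2, 1, by norm_num, by norm_num⟩
  set ρ : ℝ → ℝ := f.normed volume
  have c : ContDiff ℝ 3 ρ := f.contDiff_normed (n := 3)
  have c1 : ContDiff ℝ 2 (deriv ρ) := by
    rw [show (3 : WithTop ℕ∞) = 2 + 1 by norm_num, contDiff_succ_iff_deriv] at c; exact c.2.2
  have c2 : ContDiff ℝ 1 (deriv (deriv ρ)) := by
    rw [show (2 : WithTop ℕ∞) = 1 + 1 by norm_num, contDiff_succ_iff_deriv] at c1; exact c1.2.2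
  have c3 : Continuous (deriv (deriv (deriv ρ))) := c2.continuous_deriv le_rfl
  have d1 : ∀ x, HasDerivAt ρ (deriv ρ x) x := fun x => (c.differentiable (by norm_num) x).hasDerivAt
  have d2 : ∀ x, HasDerivAt (deriv ρ) (deriv (deriv ρ) x) x := fun x => (c1.differentiable (by norm_num) x).hasDerivAt
  have d3 : ∀ x, HasDerivAt (deriv (deriv ρ)) (deriv (deriv (deriv ρ)) x) x := fun x => (c2.differentiable (by norm_num) x).hasDerivAt
  have s0 : ∀ x, 1 < |x| → ρ x = 0 := by
    intro x hx
    have := f.support_normed_eq (μ := volume)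
    by_contra hne
    have hm : x ∈ Function.support (f.normed volume) := hne
    rw [this, Metric.mem_ball, dist_zero_right, Real.norm_eq_abs] at hm
    have : f.rOut = 1 := rfl
    linarith
  have s1 := deriv_supp d1 s0
  have s2 := deriv_supp d2 s1
  have s3 := deriv_supp d3 s2
  obtain ⟨A0, a0⟩ := bdd_of_supp c.continuous s0
  obtain ⟨A1, a1⟩ := bdd_of_supp c1.continuous s1
  obtain ⟨A2, a2⟩ := bdd_of_supp c2.continuous s2
  obtain ⟨A3, a3⟩ := bdd_of_supp c3 s3
  have n0 := (abs_nonneg _).trans (a0.2 0)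
  have n1 := (abs_nonneg _).trans (a1.2 0)
  have n2 := (abs_nonneg _).trans (a2.2 0)
  have n3 := (abs_nonneg _).trans (a3.2 0)
  refine ⟨ρ, _, _, _, A0 + A1 + A2 + A3, ⟨c.continuous.measurable, fun x => f.nonneg_normed x, fun x => f.normed_neg x,
    f.integrable_normed, f.integral_normed⟩, d1, d2, d3, c3, fun x => ?_, fun x => ?_, fun x => ?_, fun x => ?_, s0⟩
  · linarith [a0.2 x]
  · linarith [a1.2 x]
  · linarith [a2.2 x]
  · linarith [a3.2 x]

structure BS (q μ M s0 T0 Λ B : ℝ) (j : ℝ → ℝ) (U U1 U2 N : ℝ → ℝ → ℝ) : Prop where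
  ps : PS q μ M s0 T0 U U1 U2 N
  kj : Kern j
  hΛ : 0 ≤ Λ
  hN : ∀ t, N t = nl j Λ (U t)
  hb : ∀ t x, |U t x| ≤ B

theorem beta_id : Beta (fun v => v) (fun _ => 1) (fun _ => 0) 1 where
  d1 v := hasDerivAt_id v
  d2 v := hasDerivAt_const v 1
  c2 := continuous_const
  b1 v := by simp
  b2 v := by simp

section
variable {q μ M s0 T0 Λ B : ℝ} {j : ℝ → ℝ} {U U1 U2 N : ℝ → ℝ → ℝ} {ρ ρ1 ρ2 ρ3 : ℝ → ℝ} {r A : ℝ}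

theorem BS.B0 (h : BS q μ M s0 T0 Λ B j U U1 U2 N) : 0 ≤ B := (abs_nonneg _).trans (h.hb 0 0)

theorem BS.Fl_lip (h : BS q μ M s0 T0 Λ B j U U1 U2 N) (t s x : ℝ) :
    |Fl q (U t x) - Fl q (U s x)| ≤ B ^ (q - 1) * |U t x - U s x| := by
  refine mvt_abs (r := B) (fun v => hasDerivAt_Fl q v h.ps.hq) (fun v hv => ?_) (h.hb _ _) (h.hb _ _)
  rw [abs_of_nonneg (by positivity)]
  exact Real.rpow_le_rpow (abs_nonneg _) hv (by linarith [h.ps.hq])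

theorem BS.Fl_bd (h : BS q μ M s0 T0 Λ B j U U1 U2 N) (t x : ℝ) : |Fl q (U t x)| ≤ B ^ (q - 1) * |U t x| := by
  have := mvt_abs (r := B) (x := 0) (y := U t x) (C := B ^ (q - 1)) (fun v => hasDerivAt_Fl q v h.ps.hq) (fun v hv => ?_) (by simpa using h.B0) (h.hb _ _)
  · simpa [Fl_zero] using this
  · rw [abs_of_nonneg (by positivity)]
    exact Real.rpow_le_rpow (abs_nonneg _) hv (by linarith [h.ps.hq])

theorem BS.Fl_int (h : BS q μ M s0 T0 Λ B j U U1 U2 N) (t : ℝ) : Integrable fun x => Fl q (U t x) :=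
  Integrable.mono' ((h.ps.int t).abs.const_mul _) ((continuous_Fl q h.ps.hq).comp (h.ps.c2 t).c0).aestronglyMeasurable
    (Eventually.of_forall fun x => h.Fl_bd t x)

theorem BS.Fl_l1c (h : BS q μ M s0 T0 Λ B j U U1 U2 N) (t0 : ℝ) :
    Tendsto (fun t => ∫ x, |Fl q (U t x) - Fl q (U t0 x)|) (nhds t0) (nhds 0) := by
  refine squeeze_zero (fun t => integral_nonneg fun x => abs_nonneg _) (fun t => ?_) (by simpa using (h.ps.l1c t0).const_mul (B ^ (q - 1)))
  rw [← integral_const_mul]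
  exact integral_mono ((h.Fl_int t).sub (h.Fl_int t0)).abs ((int_sub_abs h.ps t t0).const_mul _) fun x => h.Fl_lip t t0 x

theorem nl_sub {V W : ℝ → ℝ} (hj : Kern j) (hΛ : 0 ≤ Λ) (hV : Integrable V) (hW : Integrable W) :
    ∫ x, |nl j Λ V x - nl j Λ W x| ≤ 2 * Λ * ∫ x, |V x - W x| := by
  refine le_trans (le_of_eq ?_) (nl_norm hj hΛ (hV.sub hW))
  refine integral_congr_ae ?_
  filter_upwards [cv_ae hj.int hV, cv_ae hj.int hW] with x a b
  have : cv j (fun y => V y - W y) x = cv j V x - cv j W x := by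
    unfold cv; rw [← integral_sub a b]; congr 1; ext y; ring
  simp only [nl, this, Pi.sub_apply]
  congr 1; ring

theorem BS.N_l1c (h : BS q μ M s0 T0 Λ B j U U1 U2 N) (t0 : ℝ) :
    Tendsto (fun t => ∫ x, |N t x - N t0 x|) (nhds t0) (nhds 0) := by
  refine squeeze_zero (fun t => integral_nonneg fun x => abs_nonneg _) (fun t => ?_) (by simpa using (h.ps.l1c t0).const_mul (2 * Λ))
  rw [h.hN, h.hN]
  exact nl_sub h.kj h.hΛ (h.ps.int t) (h.ps.int t0)

theorem cv_bdd {V : ℝ → ℝ} (hj : Kern j) (hV : ∀ x, |V x| ≤ B) (x : ℝ) : |cv j V x| ≤ B := by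
  obtain ⟨a, b⟩ := hj.sh x
  calc |cv j V x| ≤ ∫ y, j (x - y) * B := by
        unfold cv
        rw [← Real.norm_eq_abs]
        refine norm_integral_le_of_norm_le (a.mul_const B) (Eventually.of_forall fun y => ?_)
        rw [Real.norm_eq_abs, abs_mul, abs_of_nonneg (hj.nn _)]
        exact mul_le_mul_of_nonneg_left (hV y) (hj.nn _)
    _ = B := by rw [integral_mul_const, b, one_mul]

theorem BS.N_bd (h : BS q μ M s0 T0 Λ B j U U1 U2 N) (t x : ℝ) : |N t x| ≤ 2 * Λ * B := by
  rw [h.hN, nl, abs_mul, abs_of_nonneg h.hΛ]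
  have := (abs_sub (cv j (U t) x) (U t x)).trans (add_le_add (cv_bdd h.kj (h.hb t) x) (h.hb t x))
  have := mul_le_mul_of_nonneg_left this h.hΛ
  linarith

noncomputable def gg (q μ : ℝ) (ρ1 ρ2 ρ3 : ℝ → ℝ) (V N : ℝ → ℝ) (x : ℝ) : ℝ :=
  cv ρ1 N x - cv ρ2 (fun y => Fl q (V y)) x + μ * cv ρ3 V x

theorem BS.z_eq (h : BS q μ M s0 T0 Λ B j U U1 U2 N) (hm : Mol ρ ρ1 ρ2 ρ3 r A) {s t : ℝ} (hs : s0 ≤ s) (hst : s ≤ t) (ht : t ≤ T0)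
    (x : ℝ) : cv ρ1 (U t) x - cv ρ1 (U s) x = ∫ τ in s..t, gg q μ ρ1 ρ2 ρ3 (U τ) (N τ) x := by
  have c : C2 (fun y => ρ1 (x - y)) (fun y => - ρ2 (x - y)) (fun y => ρ3 (x - y)) := by
    refine ⟨fun y => ?_, fun y => ?_, by have := hm.c3; fun_prop⟩
    · exact ((hm.d2 (x - y)).comp y ((hasDerivAt_id y).const_sub x)).congr_deriv (by ring)
    · exact ((hm.d3 (x - y)).comp y ((hasDerivAt_id y).const_sub x)).neg.congr_deriv (by ring)
  have hB : ∀ y, |ρ1 (x - y)| ≤ A ∧ |-ρ2 (x - y)| ≤ A ∧ |ρ3 (x - y)| ≤ A := fun y =>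
    ⟨hm.b1 _, by rw [abs_neg]; exact hm.b2 _, hm.b3 _⟩
  have g := gw h.ps beta_id rfl c hB hs hst ht
  rw [nu_integral hst (nu_mono hs ht (kdg_int h.ps (by linarith) beta_id rfl c hB))] at g
  have e : ∀ t, ∫ y, U t y * ρ1 (x - y) = cv ρ1 (U t) x := fun t => by
    unfold cv; congr 1; ext y; ring
  rw [e, e] at g
  rw [g]
  congr 1; ext τ
  have := (lin3 (cvi hm.c1 hm.b1 (h.ps.Ni τ) x) (cvi hm.c2 hm.b2 (h.Fl_int τ) x) (cvi hm.c3 hm.b3 (h.ps.int τ) x) 1 (-1) μ).2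
  unfold gg cv
  rw [show ∀ a b c : ℝ, a - b + c = 1 * a + -1 * b + c by intros; ring, ← this]
  congr 1; ext y
  simp only [kdg]; ring

theorem BS.gg_tc (h : BS q μ M s0 T0 Λ B j U U1 U2 N) (hm : Mol ρ ρ1 ρ2 ρ3 r A) (x : ℝ) :
    Continuous fun τ => gg q μ ρ1 ρ2 ρ3 (U τ) (N τ) x := by
  unfold gg
  have a := cv_tc hm.c1 hm.b1 h.ps.Ni h.N_l1c x
  have b := cv_tc (Ut := fun t y => Fl q (U t y)) hm.c2 hm.b2 h.Fl_int h.Fl_l1c x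
  have c := cv_tc hm.c3 hm.b3 h.ps.int h.ps.l1c x
  fun_prop

theorem BS.gg_xc (h : BS q μ M s0 T0 Λ B j U U1 U2 N) (hm : Mol ρ ρ1 ρ2 ρ3 r A) (τ : ℝ) :
    Continuous fun x => gg q μ ρ1 ρ2 ρ3 (U τ) (N τ) x := by
  unfold gg
  have a := cv_cont hm.c1 hm.b1 (h.ps.Ni τ)
  have b := cv_cont hm.c2 hm.b2 (h.Fl_int τ)
  have c := cv_cont hm.c3 hm.b3 (h.ps.int τ)
  fun_prop

theorem BS.gg_bd (h : BS q μ M s0 T0 Λ B j U U1 U2 N) (hm : Mol ρ ρ1 ρ2 ρ3 r A) (τ x : ℝ) :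
    |gg q μ ρ1 ρ2 ρ3 (U τ) (N τ) x| ≤ A * M + A * (B ^ (q - 1) * M) + μ * (A * M) := by
  have A0 : 0 ≤ A := (abs_nonneg _).trans (hm.b0 0)
  have M0 := h.ps.M0
  have a := (cv_bd hm.c1 hm.b1 (h.ps.Ni τ) x).trans (mul_le_mul_of_nonneg_left (h.ps.Nb τ) A0)
  have f : ∫ y, |Fl q (U τ y)| ≤ B ^ (q - 1) * M := by
    calc _ ≤ ∫ y, B ^ (q - 1) * |U τ y| := integral_mono (h.Fl_int τ).abs ((h.ps.int τ).abs.const_mul _) fun y => h.Fl_bd τ y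
      _ ≤ _ := by rw [integral_const_mul]; exact mul_le_mul_of_nonneg_left (h.ps.bd τ) (Real.rpow_nonneg h.B0 _)
  have b := (cv_bd hm.c2 hm.b2 (h.Fl_int τ) x).trans (mul_le_mul_of_nonneg_left f A0)
  have c := mul_le_mul_of_nonneg_left ((cv_bd hm.c3 hm.b3 (h.ps.int τ) x).trans (mul_le_mul_of_nonneg_left (h.ps.bd τ) A0)) h.ps.hμ.le
  unfold gg
  calc _ ≤ |cv ρ1 (N τ) x| + |cv ρ2 (fun y => Fl q (U τ y)) x| + |μ * cv ρ3 (U τ) x| :=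
        (abs_add_le _ _).trans (add_le_add_left (abs_sub _ _) _)
    _ ≤ _ := by rw [abs_mul, abs_of_pos h.ps.hμ]; linarith

theorem BS.z_sq (h : BS q μ M s0 T0 Λ B j U U1 U2 N) (hm : Mol ρ ρ1 ρ2 ρ3 r A) {s t : ℝ} (hs : s0 ≤ s) (hst : s ≤ t) (ht : t ≤ T0)
    (x : ℝ) : cv ρ1 (U t) x ^ 2 - cv ρ1 (U s) x ^ 2 = ∫ τ in s..t, 2 * cv ρ1 (U τ) x * gg q μ ρ1 ρ2 ρ3 (U τ) (N τ) x := by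
  have gc := h.gg_tc hm x
  have zc := cv_tc hm.c1 hm.b1 h.ps.int h.ps.l1c x
  set G := fun τ => gg q μ ρ1 ρ2 ρ3 (U τ) (N τ) x
  set H : ℝ → ℝ := fun τ => cv ρ1 (U s) x + ∫ σ in s..τ, G σ
  have d : ∀ τ, HasDerivAt H (G τ) τ := fun τ =>
    (intervalIntegral.integral_hasDerivAt_right (gc.intervalIntegrable _ _) (gc.stronglyMeasurableAtFilter _ _) gc.continuousAt).const_add _
  have e : ∀ τ ∈ Set.Icc s t, cv ρ1 (U τ) x = H τ := fun τ hτ => by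
    have := h.z_eq hm hs hτ.1 (hτ.2.trans ht) x
    simp only [H, G]; linarith
  have d2 : ∀ τ, HasDerivAt (fun τ => H τ ^ 2) (2 * H τ * G τ) τ := fun τ => by
    refine ((d τ).pow 2).congr_deriv (by norm_num)
  have Hc : Continuous H := continuous_iff_continuousAt.2 fun τ => (d τ).continuousAt
  have := intervalIntegral.integral_eq_sub_of_hasDerivAt (a := s) (b := t) (fun τ _ => d2 τ) ((by fun_prop : Continuous fun τ => 2 * H τ * G τ).intervalIntegrable _ _)
  rw [e t ⟨hst, le_rfl⟩, e s ⟨le_rfl, hst⟩, ← this]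
  refine intervalIntegral.integral_congr fun τ hτ => ?_
  rw [Set.uIcc_of_le hst] at hτ
  simp only [e τ hτ, G]

theorem BS.z_int (h : BS q μ M s0 T0 Λ B j U U1 U2 N) (hm : Mol ρ ρ1 ρ2 ρ3 r A) (s t : ℝ) :
    Integrable (fun p : ℝ × ℝ => 2 * cv ρ1 (U p.1) p.2 * gg q μ ρ1 ρ2 ρ3 (U p.1) (N p.1) p.2) (nu s t) := by
  have A0 : 0 ≤ A := (abs_nonneg _).trans (hm.b0 0)
  have m1 : Measurable fun p : ℝ × ℝ => cv ρ1 (U p.1) p.2 :=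
    measurable_uncurry_of_continuous_of_measurable (u := fun t x => cv ρ1 (U t) x) (fun x => cv_tc hm.c1 hm.b1 h.ps.int h.ps.l1c x)
      (fun t => (cv_cont hm.c1 hm.b1 (h.ps.int t)).measurable)
  have m2 : Measurable fun p : ℝ × ℝ => gg q μ ρ1 ρ2 ρ3 (U p.1) (N p.1) p.2 :=
    measurable_uncurry_of_continuous_of_measurable (u := fun t x => gg q μ ρ1 ρ2 ρ3 (U t) (N t) x) (fun x => h.gg_tc hm x)
      (fun t => (h.gg_xc hm t).measurable)
  have zi : ∀ τ, Integrable (cv ρ1 (U τ)) := fun τ => cv_int hm.i1 (h.ps.int τ)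
  set K := A * M + A * (B ^ (q - 1) * M) + μ * (A * M)
  have K0 : 0 ≤ K := (abs_nonneg _).trans (h.gg_bd hm 0 0)
  have pb : ∀ τ x, |2 * cv ρ1 (U τ) x * gg q μ ρ1 ρ2 ρ3 (U τ) (N τ) x| ≤ (2 * K) * |cv ρ1 (U τ) x| := fun τ x => by
    rw [abs_mul, abs_mul, abs_two]
    have := mul_le_mul_of_nonneg_left (h.gg_bd hm τ x) (abs_nonneg (cv ρ1 (U τ) x))
    nlinarith
  have ii : ∀ τ, Integrable fun x => 2 * cv ρ1 (U τ) x * gg q μ ρ1 ρ2 ρ3 (U τ) (N τ) x := fun τ =>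
    Integrable.mono' ((zi τ).abs.const_mul (2 * K)) (by
      have := cv_cont hm.c1 hm.b1 (h.ps.int τ)
      have := h.gg_xc hm τ
      exact (by fun_prop : Continuous fun x => 2 * cv ρ1 (U τ) x * gg q μ ρ1 ρ2 ρ3 (U τ) (N τ) x).aestronglyMeasurable)
      (Eventually.of_forall fun x => pb τ x)
  refine nu_int_of_bd (M := 2 * K * ((∫ x, |ρ1 x|) * M)) ((m1.const_mul 2).mul m2) ii fun τ => ?_
  calc _ ≤ ∫ x, (2 * K) * |cv ρ1 (U τ) x| := integral_mono (ii τ).abs ((zi τ).abs.const_mul _) (pb τ)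
    _ = (2 * K) * ∫ x, |cv ρ1 (U τ) x| := integral_const_mul _ _
    _ ≤ (2 * K) * ((∫ x, |ρ1 x|) * ∫ x, |U τ x|) := by gcongr; exact cv_norm hm.i1 (h.ps.int τ)
    _ ≤ _ := by gcongr; exact h.ps.bd τ

end

section
variable {q μ M s0 T0 Λ B : ℝ} {j : ℝ → ℝ} {U U1 U2 N : ℝ → ℝ → ℝ} {ρ ρ1 ρ2 ρ3 : ℝ → ℝ} {r A : ℝ}

noncomputable def ff (q : ℝ) (V V1 N : ℝ → ℝ) (x : ℝ) : ℝ := N x - |V x| ^ (q - 1) * V1 x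

theorem cv_ibp {G G1 : ℝ → ℝ} (hm : Mol ρ ρ1 ρ2 ρ3 r A) (hd : ∀ x, HasDerivAt G (G1 x) x) (hc : Continuous G1) (x : ℝ) :
    cv ρ1 G x = cv ρ G1 x ∧ Integrable fun y => ρ (x - y) * G1 y := by
  have d : ∀ y, HasDerivAt (fun y => ρ (x - y) * G y) (-ρ1 (x - y) * G y + ρ (x - y) * G1 y) y := fun y =>
    (((hm.d1 (x - y)).comp y ((hasDerivAt_id y).const_sub x)).mul (hd y)).congr_deriv (by simp)
  have Gc : Continuous G := continuous_iff_continuousAt.2 fun x => (hd x).continuousAt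
  have h0 := hm.c0
  have h1 := hm.c1
  have far : ∀ y, r + |x| < |y| → r < |x - y| := fun y hy => by
    have := abs_sub_abs_le_abs_sub y x
    rw [abs_sub_comm] at this; linarith
  have z := ibp0 (r := r + |x|) d (by fun_prop) (fun y hy => by rw [hm.s0 _ (far y hy), zero_mul])
  have i1 : Integrable fun y => ρ1 (x - y) * G y :=
    int_of_supp (r := r + |x|) (by fun_prop) (fun y hy => by rw [hm.s1 _ (far y hy), zero_mul])
  have i2 : Integrable fun y => ρ (x - y) * G1 y :=
    int_of_supp (r := r + |x|) (by fun_prop) (fun y hy => by rw [hm.s0 _ (far y hy), zero_mul])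
  refine ⟨?_, i2⟩
  have e := (lin2 i1 i2 (-1) 1).2
  have : ∫ y, (-ρ1 (x - y) * G y + ρ (x - y) * G1 y) = ∫ y, (-1 * (ρ1 (x - y) * G y) + 1 * (ρ (x - y) * G1 y)) := by
    congr 1; ext y; ring
  rw [this, e] at z
  unfold cv; linarith

theorem BS.ff_bd (h : BS q μ M s0 T0 Λ B j U U1 U2 N) (τ x : ℝ) :
    ff q (U τ) (U1 τ) (N τ) x ^ 2 ≤ 4 * Λ * B * |N τ x| + 2 * (1 + B ^ 2) ^ 2 * ge (U τ) (U1 τ) x := by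
  have n : N τ x ^ 2 ≤ 2 * Λ * B * |N τ x| := by
    rw [← sq_abs, sq]; exact mul_le_mul_of_nonneg_right (h.N_bd τ x) (abs_nonneg _)
  have ub : U τ x ^ 2 ≤ B ^ 2 := by
    rw [← sq_abs]; exact pow_le_pow_left₀ (abs_nonneg _) (h.hb τ x) 2
  have p : (|U τ x| ^ (q - 1)) ^ 2 ≤ 1 + B ^ 2 := by
    have := rpow_le_one_add_sq (q := 2 * (q - 1)) (by linarith [h.ps.hq]) (by linarith [h.ps.hq2]) (U τ x)
    rw [← Real.rpow_natCast, ← Real.rpow_mul (abs_nonneg _), mul_comm (q - 1)]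
    push_cast; linarith
  have g : U1 τ x ^ 2 ≤ (1 + B ^ 2) * ge (U τ) (U1 τ) x := by
    have e : U1 τ x ^ 2 = (1 + U τ x ^ 2) * (U1 τ x ^ 2 / (1 + U τ x ^ 2)) := by field_simp
    rw [e]; unfold ge
    gcongr
    nlinarith [sq_nonneg (U τ x)]
  have pg := mul_le_mul p g (sq_nonneg _) (by positivity)
  unfold ff
  nlinarith [sq_nonneg (N τ x + |U τ x| ^ (q - 1) * U1 τ x)]

theorem BS.tau_bd (h : BS q μ M s0 T0 Λ B j U U1 U2 N) (hm : Mol ρ ρ1 ρ2 ρ3 r A) (τ : ℝ) (hg : Integrable (ge (U τ) (U1 τ))) :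
    ∫ x, 2 * cv ρ1 (U τ) x * gg q μ ρ1 ρ2 ρ3 (U τ) (N τ) x
      ≤ 1 / (2 * μ) * ∫ x, (4 * Λ * B * |N τ x| + 2 * (1 + B ^ 2) ^ 2 * ge (U τ) (U1 τ) x) := by
  have hμ := h.ps.hμ
  set V := U τ with hV
  have iV := h.ps.int τ
  have iN := h.ps.Ni τ
  have iF := h.Fl_int τ
  have cV := (h.ps.c2 τ).c0
  have cV1 := (h.ps.c2 τ).c1
  set FV : ℝ → ℝ := fun y => Fl q (U τ y) with hFV
  have ca := continuous_absrpow (q - 1) (by linarith [h.ps.hq])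
  have dF : ∀ x, HasDerivAt FV (|U τ x| ^ (q - 1) * U1 τ x) x := fun x =>
    (hasDerivAt_Fl q (U τ x) h.ps.hq).comp x ((h.ps.c2 τ).d1 x)
  have cF1 : Continuous fun x => |U τ x| ^ (q - 1) * U1 τ x := (ca.comp cV).mul cV1
  -- m
  set m : ℝ → ℝ := fun x => cv ρ (N τ) x - cv ρ1 FV x with hmdef
  have dm : ∀ x, HasDerivAt m (cv ρ1 (N τ) x - cv ρ2 FV x) x := fun x =>
    (cv_deriv hm.d1 hm.c1 hm.b0 hm.b1 iN x).sub (cv_deriv hm.d2 hm.c2 hm.b1 hm.b2 iF x)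
  have em : ∀ x, m x = cv ρ (ff q (U τ) (U1 τ) (N τ)) x := fun x => by
    obtain ⟨e, i⟩ := cv_ibp hm dF cF1 x
    simp only [hmdef]
    rw [e]
    unfold cv
    rw [← integral_sub (cvi hm.c0 hm.b0 iN x) i]
    congr 1; ext y; simp only [ff]; ring
  have fm : AEStronglyMeasurable (ff q (U τ) (U1 τ) (N τ)) := iN.aestronglyMeasurable.sub cF1.aestronglyMeasurable
  have ib := (lin2 iN.abs hg (4 * Λ * B) (2 * (1 + B ^ 2) ^ 2)).1
  have fi : Integrable fun x => ff q (U τ) (U1 τ) (N τ) x ^ 2 :=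
    Integrable.mono' ib (fm.pow 2) (Eventually.of_forall fun x => by
      rw [Real.norm_eq_abs, abs_of_nonneg (sq_nonneg _)]; exact h.ff_bd τ x)
  obtain ⟨mi, mb⟩ := cv_jensen hm.k fm fi
  simp only [← em] at mi mb
  have fb : ∫ x, m x ^ 2 ≤ ∫ x, (4 * Λ * B * |N τ x| + 2 * (1 + B ^ 2) ^ 2 * ge (U τ) (U1 τ) x) :=
    mb.trans (integral_mono fi ib fun x => h.ff_bd τ x)
  -- integrations by parts
  have iz1 := cv_int hm.i1 iV
  have iz2 := cv_int hm.i2 iV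
  have iz3 := cv_int hm.i3 iV
  have cz1 := cv_cont hm.c1 hm.b1 iV
  have cz2 := cv_cont hm.c2 hm.b2 iV
  have im := (cv_int hm.k.int iN).sub (cv_int hm.i1 iF)
  have im1 := (cv_int hm.i1 iN).sub (cv_int hm.i2 iF)
  have bz1 := cv_bd hm.c1 hm.b1 iV
  have bz2 := cv_bd hm.c2 hm.b2 iV
  have j1 : Integrable (cv ρ1 V * cv ρ3 V) := iz3.bdd_mul cz1.aestronglyMeasurable (Eventually.of_forall bz1)
  have j2 : Integrable (cv ρ2 V * cv ρ2 V) := iz2.bdd_mul cz2.aestronglyMeasurable (Eventually.of_forall bz2)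
  have j3 : Integrable (cv ρ1 V * cv ρ2 V) := iz2.bdd_mul cz1.aestronglyMeasurable (Eventually.of_forall bz1)
  have j4 : Integrable (cv ρ1 V * fun x => cv ρ1 (N τ) x - cv ρ2 FV x) := im1.bdd_mul cz1.aestronglyMeasurable (Eventually.of_forall bz1)
  have j5 : Integrable (cv ρ2 V * m) := im.bdd_mul cz2.aestronglyMeasurable (Eventually.of_forall bz2)
  have j6 : Integrable (cv ρ1 V * m) := im.bdd_mul cz1.aestronglyMeasurable (Eventually.of_forall bz1)
  have p1 := integral_mul_deriv_eq_deriv_mul_of_integrable (fun x _ => cv_deriv hm.d2 hm.c2 hm.b1 hm.b2 iV x)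
    (fun x _ => cv_deriv hm.d3 hm.c3 hm.b2 hm.b3 iV x) j1 j2 j3
  have p2 := integral_mul_deriv_eq_deriv_mul_of_integrable (fun x _ => cv_deriv hm.d2 hm.c2 hm.b1 hm.b2 iV x)
    (fun x _ => dm x) j4 j5 j6
  have e1 : ∫ x, 2 * cv ρ1 V x * gg q μ ρ1 ρ2 ρ3 V (N τ) x
      = 2 * μ * (∫ x, cv ρ1 V x * cv ρ3 V x) + 2 * ∫ x, cv ρ1 V x * (cv ρ1 (N τ) x - cv ρ2 FV x) := by
    rw [← (lin2 (f := fun x => cv ρ1 V x * cv ρ3 V x) (g := fun x => cv ρ1 V x * (cv ρ1 (N τ) x - cv ρ2 FV x)) j1 j4 (2 * μ) 2).2]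
    congr 1; ext x; simp only [gg, hFV]; ring
  have e2 : -(2 * μ) * (∫ x, cv ρ2 V x * cv ρ2 V x) + (-2) * ∫ x, cv ρ2 V x * m x ≤ 1 / (2 * μ) * ∫ x, m x ^ 2 := by
    rw [← (lin2 (f := fun x => cv ρ2 V x * cv ρ2 V x) (g := fun x => cv ρ2 V x * m x) j2 j5 (-(2 * μ)) (-2)).2, ← integral_const_mul]
    refine integral_mono (lin2 (f := fun x => cv ρ2 V x * cv ρ2 V x) (g := fun x => cv ρ2 V x * m x) j2 j5 (-(2 * μ)) (-2)).1 (mi.const_mul _) fun x => ?_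
    simp only
    have : 0 ≤ 1 / (2 * μ) * (2 * μ * cv ρ2 V x + m x) ^ 2 := by positivity
    have e : 1 / (2 * μ) * (2 * μ * cv ρ2 V x + m x) ^ 2 = 2 * μ * (cv ρ2 V x * cv ρ2 V x) + 2 * (cv ρ2 V x * m x) + 1 / (2 * μ) * m x ^ 2 := by
      field_simp; ring
    linarith
  have e3 : 1 / (2 * μ) * ∫ x, m x ^ 2 ≤ 1 / (2 * μ) * ∫ x, (4 * Λ * B * |N τ x| + 2 * (1 + B ^ 2) ^ 2 * ge (U τ) (U1 τ) x) := by
    gcongr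
  rw [e1, p1, p2]
  linarith

/-- uniform H¹-type estimate -/
theorem BS.H1 (h : BS q μ M s0 T0 Λ B j U U1 U2 N) (h1 : Integrable fun x => U1 s0 x ^ 2) :
    ∃ K, ∀ (ρ ρ1 ρ2 ρ3 : ℝ → ℝ) (r A : ℝ), Mol ρ ρ1 ρ2 ρ3 r A → ∀ t ∈ Set.Icc s0 T0,
      (Integrable fun x => cv ρ1 (U t) x ^ 2) ∧ ∫ x, cv ρ1 (U t) x ^ 2 ≤ K := by
  have hμ := h.ps.hμ
  set D : ℝ × ℝ → ℝ := fun p => 4 * Λ * B * |N p.1 p.2| + 2 * (1 + B ^ 2) ^ 2 * ge (U p.1) (U1 p.1) p.2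
  have D0 : ∀ p, 0 ≤ D p := fun p => by
    have := h.hΛ; have := h.B0; have := ge_nn (U p.1) (U1 p.1) p.2
    positivity
  refine ⟨(∫ x, U1 s0 x ^ 2) + 1 / (2 * μ) * ∫ p, D p ∂(nu s0 T0), fun ρ ρ1 ρ2 ρ3 r A hm t ht => ?_⟩
  have h00 : s0 ≤ T0 := ht.1.trans ht.2
  have Di : Integrable D (nu s0 T0) := by
    have a : Integrable (fun p : ℝ × ℝ => |N p.1 p.2|) (nu s0 T0) :=
      nu_int_of_bd (M := M) h.ps.Nm.abs (fun τ => (h.ps.Ni τ).abs) (fun τ => by simpa using h.ps.Nb τ)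
    exact (lin2 a (ge_int h.ps h00) _ _).1
  have isq : ∀ t, Integrable fun x => cv ρ1 (U t) x ^ 2 := fun t => by
    simp only [sq]
    exact (cv_int hm.i1 (h.ps.int t)).bdd_mul (cv_cont hm.c1 hm.b1 (h.ps.int t)).aestronglyMeasurable
      (Eventually.of_forall (cv_bd hm.c1 hm.b1 (h.ps.int t)))
  refine ⟨isq t, ?_⟩
  have st : ∫ x, cv ρ1 (U s0) x ^ 2 ≤ ∫ x, U1 s0 x ^ 2 := by
    have e : ∀ x, cv ρ1 (U s0) x = cv ρ (U1 s0) x := fun x => (cv_ibp hm (h.ps.c2 s0).d1 (h.ps.c2 s0).c1 x).1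
    simp only [e]
    exact (cv_jensen hm.k (h.ps.c2 s0).c1.aestronglyMeasurable h1).2
  have zi := h.z_int hm s0 t
  have e : (∫ x, cv ρ1 (U t) x ^ 2) - ∫ x, cv ρ1 (U s0) x ^ 2
      = ∫ p, 2 * cv ρ1 (U p.1) p.2 * gg q μ ρ1 ρ2 ρ3 (U p.1) (N p.1) p.2 ∂(nu s0 t) := by
    rw [← integral_sub (isq t) (isq s0)]
    simp only [h.z_sq hm le_rfl ht.1 ht.2]
    unfold nu at zi ⊢
    rw [integral_prod_symm _ zi]
    congr 1; ext x
    rw [intervalIntegral.integral_of_le ht.1, integral_Icc_eq_integral_Ioc]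
  have b : ∫ p, 2 * cv ρ1 (U p.1) p.2 * gg q μ ρ1 ρ2 ρ3 (U p.1) (N p.1) p.2 ∂(nu s0 t) ≤ 1 / (2 * μ) * ∫ p, D p ∂(nu s0 t) := by
    have Di2 := nu_mono le_rfl ht.2 Di
    have gi := nu_mono le_rfl ht.2 (ge_int h.ps h00)
    unfold nu at *
    rw [integral_prod _ zi, integral_prod _ Di2, ← integral_const_mul]
    refine integral_mono_ae zi.integral_prod_left (Di2.integral_prod_left.const_mul _) ?_
    filter_upwards [gi.prod_right_ae] with τ hτ
    exact h.tau_bd hm τ hτ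
  have c : ∫ p, D p ∂(nu s0 t) ≤ ∫ p, D p ∂(nu s0 T0) := by
    refine integral_mono_measure ?_ (Eventually.of_forall D0) Di
    unfold nu
    exact Measure.prod_mono (Measure.restrict_mono (Set.Icc_subset_Icc le_rfl ht.2) le_rfl) le_rfl
  have c' : 1 / (2 * μ) * ∫ p, D p ∂(nu s0 t) ≤ 1 / (2 * μ) * ∫ p, D p ∂(nu s0 T0) := by gcongr
  linarith
end

section
variable {q μ M s0 T0 Λ B : ℝ} {j : ℝ → ℝ} {U U1 U2 N : ℝ → ℝ → ℝ} {ρ ρ1 ρ2 ρ3 : ℝ → ℝ} {r A : ℝ}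

theorem cv_near {V : ℝ → ℝ} (hm : Mol ρ ρ1 ρ2 ρ3 r A) (hV : Integrable V) {x ε : ℝ}
    (hx : ∀ y, |y - x| ≤ r → |V y - V x| ≤ ε) : |cv ρ V x - V x| ≤ ε := by
  obtain ⟨a, b⟩ := hm.k.sh x
  have e : cv ρ V x - V x = ∫ y, ρ (x - y) * (V y - V x) := by
    simp only [mul_sub]
    rw [integral_sub (cvi hm.c0 hm.b0 hV x) (a.mul_const _), integral_mul_const, b, one_mul]; rfl
  rw [e, ← Real.norm_eq_abs]
  calc _ ≤ ∫ y, ρ (x - y) * ε := by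
        refine norm_integral_le_of_norm_le (a.mul_const ε) (Eventually.of_forall fun y => ?_)
        rw [Real.norm_eq_abs, abs_mul, abs_of_nonneg (hm.k.nn _)]
        rcases le_or_gt |x - y| r with h | h
        · exact mul_le_mul_of_nonneg_left (hx y (by rwa [abs_sub_comm])) (hm.k.nn _)
        · rw [hm.s0 _ h]; simp
    _ = ε := by rw [integral_mul_const, b, one_mul]

theorem BS.holder (h : BS q μ M s0 T0 Λ B j U U1 U2 N) (h1 : Integrable fun x => U1 s0 x ^ 2) :
    ∃ K, 0 < K ∧ ∀ t ∈ Set.Icc s0 T0, ∀ x y, |U t x - U t y| ≤ K * Real.sqrt |x - y| := by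
  obtain ⟨K0, hK⟩ := h.H1 h1
  obtain ⟨ρ, ρ1, ρ2, ρ3, A, hm⟩ := exists_mol
  refine ⟨|K0| + 1, by positivity, fun t ht => ?_⟩
  suffices ∀ x y, x < y → |U t x - U t y| ≤ (|K0| + 1) * Real.sqrt (y - x) by
    intro x y
    rcases lt_trichotomy x y with g | rfl | g
    · rw [abs_sub_comm x y, abs_of_pos (sub_pos.2 g)]; exact this x y g
    · simp
    · rw [abs_of_pos (sub_pos.2 g), abs_sub_comm]; exact this y x g
  intro x y hxy
  have hyx : 0 < y - x := sub_pos.2 hxy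
  set w := Real.sqrt (y - x)
  have w0 : 0 < w := Real.sqrt_pos.2 hyx
  have ww : w * w = y - x := Real.mul_self_sqrt hyx.le
  have cU := (h.ps.c2 t).c0
  refine le_of_forall_pos_le_add fun ε hε => ?_
  obtain ⟨d1, hd1, k1⟩ := Metric.continuousAt_iff.1 (cU.continuousAt (x := x)) (ε / 2) (by positivity)
  obtain ⟨d2, hd2, k2⟩ := Metric.continuousAt_iff.1 (cU.continuousAt (x := y)) (ε / 2) (by positivity)
  obtain ⟨δ, hδ, hδ'⟩ : ∃ δ, 0 < δ ∧ δ < min d1 d2 := exists_between (by positivity)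
  obtain ⟨A', hm'⟩ := hm.scale hδ
  obtain ⟨zi, zb⟩ := hK _ _ _ _ _ _ hm' t ht
  set σ : ℝ → ℝ := fun x => ρ (x / δ) / δ
  set σ1 : ℝ → ℝ := fun x => ρ1 (x / δ) / δ / δ
  have n1 : |cv σ (U t) x - U t x| ≤ ε / 2 := cv_near hm' (h.ps.int t) fun z hz => by
    have := k1 (x := z) (by rw [Real.dist_eq]; linarith [min_le_left d1 d2])
    rw [Real.dist_eq] at this; exact this.le
  have n2 : |cv σ (U t) y - U t y| ≤ ε / 2 := cv_near hm' (h.ps.int t) fun z hz => by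
    have := k2 (x := z) (by rw [Real.dist_eq]; linarith [min_le_right d1 d2])
    rw [Real.dist_eq] at this; exact this.le
  have zc := cv_cont hm'.c1 hm'.b1 (h.ps.int t)
  have ft := intervalIntegral.integral_eq_sub_of_hasDerivAt (a := x) (b := y)
    (fun z _ => cv_deriv hm'.d1 hm'.c1 hm'.b0 hm'.b1 (h.ps.int t) z) (zc.intervalIntegrable _ _)
  have b : |cv σ (U t) y - cv σ (U t) x| ≤ (|K0| + 1) * w := by
    rw [← ft]
    calc _ ≤ ∫ z in x..y, |cv σ1 (U t) z| := intervalIntegral.abs_integral_le_integral_abs hxy.le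
      _ ≤ ∫ z in x..y, (1 / w + w * cv σ1 (U t) z ^ 2) := by
          refine intervalIntegral.integral_mono_on hxy.le (zc.abs.intervalIntegrable _ _) ((by fun_prop : Continuous fun z => (1 / w + w * cv σ1 (U t) z ^ 2)).intervalIntegrable _ _) fun z _ => ?_
          have : 0 ≤ 1 / w * (1 - w * |cv σ1 (U t) z|) ^ 2 := by positivity
          have e : 1 / w * (1 - w * |cv σ1 (U t) z|) ^ 2 = 1 / w - 2 * |cv σ1 (U t) z| + w * |cv σ1 (U t) z| ^ 2 := by field_simp; ring
          rw [e, sq_abs] at this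
          linarith [abs_nonneg (cv σ1 (U t) z)]
      _ = (y - x) * (1 / w) + w * ∫ z in x..y, cv σ1 (U t) z ^ 2 := by
          rw [intervalIntegral.integral_add (by simp) ((by fun_prop : Continuous fun z => w * cv σ1 (U t) z ^ 2).intervalIntegrable _ _),
            intervalIntegral.integral_const_mul]; simp
      _ ≤ w + w * |K0| := by
          have : ∫ z in x..y, cv σ1 (U t) z ^ 2 ≤ |K0| := by
            rw [intervalIntegral.integral_of_le hxy.le]
            exact (setIntegral_le_integral zi (Eventually.of_forall fun z => sq_nonneg _)).trans (zb.trans (le_abs_self _))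
          have e : (y - x) * (1 / w) = w := by rw [← ww]; field_simp
          rw [e]; gcongr
      _ = _ := by ring
  rw [abs_le] at n1 n2 b ⊢
  constructor <;> linarith [n1.1, n1.2, n2.1, n2.2, b.1, b.2]

theorem sup_of_L1 {w : ℝ → ℝ} {K : ℝ} (hK : 0 < K) (hc : Continuous w) (hi : Integrable w)
    (hh : ∀ x y, |w x - w y| ≤ K * Real.sqrt |x - y|) (x : ℝ) :
    |w x| ^ 3 ≤ 4 * K ^ 2 * ∫ y in Set.Icc (x - (|w x| / (2 * K)) ^ 2) (x + (|w x| / (2 * K)) ^ 2), |w y| := by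
  set d := |w x|
  have d0 : 0 ≤ d := abs_nonneg _
  set l := (d / (2 * K)) ^ 2
  have l0 : 0 ≤ l := sq_nonneg _
  have : ∫ y in Set.Icc (x - l) (x + l), d / 2 ≤ ∫ y in Set.Icc (x - l) (x + l), |w y| := by
    refine setIntegral_mono_on (by simp) hi.abs.integrableOn measurableSet_Icc fun y hy => ?_
    have a := hh x y
    have b : Real.sqrt |x - y| ≤ d / (2 * K) := by
      rw [Real.sqrt_le_left (by positivity)]
      rw [abs_le]; constructor <;> linarith [hy.1, hy.2]
    have c : K * Real.sqrt |x - y| ≤ d / 2 := by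
      calc _ ≤ K * (d / (2 * K)) := by gcongr
        _ = d / 2 := by field_simp
    have := abs_sub_abs_le_abs_sub (w x) (w y)
    linarith
  rw [setIntegral_const, measureReal_def, Real.volume_Icc, ENNReal.toReal_ofReal (by linarith)] at this
  simp only [smul_eq_mul] at this
  calc d ^ 3 = 4 * K ^ 2 * ((x + l - (x - l)) * (d / 2)) := by simp only [l]; field_simp; ring
    _ ≤ _ := by gcongr

theorem sup_of_L1' {w : ℝ → ℝ} {K : ℝ} (hK : 0 < K) (hc : Continuous w) (hi : Integrable w)
    (hh : ∀ x y, |w x - w y| ≤ K * Real.sqrt |x - y|) (x : ℝ) : |w x| ^ 3 ≤ 4 * K ^ 2 * ∫ y, |w y| :=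
  (sup_of_L1 hK hc hi hh x).trans (mul_le_mul_of_nonneg_left
    (setIntegral_le_integral hi.abs (Eventually.of_forall fun y => abs_nonneg _)) (by positivity))

structure UC (s0 T0 : ℝ) (U : ℝ → ℝ → ℝ) : Prop where
  uni : ∀ t0 ∈ Set.Icc s0 T0, ∀ ε > 0, ∀ᶠ t in nhdsWithin t0 (Set.Icc s0 T0), ∀ x, |U t x - U t0 x| ≤ ε
  dec : ∀ t ∈ Set.Icc s0 T0, ∀ ε > 0, ∃ R, ∀ x, R < |x| → |U t x| ≤ ε

theorem BS.uc (h : BS q μ M s0 T0 Λ B j U U1 U2 N) (h1 : Integrable fun x => U1 s0 x ^ 2) : UC s0 T0 U := by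
  obtain ⟨K, hK, hh⟩ := h.holder h1
  refine ⟨fun t0 ht0 ε hε => ?_, fun t ht ε hε => ?_⟩
  · have l := ((h.ps.l1c t0).const_mul (4 * (2 * K) ^ 2)).mono_left (nhdsWithin_le_nhds (s := Set.Icc s0 T0))
    rw [mul_zero] at l
    filter_upwards [l.eventually_lt_const (show (0:ℝ) < ε ^ 3 by positivity), self_mem_nhdsWithin] with t a ht x
    have := sup_of_L1' (w := fun x => U t x - U t0 x) (K := 2 * K) (by positivity) ((h.ps.c2 t).c0.sub (h.ps.c2 t0).c0)
      ((h.ps.int t).sub (h.ps.int t0)) (fun x y => by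
        have a := hh t ht x y
        have b := hh t0 ht0 x y
        rw [sub_sub_sub_comm]
        exact (abs_sub _ _).trans (by linarith)) x
    exact (lt_of_pow_lt_pow_left₀ 3 hε.le (this.trans_lt a)).le
  · set L := (B / (2 * K)) ^ 2
    have tl : Tendsto (fun R : ℝ => ∫ y in {y : ℝ | R ≤ |y|}, |U t y|) atTop (nhds 0) := by
      have hi := (h.ps.int t).abs
      have := tendsto_setIntegral_of_antitone (μ := volume) (f := fun y => |U t y|) (s := fun R : ℝ => {y : ℝ | R ≤ |y|})
        (fun R => (measurableSet_le measurable_const measurable_id.abs)) (fun a b hab y hy => le_trans hab hy) ⟨0, hi.integrableOn⟩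
      have e : (⋂ R : ℝ, {y : ℝ | R ≤ |y|}) = ∅ := by
        ext y; simp only [Set.mem_iInter, Set.mem_setOf_eq, Set.mem_empty_iff_false, iff_false, not_forall, not_le]
        exact ⟨|y| + 1, by linarith⟩
      rw [e] at this; simpa using this
    have tl2 := tl.const_mul (4 * K ^ 2)
    rw [mul_zero] at tl2
    obtain ⟨R, hR⟩ := (tl2.eventually_lt_const (show (0:ℝ) < ε ^ 3 by positivity)).exists
    refine ⟨R + L, fun x hx => ?_⟩
    have := sup_of_L1 hK (h.ps.c2 t).c0 (h.ps.int t) (hh t ht) x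
    have sub : ∫ y in Set.Icc (x - (|U t x| / (2 * K)) ^ 2) (x + (|U t x| / (2 * K)) ^ 2), |U t y| ≤ ∫ y in {y : ℝ | R ≤ |y|}, |U t y| := by
      refine setIntegral_mono_set (h.ps.int t).abs.integrableOn (Eventually.of_forall fun y => abs_nonneg _) (HasSubset.Subset.eventuallyLE fun y hy => ?_)
      have l : (|U t x| / (2 * K)) ^ 2 ≤ L := by
        simp only [L]; gcongr; exact h.hb t x
      have : |x - y| ≤ L := by rw [abs_le]; constructor <;> linarith [hy.1, hy.2]
      have := abs_sub_abs_le_abs_sub x y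
      show R ≤ |y|
      linarith
    have : |U t x| ^ 3 < ε ^ 3 := this.trans_lt (lt_of_le_of_lt (mul_le_mul_of_nonneg_left sub (by positivity)) hR)
    exact (lt_of_pow_lt_pow_left₀ 3 hε.le this).le

theorem UC.cont (h : UC s0 T0 U) (hc : ∀ t, Continuous (U t)) : ContinuousOn (fun p : ℝ × ℝ => U p.1 p.2) (Set.Icc s0 T0 ×ˢ Set.univ) := by
  rintro ⟨t0, x0⟩ ⟨ht, -⟩
  rw [ContinuousWithinAt, Metric.tendsto_nhds]
  intro ε hε
  rw [nhdsWithin_prod_eq, nhdsWithin_univ]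
  have a := h.uni t0 ht (ε / 3) (by positivity)
  have b := Metric.continuousAt_iff'.1 ((hc t0).continuousAt (x := x0)) (ε / 3) (by positivity)
  filter_upwards [a.prod_mk b] with p hp
  have h1 := hp.1 p.2
  have h2 := hp.2
  rw [Real.dist_eq] at *
  have := abs_add_le (U p.1 p.2 - U t0 p.2) (U t0 p.2 - U t0 x0)
  rw [sub_add_sub_cancel] at this
  linarith

theorem UC.udec (h : UC s0 T0 U) {ε : ℝ} (hε : 0 < ε) : ∃ R, ∀ t ∈ Set.Icc s0 T0, ∀ x, R < |x| → |U t x| ≤ ε := by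
  refine (isCompact_Icc (a := s0) (b := T0)).induction_on (p := fun S => ∃ R, ∀ t ∈ S, ∀ x, R < |x| → |U t x| ≤ ε) ⟨0, by simp⟩ ?_ ?_ ?_
  · rintro S S' hS ⟨R, hR⟩
    exact ⟨R, fun t ht => hR t (hS ht)⟩
  · rintro S S' ⟨R, hR⟩ ⟨R', hR'⟩
    refine ⟨max R R', fun t ht x hx => ?_⟩
    rcases ht with ht | ht
    · exact hR t ht x ((le_max_left _ _).trans_lt hx)
    · exact hR' t ht x ((le_max_right _ _).trans_lt hx)
  · intro t0 ht0
    obtain ⟨R, hR⟩ := h.dec t0 ht0 (ε / 2) (by positivity)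
    refine ⟨_, h.uni t0 ht0 (ε / 2) (by positivity), R, fun t ht x hx => ?_⟩
    have := abs_add_le (U t x - U t0 x) (U t0 x)
    rw [sub_add_cancel] at this
    linarith [ht x, hR x hx]
end

theorem rpow_shift_le {a c ε θ : ℝ} (hc : 0 ≤ c) (hca : c ≤ a) (hε : 0 < ε) (h0 : 0 < θ) (h1 : θ ≤ 1) :
    (a + ε) ^ θ - (c + ε) ^ θ ≤ a ^ θ - c ^ θ := by
  have cc := Real.concaveOn_rpow h0.le h1
  set s := (a - c) / (a - c + ε) with hs
  have hd : 0 < a - c + ε := by linarith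
  have s0 : 0 ≤ s := div_nonneg (by linarith) hd.le
  have s1 : 0 ≤ 1 - s := by
    rw [sub_nonneg, hs, div_le_one hd]; linarith
  have sd : s * (a - c + ε) = a - c := div_mul_cancel₀ _ hd.ne'
  have e1 := cc.2 (Set.mem_Ici.2 hc) (Set.mem_Ici.2 (by linarith : 0 ≤ a + ε)) s1 s0 (by ring)
  have e2 := cc.2 (Set.mem_Ici.2 hc) (Set.mem_Ici.2 (by linarith : 0 ≤ a + ε)) s0 s1 (by ring)
  simp only [smul_eq_mul] at e1 e2
  rw [show (1 - s) * c + s * (a + ε) = a by linear_combination sd] at e1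
  rw [show s * c + (1 - s) * (a + ε) = c + ε by linear_combination -sd] at e2
  linarith

theorem rpow_nl {A B C D θ : ℝ} (hA : 0 < A) (hB : 0 < B) (hC : 0 < C) (hD : 0 < D) (h0 : 0 < θ) (h1 : θ ≤ 1)
    (hCA : C ≤ A) (h : B ^ θ - D ^ θ ≤ A ^ θ - C ^ θ) : A ^ (θ - 1) * (B - A) ≤ C ^ (θ - 1) * (D - C) := by
  have hs : 0 < A ^ θ := by positivity
  have ha : 0 < C ^ θ := by positivity
  have hd : C ^ θ ≤ A ^ θ := Real.rpow_le_rpow hC.le hCA h0.le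
  have cx := (convexOn_rpow (p := 1 / θ) (by rw [le_div_iff₀ h0]; linarith)).2
    (Set.mem_Ici.2 (by positivity : 0 ≤ D ^ θ / C ^ θ)) (Set.mem_Ici.2 zero_le_one)
    (by positivity : 0 ≤ C ^ θ / A ^ θ) (by rw [sub_nonneg, div_le_one hs]; exact hd : 0 ≤ 1 - C ^ θ / A ^ θ) (by ring)
  simp only [smul_eq_mul, Real.one_rpow] at cx
  have e1 : (D ^ θ / C ^ θ) ^ (1 / θ) = D / C := by
    rw [← Real.div_rpow hD.le hC.le, ← Real.rpow_mul (by positivity), mul_one_div_cancel h0.ne', Real.rpow_one]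
  have e2 : C ^ θ / A ^ θ * (D ^ θ / C ^ θ) + (1 - C ^ θ / A ^ θ) * 1 = (D ^ θ + A ^ θ - C ^ θ) / A ^ θ := by
    field_simp; ring
  rw [e1, e2] at cx
  have e3 : B / A ≤ ((D ^ θ + A ^ θ - C ^ θ) / A ^ θ) ^ (1 / θ) := by
    have : B / A = ((B / A) ^ θ) ^ (1 / θ) := by
      rw [← Real.rpow_mul (by positivity), mul_one_div_cancel h0.ne', Real.rpow_one]
    rw [this, Real.div_rpow hB.le hA.le]
    refine Real.rpow_le_rpow (by positivity) ?_ (by positivity)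
    gcongr; linarith
  have e4 := mul_le_mul_of_nonneg_left (e3.trans cx) hs.le
  rw [Real.rpow_sub_one hA.ne', Real.rpow_sub_one hC.ne']
  have e5 : A ^ θ * (C ^ θ / A ^ θ * (D / C) + (1 - C ^ θ / A ^ θ) * 1) = C ^ θ / C * D + A ^ θ - C ^ θ := by
    field_simp; ring
  have e6 : A ^ θ / A * (B - A) = A ^ θ * (B / A) - A ^ θ := by field_simp
  have e7 : C ^ θ / C * (D - C) = C ^ θ / C * D - C ^ θ := by field_simp
  rw [e6, e7]; rw [e5] at e4; linarith

theorem second_max {f f1 : ℝ → ℝ} {f2 x0 : ℝ} (hd : ∀ x, HasDerivAt f (f1 x) x) (hd2 : HasDerivAt f1 f2 x0)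
    (hm : ∀ x, f x ≤ f x0) : f2 ≤ 0 := by
  by_contra hc; push Not at hc
  have e1 : deriv f = f1 := funext fun x => (hd x).deriv
  have hmax : IsLocalMax f x0 := Eventually.of_forall hm
  have z : deriv f x0 = 0 := hmax.deriv_eq_zero
  have hmin : IsLocalMin f x0 := isLocalMin_of_deriv_deriv_pos (by rw [e1, hd2.deriv]; exact hc) z (hd x0).continuousAt
  have he : f =ᶠ[nhds x0] fun _ => f x0 := by
    filter_upwards [hmin] with x hx using le_antisymm (hm x) hx
  have := he.deriv.deriv_eq
  simp only [deriv_const', e1, hd2.deriv] at this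
  linarith

section
variable {s0 T0 θ ε : ℝ} {U : ℝ → ℝ → ℝ}

noncomputable def Pho (s0 θ ε : ℝ) (U : ℝ → ℝ → ℝ) (t x y : ℝ) : ℝ :=
  (t - s0) * ((U t x + ε) ^ θ - (U t y + ε) ^ θ) - (x - y)

theorem rpow_add_le' {a b θ : ℝ} (ha : 0 ≤ a) (hb : 0 ≤ b) (h0 : 0 < θ) (h1 : θ ≤ 1) : (a + b) ^ θ ≤ a ^ θ + b ^ θ := by
  lift a to NNReal using ha
  lift b to NNReal using hb
  exact_mod_cast NNReal.rpow_add_le_add_rpow a b h0.le h1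

theorem Pho_max {T B : ℝ} (h : UC s0 T0 U) (hc : ∀ t, Continuous (U t)) (hnn : ∀ t x, 0 ≤ U t x) (hB : ∀ t x, U t x ≤ B)
    (hε : 0 < ε) (h0 : 0 < θ) (h1 : θ ≤ 1) (hT : T ≤ T0) {t1 x1 y1 : ℝ} (ht1 : t1 ∈ Set.Icc s0 T) (hxy : y1 ≤ x1)
    (hp : 0 < Pho s0 θ ε U t1 x1 y1) :
    ∃ t ∈ Set.Icc s0 T, ∃ x y, y ≤ x ∧ 0 < Pho s0 θ ε U t x y ∧
      ∀ t' ∈ Set.Icc s0 T, ∀ x' y', y' ≤ x' → Pho s0 θ ε U t' x' y' ≤ Pho s0 θ ε U t x y := by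
  set c := Pho s0 θ ε U t1 x1 y1 with hcdef
  have hsT : s0 ≤ T := ht1.1.trans ht1.2
  set κ := c / (2 * (T - s0) + 1) with hκ
  have hdn : 0 < 2 * (T - s0) + 1 := by linarith
  have κ0 : 0 < κ := by positivity
  obtain ⟨R, hR⟩ := h.udec (ε := κ ^ (1 / θ)) (by positivity)
  set Zm := (B + ε) ^ θ with hZm
  have B0 : 0 ≤ B := (hnn s0 0).trans (hB s0 0)
  have Z0 : 0 ≤ Zm := by positivity
  have bb : ∀ t x, ε ^ θ ≤ (U t x + ε) ^ θ ∧ (U t x + ε) ^ θ ≤ Zm := fun t x =>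
    ⟨Real.rpow_le_rpow hε.le (by linarith [hnn t x]) h0.le, Real.rpow_le_rpow (by linarith [hnn t x]) (by linarith [hB t x]) h0.le⟩
  have far : ∀ t ∈ Set.Icc s0 T, ∀ x y, y ≤ x → R < |x| → Pho s0 θ ε U t x y < c := by
    intro t ht x y hyx hx
    have u1 : U t x ≤ κ ^ (1 / θ) := (le_abs_self _).trans (hR t ⟨ht.1, ht.2.trans hT⟩ x hx)
    have u2 : (U t x + ε) ^ θ ≤ κ + ε ^ θ := by
      refine (Real.rpow_le_rpow (by linarith [hnn t x]) (by linarith : U t x + ε ≤ κ ^ (1 / θ) + ε) h0.le).trans ?_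
      refine (rpow_add_le' (by positivity) hε.le h0 h1).trans ?_
      rw [← Real.rpow_mul κ0.le, one_div_mul_cancel h0.ne', Real.rpow_one]
    have u3 : (t - s0) * ((U t x + ε) ^ θ - (U t y + ε) ^ θ) ≤ (T - s0) * κ := by
      refine (mul_le_mul_of_nonneg_left (by linarith [(bb t y).1] : _ ≤ κ) (by linarith [ht.1])).trans ?_
      gcongr; exact ht.2
    have u4 : κ * (2 * (T - s0) + 1) = c := div_mul_cancel₀ _ hdn.ne'
    have u5 : 0 ≤ (T - s0) * κ := mul_nonneg (by linarith) κ0.le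
    unfold Pho; nlinarith
  set R' := |R| + (T - s0) * Zm with hR'
  have far2 : ∀ t ∈ Set.Icc s0 T, ∀ x y, y ≤ x → |x| ≤ R → R' < |y| → Pho s0 θ ε U t x y < c := by
    intro t ht x y hyx hx hy
    have r0 := abs_nonneg R
    have r1 := le_abs_self R
    have r2 : 0 ≤ (T - s0) * Zm := mul_nonneg (by linarith) Z0
    have hx' := abs_le.1 hx
    have y1 : y < -R' := by
      rcases lt_abs.1 hy with h | h
      · linarith
      · linarith
    have u3 : (t - s0) * ((U t x + ε) ^ θ - (U t y + ε) ^ θ) ≤ (T - s0) * Zm := by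
      refine (mul_le_mul_of_nonneg_left (by linarith [(bb t y).1, (bb t x).2, Real.rpow_nonneg hε.le θ] : _ ≤ Zm) (by linarith [ht.1])).trans ?_
      gcongr; exact ht.2
    unfold Pho; linarith
  let K : Set (ℝ × ℝ × ℝ) := (Set.Icc s0 T ×ˢ (Set.Icc (-R) R ×ˢ Set.Icc (-R') R')) ∩ {p | p.2.2 ≤ p.2.1}
  have Kc : IsCompact K := (isCompact_Icc.prod (isCompact_Icc.prod isCompact_Icc)).inter_right
    (isClosed_le (by fun_prop) (by fun_prop))
  have inK : ∀ t ∈ Set.Icc s0 T, ∀ x y, y ≤ x → c ≤ Pho s0 θ ε U t x y → (t, x, y) ∈ K := by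
    intro t ht x y hyx hle
    have a1 : |x| ≤ R := by
      by_contra hh; push Not at hh; exact absurd (far t ht x y hyx hh) (not_lt.2 hle)
    have a2 : |y| ≤ R' := by
      by_contra hh; push Not at hh; exact absurd (far2 t ht x y hyx a1 hh) (not_lt.2 hle)
    exact ⟨⟨ht, abs_le.1 a1, abs_le.1 a2⟩, hyx⟩
  have cU := h.cont hc
  have Pc : ContinuousOn (fun p : ℝ × ℝ × ℝ => Pho s0 θ ε U p.1 p.2.1 p.2.2) K := by
    have c1 : ContinuousOn (fun p : ℝ × ℝ × ℝ => U p.1 p.2.1) K :=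
      cU.comp (f := fun p : ℝ × ℝ × ℝ => (p.1, p.2.1)) (by fun_prop) fun p hp => ⟨⟨hp.1.1.1, hp.1.1.2.trans hT⟩, trivial⟩
    have c2 : ContinuousOn (fun p : ℝ × ℝ × ℝ => U p.1 p.2.2) K :=
      cU.comp (f := fun p : ℝ × ℝ × ℝ => (p.1, p.2.2)) (by fun_prop) fun p hp => ⟨⟨hp.1.1.1, hp.1.1.2.trans hT⟩, trivial⟩
    unfold Pho
    have c3 := (c1.add_const ε).rpow_const (p := θ) fun p _ => Or.inr h0.le
    have c4 := (c2.add_const ε).rpow_const (p := θ) fun p _ => Or.inr h0.le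
    fun_prop
  obtain ⟨⟨t, x, y⟩, hm, hmax⟩ := Kc.exists_isMaxOn ⟨_, inK t1 ht1 x1 y1 hxy le_rfl⟩ Pc
  have big : c ≤ Pho s0 θ ε U t x y := hmax (inK t1 ht1 x1 y1 hxy le_rfl)
  refine ⟨t, hm.1.1, x, y, hm.2, hp.trans_le big, fun t' ht' x' y' hyx' => ?_⟩
  by_contra hh; push Not at hh
  exact absurd (hmax (inK t' ht' x' y' hyx' (big.trans hh.le))) (not_le.2 hh)
end

theorem nl_form {j V : ℝ → ℝ} {Λ B : ℝ} (hj : Kern j) (hc : Continuous V) (hB : ∀ x, |V x| ≤ B) (x ε : ℝ) :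
    Integrable (fun z => j z * ((V (x - z) + ε) - (V x + ε))) ∧
    nl j Λ V x = Λ * ∫ z, j z * ((V (x - z) + ε) - (V x + ε)) := by
  have i1 : Integrable fun z => j z * V (x - z) :=
    hj.int.mul_bdd (c := B) (by fun_prop : Continuous fun z => V (x - z)).aestronglyMeasurable (Eventually.of_forall fun z => hB _)
  have e : (fun z => j z * ((V (x - z) + ε) - (V x + ε))) = fun z => j z * V (x - z) - j z * V x := by ext z; ring
  rw [e]
  refine ⟨i1.sub (hj.int.mul_const _), ?_⟩
  rw [integral_sub i1 (hj.int.mul_const _), integral_mul_const, hj.mass, one_mul]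
  unfold nl cv
  have := integral_sub_left_eq_self (fun z => j z * V (x - z)) volume x
  rw [← this]
  congr 2
  refine integral_congr_ae (Eventually.of_forall fun z => ?_)
  simp

theorem nl_olei {j V : ℝ → ℝ} {Λ B θ ε : ℝ} (hj : Kern j) (hΛ : 0 ≤ Λ) (hc : Continuous V) (hB : ∀ x, |V x| ≤ B) (hnn : ∀ x, 0 ≤ V x)
    (hε : 0 < ε) (h0 : 0 < θ) (h1 : θ ≤ 1) {x y : ℝ} (hyx : V y ≤ V x)
    (htr : ∀ ξ, (V (x + ξ) + ε) ^ θ - (V (y + ξ) + ε) ^ θ ≤ (V x + ε) ^ θ - (V y + ε) ^ θ) :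
    (V x + ε) ^ (θ - 1) * nl j Λ V x ≤ (V y + ε) ^ (θ - 1) * nl j Λ V y := by
  obtain ⟨ix, ex⟩ := nl_form (Λ := Λ) hj hc hB x ε
  obtain ⟨iy, ey⟩ := nl_form (Λ := Λ) hj hc hB y ε
  rw [ex, ey, mul_left_comm, mul_left_comm _ Λ, ← integral_const_mul ((V x + ε) ^ (θ - 1)), ← integral_const_mul ((V y + ε) ^ (θ - 1))]
  refine mul_le_mul_of_nonneg_left (integral_mono (ix.const_mul _) (iy.const_mul _) fun z => ?_) hΛ
  have vp : ∀ x, 0 < V x + ε := fun x => by linarith [hnn x]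
  have := rpow_nl (vp x) (vp (x - z)) (vp y) (vp (y - z)) h0 h1 (by linarith) (htr (-z))
  simp only
  rw [mul_left_comm, mul_left_comm _ (j z)]
  exact mul_le_mul_of_nonneg_left this (hj.nn z)

section
variable {q μ M s0 T0 Λ B ε : ℝ} {j : ℝ → ℝ} {U U1 U2 N : ℝ → ℝ → ℝ}

/-- algebra at the maximum point -/
theorem olei_alg {θ μ p d a c A C a1 c1 a2 c2 na nc : ℝ} (hμ : 0 < μ) (h0 : 0 < θ) (h1 : θ < 1) (hC : 0 < C) (hCA : C < A)
    (hp : 0 < p) (ea : θ * A ^ (θ - 1) * a1 = p) (ec : θ * C ^ (θ - 1) * c1 = p)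
    (h2 : θ * A ^ (θ - 1) * a2 + θ * (θ - 1) * A ^ (θ - 2) * a1 ^ 2 ≤ θ * C ^ (θ - 1) * c2 + θ * (θ - 1) * C ^ (θ - 2) * c1 ^ 2)
    (hn : A ^ (θ - 1) * na ≤ C ^ (θ - 1) * nc) (hconv : d ≤ a - c) :
    d * p + (θ * A ^ (θ - 1) * (-(a * a1) + na + μ * a2) - θ * C ^ (θ - 1) * (-(c * c1) + nc + μ * c2)) < 0 := by
  have hA : 0 < A := hC.trans hCA
  have key : ∀ {X x1 : ℝ}, 0 < X → θ * X ^ (θ - 1) * x1 = p → θ * (θ - 1) * X ^ (θ - 2) * x1 ^ 2 = -((1 - θ) / θ * p ^ 2 * (X ^ θ)⁻¹) := by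
    intro X x1 hX e
    have e2 : X ^ (θ - 2) = X ^ (θ - 1) * X ^ (θ - 1) * (X ^ θ)⁻¹ := by
      rw [← Real.rpow_neg hX.le, ← Real.rpow_add hX, ← Real.rpow_add hX]; congr 1; ring
    rw [e2, ← e]; field_simp; ring
  rw [key hA ea, key hC ec] at h2
  have st : (A ^ θ)⁻¹ < (C ^ θ)⁻¹ := by
    have : C ^ θ < A ^ θ := Real.rpow_lt_rpow hC.le hCA h0
    exact inv_strictAnti₀ (by positivity) this
  have k0 : 0 < (1 - θ) / θ * p ^ 2 := by
    have : 0 < 1 - θ := by linarith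
    positivity
  have st2 := mul_lt_mul_of_pos_left st k0
  have m2 : μ * (θ * A ^ (θ - 1) * a2) < μ * (θ * C ^ (θ - 1) * c2) := by
    refine mul_lt_mul_of_pos_left ?_ hμ; linarith
  have ia : θ * A ^ (θ - 1) * (-(a * a1) + na + μ * a2) = -(a * p) + θ * (A ^ (θ - 1) * na) + μ * (θ * A ^ (θ - 1) * a2) := by
    rw [← ea]; ring
  have ic : θ * C ^ (θ - 1) * (-(c * c1) + nc + μ * c2) = -(c * p) + θ * (C ^ (θ - 1) * nc) + μ * (θ * C ^ (θ - 1) * c2) := by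
    rw [← ec]; ring
  rw [ia, ic]
  have := mul_le_mul_of_nonneg_left hn h0.le
  have := mul_le_mul_of_nonneg_right hconv hp.le
  linarith

theorem BS.olei_eps (h : BS q μ M s0 T0 Λ B j U U1 U2 N) (uc : UC s0 T0 U) (hnn : ∀ t x, 0 ≤ U t x) (hε : 0 < ε)
    {t x y : ℝ} (h1 : s0 ≤ t) (h2 : t < T0) (hyx : y ≤ x) : Pho s0 (q - 1) ε U t x y ≤ 0 := by
  by_contra hcon; push Not at hcon
  have θ0 : 0 < q - 1 := by linarith [h.ps.hq]
  have θ1 : q - 1 < 1 := by linarith [h.ps.hq2]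
  set θ := q - 1 with hθ
  obtain ⟨s, hs, X, Y, hYX, hpos, hmax⟩ := Pho_max uc (fun t => (h.ps.c2 t).c0) hnn (fun t x => (le_abs_self _).trans (h.hb t x)) hε θ0 θ1.le h2.le ⟨h1, le_rfl⟩ hyx hcon
  have vp : ∀ t x, 0 < U t x + ε := fun t x => by linarith [hnn t x]
  have hd0 : 0 < (s - s0) * ((U s X + ε) ^ θ - (U s Y + ε) ^ θ) := by
    unfold Pho at hpos; linarith
  have hs0 : 0 < s - s0 := by
    rcases (sub_nonneg.2 hs.1).eq_or_lt with e | e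
    · rw [← e] at hd0; simp at hd0
    · exact e
  have hd1 : 0 < (U s X + ε) ^ θ - (U s Y + ε) ^ θ := pos_of_mul_pos_right hd0 hs0.le
  have hlt : U s Y + ε < U s X + ε := (Real.rpow_lt_rpow_iff (vp s Y).le (vp s X).le θ0).1 (by linarith)
  have hYX' : Y < X := by
    rcases hYX.eq_or_lt with e | e
    · rw [e] at hlt; exact absurd hlt (lt_irrefl _)
    · exact e
  have dZ : ∀ t x, HasDerivAt (fun x => (U t x + ε) ^ θ) (θ * (U t x + ε) ^ (θ - 1) * U1 t x) x := fun t x => by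
    have := (((h.ps.c2 t).d1 x).add_const ε).rpow_const (p := θ) (Or.inl (vp t x).ne')
    exact this.congr_deriv (by ring)
  have dZ1 : ∀ t x, HasDerivAt (fun x => θ * (U t x + ε) ^ (θ - 1) * U1 t x)
      (θ * (U t x + ε) ^ (θ - 1) * U2 t x + θ * (θ - 1) * (U t x + ε) ^ (θ - 2) * U1 t x ^ 2) x := fun t x => by
    have := ((((h.ps.c2 t).d1 x).add_const ε).rpow_const (p := θ - 1) (Or.inl (vp t x).ne')).const_mul θ |>.mul ((h.ps.c2 t).d2 x)
    refine this.congr_deriv ?_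
    rw [show θ - 1 - 1 = θ - 2 by ring]; ring
  have pX : (s - s0) * (θ * (U s X + ε) ^ (θ - 1) * U1 s X) = 1 := by
    have lm : IsLocalMax (fun x => Pho s0 θ ε U s x Y) X := by
      filter_upwards [Ioi_mem_nhds hYX'] with x hx using hmax s hs x Y (le_of_lt hx)
    have hd : HasDerivAt (fun x => Pho s0 θ ε U s x Y) ((s - s0) * (θ * (U s X + ε) ^ (θ - 1) * U1 s X) - 1) X :=
      (((dZ s X).sub_const _).const_mul _).sub ((hasDerivAt_id X).sub_const _)
    linarith [lm.hasDerivAt_eq_zero hd]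
  have pY : (s - s0) * (θ * (U s Y + ε) ^ (θ - 1) * U1 s Y) = 1 := by
    have lm : IsLocalMax (fun y => Pho s0 θ ε U s X y) Y := by
      filter_upwards [Iio_mem_nhds hYX'] with y hy using hmax s hs X y (le_of_lt hy)
    have hd : HasDerivAt (fun y => Pho s0 θ ε U s X y) ((s - s0) * (-(θ * (U s Y + ε) ^ (θ - 1) * U1 s Y)) - (-1)) Y :=
      (((dZ s Y).const_sub _).const_mul _).sub ((hasDerivAt_id Y).const_sub _)
    linarith [lm.hasDerivAt_eq_zero hd]
  have htr : ∀ ξ, (U s (X + ξ) + ε) ^ θ - (U s (Y + ξ) + ε) ^ θ ≤ (U s X + ε) ^ θ - (U s Y + ε) ^ θ := fun ξ => by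
    have := hmax s hs (X + ξ) (Y + ξ) (by linarith)
    unfold Pho at this
    have : (s - s0) * ((U s (X + ξ) + ε) ^ θ - (U s (Y + ξ) + ε) ^ θ) ≤ (s - s0) * ((U s X + ε) ^ θ - (U s Y + ε) ^ θ) := by linarith
    exact le_of_mul_le_mul_left this hs0
  have sec := second_max (x0 := 0) (f := fun ξ => (U s (X + ξ) + ε) ^ θ - (U s (Y + ξ) + ε) ^ θ)
    (fun ξ => ((dZ s (X + ξ)).comp_const_add X ξ).sub ((dZ s (Y + ξ)).comp_const_add Y ξ))
    (((dZ1 s (X + 0)).comp_const_add X 0).sub ((dZ1 s (Y + 0)).comp_const_add Y 0)) (fun ξ => by simpa using htr ξ)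
  simp only [add_zero] at sec
  have nlo := nl_olei h.kj h.hΛ (h.ps.c2 s).c0 (h.hb s) (hnn s) hε θ0 θ1.le (by linarith) htr
  have conv := rpow_shift_le (hnn s Y) (by linarith : U s Y ≤ U s X) hε θ0 θ1.le
  have hsT : s ∈ Set.Ioo s0 T0 := ⟨by linarith, hs.2.trans_lt h2⟩
  set p := 1 / (s - s0) with hp
  have p0 : 0 < p := by positivity
  have pe : p * (s - s0) = 1 := one_div_mul_cancel hs0.ne'
  have alg := olei_alg h.ps.hμ θ0 θ1 (vp s Y) hlt p0 (by rw [hp, eq_div_iff hs0.ne', mul_comm]; exact pX)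
    (by rw [hp, eq_div_iff hs0.ne', mul_comm]; exact pY) (sub_nonpos.1 sec) nlo conv
  have dT : ∀ x, HasDerivAt (fun t => (U t x + ε) ^ θ) (θ * (U s x + ε) ^ (θ - 1) * (-(U s x ^ θ * U1 s x) + nl j Λ (U s) x + μ * U2 s x)) s := fun x => by
    have := ((h.ps.hd x s hsT).add_const ε).rpow_const (p := θ) (Or.inl (vp s x).ne')
    refine this.congr_deriv ?_
    unfold Rr
    rw [abs_of_nonneg (hnn s x), h.hN]; ring
  have dP := ((hasDerivAt_id s).sub_const s0).mul ((dT X).sub (dT Y))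
  have nonneg : 0 ≤ 1 * ((U s X + ε) ^ θ - (U s Y + ε) ^ θ) + (s - s0) * (θ * (U s X + ε) ^ (θ - 1) * (-(U s X ^ θ * U1 s X) + nl j Λ (U s) X + μ * U2 s X)
      - θ * (U s Y + ε) ^ (θ - 1) * (-(U s Y ^ θ * U1 s Y) + nl j Λ (U s) Y + μ * U2 s Y)) := by
    have tl := (hasDerivAt_iff_tendsto_slope.1 dP).mono_left (nhdsWithin_mono s (fun r (hr : r < s) => (ne_of_lt hr : r ≠ s)) : nhdsWithin s (Set.Iio s) ≤ _)
    refine ge_of_tendsto tl ?_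
    have : Set.Ioo s0 s ∈ nhdsWithin s (Set.Iio s) := Ioo_mem_nhdsLT (by linarith)
    filter_upwards [this] with r hr
    rw [slope_def_field]
    refine div_nonneg_of_nonpos ?_ (by linarith [hr.2])
    have := hmax r ⟨hr.1.le, hr.2.le.trans hs.2⟩ X Y hYX
    unfold Pho at this
    simp only [Pi.mul_apply, Pi.sub_apply, id]
    linarith
  have := mul_neg_of_pos_of_neg hs0 alg
  rw [mul_add, mul_comm, mul_assoc, pe] at this
  linarith

theorem BS.olei (h : BS q μ M s0 T0 Λ B j U U1 U2 N) (uc : UC s0 T0 U) (hnn : ∀ t x, 0 ≤ U t x)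
    {t x y : ℝ} (h1 : s0 ≤ t) (h2 : t < T0) (hyx : y ≤ x) : (t - s0) * (U t x ^ (q - 1) - U t y ^ (q - 1)) ≤ x - y := by
  have θ0 : 0 < q - 1 := by linarith [h.ps.hq]
  have c : Continuous fun ε => Pho s0 (q - 1) ε U t x y := by
    unfold Pho
    have a := (continuous_const.add continuous_id : Continuous fun ε => U t x + ε).rpow_const (p := q - 1) fun p => Or.inr θ0.le
    have b := (continuous_const.add continuous_id : Continuous fun ε => U t y + ε).rpow_const (p := q - 1) fun p => Or.inr θ0.le
    fun_prop
  have l := (c.tendsto 0).mono_left (nhdsWithin_le_nhds (s := Set.Ioi 0))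
  have := le_of_tendsto l (by filter_upwards [self_mem_nhdsWithin] with ε hε using h.olei_eps uc hnn hε h1 h2 hyx)
  unfold Pho at this
  simp only [add_zero] at this
  linarith
end

structure Sol (q μ Λ : ℝ) (j : ℝ → ℝ) (u : ℝ → ℝ → ℝ) : Prop where
  hq : 1 < q
  hq2 : q < 2
  hμ : 0 < μ
  kj : Kern j
  hΛ : 0 ≤ Λ
  int : ∀ t : ℝ, 0 ≤ t → Integrable (u t)
  l1c : ∀ t₀ : ℝ, 0 ≤ t₀ → Tendsto (fun t => ∫ x, |u t x - u t₀ x|) (nhdsWithin t₀ (Set.Ici 0)) (nhds 0)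
  c2 : ∀ t : ℝ, 0 < t → ContDiff ℝ 2 (u t)
  tc : ∀ x : ℝ, ContDiffOn ℝ 1 (fun s => u s x) (Set.Ioi 0)
  eq : ∀ t : ℝ, 0 < t → ∀ x : ℝ, deriv (fun s => u s x) t + |u t x| ^ (q - 1) * deriv (u t) x
      = nl j Λ (u t) x + μ * deriv (deriv (u t)) x
  nn0 : ∀ᵐ x, 0 ≤ u 0 x

def cl (s0 T0 t : ℝ) : ℝ := max s0 (min t T0)

section
variable {q μ Λ s0 T0 t : ℝ} {j : ℝ → ℝ} {u : ℝ → ℝ → ℝ}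

theorem cl_cont : Continuous (cl s0 T0) := by unfold cl; fun_prop
theorem cl_ge (s0 T0 t : ℝ) : s0 ≤ cl s0 T0 t := le_max_left _ _
theorem cl_le (h : s0 ≤ T0) (t : ℝ) : cl s0 T0 t ≤ T0 := max_le h (min_le_right _ _)
theorem cl_eq (h1 : s0 ≤ t) (h2 : t ≤ T0) : cl s0 T0 t = t := by
  unfold cl; rw [min_eq_left h2, max_eq_right h1]

theorem Sol.l1b (h : Sol q μ Λ j u) (h0 : 0 ≤ s0) : ∃ M, 0 ≤ M ∧ ∀ t ∈ Set.Icc s0 T0, ∫ x, |u t x| ≤ M := by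
  have c : ContinuousOn (fun t => ∫ x, |u t x|) (Set.Icc s0 T0) := by
    intro t0 ht0
    have l := (h.l1c t0 (h0.trans ht0.1)).mono_left (nhdsWithin_mono t0 (fun t (ht : t ∈ Set.Icc s0 T0) => (h0.trans ht.1 : (0:ℝ) ≤ t)))
    rw [ContinuousWithinAt, tendsto_iff_dist_tendsto_zero]
    refine squeeze_zero' (Eventually.of_forall fun _ => dist_nonneg) ?_ l
    filter_upwards [self_mem_nhdsWithin] with t ht
    have i1 := h.int t (h0.trans ht.1)
    have i2 := h.int t0 (h0.trans ht0.1)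
    rw [Real.dist_eq, ← integral_sub i1.abs i2.abs]
    exact abs_integral_le_integral_abs.trans (integral_mono (i1.abs.sub i2.abs).abs (i1.sub i2).abs fun x => abs_abs_sub_abs_le_abs_sub _ _)
  obtain ⟨C, hC⟩ := isCompact_Icc.bddAbove_image c
  refine ⟨max C 0, le_max_right _ _, fun t ht => (hC ⟨t, ht, rfl⟩).trans (le_max_left _ _)⟩

theorem Sol.ps (h : Sol q μ Λ j u) (h0 : 0 < s0) (hst : s0 ≤ T0) : ∃ M, PS q μ M s0 T0 (fun t => u (cl s0 T0 t))
    (fun t => deriv (u (cl s0 T0 t))) (fun t => deriv (deriv (u (cl s0 T0 t)))) (fun t => nl j Λ (u (cl s0 T0 t))) := by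
  obtain ⟨M, M0, hM⟩ := h.l1b (T0 := T0) h0.le
  have cp : ∀ t, 0 < cl s0 T0 t := fun t => h0.trans_le (cl_ge _ _ _)
  have cI : ∀ t, cl s0 T0 t ∈ Set.Icc s0 T0 := fun t => ⟨cl_ge _ _ _, cl_le hst _⟩
  have ctc : ∀ x, Continuous fun t => u (cl s0 T0 t) x := fun x =>
    (h.tc x).continuousOn.comp_continuous cl_cont fun t => cp t
  have hR : ∀ t x, Rr q μ (u (cl s0 T0 t)) (deriv (u (cl s0 T0 t))) (deriv (deriv (u (cl s0 T0 t)))) (nl j Λ (u (cl s0 T0 t))) x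
      = deriv (fun s => u s x) (cl s0 T0 t) := fun t x => by
    have := h.eq _ (cp t) x
    unfold Rr; linarith
  have hc2 : ∀ t, C2 (u (cl s0 T0 t)) (deriv (u (cl s0 T0 t))) (deriv (deriv (u (cl s0 T0 t)))) := fun t => C2.of_contDiff (h.c2 _ (cp t))
  have mU : Measurable fun p : ℝ × ℝ => u (cl s0 T0 p.1) p.2 :=
    measurable_uncurry_of_continuous_of_measurable (u := fun t x => u (cl s0 T0 t) x) ctc fun t => (hc2 t).c0.measurable
  refine ⟨M + 2 * Λ * M, ?_⟩
  have hΛ := h.hΛ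
  have M1 : 0 ≤ 2 * Λ * M := by positivity
  refine { hq := h.hq, hq2 := h.hq2, hμ := h.hμ, int := fun t => h.int _ (cp t).le, bd := fun t => (hM _ (cI t)).trans (by linarith), c2 := hc2, l1c := fun t0 => ?_, tc := ctc, Nm := ?_, Ni := fun t => nl_int h.kj (h.int _ (cp t).le), Nb := fun t => ?_, Rc := fun x => ?_, hd := fun x t ht => ?_ }
  · have : Tendsto (cl s0 T0) (nhds t0) (nhdsWithin (cl s0 T0 t0) (Set.Ici 0)) :=
      tendsto_nhdsWithin_iff.2 ⟨cl_cont.tendsto t0, Eventually.of_forall fun t => (cp t).le⟩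
    exact (h.l1c _ (cp t0).le).comp this
  · unfold nl cv
    have m1 : Measurable fun p : (ℝ × ℝ) × ℝ => j (p.1.2 - p.2) * u (cl s0 T0 p.1.1) p.2 :=
      (h.kj.m.comp (by fun_prop)).mul (mU.comp (f := fun p : (ℝ × ℝ) × ℝ => (p.1.1, p.2)) (by fun_prop))
    have m2 := m1.stronglyMeasurable.integral_prod_right' (ν := volume)
    exact (m2.measurable.sub mU).const_mul Λ
  · refine (nl_norm h.kj h.hΛ (h.int _ (cp t).le)).trans ?_
    have := mul_le_mul_of_nonneg_left (hM _ (cI t)) (by positivity : 0 ≤ 2 * Λ)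
    linarith
  · simp_rw [hR]
    exact ((h.tc x).continuousOn_deriv_of_isOpen isOpen_Ioi le_rfl).comp_continuous cl_cont fun t => cp t
  · rw [hR, cl_eq ht.1.le ht.2.le]
    have d : HasDerivAt (fun s => u s x) (deriv (fun s => u s x) t) t :=
      (((h.tc x).differentiableOn one_ne_zero).differentiableAt (Ioi_mem_nhds (h0.trans ht.1))).hasDerivAt
    refine d.congr_of_eventuallyEq ?_
    filter_upwards [Ioo_mem_nhds ht.1 ht.2] with r hr
    rw [cl_eq hr.1.le hr.2.le]

theorem Sol.nn (h : Sol q μ Λ j u) (ht : 0 < t) (x : ℝ) : 0 ≤ u t x := by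
  have key : ∀ s, 0 < s → s ≤ t → ∫ x, Th (-u t x) ≤ ∫ x, |u s x - u 0 x| := by
    intro s hs hst
    obtain ⟨M, hp⟩ := h.ps hs hst
    have := nonneg_prop hp h.kj h.hΛ (fun t => rfl) hst le_rfl
    simp only [cl_eq hst le_rfl, cl_eq le_rfl hst] at this
    refine this.trans ?_
    have i1 : Integrable fun x => Th (-u s x) := by
      have hb := Th_beta (σ := -1) (k := 0) (by norm_num) le_rfl
      have := beta_int hp hb (by simp [Th_zero]) s
      simpa [cl_eq le_rfl hst] using this
    refine integral_mono_ae i1 ((h.int s hs.le).sub (h.int 0 le_rfl)).abs ?_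
    filter_upwards [h.nn0] with x hx
    rcases le_total (-u s x) 0 with h' | h'
    · rw [Th_zero h']; positivity
    · refine (Th_le _ h').trans ?_
      rw [← abs_neg]; refine le_trans ?_ (le_abs_self _); linarith
  have l := (h.l1c 0 le_rfl).mono_left (nhdsWithin_mono 0 (Set.Ioi_subset_Ici_self))
  have z : ∫ x, Th (-u t x) ≤ 0 := by
    refine ge_of_tendsto l ?_
    filter_upwards [Ioc_mem_nhdsGT ht] with s hs using key s hs.1 hs.2
  obtain ⟨M, hp⟩ := h.ps ht le_rfl
  have := nonneg_concl hp (t := t) (by simpa [cl_eq le_rfl le_rfl] using z) x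
  simpa [cl_eq le_rfl le_rfl] using this

/-- at some time in every interval the solution becomes bounded with square integrable derivative -/
theorem Sol.bs (h : Sol q μ Λ j u) {a b T : ℝ} (ha : 0 < a) (hab : a < b) (hbT : b < T) : ∃ s ∈ Set.Icc a b, ∃ M B,
    BS q μ M s T Λ B j (fun t => u (cl s T t)) (fun t => deriv (u (cl s T t))) (fun t => deriv (deriv (u (cl s T t)))) (fun t => nl j Λ (u (cl s T t)))
    ∧ UC s T (fun t => u (cl s T t)) := by
  obtain ⟨M, hp⟩ := h.ps ha (hab.trans hbT).le
  obtain ⟨s, hs, hg⟩ := exists_good_time hp (hab.trans hbT) hab hbT.le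
  have hsT : s ≤ T := hs.2.trans hbT.le
  rw [cl_eq hs.1 hsT] at hg
  have s0 : 0 < s := ha.trans_le hs.1
  have hc := C2.of_contDiff (h.c2 s s0)
  have hb := bdd_of_ge (h.int s s0.le) hc.d1 hc.c1 hg
  set B := 1 + ∫ x, ge (u s) (deriv (u s)) x with hB
  obtain ⟨M', hp'⟩ := h.ps s0 hsT
  have bs : BS q μ M' s T Λ B j (fun t => u (cl s T t)) (fun t => deriv (u (cl s T t))) (fun t => deriv (deriv (u (cl s T t)))) (fun t => nl j Λ (u (cl s T t))) := by
    refine ⟨hp', h.kj, h.hΛ, fun t => rfl, fun t x => ?_⟩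
    have := sup_prop hp' h.kj h.hΛ (fun t => rfl) le_rfl (cl_ge s T t) (cl_le hsT t) (k := B) (fun x => by simpa [cl_eq le_rfl hsT] using hb x) x
    simpa [cl_eq (cl_ge s T t) (cl_le hsT t)] using this
  refine ⟨s, hs, M', B, bs, bs.uc ?_⟩
  rw [cl_eq le_rfl hsT]
  have B0 : 0 ≤ B := (abs_nonneg _).trans (hb 0)
  refine Integrable.mono' (hg.const_mul (1 + B ^ 2)) (hc.c1.pow 2).aestronglyMeasurable (Eventually.of_forall fun x => ?_)
  rw [Real.norm_eq_abs, abs_of_nonneg (sq_nonneg _)]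
  have v2 : u s x ^ 2 ≤ B ^ 2 := by rw [← sq_abs]; exact pow_le_pow_left₀ (abs_nonneg _) (hb x) 2
  unfold ge
  have e : deriv (u s) x ^ 2 = (1 + u s x ^ 2) * (deriv (u s) x ^ 2 / (1 + u s x ^ 2)) := by
    rw [mul_div_cancel₀]; positivity
  calc _ = _ := e
    _ ≤ (1 + B ^ 2) * (deriv (u s) x ^ 2 / (1 + u s x ^ 2)) := by gcongr
    _ ≤ _ := by gcongr; linarith [sq_nonneg (u s x)]

theorem Sol.olei (h : Sol q μ Λ j u) (ht : 0 < t) {x y : ℝ} (hyx : y ≤ x) : t * (u t x ^ (q - 1) - u t y ^ (q - 1)) ≤ x - y := by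
  have key : ∀ b, 0 < b → b < t → (t - b) * (u t x ^ (q - 1) - u t y ^ (q - 1)) ≤ x - y := by
    intro b hb hbt
    obtain ⟨s, hs, M, B, bs, uc⟩ := h.bs (a := b / 2) (b := b) (T := t + 1) (by positivity) (by linarith) (by linarith)
    have := bs.olei uc (fun r x => h.nn ((by positivity : 0 < b / 2).trans_le (hs.1.trans (cl_ge _ _ _))) x) (t := t) (by linarith [hs.2]) (by linarith) hyx
    rw [cl_eq (by linarith [hs.2]) (by linarith)] at this
    rcases le_total (u t x ^ (q - 1) - u t y ^ (q - 1)) 0 with h' | h'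
    · have := mul_nonpos_of_nonneg_of_nonpos (by linarith : 0 ≤ t - b) h'; linarith
    · refine le_trans ?_ this
      gcongr; exact hs.2
  have c : Tendsto (fun b => (t - b) * (u t x ^ (q - 1) - u t y ^ (q - 1))) (nhdsWithin 0 (Set.Ioi 0)) (nhds ((t - 0) * (u t x ^ (q - 1) - u t y ^ (q - 1)))) :=
    ((by fun_prop : Continuous fun b => (t - b) * (u t x ^ (q - 1) - u t y ^ (q - 1))).tendsto 0).mono_left nhdsWithin_le_nhds
  rw [sub_zero] at c
  refine le_of_tendsto c ?_
  filter_upwards [Ioo_mem_nhdsGT ht] with b hb using key b hb.1 hb.2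
end

section
variable {q μ Λ s t : ℝ} {j : ℝ → ℝ} {u : ℝ → ℝ → ℝ} {ψ ψ1 ψ2 : ℝ → ℝ} {B D1 D2 : ℝ}

theorem nl_dual {V : ℝ → ℝ} (hj : Kern j) (hV : Integrable V) (hc : Continuous ψ) (hB : ∀ x, |ψ x| ≤ B) :
    ∫ x, nl j Λ V x * ψ x = ∫ x, V x * nl j Λ ψ x := by
  have e1 : ∫ x, cv j V x * ψ x = ∫ x, V x * cv j ψ x := by
    rw [cv_dual hj.int hV hc.aestronglyMeasurable hB]
    congr 1; ext y; congr 1; unfold cv; congr 1; ext x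
    rw [← hj.even (x - y), neg_sub]
  have cb := cv_bdd hj hB
  have cm : AEStronglyMeasurable (cv j ψ) := by
    unfold cv
    exact ((hj.m.comp (by fun_prop : Measurable fun p : ℝ × ℝ => p.1 - p.2)).mul (hc.measurable.comp measurable_snd)).stronglyMeasurable.integral_prod_right'.aestronglyMeasurable
  have i1 : Integrable fun x => cv j V x * ψ x := (cv_int hj.int hV).mul_bdd hc.aestronglyMeasurable (Eventually.of_forall hB)
  have i2 : Integrable fun x => V x * ψ x := hV.mul_bdd hc.aestronglyMeasurable (Eventually.of_forall hB)
  have i3 : Integrable fun x => V x * cv j ψ x := hV.mul_bdd cm (Eventually.of_forall cb)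
  have a : (fun x => nl j Λ V x * ψ x) = fun x => Λ * (cv j V x * ψ x - V x * ψ x) := by ext x; unfold nl; ring
  have b : (fun x => V x * nl j Λ ψ x) = fun x => Λ * (V x * cv j ψ x - V x * ψ x) := by ext x; unfold nl; ring
  rw [a, b, integral_const_mul, integral_const_mul, integral_sub i1 i2, integral_sub i3 i2, e1]

theorem nl_c2 (hj : Kern j) (hΛ : 0 ≤ Λ) (hj2 : Integrable fun z => z ^ 2 * j z) (hψ : C2 ψ ψ1 ψ2) (hB : ∀ x, |ψ x| ≤ B)
    (h2 : ∀ x, |ψ2 x| ≤ D2) (x : ℝ) : |nl j Λ ψ x| ≤ Λ * (∫ z, z ^ 2 * j z) * D2 := by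
  obtain ⟨i, e⟩ := nl_form (Λ := Λ) hj hψ.c0 hB x 0
  simp only [add_zero] at i e
  have i' : Integrable fun z => j z * (ψ (x + z) - ψ x) := by
    have := i.comp_neg
    refine this.congr (Eventually.of_forall fun z => ?_)
    simp [hj.even]
  have e' : ∫ z, j z * (ψ (x + z) - ψ x) = ∫ z, j z * (ψ (x - z) - ψ x) := by
    rw [← integral_neg_eq_self (fun z => j z * (ψ (x - z) - ψ x))]
    congr 1; ext z; simp [hj.even]
  have e2 : 2 * ∫ z, j z * (ψ (x - z) - ψ x) = ∫ z, j z * (ψ (x + z) + ψ (x - z) - 2 * ψ x) := by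
    rw [two_mul]; nth_rw 1 [← e']; rw [← integral_add i' i]; congr 1; ext z; ring
  have D0 : 0 ≤ D2 := (abs_nonneg _).trans (h2 0)
  have lip : ∀ a b, |ψ1 b - ψ1 a| ≤ D2 * |b - a| := fun a b =>
    mvt_abs (r := max |a| |b|) (fun v => hψ.d2 v) (fun v _ => h2 v) (le_max_left _ _) (le_max_right _ _)
  have sd : ∀ z, |ψ (x + z) + ψ (x - z) - 2 * ψ x| ≤ D2 * z ^ 2 := fun z => by
    have := mvt_abs (r := max |x - z| |x|) (f := fun y => ψ (y + z) - ψ y) (C := D2 * |z|) (x := x - z) (y := x)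
      (fun v => ((hψ.d1 (v + z)).comp_add_const v z).sub (hψ.d1 v)) (fun v _ => by simpa using lip v (v + z))
      (le_max_left _ _) (le_max_right _ _)
    rw [show x - (x - z) = z by ring, mul_assoc, ← sq, sq_abs] at this
    refine le_trans (le_of_eq ?_) this
    simp only [sub_add_cancel]; congr 1; ring
  have b : |∫ z, j z * (ψ (x + z) + ψ (x - z) - 2 * ψ x)| ≤ (∫ z, z ^ 2 * j z) * D2 := by
    rw [← integral_mul_const, ← Real.norm_eq_abs]
    refine norm_integral_le_of_norm_le (hj2.mul_const D2) (Eventually.of_forall fun z => ?_)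
    rw [Real.norm_eq_abs, abs_mul, abs_of_nonneg (hj.nn z)]
    have := mul_le_mul_of_nonneg_left (sd z) (hj.nn z)
    linarith
  rw [e, abs_mul, abs_of_nonneg hΛ, mul_assoc]
  refine mul_le_mul_of_nonneg_left ?_ hΛ
  rw [← e2, abs_mul, abs_two] at b
  linarith [abs_nonneg (∫ z, j z * (ψ (x - z) - ψ x))]

theorem Sol.sup0 (h : Sol q μ Λ j u) (hs : 0 < s) (hst : s ≤ t) : ∃ B, ∀ τ ∈ Set.Icc s t, ∀ x, |u τ x| ≤ B := by
  obtain ⟨r, hr, M, B, bs, -⟩ := h.bs (a := s / 2) (b := s) (T := t + 1) (by linarith) (by linarith) (by linarith)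
  refine ⟨B, fun τ hτ x => ?_⟩
  have := bs.hb τ x
  rwa [cl_eq (by linarith [hr.2, hτ.1]) (by linarith [hτ.2])] at this

theorem Sol.Fl_int (h : Sol q μ Λ j u) (ht : 0 < t) : Integrable fun x => Fl q (u t x) := by
  obtain ⟨r, hr, M, B, bs, -⟩ := h.bs (a := t / 2) (b := t) (T := t + 1) (by linarith) (by linarith) (by linarith)
  have := bs.Fl_int t
  rwa [cl_eq (by linarith [hr.2]) (by linarith)] at this

theorem Sol.weak (h : Sol q μ Λ j u) (hs : 0 < s) (hst : s ≤ t) (hψ : C2 ψ ψ1 ψ2) (hB : ∀ x, |ψ x| ≤ B ∧ |ψ1 x| ≤ B ∧ |ψ2 x| ≤ B) :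
    (∫ x, u t x * ψ x) - ∫ x, u s x * ψ x
      = ∫ τ in s..t, ((∫ x, u τ x * nl j Λ ψ x) + (∫ x, Fl q (u τ x) * ψ1 x) + μ * ∫ x, u τ x * ψ2 x) := by
  obtain ⟨M, hp⟩ := h.ps hs hst
  have g := gw hp beta_id rfl hψ hB le_rfl hst le_rfl
  have ki := kdg_int hp hst beta_id rfl hψ hB
  simp only [cl_eq hst le_rfl, cl_eq le_rfl hst] at g
  rw [nu_integral hst ki] at g
  rw [g]
  refine intervalIntegral.integral_congr fun τ hτ => ?_
  rw [Set.uIcc_of_le hst] at hτ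
  have τ0 : 0 < τ := hs.trans_le hτ.1
  simp only [cl_eq hτ.1 hτ.2]
  have iu := h.int τ τ0.le
  have i1 : Integrable fun x => nl j Λ (u τ) x * ψ x :=
    (nl_int h.kj iu).mul_bdd hψ.c0.aestronglyMeasurable (Eventually.of_forall fun x => (hB x).1)
  have i2 : Integrable fun x => Fl q (u τ x) * ψ1 x :=
    (h.Fl_int τ0).mul_bdd hψ.c1.aestronglyMeasurable (Eventually.of_forall fun x => (hB x).2.1)
  have i3 : Integrable fun x => u τ x * ψ2 x :=
    iu.mul_bdd hψ.c2.aestronglyMeasurable (Eventually.of_forall fun x => (hB x).2.2)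
  rw [← nl_dual h.kj iu hψ.c0 (fun x => (hB x).1), ← integral_const_mul, ← integral_add i1 i2, ← integral_add (f := fun x => nl j Λ (u τ) x * ψ x + Fl q (u τ x) * ψ1 x) (i1.add i2) (i3.const_mul μ)]
  congr 1; ext x
  simp only [kdg]; ring

theorem Sol.l1_bdd_lim (h : Sol q μ Λ j u) (hc : Continuous ψ) (hB : ∀ x, |ψ x| ≤ B) :
    Tendsto (fun s => ∫ x, u s x * ψ x) (nhdsWithin 0 (Set.Ioi 0)) (nhds (∫ x, u 0 x * ψ x)) := by
  have l := ((h.l1c 0 le_rfl).mono_left (nhdsWithin_mono 0 (Set.Ioi_subset_Ici_self))).mul_const B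
  rw [zero_mul] at l
  rw [tendsto_iff_dist_tendsto_zero]
  refine squeeze_zero' (Eventually.of_forall fun _ => dist_nonneg) ?_ l
  filter_upwards [self_mem_nhdsWithin] with s hs
  have i1 := h.int s (le_of_lt hs)
  have i0 := h.int 0 le_rfl
  have m : ∀ {V : ℝ → ℝ}, Integrable V → Integrable fun x => V x * ψ x := fun hV =>
    hV.mul_bdd hc.aestronglyMeasurable (Eventually.of_forall hB)
  rw [Real.dist_eq, ← integral_sub (m i1) (m i0), ← integral_mul_const, ← Real.norm_eq_abs]
  refine norm_integral_le_of_norm_le ((i1.sub i0).abs.mul_const B) (Eventually.of_forall fun x => ?_)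
  rw [Real.norm_eq_abs, ← sub_mul, abs_mul]
  exact mul_le_mul_of_nonneg_left (hB x) (abs_nonneg _)

theorem Sol.mass (h : Sol q μ Λ j u) (ht : 0 < t) : ∫ x, u t x = ∫ x, u 0 x := by
  have c : C2 (fun _ => 1) (fun _ => 0) (fun _ => 0) := ⟨fun x => hasDerivAt_const x 1, fun x => hasDerivAt_const x 0, continuous_const⟩
  have z : ∀ x, nl j Λ (fun _ => 1) x = 0 := fun x => by simp [nl, cv, (h.kj.sh x).2]
  have key : ∀ s, 0 < s → s ≤ t → ∫ x, u s x * 1 = ∫ x, u t x * 1 := fun s hs hst => by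
    have := h.weak hs hst c (B := 1) (by simp)
    simp only [z, mul_zero, integral_zero, add_zero, intervalIntegral.integral_zero] at this
    linarith
  have l := h.l1_bdd_lim (ψ := fun _ => 1) (B := 1) continuous_const (by simp)
  have l2 : Tendsto (fun s => ∫ x, u s x * 1) (nhdsWithin 0 (Set.Ioi 0)) (nhds (∫ x, u t x * 1)) :=
    tendsto_const_nhds.congr' (by filter_upwards [Ioc_mem_nhdsGT ht] with s hs using (key s hs.1 hs.2).symm)
  simpa using tendsto_nhds_unique l2 l
end

section
variable {q μ Λ s t m : ℝ} {j : ℝ → ℝ} {u : ℝ → ℝ → ℝ} {ψ ψ1 ψ2 : ℝ → ℝ} {B D1 D2 : ℝ}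

theorem Sol.m0 (h : Sol q μ Λ j u) (hm : ∫ x, u 0 x = m) : 0 ≤ m := hm ▸ integral_nonneg_of_ae h.nn0

theorem Sol.sup1 (h : Sol q μ Λ j u) (hm : ∫ x, u 0 x = m) (ht : 0 < t) (x : ℝ) :
    u t x ^ (q - 1) ≤ 2 * m ^ ((q - 1) / q) * t ^ (1 / q - 1) := by
  have m0 := h.m0 hm
  have θ0 : 0 < q - 1 := by linarith [h.hq]
  have q0 : 0 < q := by linarith [h.hq]
  set a := u t x ^ (q - 1) with ha
  have a0 : 0 ≤ a := Real.rpow_nonneg (h.nn ht x) _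
  have lb : ∀ y ∈ Set.Icc (x - a * t / 2) x, (a / 2) ^ (1 / (q - 1)) ≤ u t y := by
    intro y hy
    have o := h.olei ht hy.2
    have : a / 2 ≤ u t y ^ (q - 1) := by
      have : t * (a - u t y ^ (q - 1)) ≤ t * (a / 2) := by linarith [hy.1]
      linarith [le_of_mul_le_mul_left this ht]
    have h1 := Real.rpow_le_rpow (by positivity) this (by positivity : 0 ≤ 1 / (q - 1))
    rwa [← Real.rpow_mul (h.nn ht y), mul_one_div_cancel θ0.ne', Real.rpow_one] at h1
  have iu := h.int t ht.le
  have e : (a * t / 2) * (a / 2) ^ (1 / (q - 1)) ≤ m := by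
    rw [← hm, ← h.mass ht]
    calc _ = ∫ y in Set.Icc (x - a * t / 2) x, (a / 2) ^ (1 / (q - 1)) := by
          rw [setIntegral_const, Real.volume_real_Icc_of_le (by have : 0 ≤ a * t / 2 := by positivity
                                                                linarith), smul_eq_mul]
          ring
      _ ≤ ∫ y in Set.Icc (x - a * t / 2) x, u t y :=
          setIntegral_mono_on (integrableOn_const (by simp)) iu.integrableOn measurableSet_Icc lb
      _ ≤ _ := setIntegral_le_integral iu (Eventually.of_forall fun y => h.nn ht y)
  have e1 : (a / 2) ^ (q / (q - 1)) ≤ m / t := by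
    rw [le_div_iff₀ ht]
    refine le_trans (le_of_eq ?_) e
    rw [show q / (q - 1) = 1 + 1 / (q - 1) by field_simp; ring, Real.rpow_add' (by positivity) (by positivity), Real.rpow_one]; ring
  have e2 := Real.rpow_le_rpow (by positivity) e1 (by positivity : 0 ≤ (q - 1) / q)
  rw [← Real.rpow_mul (by positivity), show q / (q - 1) * ((q - 1) / q) = 1 by field_simp, Real.rpow_one, Real.div_rpow m0 ht.le,
    div_eq_mul_inv _ (t ^ _), ← Real.rpow_neg ht.le, show -((q - 1) / q) = 1 / q - 1 by field_simp; ring] at e2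
  linarith

theorem Sol.sup (h : Sol q μ Λ j u) (hm : ∫ x, u 0 x = m) (ht : 0 < t) (x : ℝ) :
    u t x ≤ 2 ^ (1 / (q - 1)) * m ^ (1 / q) * t ^ (-(1 / q)) := by
  have m0 := h.m0 hm
  have θ0 : 0 < q - 1 := by linarith [h.hq]
  have q0 : 0 < q := by linarith [h.hq]
  have := Real.rpow_le_rpow (Real.rpow_nonneg (h.nn ht x) _) (h.sup1 hm ht x) (by positivity : 0 ≤ 1 / (q - 1))
  rw [← Real.rpow_mul (h.nn ht x), mul_one_div_cancel θ0.ne', Real.rpow_one, Real.mul_rpow (by positivity) (by positivity),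
    Real.mul_rpow (by positivity) (by positivity), ← Real.rpow_mul m0, ← Real.rpow_mul ht.le,
    show (q - 1) / q * (1 / (q - 1)) = 1 / q by field_simp, show (1 / q - 1) * (1 / (q - 1)) = -(1 / q) by field_simp; ring] at this
  exact this

theorem rpow_tan {a b P : ℝ} (ha : 0 ≤ a) (hb : 0 ≤ b) (hP : 1 ≤ P) : a ^ P - b ^ P ≤ P * a ^ (P - 1) * (a - b) := by
  rcases ha.eq_or_lt with rfl | ha
  · rw [Real.zero_rpow (by linarith)]
    rcases hP.eq_or_lt with rfl | hP
    · simp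
    · rw [Real.zero_rpow (by linarith)]; simp; positivity
  · have := one_add_mul_self_le_rpow_one_add (s := b / a - 1) (by have := div_nonneg hb ha.le; linarith) hP
    rw [add_sub_cancel, Real.div_rpow hb ha.le, le_div_iff₀ (by positivity)] at this
    rw [Real.rpow_sub_one ha.ne']
    have e : (1 + P * (b / a - 1)) * a ^ P = a ^ P - P * (a ^ P / a) * (a - b) := by field_simp; ring
    linarith

theorem Sol.lip1 (h : Sol q μ Λ j u) (hm : ∫ x, u 0 x = m) (ht : 0 < t) {x y : ℝ} (hyx : y ≤ x) :
    u t x - u t y ≤ (1 / (q - 1) * 2 ^ (1 / (q - 1) - 1) * m ^ ((2 - q) / q) * t ^ (-(2 / q))) * (x - y) := by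
  have m0 := h.m0 hm
  have θ0 : 0 < q - 1 := by linarith [h.hq]
  have q0 : 0 < q := by linarith [h.hq]
  have hP : 1 ≤ 1 / (q - 1) := by rw [le_div_iff₀ θ0]; linarith [h.hq2]
  have ux := h.nn ht x
  have uy := h.nn ht y
  have L0 : 0 ≤ (1 / (q - 1) * 2 ^ (1 / (q - 1) - 1) * m ^ ((2 - q) / q) * t ^ (-(2 / q))) := by positivity
  rcases le_total (u t x) (u t y) with hc | hc
  · have := mul_nonneg L0 (sub_nonneg.2 hyx); linarith
  have tn := rpow_tan (a := u t x ^ (q - 1)) (b := u t y ^ (q - 1)) (by positivity) (by positivity) hP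
  rw [← Real.rpow_mul ux, ← Real.rpow_mul uy, mul_one_div_cancel θ0.ne', Real.rpow_one, Real.rpow_one] at tn
  refine tn.trans ?_
  have s1 := Real.rpow_le_rpow (by positivity) (h.sup1 hm ht x) (by linarith : 0 ≤ 1 / (q - 1) - 1)
  have o := h.olei ht hyx
  have o' : u t x ^ (q - 1) - u t y ^ (q - 1) ≤ (x - y) / t := by rw [le_div_iff₀ ht]; linarith
  have d0 : 0 ≤ u t x ^ (q - 1) - u t y ^ (q - 1) := sub_nonneg.2 (Real.rpow_le_rpow uy hc θ0.le)
  calc _ ≤ 1 / (q - 1) * (2 * m ^ ((q - 1) / q) * t ^ (1 / q - 1)) ^ (1 / (q - 1) - 1) * ((x - y) / t) := by gcongr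
    _ = _ := by
      rw [Real.mul_rpow (by positivity) (by positivity), Real.mul_rpow (by positivity) (by positivity), ← Real.rpow_mul m0, ← Real.rpow_mul ht.le,
        show (q - 1) / q * (1 / (q - 1) - 1) = (2 - q) / q by field_simp; ring,
        show -(2 / q) = (1 / q - 1) * (1 / (q - 1) - 1) - 1 by field_simp; ring, Real.rpow_sub_one ht.ne']
      ring

theorem Sol.wstep (h : Sol q μ Λ j u) (hm : ∫ x, u 0 x = m) (hj2 : Integrable fun z => z ^ 2 * j z) (hs : 0 < s)
    (hψ : C2 ψ ψ1 ψ2) (hB : ∀ x, |ψ x| ≤ B) (h1 : ∀ x, |ψ1 x| ≤ D1) (h2 : ∀ x, |ψ2 x| ≤ D2) :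
    |(∫ x, u s x * nl j Λ ψ x) + (∫ x, Fl q (u s x) * ψ1 x) + μ * ∫ x, u s x * ψ2 x|
      ≤ (Λ * (∫ z, z ^ 2 * j z) + μ) * D2 * m + D1 * (2 * m ^ ((q - 1) / q) * m) * s ^ (1 / q - 1) := by
  have m0 := h.m0 hm
  have iu := h.int s hs.le
  have D0 : 0 ≤ D1 := (abs_nonneg _).trans (h1 0)
  have am : ∀ {g : ℝ → ℝ} {D : ℝ}, (∀ x, |g x| ≤ D) → |∫ x, u s x * g x| ≤ m * D := by
    intro g D hg
    rw [← hm, ← h.mass hs, ← integral_mul_const, ← Real.norm_eq_abs]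
    refine norm_integral_le_of_norm_le (iu.mul_const D) (Eventually.of_forall fun x => ?_)
    rw [Real.norm_eq_abs, abs_mul, abs_of_nonneg (h.nn hs x)]
    exact mul_le_mul_of_nonneg_left (hg x) (h.nn hs x)
  have a1 := am (nl_c2 h.kj h.hΛ hj2 hψ hB h2)
  have a3 := am h2
  have a2 : |∫ x, Fl q (u s x) * ψ1 x| ≤ ((2 * m ^ ((q - 1) / q) * s ^ (1 / q - 1)) * D1) * m := by
    rw [← hm, ← h.mass hs, ← integral_const_mul, ← Real.norm_eq_abs, h.mass hs, hm]
    refine norm_integral_le_of_norm_le (iu.const_mul _) (Eventually.of_forall fun x => ?_)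
    rw [Real.norm_eq_abs, abs_mul]
    have un := h.nn hs x
    have f1 : |Fl q (u s x)| ≤ (2 * m ^ ((q - 1) / q) * s ^ (1 / q - 1)) * u s x := by
      unfold Fl
      rw [abs_div, abs_mul, abs_of_nonneg un, abs_of_nonneg (by positivity), abs_of_pos (by linarith [h.hq] : 0 < q)]
      refine (div_le_self (by positivity) h.hq.le).trans ?_
      exact mul_le_mul_of_nonneg_right (h.sup1 hm hs x) un
    calc _ ≤ ((2 * m ^ ((q - 1) / q) * s ^ (1 / q - 1)) * u s x) * D1 := mul_le_mul f1 (h1 x) (abs_nonneg _) (by positivity)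
      _ = _ := by ring
  refine (abs_add_three _ _ _).trans ?_
  rw [abs_mul μ, abs_of_pos h.hμ]
  have := mul_le_mul_of_nonneg_left a3 h.hμ.le
  linarith

theorem Sol.wbd (h : Sol q μ Λ j u) (hm : ∫ x, u 0 x = m) (hj2 : Integrable fun z => z ^ 2 * j z) (hs : 0 < s) (hst : s ≤ t)
    (hψ : C2 ψ ψ1 ψ2) (hB : ∀ x, |ψ x| ≤ B) (h1 : ∀ x, |ψ1 x| ≤ D1) (h2 : ∀ x, |ψ2 x| ≤ D2) :
    |(∫ x, u t x * ψ x) - ∫ x, u s x * ψ x| ≤ ∫ τ in s..t,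
      ((Λ * (∫ z, z ^ 2 * j z) + μ) * D2 * m + D1 * (2 * m ^ ((q - 1) / q) * m) * τ ^ (1 / q - 1)) := by
  rw [h.weak hs hst hψ (B := max B (max D1 D2)) fun x => ⟨(hB x).trans (le_max_left _ _), (h1 x).trans ((le_max_left _ _).trans (le_max_right _ _)),
    (h2 x).trans ((le_max_right _ _).trans (le_max_right _ _))⟩, ← Real.norm_eq_abs]
  refine intervalIntegral.norm_integral_le_of_norm_le hst (Eventually.of_forall fun τ hτ => ?_) ?_
  · exact h.wstep hm hj2 (hs.trans hτ.1) hψ hB h1 h2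
  · refine ContinuousOn.intervalIntegrable fun τ hτ => ?_
    rw [Set.uIcc_of_le hst] at hτ
    have : τ ≠ 0 := (hs.trans_le hτ.1).ne'
    have c := (Real.continuousAt_rpow_const τ (1 / q - 1) (Or.inl this))
    exact (continuousAt_const.add (continuousAt_const.mul c)).continuousWithinAt

theorem Sol.wa (h : Sol q μ Λ j u) (hm : ∫ x, u 0 x = m) (hj2 : Integrable fun z => z ^ 2 * j z) (hs : 0 < s) (hst : s ≤ t)
    (hψ : C2 ψ ψ1 ψ2) (hB : ∀ x, |ψ x| ≤ B) (h1 : ∀ x, |ψ1 x| ≤ D1) (h2 : ∀ x, |ψ2 x| ≤ D2) :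
    |(∫ x, u t x * ψ x) - ∫ x, u s x * ψ x| ≤ (Λ * (∫ z, z ^ 2 * j z) + μ) * D2 * m * t + D1 * (2 * m ^ ((q - 1) / q) * m) * (q * t ^ (1 / q)) := by
  have m0 := h.m0 hm
  have q0 : 0 < q := by linarith [h.hq]
  have D0 : 0 ≤ D1 := (abs_nonneg _).trans (h1 0)
  have D0' : 0 ≤ D2 := (abs_nonneg _).trans (h2 0)
  have κ0 : 0 ≤ Λ * (∫ z, z ^ 2 * j z) + μ := add_nonneg (mul_nonneg h.hΛ (integral_nonneg fun z => mul_nonneg (sq_nonneg z) (h.kj.nn z))) h.hμ.le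
  refine (h.wbd hm hj2 hs hst hψ hB h1 h2).trans ?_
  have q1 : -1 < 1 / q - 1 := by have : 0 < 1 / q := by positivity
                                 linarith
  rw [intervalIntegral.integral_add (by simp) ((intervalIntegral.intervalIntegrable_rpow' q1).const_mul _), intervalIntegral.integral_const,
    intervalIntegral.integral_const_mul, integral_rpow (Or.inl q1), sub_add_cancel, smul_eq_mul]
  have e : (t ^ (1 / q) - s ^ (1 / q)) / (1 / q) ≤ q * t ^ (1 / q) := by
    have : 0 ≤ s ^ (1 / q) := by positivity
    have : (t ^ (1 / q) - s ^ (1 / q)) / (1 / q) = q * (t ^ (1 / q) - s ^ (1 / q)) := by field_simp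
    rw [this]; gcongr; linarith
  have e1 : (t - s) * ((Λ * (∫ z, z ^ 2 * j z) + μ) * D2 * m) ≤ (Λ * (∫ z, z ^ 2 * j z) + μ) * D2 * m * t := by
    rw [mul_comm]; gcongr; linarith
  gcongr

theorem Sol.wb (h : Sol q μ Λ j u) (hm : ∫ x, u 0 x = m) (hj2 : Integrable fun z => z ^ 2 * j z) (hs : 0 < s) (hst : s ≤ t)
    (hψ : C2 ψ ψ1 ψ2) (hB : ∀ x, |ψ x| ≤ B) (h1 : ∀ x, |ψ1 x| ≤ D1) (h2 : ∀ x, |ψ2 x| ≤ D2) :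
    |(∫ x, u t x * ψ x) - ∫ x, u s x * ψ x| ≤ ((Λ * (∫ z, z ^ 2 * j z) + μ) * D2 * m + D1 * (2 * m ^ ((q - 1) / q) * m) * s ^ (1 / q - 1)) * (t - s) := by
  have m0 := h.m0 hm
  have q0 : 0 < q := by linarith [h.hq]
  have D0 : 0 ≤ D1 := (abs_nonneg _).trans (h1 0)
  rw [h.weak hs hst hψ (B := max B (max D1 D2)) fun x => ⟨(hB x).trans (le_max_left _ _), (h1 x).trans ((le_max_left _ _).trans (le_max_right _ _)),
    (h2 x).trans ((le_max_right _ _).trans (le_max_right _ _))⟩, ← Real.norm_eq_abs, ← abs_of_nonneg (sub_nonneg.2 hst)]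
  refine intervalIntegral.norm_integral_le_of_norm_le_const fun τ hτ => ?_
  rw [Set.uIoc_of_le hst] at hτ
  refine (h.wstep hm hj2 (hs.trans hτ.1) hψ hB h1 h2).trans ?_
  have : τ ^ (1 / q - 1) ≤ s ^ (1 / q - 1) := by
    refine Real.rpow_le_rpow_of_nonpos hs hτ.1.le ?_
    rw [sub_nonpos, div_le_one q0]; exact h.hq.le
  gcongr
end

section
variable {q μ Λ s t m L S c1 h : ℝ} {j : ℝ → ℝ} {u : ℝ → ℝ → ℝ} {Y χ χ1 χ2 : ℝ → ℝ}

theorem Sol.tail (h : Sol q μ Λ j u) (hm : ∫ x, u 0 x = m) (hj2 : Integrable fun z => z ^ 2 * j z) (hχ : Cutf q c1 Y χ χ1 χ2 2)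
    (h1 : ∀ x, |x| ≤ 1 → χ x = 1) (ht : 0 < t) (hs : 1 ≤ s) :
    ∫ x in {x : ℝ | 2 * s < |x|}, u t x ≤ (∫ x in {x : ℝ | s < |x|}, u 0 x)
      + ((Λ * (∫ z, z ^ 2 * j z) + μ) * c1 * m * t + c1 * (2 * m ^ ((q - 1) / q) * m) * (q * t ^ (1 / q))) / s := by
  have s0 : 0 < s := by linarith
  have m0 := h.m0 hm
  have c0 : 0 ≤ c1 := (abs_nonneg _).trans (hχ.b1 0)
  have κ0 : 0 ≤ Λ * (∫ z, z ^ 2 * j z) + μ := add_nonneg (mul_nonneg h.hΛ (integral_nonneg fun z => mul_nonneg (sq_nonneg z) (h.kj.nn z))) h.hμ.le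
  have hc := hχ.scale hs
  set ψ : ℝ → ℝ := fun x => 1 - χ (x / s) with hψd
  have hψ : C2 ψ (fun x => -(χ1 (x / s) / s)) (fun x => -(χ2 (x / s) / s / s)) :=
    ⟨fun x => (hc.c2.d1 x).const_sub 1, fun x => (hc.c2.d2 x).neg, hc.c2.c2.neg⟩
  have p0 : ∀ x, 0 ≤ ψ x := fun x => sub_nonneg.2 (hχ.le1 _)
  have p1 : ∀ x, ψ x ≤ 1 := fun x => by have := hχ.nn (x / s); simp only [hψd]; linarith
  have hB : ∀ x, |ψ x| ≤ 1 := fun x => by rw [abs_of_nonneg (p0 x)]; exact p1 x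
  have b1 : ∀ x, |-(χ1 (x / s) / s)| ≤ c1 / s := fun x => by
    rw [abs_neg, abs_div, abs_of_pos s0]; gcongr; exact hχ.b1 _
  have b2 : ∀ x, |-(χ2 (x / s) / s / s)| ≤ c1 / s := fun x => by
    rw [abs_neg, abs_div, abs_div, abs_of_pos s0]
    refine (div_le_self (by positivity) hs).trans ?_
    gcongr; exact hχ.b2 _
  have mu : ∀ τ, 0 ≤ τ → Integrable fun x => u τ x * ψ x := fun τ hτ =>
    (h.int τ hτ).mul_bdd hψ.c0.aestronglyMeasurable (Eventually.of_forall hB)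
  have mS : ∀ r : ℝ, MeasurableSet {x : ℝ | r < |x|} := fun r => measurableSet_lt measurable_const measurable_norm
  set E := ((Λ * (∫ z, z ^ 2 * j z) + μ) * c1 * m * t + c1 * (2 * m ^ ((q - 1) / q) * m) * (q * t ^ (1 / q))) / s with hE
  have key : ∫ x, u t x * ψ x ≤ (∫ x, u 0 x * ψ x) + E := by
    have l := (h.l1_bdd_lim hψ.c0 hB).add_const E
    refine ge_of_tendsto l ?_
    filter_upwards [Ioc_mem_nhdsGT ht] with τ hτ
    have := (le_abs_self _).trans (h.wa hm hj2 hτ.1 hτ.2 hψ hB b1 b2)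
    have e : (Λ * (∫ z, z ^ 2 * j z) + μ) * (c1 / s) * m * t + (c1 / s) * (2 * m ^ ((q - 1) / q) * m) * (q * t ^ (1 / q)) = E := by
      rw [hE]; ring
    linarith
  have lo : ∫ x in {x : ℝ | 2 * s < |x|}, u t x ≤ ∫ x, u t x * ψ x := by
    rw [← integral_indicator (mS _)]
    refine integral_mono ((h.int t ht.le).indicator (mS _)) (mu t ht.le) fun x => ?_
    by_cases hx : 2 * s < |x|
    · have : ψ x = 1 := by
        have : χ (x / s) = 0 := hχ.supp _ (by rw [abs_div, abs_of_pos s0, lt_div_iff₀ s0]; exact hx)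
        simp only [hψd, this, sub_zero]
      simp only [this, mul_one]
      rw [Set.indicator_of_mem (by exact hx)]
    · rw [Set.indicator_of_notMem (by exact hx)]
      exact mul_nonneg (h.nn ht x) (p0 x)
  have up : ∫ x, u 0 x * ψ x ≤ ∫ x in {x : ℝ | s < |x|}, u 0 x := by
    rw [← integral_indicator (mS _)]
    refine integral_mono_ae (mu 0 le_rfl) ((h.int 0 le_rfl).indicator (mS _)) ?_
    filter_upwards [h.nn0] with x un
    by_cases hx : s < |x|
    · rw [Set.indicator_of_mem (by exact hx)]
      exact mul_le_of_le_one_right un (p1 x)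
    · have : ψ x = 0 := by
        have : χ (x / s) = 1 := h1 _ (by rw [abs_div, abs_of_pos s0, div_le_iff₀ s0]; linarith)
        simp only [hψd, this, sub_self]
      simp only [this, mul_zero]
      rw [Set.indicator_of_notMem (by exact hx)]
  linarith

/-- translation estimate from one-sided Lipschitz bound, sup bound, tail -/
theorem transl {v : ℝ → ℝ} (hv : Integrable v) (v0 : ∀ x, 0 ≤ v x) (hS : ∀ x, v x ≤ S) (hL : ∀ x y, y ≤ x → v x - v y ≤ L * (x - y))
    (L0 : 0 ≤ L) (hh : 0 < h) (hh1 : h < 1) (hs : 1 ≤ s) :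
    ∫ x, |v (x + h) - v x| ≤ 2 * (∫ x in {x : ℝ | 2 * s < |x|}, v x) + (4 * (2 * s + 1) * L * h + h * S) := by
  set R := 2 * s + 1 with hR
  have R0 : 0 < R := by linarith
  have vh : Integrable fun x => v (x + h) := hv.comp_add_right h
  have mS : ∀ r : ℝ, MeasurableSet {x : ℝ | r < |x|} := fun r => measurableSet_lt measurable_const measurable_norm
  have mA : MeasurableSet {x : ℝ | R < |x|} := mS R
  have iA : Integrable fun x => |v (x + h) - v x| := (vh.sub hv).abs
  rw [← integral_add_compl mA iA]
  have out : ∫ x in {x : ℝ | R < |x|}, |v (x + h) - v x| ≤ 2 * (∫ x in {x : ℝ | 2 * s < |x|}, v x) := by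
    have i2 : Integrable ({x : ℝ | 2 * s < |x|}.indicator v) := hv.indicator (mS _)
    have i2h := i2.comp_add_right h
    have e := integral_add_right_eq_self (μ := volume) ({x : ℝ | 2 * s < |x|}.indicator v) h
    rw [two_mul, ← integral_indicator (mS (2 * s)), ← integral_indicator mA]
    nth_rw 1 [← e]
    rw [← integral_add i2h i2]
    have nn : ∀ x, 0 ≤ {x : ℝ | 2 * s < |x|}.indicator v x := fun x => Set.indicator_nonneg (fun y _ => v0 y) x
    refine integral_mono (iA.indicator mA) (i2h.add i2) fun x => ?_
    by_cases hx : R < |x|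
    · rw [Set.indicator_of_mem (by exact hx)]
      have a1 : 2 * s < |x| := by linarith
      have a2 : 2 * s < |x + h| := by
        have := abs_sub_abs_le_abs_sub x (x + h)
        rw [show x - (x + h) = -h by ring, abs_neg, abs_of_pos hh] at this
        linarith
      simp only []
      rw [Set.indicator_of_mem (by exact a2), Set.indicator_of_mem (by exact a1), abs_le]
      constructor <;> linarith [v0 x, v0 (x + h)]
    · rw [Set.indicator_of_notMem (by exact hx)]
      exact add_nonneg (nn _) (nn _)
  have inn : ∫ x in {x : ℝ | R < |x|}ᶜ, |v (x + h) - v x| ≤ 4 * R * L * h + h * S := by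
    have ec : {x : ℝ | R < |x|}ᶜ = Set.Icc (-R) R := by
      ext x; simp only [Set.mem_compl_iff, Set.mem_ofPred_eq, not_lt, Set.mem_Icc, abs_le]
    rw [ec, integral_Icc_eq_integral_Ioc, ← intervalIntegral.integral_of_le (by linarith)]
    have iv : ∀ a b, IntervalIntegrable v volume a b := fun a b => hv.intervalIntegrable
    have ivh : ∀ a b, IntervalIntegrable (fun x => v (x + h)) volume a b := fun a b => vh.intervalIntegrable
    have st1 : ∫ x in (-R)..R, |v (x + h) - v x| ≤ ∫ x in (-R)..R, (2 * (L * h) - (v (x + h) - v x)) := by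
      refine intervalIntegral.integral_mono_on (by linarith) iA.intervalIntegrable
        (intervalIntegrable_const.sub ((ivh _ _).sub (iv _ _))) fun x _ => ?_
      have := hL (x + h) x (by linarith)
      rw [add_sub_cancel_left] at this
      have : 0 ≤ L * h := by positivity
      rw [abs_le]; constructor <;> linarith
    refine st1.trans ?_
    rw [intervalIntegral.integral_sub intervalIntegrable_const ((ivh _ _).sub (iv _ _)), intervalIntegral.integral_const,
      intervalIntegral.integral_sub (ivh _ _) (iv _ _), intervalIntegral.integral_comp_add_right v h, smul_eq_mul]
    have e1 := intervalIntegral.integral_add_adjacent_intervals (iv (-R) (-R + h)) (iv (-R + h) (R + h))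
    have e2 := intervalIntegral.integral_add_adjacent_intervals (iv (-R) R) (iv R (R + h))
    have p : 0 ≤ ∫ x in R..(R + h), v x := intervalIntegral.integral_nonneg (by linarith) fun x _ => v0 x
    have p2 : ∫ x in (-R)..(-R + h), v x ≤ h * S := by
      have := intervalIntegral.integral_mono_on (a := -R) (b := -R + h) (by linarith) (iv _ _) (intervalIntegrable_const (c := S)) fun x _ => hS x
      rw [intervalIntegral.integral_const, smul_eq_mul] at this
      linarith
    linarith
  linarith

end

section
variable {q μ Λ s t m c1 h κ C r r' : ℝ} {j : ℝ → ℝ} {u : ℝ → ℝ → ℝ} {Y χ χ1 χ2 : ℝ → ℝ}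

noncomputable def Csp (q m c1 κ : ℝ) : ℝ :=
  2 * (κ * c1 * m) + 2 * (c1 * (2 * m ^ ((q - 1) / q) * m) * q) + 12 * (1 / (q - 1) * 2 ^ (1 / (q - 1) - 1) * m ^ ((2 - q) / q))
    + 2 ^ (1 / (q - 1)) * m ^ (1 / q)

theorem Sol.space_pos (h : Sol q μ Λ j u) (hm : ∫ x, u 0 x = m) (hj2 : Integrable fun z => z ^ 2 * j z) (hχ : Cutf q c1 Y χ χ1 χ2 2)
    (h1 : ∀ x, |x| ≤ 1 → χ x = 1) (hκ : Λ * (∫ z, z ^ 2 * j z) + μ ≤ κ) (hC : Csp q m c1 κ ≤ C) (ht : 0 < t) (hr : 0 < r) (hr1 : r < 1) :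
    ∫ x, |u t (x + r) - u t x| ≤ omegaMod (u 0) q C t r := by
  have m0 := h.m0 hm
  have θ0 : 0 < q - 1 := by linarith [h.hq]
  have q0 : 0 < q := by linarith [h.hq]
  have c0 : 0 ≤ c1 := (abs_nonneg _).trans (hχ.b1 0)
  have κ0 : 0 ≤ Λ * (∫ z, z ^ 2 * j z) + μ := add_nonneg (mul_nonneg h.hΛ (integral_nonneg fun z => mul_nonneg (sq_nonneg z) (h.kj.nn z))) h.hμ.le
  have κ0' : 0 ≤ κ := κ0.trans hκ
  set s := r ^ (-(1 : ℝ) / 2) with hsd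
  have hs : 1 ≤ s := Real.one_le_rpow_of_pos_of_le_one_of_nonpos hr hr1.le (by norm_num)
  have s0 : 0 < s := by linarith
  set L := (1 / (q - 1) * 2 ^ (1 / (q - 1) - 1) * m ^ ((2 - q) / q)) with hL
  have L0 : 0 ≤ L := by positivity
  set S := (2:ℝ) ^ (1 / (q - 1)) * m ^ (1 / q) with hS
  have S0 : 0 ≤ S := by positivity
  set ρ := r ^ ((1 : ℝ) / 2) with hρ
  have ρ0 : 0 < ρ := by positivity
  have sρ : s * ρ = 1 := by rw [hsd, hρ, ← Real.rpow_add hr]; norm_num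
  have ρρ : ρ * ρ = r := by rw [hρ, ← Real.rpow_add hr]; norm_num
  have ρ1 : ρ ≤ 1 := Real.rpow_le_one hr.le hr1.le (by norm_num)
  have tr := transl (h.int t ht.le) (h.nn ht) (h.sup hm ht) (fun x y hxy => h.lip1 hm ht hxy) (by positivity) hr hr1 hs
  have tl := h.tail hm hj2 hχ h1 ht hs
  rw [← hL, ← hS] at tr
  have si : ∀ a : ℝ, a / s = a * ρ := fun a => by rw [div_eq_iff s0.ne', mul_assoc, mul_comm ρ, sρ, mul_one]
  rw [si] at tl
  unfold omegaMod
  rw [← hsd, ← hρ]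
  set G := c1 * (2 * m ^ ((q - 1) / q) * m) with hG
  have G0 : 0 ≤ G := by positivity
  set a := t ^ (-(2 / q))
  set b := t ^ (-(1 / q))
  set d := t ^ (1 / q)
  have a0 : 0 ≤ a := by positivity
  have b0 : 0 ≤ b := by positivity
  have d0 : 0 ≤ d := by positivity
  have A1 : 4 * (2 * s + 1) * (L * a) * r ≤ 12 * L * ρ * a := by
    have : (2 * s + 1) * r ≤ 3 * ρ := by
      rw [← ρρ]
      have e : (2 * s + 1) * (ρ * ρ) = (2 * (s * ρ) + ρ) * ρ := by ring
      rw [e, sρ]; gcongr; linarith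
    have := mul_le_mul_of_nonneg_left this (by positivity : 0 ≤ 4 * (L * a))
    linarith
  have A2 : r * (S * b) ≤ S * ρ * b := by
    have : r ≤ ρ := by rw [← ρρ]; exact mul_le_of_le_one_left ρ0.le ρ1
    have := mul_le_mul_of_nonneg_right this (by positivity : 0 ≤ S * b)
    linarith
  have A3 : (Λ * (∫ z, z ^ 2 * j z) + μ) * c1 * m * t ≤ κ * c1 * m * t := by gcongr
  have A4 := mul_le_mul_of_nonneg_right A3 ρ0.le
  have cc : 2 * (κ * c1 * m) + 2 * (G * q) + 12 * L + S ≤ C := hC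
  have P1 : 0 ≤ κ * c1 * m := by positivity
  have P2 : 0 ≤ G * q := by positivity
  have B1 : 12 * L * (ρ * a) ≤ C * (ρ * a) := by gcongr; linarith
  have B2 : S * (ρ * b) ≤ C * (ρ * b) := by gcongr; linarith
  have B3 : 2 * (κ * c1 * m) * (ρ * t) ≤ C * (ρ * t) := by gcongr; linarith
  have B4 : 2 * (G * q) * (ρ * d) ≤ C * (ρ * d) := by gcongr; linarith
  linarith

theorem Sol.space (h : Sol q μ Λ j u) (hm : ∫ x, u 0 x = m) (hj2 : Integrable fun z => z ^ 2 * j z) (hχ : Cutf q c1 Y χ χ1 χ2 2)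
    (h1 : ∀ x, |x| ≤ 1 → χ x = 1) (hκ : Λ * (∫ z, z ^ 2 * j z) + μ ≤ κ) (hC : Csp q m c1 κ ≤ C) (ht : 0 < t) (hr : 0 < |r|) (hr1 : |r| < 1) :
    ∫ x, |u t (x + r) - u t x| ≤ omegaMod (u 0) q C t |r| := by
  have := h.space_pos hm hj2 hχ h1 hκ hC ht hr hr1
  rcases abs_cases r with ⟨e, _⟩ | ⟨e, _⟩
  · rwa [e] at this ⊢
  · refine le_trans (le_of_eq ?_) this
    rw [← integral_add_right_eq_self (fun x => |u t (x + r) - u t x|) |r|]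
    congr 1; ext x
    rw [e, neg_add_cancel_right, abs_sub_comm]

theorem omega_nn {V : ℝ → ℝ} (hV : ∀ᵐ x, 0 ≤ V x) (hC : 0 ≤ C) (ht : 0 < t) (hr : 0 < r) : 0 ≤ omegaMod V q C t r := by
  unfold omegaMod
  have : 0 ≤ ∫ x in {x : ℝ | r ^ (-(1 : ℝ) / 2) < |x|}, V x := integral_nonneg_of_ae (ae_restrict_of_ae hV)
  positivity

theorem omega_mono {V : ℝ → ℝ} (hi : Integrable V) (hV : ∀ᵐ x, 0 ≤ V x) (hC : 0 ≤ C) (ht : 0 < t) (hr : 0 < r) (hrr : r ≤ r') :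
    omegaMod V q C t r ≤ omegaMod V q C t r' := by
  unfold omegaMod
  have : ∫ x in {x : ℝ | r ^ (-(1 : ℝ) / 2) < |x|}, V x ≤ ∫ x in {x : ℝ | r' ^ (-(1 : ℝ) / 2) < |x|}, V x := by
    refine setIntegral_mono_set hi.integrableOn (ae_restrict_of_ae hV) (HasSubset.Subset.eventuallyLE fun x hx => ?_)
    exact lt_of_le_of_lt (Real.rpow_le_rpow_of_nonpos hr hrr (by norm_num)) hx
  gcongr

end

section
variable {q μ Λ s t m c1 κ C r δ A W : ℝ} {j : ℝ → ℝ} {u : ℝ → ℝ → ℝ} {Y χ χ1 χ2 ρ ρ1 ρ2 ρ3 w : ℝ → ℝ}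

theorem mol_modulus (hρ : Mol ρ ρ1 ρ2 ρ3 δ A) (hw : Continuous w) (hi : Integrable w)
    (hW : ∀ z, |z| ≤ δ → ∫ x, |w (x - z) - w x| ≤ W) : ∫ x, |w x - cv ρ w x| ≤ W := by
  have W0 : 0 ≤ W := by
    by_cases hδ : 0 ≤ δ
    · exact (integral_nonneg fun _ => abs_nonneg _).trans (hW 0 (by simpa using hδ))
    · exfalso
      have : ∀ x, ρ x = 0 := fun x => hρ.s0 x (lt_of_lt_of_le (not_le.1 hδ) (abs_nonneg x))
      have e := hρ.k.mass
      simp [this] at e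
  have ci := cv_int hρ.k.int hi
  have pt : ∀ x, ‖w x - cv ρ w x‖ₑ ≤ ∫⁻ z, ‖ρ z * (w (x - z) - w x)‖ₑ := fun x => by
    have e : w x - cv ρ w x = -∫ z, ρ z * (w (x - z) - w x) := by
      obtain ⟨a, b⟩ := hρ.k.sh x
      have sb : ∫ y, ρ (x - y) * (w y - w x) = ∫ z, ρ z * (w (x - z) - w x) := by
        rw [← integral_sub_left_eq_self (fun z => ρ z * (w (x - z) - w x)) volume x]
        congr 1; ext y; rw [show x - (x - y) = y by ring]
      rw [← sb]
      have : ∫ y, ρ (x - y) * (w y - w x) = cv ρ w x - w x := by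
        unfold cv
        rw [show (fun y => ρ (x - y) * (w y - w x)) = fun y => ρ (x - y) * w y - ρ (x - y) * w x by ext y; ring,
          integral_sub (cvi hρ.c0 hρ.b0 hi x) (a.mul_const _), integral_mul_const, b, one_mul]
      rw [this]; ring
    rw [e, enorm_neg]
    exact enorm_integral_le_lintegral_enorm _
  have key : ∫⁻ x, ‖w x - cv ρ w x‖ₑ ≤ ENNReal.ofReal W := by
    have c := hρ.c0
    calc _ ≤ ∫⁻ x, ∫⁻ z, ‖ρ z * (w (x - z) - w x)‖ₑ := lintegral_mono pt
      _ = ∫⁻ z, ∫⁻ x, ‖ρ z * (w (x - z) - w x)‖ₑ := by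
          refine lintegral_lintegral_swap ?_
          have : Continuous fun p : ℝ × ℝ => ρ p.2 * (w (p.1 - p.2) - w p.1) := by fun_prop
          exact this.measurable.enorm.aemeasurable
      _ ≤ ∫⁻ z, ENNReal.ofReal (ρ z) * ENNReal.ofReal W := by
          refine lintegral_mono fun z => ?_
          simp only [enorm_mul]
          rw [lintegral_const_mul _ (by fun_prop), Real.enorm_of_nonneg (hρ.k.nn z)]
          by_cases hz : |z| ≤ δ
          · gcongr
            have := hW z hz
            have ii : Integrable fun x => w (x - z) - w x := (hi.comp_sub_right z).sub hi
            rw [← ofReal_integral_norm_eq_lintegral_enorm ii]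
            exact ENNReal.ofReal_le_ofReal this
          · rw [hρ.s0 z (not_le.1 hz)]; simp
      _ = _ := by
          rw [lintegral_mul_const _ (by fun_prop), ← ofReal_integral_eq_lintegral_ofReal hρ.k.int (Eventually.of_forall hρ.k.nn), hρ.k.mass]
          simp
  rw [← ofReal_integral_norm_eq_lintegral_enorm (f := fun x => w x - cv ρ w x) (hi.sub ci)] at key
  exact (ENNReal.ofReal_le_ofReal_iff W0).1 key

theorem cv_bd1 {k σ : ℝ → ℝ} (hk : Integrable k) (hσ : ∀ x, |σ x| ≤ 1) (x : ℝ) : |cv k σ x| ≤ ∫ y, |k y| := by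
  unfold cv
  have e := integral_sub_left_eq_self (fun y => |k y|) volume x
  rw [← e, ← Real.norm_eq_abs]
  refine norm_integral_le_of_norm_le (hk.abs.comp_sub_left x) (Eventually.of_forall fun y => ?_)
  rw [Real.norm_eq_abs, abs_mul]
  exact mul_le_of_le_one_right (abs_nonneg _) (hσ y)

theorem Sol.time0 (h : Sol q μ Λ j u) (hm : ∫ x, u 0 x = m) (hj2 : Integrable fun z => z ^ 2 * j z) (hρ : Mol ρ ρ1 ρ2 ρ3 δ A)
    (hs : 0 < s) (hst : s ≤ t) (hW : ∀ z, |z| ≤ δ → ∫ x, |(u t (x - z) - u s (x - z)) - (u t x - u s x)| ≤ W) :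
    ∫ x, |u t x - u s x| ≤ W + ((Λ * (∫ z, z ^ 2 * j z) + μ) * (∫ z, |ρ2 z|) * m + (∫ z, |ρ1 z|) * (2 * m ^ ((q - 1) / q) * m) * s ^ (1 / q - 1)) * (t - s) := by
  have ht : 0 < t := hs.trans_le hst
  set w : ℝ → ℝ := fun x => u t x - u s x with hwd
  have wc : Continuous w := (h.c2 t ht).continuous.sub (h.c2 s hs).continuous
  have it := h.int t ht.le
  have is := h.int s hs.le
  have wi : Integrable w := it.sub is
  have mm := mol_modulus hρ wc wi hW
  set E := ((Λ * (∫ z, z ^ 2 * j z) + μ) * (∫ z, |ρ2 z|) * m + (∫ z, |ρ1 z|) * (2 * m ^ ((q - 1) / q) * m) * s ^ (1 / q - 1)) * (t - s) with hE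
  have key : ∀ n : ℝ, 0 ≤ n → ∫ x in (-n)..n, |w x| ≤ W + E := by
    intro n hn
    rw [intervalIntegral.integral_of_le (by linarith), ← integral_indicator measurableSet_Ioc]
    set σ : ℝ → ℝ := (Set.Ioc (-n) n).indicator fun x => SignType.sign (w x) with hσd
    have sg : Measurable fun x : ℝ => ((SignType.sign x : SignType) : ℝ) := by
      have : (fun x : ℝ => ((SignType.sign x : SignType) : ℝ)) = fun x => if 0 < x then 1 else if x < 0 then -1 else 0 := by
        ext x
        rcases lt_trichotomy x 0 with hx | hx | hx
        · simp [hx, not_lt.2 hx.le]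
        · simp [hx]
        · simp [hx]
      rw [this]
      exact Measurable.ite measurableSet_Ioi measurable_const (Measurable.ite measurableSet_Iio measurable_const measurable_const)
    have σm : Measurable σ := (sg.comp wc.measurable).indicator measurableSet_Ioc
    have sg1 : ∀ x : ℝ, |((SignType.sign x : SignType) : ℝ)| ≤ 1 := fun x => by
      rcases lt_trichotomy x 0 with hx | hx | hx <;> simp [hx]
    have σ1 : ∀ x, |σ x| ≤ 1 := fun x => by
      rw [hσd]
      by_cases hx : x ∈ Set.Ioc (-n) n
      · rw [Set.indicator_of_mem hx]; exact sg1 _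
      · rw [Set.indicator_of_notMem hx]; simp
    have σi : Integrable σ := by
      refine (integrable_indicator_iff measurableSet_Ioc).2 ?_
      refine Measure.integrableOn_of_bounded (M := 1) (by simp) (sg.comp wc.measurable).aestronglyMeasurable (Eventually.of_forall fun x => sg1 _)
    have e1 : ((Set.Ioc (-n) n).indicator fun x => |w x|) = fun x => w x * σ x := by
      ext x
      by_cases hx : x ∈ Set.Ioc (-n) n
      · simp only [hσd, Set.indicator_of_mem hx]
        exact (self_mul_sign (w x)).symm
      · simp only [hσd, Set.indicator_of_notMem hx, mul_zero]
    set η := cv ρ σ with hη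
    have hη2 : C2 η (cv ρ1 σ) (cv ρ2 σ) :=
      ⟨cv_deriv hρ.d1 hρ.c1 hρ.b0 hρ.b1 σi, cv_deriv hρ.d2 hρ.c2 hρ.b1 hρ.b2 σi, cv_cont hρ.c2 hρ.b2 σi⟩
    have ηb : ∀ x, |η x| ≤ 1 := cv_bdd hρ.k σ1
    have wb := h.wb hm hj2 hs hst hη2 ηb (cv_bd1 hρ.i1 σ1) (cv_bd1 hρ.i2 σ1)
    rw [← hE] at wb
    have mη : ∀ {V : ℝ → ℝ}, Integrable V → Integrable fun x => V x * η x := fun hV =>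
      hV.mul_bdd hη2.c0.aestronglyMeasurable (Eventually.of_forall ηb)
    have mσ : ∀ {V : ℝ → ℝ}, Integrable V → Integrable fun x => V x * σ x := fun hV =>
      hV.mul_bdd σm.aestronglyMeasurable (Eventually.of_forall σ1)
    have ci := cv_int hρ.k.int wi
    have e2 : ∫ x, cv ρ w x * σ x = ∫ x, w x * η x := by
      rw [cv_dual hρ.k.int wi σm.aestronglyMeasurable σ1]
      congr 1; ext y; congr 1; rw [hη]; unfold cv; congr 1; ext x
      rw [← hρ.k.even (x - y), neg_sub]
    have e3 : ∫ x, w x * η x = (∫ x, u t x * η x) - ∫ x, u s x * η x := by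
      rw [← integral_sub (mη it) (mη is)]; congr 1; ext x; simp only [hwd]; ring
    have e4 : ∫ x, w x * σ x = (∫ x, (w x - cv ρ w x) * σ x) + ∫ x, cv ρ w x * σ x := by
      rw [← integral_add (mσ (V := fun x => w x - cv ρ w x) (wi.sub ci)) (mσ ci)]; congr 1; ext x; ring
    have e5 : ∫ x, (w x - cv ρ w x) * σ x ≤ ∫ x, |w x - cv ρ w x| := by
      refine integral_mono (mσ (wi.sub ci)) (wi.sub ci).abs fun x => ?_
      refine (le_abs_self _).trans ?_
      simp only [abs_mul]
      exact mul_le_of_le_one_right (abs_nonneg _) (σ1 x)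
    rw [e1, e4, e2, e3]
    linarith [le_abs_self ((∫ x, u t x * η x) - ∫ x, u s x * η x)]
  have l := intervalIntegral_tendsto_integral (μ := volume) (f := fun x => |w x|) wi.abs tendsto_neg_atTop_atBot tendsto_id
  exact le_of_tendsto l (by filter_upwards [eventually_ge_atTop 0] with n hn using key n hn)

theorem mol_scale_l1 (δ0 : 0 < δ) (f : ℝ → ℝ) : (∫ x, |f (x / δ) / δ / δ| = (∫ x, |f x|) / δ) ∧ ∫ x, |f (x / δ) / δ / δ / δ| = (∫ x, |f x|) / δ / δ := by
  have e := Measure.integral_comp_div (fun x => |f x|) δ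
  simp only [abs_div, abs_of_pos δ0, integral_div]
  rw [e, smul_eq_mul, abs_of_pos δ0]
  constructor <;> field_simp

noncomputable def Cti (q m m2 A1 A2 : ℝ) : ℝ := (m2 + 1) * A2 * m + A1 * (2 * m ^ ((q - 1) / q) * m)

theorem Sol.time (h : Sol q μ Λ j u) (hm : ∫ x, u 0 x = m) (hj2 : Integrable fun z => z ^ 2 * j z) (hχ : Cutf q c1 Y χ χ1 χ2 2)
    (h1 : ∀ x, |x| ≤ 1 → χ x = 1) (hκ : Λ * (∫ z, z ^ 2 * j z) + μ ≤ κ) (hC : Csp q m c1 κ ≤ C) (hρ : Mol ρ ρ1 ρ2 ρ3 1 A)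
    {m2 l k : ℝ} (hm2 : 0 ≤ m2) (hl : 0 ≤ l) (hl2 : Λ * (∫ z, z ^ 2 * j z) ≤ m2 * l) (C0 : 0 ≤ C)
    (hC2 : Cti q m m2 (∫ z, |ρ1 z|) (∫ z, |ρ2 z|) ≤ C) (ht : 0 < t) (hk : 0 < k) (hk1 : k < 1) :
    ∫ x, |u (t + k) x - u t x| ≤ C * ((l + μ) * k ^ ((1 : ℝ) / 3) + k ^ ((2 : ℝ) / 3) * t ^ (1 / q - 1))
      + 2 * omegaMod (u 0) q C (t + k) (k ^ ((1 : ℝ) / 3)) + 2 * omegaMod (u 0) q C t (k ^ ((1 : ℝ) / 3)) := by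
  have m0 := h.m0 hm
  have tk : 0 < t + k := by linarith
  set δ := k ^ ((1 : ℝ) / 3) with hδ
  have δ0 : 0 < δ := by positivity
  have δ1 : δ < 1 := Real.rpow_lt_one hk.le hk1 (by norm_num)
  have e2 : k ^ ((2 : ℝ) / 3) = δ * δ := by rw [hδ, ← Real.rpow_add hk]; norm_num
  have e3 : k = δ * δ * δ := by rw [hδ, ← Real.rpow_add hk, ← Real.rpow_add hk]; norm_num
  obtain ⟨A', hρδ⟩ := hρ.scale δ0
  rw [one_mul] at hρδ
  have om0 : ∀ τ, 0 < τ → 0 ≤ omegaMod (u 0) q C τ δ := fun τ hτ => omega_nn h.nn0 C0 hτ δ0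
  have sp : ∀ τ, 0 < τ → ∀ z, |z| ≤ δ → ∫ x, |u τ (x - z) - u τ x| ≤ omegaMod (u 0) q C τ δ := by
    intro τ hτ z hz
    rcases eq_or_ne z 0 with rfl | hz0
    · simpa using om0 τ hτ
    have zp : 0 < |-z| := by rw [abs_neg]; exact abs_pos.2 hz0
    have hz' : |-z| ≤ δ := by rwa [abs_neg]
    exact (h.space hm hj2 hχ h1 hκ hC hτ zp (hz'.trans_lt δ1)).trans (omega_mono (h.int 0 le_rfl) h.nn0 C0 hτ zp hz')
  have hW : ∀ z, |z| ≤ δ → ∫ x, |(u (t + k) (x - z) - u t (x - z)) - (u (t + k) x - u t x)| ≤ omegaMod (u 0) q C (t + k) δ + omegaMod (u 0) q C t δ := by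
    intro z hz
    have d : ∀ τ, 0 < τ → Integrable fun x => u τ (x - z) - u τ x := fun τ hτ => ((h.int τ hτ.le).comp_sub_right z).sub (h.int τ hτ.le)
    refine le_trans ?_ (add_le_add (sp (t + k) tk z hz) (sp t ht z hz))
    rw [← integral_add (d _ tk).abs (d _ ht).abs]
    refine integral_mono ?_ ((d _ tk).abs.add (d _ ht).abs) fun x => ?_
    · refine ((d _ tk).sub (d _ ht)).abs.congr (Eventually.of_forall fun x => ?_)
      simp only [Pi.sub_apply]; congr 1; ring
    · have := abs_sub (u (t + k) (x - z) - u (t + k) x) (u t (x - z) - u t x)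
      refine le_trans (le_of_eq ?_) this
      congr 1; ring
  have main := h.time0 hm hj2 hρδ ht (by linarith : t ≤ t + k) hW
  rw [(mol_scale_l1 δ0 ρ1).1, (mol_scale_l1 δ0 ρ2).2, add_sub_cancel_left] at main
  set A1 := ∫ z, |ρ1 z|
  set A2 := ∫ z, |ρ2 z|
  have A10 : 0 ≤ A1 := integral_nonneg fun _ => abs_nonneg _
  have A20 : 0 ≤ A2 := integral_nonneg fun _ => abs_nonneg _
  set G := 2 * m ^ ((q - 1) / q) * m
  have G0 : 0 ≤ G := by positivity
  set T := t ^ (1 / q - 1)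
  have T0 : 0 ≤ T := by positivity
  have cc : (m2 + 1) * A2 * m + A1 * G ≤ C := hC2
  have kk : Λ * (∫ z, z ^ 2 * j z) + μ ≤ (m2 + 1) * (l + μ) := by
    have := mul_nonneg hm2 h.hμ.le
    linarith
  set κ' := Λ * (∫ z, z ^ 2 * j z) + μ
  have e4 : (κ' * (A2 / δ / δ) * m + A1 / δ * G * T) * k = κ' * (A2 * m * δ) + A1 * G * (δ * δ * T) := by
    refine (congrArg ((κ' * (A2 / δ / δ) * m + A1 / δ * G * T) * ·) e3).trans ?_
    field_simp
  rw [e4] at main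
  rw [e2]
  have lμ : 0 ≤ l + μ := add_nonneg hl h.hμ.le
  have B1 : κ' * (A2 * m * δ) ≤ (m2 + 1) * (l + μ) * (A2 * m * δ) := by gcongr
  have B2 : (m2 + 1) * A2 * m * ((l + μ) * δ) ≤ C * ((l + μ) * δ) := by
    gcongr; have := mul_nonneg A10 G0; linarith
  have B3 : A1 * G * (δ * δ * T) ≤ C * (δ * δ * T) := by
    gcongr; have : 0 ≤ (m2 + 1) * A2 * m := by positivity
    linarith
  linarith [om0 _ tk, om0 _ ht]
end

theorem exists_kern_rep {J : ℝ → ℝ} (hJpos : ∀ x, 0 ≤ J x) (hJeven : ∀ x, J (-x) = J x) (hJint : Integrable J) :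
    ∃ G : ℝ → ℝ, Measurable G ∧ (∀ x, 0 ≤ G x) ∧ (∀ x, G (-x) = G x) ∧ J =ᵐ[volume] G := by
  have am := hJint.aestronglyMeasurable.aemeasurable
  have ae := am.ae_eq_mk
  have aen : (fun x => J (-x)) =ᵐ[volume] fun x => am.mk J (-x) :=
    (Measure.measurePreserving_neg (volume : Measure ℝ)).quasiMeasurePreserving.ae_eq_comp ae
  have gm := am.measurable_mk
  refine ⟨fun x => (|am.mk J x| + |am.mk J (-x)|) / 2, by fun_prop, fun x => by positivity, fun x => by simp only [neg_neg]; rw [add_comm], ?_⟩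
  filter_upwards [ae, aen] with x h1 h2
  rw [← h1, ← h2, hJeven, abs_of_nonneg (hJpos x)]; ring

theorem qmp_mul {a : ℝ} (ha : 0 < a) : Measure.QuasiMeasurePreserving (fun x : ℝ => a * x) volume volume :=
  ⟨by fun_prop, by rw [Real.map_volume_mul_left ha.ne']; exact Measure.smul_absolutelyContinuous⟩

theorem int_scale {a : ℝ} (ha : 0 < a) (f : ℝ → ℝ) : ∫ x, a * f (a * x) = ∫ x, f x := by
  rw [integral_const_mul, Measure.integral_comp_mul_left, abs_of_pos (by positivity), smul_eq_mul, ← mul_assoc, mul_inv_cancel₀ ha.ne', one_mul]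

theorem kern_scale {G : ℝ → ℝ} (hG : Kern G) {a : ℝ} (ha : 0 < a) : Kern fun x => a * G (a * x) where
  m := by have := hG.m; fun_prop
  nn x := mul_nonneg ha.le (hG.nn _)
  even x := by rw [mul_neg, hG.even]
  int := (hG.int.comp_mul_left' ha.ne').const_mul a
  mass := by rw [int_scale ha, hG.mass]

theorem kern_scale2 {G : ℝ → ℝ} (hG : Integrable fun x => x ^ 2 * G x) {a : ℝ} (ha : 0 < a) :
    Integrable (fun x => x ^ 2 * (a * G (a * x))) ∧ ∫ x, x ^ 2 * (a * G (a * x)) = a⁻¹ ^ 2 * ∫ x, x ^ 2 * G x := by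
  have e : (fun x => x ^ 2 * (a * G (a * x))) = fun x => a⁻¹ ^ 2 * (a * ((a * x) ^ 2 * G (a * x))) := by
    ext x; field_simp
  rw [e]
  refine ⟨((hG.comp_mul_left' ha.ne').const_mul a).const_mul _, ?_⟩
  rw [integral_const_mul, int_scale ha fun x => x ^ 2 * G x]

theorem tail_scale {φ v : ℝ → ℝ} {a s : ℝ} (ha : 1 ≤ a) (hs : 0 ≤ s) (hφ : Integrable φ) (h0 : ∀ x, 0 ≤ φ x)
    (hv : v =ᵐ[volume] fun x => a * φ (a * x)) : ∫ x in {x : ℝ | s < |x|}, v x ≤ ∫ x in {x : ℝ | s < |x|}, φ x := by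
  have a0 : 0 < a := by linarith
  have mS : ∀ r : ℝ, MeasurableSet {x : ℝ | r < |x|} := fun r => measurableSet_lt measurable_const measurable_norm
  rw [integral_congr_ae (ae_restrict_of_ae hv), ← integral_indicator (mS s), ← integral_indicator (mS s)]
  rw [← int_scale a0 ({x : ℝ | s < |x|}.indicator φ)]
  have is : Integrable ({x : ℝ | s < |x|}.indicator φ) := hφ.indicator (mS s)
  refine integral_mono (((hφ.comp_mul_left' a0.ne').const_mul a).indicator (mS s)) ((is.comp_mul_left' a0.ne').const_mul a) fun x => ?_
  by_cases hx : s < |x|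
  · have : s < |a * x| := by
      rw [abs_mul, abs_of_pos a0]
      exact hx.trans_le (le_mul_of_one_le_left (abs_nonneg x) ha)
    simp only []
    rw [Set.indicator_of_mem (by exact hx), Set.indicator_of_mem (by exact this)]
  · rw [Set.indicator_of_notMem (by exact hx)]
    exact mul_nonneg a0.le (Set.indicator_nonneg (fun y _ => h0 y) _)

theorem stmt17
    (J : ℝ → ℝ) (hJpos : ∀ x, 0 ≤ J x) (hJeven : ∀ x, J (-x) = J x)
    (hJint : Integrable J) (hJmass : ∫ x, J x = 1)
    (hJ2 : Integrable (fun x => (1 + |x| ^ 2) * J x))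
    (q K : ℝ) (hq1 : 1 < q) (hq2 : q < 2) (hK : 0 ≤ K) :
    -- a constant C(‖φ‖₁, q, J), independent of λ and μ
    ∃ C : ℝ, 0 < C ∧
      ∀ (φ : ℝ → ℝ) (lam μ : ℝ) (u : ℝ → ℝ → ℝ),
        0 < μ → μ ≤ 1 → 1 ≤ lam → Integrable φ → (∀ x, 0 ≤ φ x) →
        (∫ y, |φ y|) = K → IsRescaledSol J q lam μ φ u →
        -- (i) translations in space
        (∀ t : ℝ, 0 < t → ∀ h : ℝ, 0 < |h| → |h| < 1 →
          (∫ x, |u t (x + h) - u t x|) ≤ omegaMod φ q C t |h|) ∧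
        -- (ii) translations in time
        (∀ t : ℝ, 0 < t → ∀ k : ℝ, 0 < k → k < 1 →
          (∫ x, |u (t + k) x - u t x|)
            ≤ C * ((lam ^ (q - 2) + μ) * k ^ ((1 : ℝ) / 3)
                + k ^ ((2 : ℝ) / 3) * t ^ (1 / q - 1))
              + 2 * omegaMod φ q C (t + k) (k ^ ((1 : ℝ) / 3))
              + 2 * omegaMod φ q C t (k ^ ((1 : ℝ) / 3))) := by
  obtain ⟨G, Gm, G0, Ge, hG⟩ := exists_kern_rep hJpos hJeven hJint
  have kG : Kern G := ⟨Gm, G0, Ge, hJint.congr hG, by rw [← hJmass]; exact integral_congr_ae hG.symm⟩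
  have G2 : Integrable fun x => x ^ 2 * G x := by
    refine (hJ2.sub hJint).congr ?_
    filter_upwards [hG] with x hx
    simp only [Pi.sub_apply]
    rw [sq_abs, hx]; ring
  set M2 := ∫ x, x ^ 2 * G x with hM2
  have M20 : 0 ≤ M2 := integral_nonneg fun x => mul_nonneg (sq_nonneg x) (G0 x)
  obtain ⟨c1, Y, χ, χ1, χ2, -, hχ, hχ1⟩ := exists_cutf hq1 hq2 one_pos one_lt_two
  obtain ⟨ρ, ρ1, ρ2, ρ3, A, hρ⟩ := exists_mol
  set C1 := Csp q K c1 (M2 + 1)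
  set C2 := Cti q K M2 (∫ z, |ρ1 z|) (∫ z, |ρ2 z|)
  have CC : 0 < 1 + |C1| + |C2| := by positivity
  have CC1 : C1 ≤ 1 + |C1| + |C2| := by linarith [le_abs_self C1, abs_nonneg C2]
  have CC2 : C2 ≤ 1 + |C1| + |C2| := by linarith [le_abs_self C2, abs_nonneg C1]
  refine ⟨1 + |C1| + |C2|, CC, ?_⟩
  generalize 1 + |C1| + |C2| = C at CC CC1 CC2 ⊢
  intro φ lam μ u hμ hμ1 hlam hφ hφ0 hφK hu
  obtain ⟨u1, u2, u3, u4, u5, u6⟩ := hu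
  have l0 : 0 < lam := by linarith
  have sol : Sol q μ (lam ^ q) (fun x => lam * G (lam * x)) u := by
    refine ⟨hq1, hq2, hμ, kern_scale kG l0, by positivity, u1, u2, u3, u4, fun t ht x => ?_, ?_⟩
    · rw [u5 t ht x]
      unfold nl cv
      congr 3
      refine integral_congr_ae ?_
      have := ((qmp_mul l0).comp (quasiMeasurePreserving_sub_left (volume : Measure ℝ) x)).ae_eq_comp hG
      filter_upwards [this] with y hy
      simp only [Function.comp] at hy
      rw [hy]
    · filter_upwards [u6] with x hx
      rw [hx]; exact mul_nonneg l0.le (hφ0 _)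
  have hm : ∫ x, u 0 x = K := by
    rw [integral_congr_ae u6, int_scale l0, ← hφK]
    congr 1; ext x; exact (abs_of_nonneg (hφ0 x)).symm
  obtain ⟨j2, j2e⟩ := kern_scale2 G2 l0
  rw [← hM2] at j2e
  have hl2 : lam ^ q * ∫ z, z ^ 2 * (lam * G (lam * z)) = M2 * lam ^ (q - 2) := by
    rw [j2e, Real.rpow_sub l0, Real.rpow_two]; field_simp
  have ll : lam ^ (q - 2) ≤ 1 := Real.rpow_le_one_of_one_le_of_nonpos hlam (by linarith)
  have hκ : lam ^ q * (∫ z, z ^ 2 * (lam * G (lam * z))) + μ ≤ M2 + 1 := by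
    rw [hl2]; exact add_le_add (mul_le_of_le_one_right M20 ll) hμ1
  have om : ∀ t r, 0 < r → omegaMod (u 0) q C t r ≤ omegaMod φ q C t r := fun t r hr => by
    unfold omegaMod
    have := tail_scale (s := r ^ (-(1 : ℝ) / 2)) hlam (by positivity) hφ hφ0 u6
    linarith
  refine ⟨fun t ht h hh hh1 => ?_, fun t ht k hk hk1 => ?_⟩
  · exact (sol.space hm j2 hχ hχ1 hκ CC1 ht hh hh1).trans (om _ _ hh)
  · have := sol.time hm j2 hχ hχ1 hκ CC1 hρ M20 (by positivity : 0 ≤ lam ^ (q - 2)) hl2.le CC.le CC2 ht hk hk1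
    linarith [om (t + k) (k ^ ((1 : ℝ) / 3)) (by positivity), om t (k ^ ((1 : ℝ) / 3)) (by positivity)]
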